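/- Assume the Riemann Hypothesis. For admissible T → ∞, ∑_{0<γ≤T} ζ'(ρ) = (T/4π) log²(T/2π) + (−1 + C_0)(T/2π) log(T/2π) + (1 − C_0 − C_0² + 3C_1)(T/2π) + O(T^{1/2} log^{13/4} T). -/

import Mathlib

open Complex Filter Finset

/-- The order of vanishing of the Riemann zeta function at a point `ρ`:
the least `k` such that the `k`-th derivative of `ζ` is nonzero at `ρ`. -/
noncomputable def zetaZeroOrder (ρ : ℂ) : ℕ :=
  sInf {k : ℕ | iteratedDeriv k riemannZeta ρ ≠ 0}

/-- A non-trivial zero of the Riemann zeta function. -/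
def IsNontrivialZero (ρ : ℂ) : Prop :=
  riemannZeta ρ = 0 ∧ 0 < ρ.re ∧ ρ.re < 1

/-- `∑_{0<γ≤T} ζ^{(n)}(ρ)`, the sum of the `n`-th derivative of `ζ` over the
non-trivial zeros `ρ = β + iγ` with `0 < γ ≤ T`, counted with multiplicity. -/
noncomputable def zetaZeroSum (n : ℕ) (T : ℝ) : ℂ :=
  ∑ᶠ ρ ∈ {ρ : ℂ | IsNontrivialZero ρ ∧ 0 < ρ.im ∧ ρ.im ≤ T},
    (zetaZeroOrder ρ : ℂ) * iteratedDeriv n riemannZeta ρ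

/-- `T` is admissible: `|T - γ| ≥ δ / log T` for every ordinate `γ` of a
non-trivial zero of `ζ`. -/
def AdmissibleHeight (δ T : ℝ) : Prop :=
  ∀ ρ : ℂ, IsNontrivialZero ρ → δ / Real.log T ≤ |T - ρ.im|

/-! ### Rectangle integrals and residues -/

noncomputable def RI (f : ℂ → ℂ) (a b c d : ℝ) : ℂ :=
  (∫ x in a..b, f (x + c * I)) - (∫ x in a..b, f (x + d * I))
    + I * (∫ y in c..d, f (b + y * I)) - I * (∫ y in c..d, f (a + y * I))

def RB (a b c d : ℝ) : Set ℂ :=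
  {s | s.re ∈ Set.Icc a b ∧ s.im ∈ Set.Icc c d ∧ (s.re = a ∨ s.re = b ∨ s.im = c ∨ s.im = d)}

def RC (a b c d : ℝ) : Set ℂ := {s | s.re ∈ Set.Icc a b ∧ s.im ∈ Set.Icc c d}

lemma RB_sub_RC {a b c d : ℝ} : RB a b c d ⊆ RC a b c d := fun _ h => ⟨h.1, h.2.1⟩

lemma RI_congr {f g : ℂ → ℂ} {a b c d : ℝ} (hab : a ≤ b) (hcd : c ≤ d)
    (h : ∀ s ∈ RB a b c d, f s = g s) : RI f a b c d = RI g a b c d := by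
  unfold RI
  congr 1
  · congr 1
    · congr 1
      · apply intervalIntegral.integral_congr
        intro x hx
        rw [Set.uIcc_of_le hab] at hx
        exact h _ ⟨by simpa using hx, by simpa using hcd, by simp⟩
      · apply intervalIntegral.integral_congr
        intro x hx
        rw [Set.uIcc_of_le hab] at hx
        exact h _ ⟨by simpa using hx, by simpa using hcd, by simp⟩
    · congr 1
      apply intervalIntegral.integral_congr
      intro x hx
      rw [Set.uIcc_of_le hcd] at hx
      exact h _ ⟨by simpa using hab, by simpa using hx, by simp⟩
  · congr 1
    apply intervalIntegral.integral_congr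
    intro x hx
    rw [Set.uIcc_of_le hcd] at hx
    exact h _ ⟨by simpa using hab, by simpa using hx, by simp⟩

lemma RB_int {f : ℂ → ℂ} {a b c d : ℝ} (hab : a ≤ b) (hcd : c ≤ d)
    (h : ContinuousOn f (RB a b c d)) :
    IntervalIntegrable (fun x : ℝ => f (x + c * I)) MeasureTheory.volume a b ∧
    IntervalIntegrable (fun x : ℝ => f (x + d * I)) MeasureTheory.volume a b ∧
    IntervalIntegrable (fun y : ℝ => f (b + y * I)) MeasureTheory.volume c d ∧
    IntervalIntegrable (fun y : ℝ => f (a + y * I)) MeasureTheory.volume c d := by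
  refine ⟨?_, ?_, ?_, ?_⟩ <;> apply ContinuousOn.intervalIntegrable
  all_goals first | rw [Set.uIcc_of_le hab] | rw [Set.uIcc_of_le hcd]
  all_goals
    refine h.comp (by fun_prop) ?_
    intro x hx
    first
    | exact ⟨by simpa using hx, by simpa using hcd, by simp⟩
    | exact ⟨by simpa using hab, by simpa using hx, by simp⟩

lemma RI_add {f g : ℂ → ℂ} {a b c d : ℝ} (hab : a ≤ b) (hcd : c ≤ d)
    (hf : ContinuousOn f (RB a b c d)) (hg : ContinuousOn g (RB a b c d)) :
    RI (fun s => f s + g s) a b c d = RI f a b c d + RI g a b c d := by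
  obtain ⟨h1, h2, h3, h4⟩ := RB_int hab hcd hf
  obtain ⟨k1, k2, k3, k4⟩ := RB_int hab hcd hg
  unfold RI
  rw [intervalIntegral.integral_add h1 k1, intervalIntegral.integral_add h2 k2,
    intervalIntegral.integral_add h3 k3, intervalIntegral.integral_add h4 k4]
  ring

lemma RI_const_mul (k : ℂ) (f : ℂ → ℂ) (a b c d : ℝ) :
    RI (fun s => k * f s) a b c d = k * RI f a b c d := by
  unfold RI
  simp only [intervalIntegral.integral_const_mul]
  ring

lemma RI_holo {f : ℂ → ℂ} {a b c d : ℝ} (hab : a ≤ b) (hcd : c ≤ d)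
    (hf : DifferentiableOn ℂ f (RC a b c d)) : RI f a b c d = 0 := by
  have := Complex.integral_boundary_rect_eq_zero_of_differentiableOn f (⟨a, c⟩ : ℂ) ⟨b, d⟩
    (hf.mono (by
      intro s hs
      rw [Complex.mem_reProdIm, Set.uIcc_of_le hab, Set.uIcc_of_le hcd] at hs
      exact hs))
  simpa [RI] using this

lemma log_corner {x y : ℝ} (hx : 0 < x) (hy : 0 < y) :
    Complex.log (x + y * I) - Complex.log (y - x * I) = I * Real.pi / 2 := by
  have h1 : (x + y * I : ℂ) = I * (y - x * I) := by
    ring_nf; simp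
  have hne : (y - x * I : ℂ) ≠ 0 := by
    intro h
    have := congrArg Complex.re h
    simp at this; exact hy.ne' this
  have harg : Complex.arg (y - x * I) < 0 := by
    rw [Complex.arg_neg_iff]; simp [hx]
  have h2 := Complex.log_mul (x := I) (y := y - x * I) I_ne_zero hne (by
    rw [Complex.arg_I]
    have := Complex.neg_pi_lt_arg (y - x * I)
    have hp := Real.pi_pos
    constructor
    · linarith
    · linarith)
  rw [h1, h2, Complex.log_I]
  ring

lemma RI_inv {a b c d : ℝ} {p : ℂ} (ha : a < p.re) (hb : p.re < b) (hc : c < p.im)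
    (hd : p.im < d) : RI (fun s => (s - p)⁻¹) a b c d = 2 * Real.pi * I := by
  have key : ∀ (k v w : ℂ) (α β : ℝ), α ≤ β → k ≠ 0 →
      (∀ x ∈ Set.Icc α β, 0 < (k * (v * x + w)).re) →
      ∫ x in α..β, v * (v * x + w)⁻¹ = Complex.log (k * (v * β + w)) - Complex.log (k * (v * α + w)) := by
    intro k v w α β hαβ hk hre
    have hd' : ∀ x ∈ Set.uIcc α β, HasDerivAt (fun x : ℝ => Complex.log (k * (v * x + w)))
        (v * (v * x + w)⁻¹) x := by
      intro x hx
      rw [Set.uIcc_of_le hαβ] at hx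
      have hne : k * (v * x + w) ≠ 0 := by
        intro h; have := hre x hx; rw [h] at this; simp at this
      have h0 : HasDerivAt (fun x : ℝ => k * (v * x + w)) (k * v) x := by
        have := (((hasDerivAt_id (x:ℂ)).const_mul v).add_const w).const_mul k
        simpa using this.comp_ofReal
      have := HasDerivAt.clog_real h0 (Or.inl (hre x hx))
      convert this using 1
      have : (v * x + w : ℂ) ≠ 0 := right_ne_zero_of_mul hne
      field_simp
    rw [intervalIntegral.integral_eq_sub_of_hasDerivAt hd']
    apply ContinuousOn.intervalIntegrable
    rw [Set.uIcc_of_le hαβ]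
    refine ContinuousOn.mul continuousOn_const (ContinuousOn.inv₀ (by fun_prop) ?_)
    intro x hx h
    have := hre x hx
    rw [h] at this; simp at this
  unfold RI
  rw [← intervalIntegral.integral_const_mul, ← intervalIntegral.integral_const_mul]
  have e1 := key I 1 (c * I - p) a b (by linarith) I_ne_zero (by intro x hx; simp; linarith)
  have e2 := key (-I) 1 (d * I - p) a b (by linarith) (by simp) (by intro x hx; simp; linarith)
  have e3 := key 1 I (b - p) c d (by linarith) one_ne_zero (by intro x hx; simp; linarith)
  have e4 := key (-1) I (a - p) c d (by linarith) (by simp) (by intro x hx; simp; linarith)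
  have s1 : (∫ x in a..b, ((x:ℂ) + c * I - p)⁻¹) = ∫ x in a..b, (1:ℂ) * (1 * x + (c * I - p))⁻¹ := by
    congr 1; ext x; ring
  have s2 : (∫ x in a..b, ((x:ℂ) + d * I - p)⁻¹) = ∫ x in a..b, (1:ℂ) * (1 * x + (d * I - p))⁻¹ := by
    congr 1; ext x; ring
  have s3 : (∫ x in c..d, I * ((b:ℂ) + x * I - p)⁻¹) = ∫ x in c..d, I * (I * x + (b - p))⁻¹ := by
    congr 1; ext x; ring
  have s4 : (∫ x in c..d, I * ((a:ℂ) + x * I - p)⁻¹) = ∫ x in c..d, I * (I * x + (a - p))⁻¹ := by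
    congr 1; ext x; ring
  rw [s1, s2, s3, s4, e1, e2, e3, e4]
  have c1 := log_corner (x := b - p.re) (y := d - p.im) (by linarith) (by linarith)
  have c2 := log_corner (x := d - p.im) (y := p.re - a) (by linarith) (by linarith)
  have c3 := log_corner (x := p.re - a) (y := p.im - c) (by linarith) (by linarith)
  have c4 := log_corner (x := p.im - c) (y := b - p.re) (by linarith) (by linarith)
  have hp : p = p.re + p.im * I := (Complex.re_add_im p).symm
  have t1 : I * (1 * (b:ℂ) + (c * I - p)) = ((p.im - c : ℝ) : ℂ) + (b - p.re : ℝ) * I := by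
    apply Complex.ext <;> simp <;> ring
  have t2 : I * (1 * (a:ℂ) + (c * I - p)) = ((p.im - c : ℝ) : ℂ) - (p.re - a : ℝ) * I := by
    apply Complex.ext <;> simp <;> ring
  have t3 : -I * (1 * (b:ℂ) + (d * I - p)) = ((d - p.im : ℝ) : ℂ) - (b - p.re : ℝ) * I := by
    apply Complex.ext <;> simp <;> ring
  have t4 : -I * (1 * (a:ℂ) + (d * I - p)) = ((d - p.im : ℝ) : ℂ) + (p.re - a : ℝ) * I := by
    apply Complex.ext <;> simp <;> ring
  have t5 : 1 * (I * (d:ℂ) + (b - p)) = ((b - p.re : ℝ) : ℂ) + (d - p.im : ℝ) * I := by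
    apply Complex.ext <;> simp <;> ring
  have t6 : 1 * (I * (c:ℂ) + (b - p)) = ((b - p.re : ℝ) : ℂ) - (p.im - c : ℝ) * I := by
    apply Complex.ext <;> simp <;> ring
  have t7 : -1 * (I * (d:ℂ) + (a - p)) = ((p.re - a : ℝ) : ℂ) - (d - p.im : ℝ) * I := by
    apply Complex.ext <;> simp <;> ring
  have t8 : -1 * (I * (c:ℂ) + (a - p)) = ((p.re - a : ℝ) : ℂ) + (p.im - c : ℝ) * I := by
    apply Complex.ext <;> simp <;> ring
  rw [t1, t2, t3, t4, t5, t6, t7, t8]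
  linear_combination c1 + c2 + c3 + c4

/-- Residue theorem for finitely many simple poles inside a rectangle. -/
lemma RI_residues {a b c d : ℝ} (hab : a ≤ b) (hcd : c ≤ d) (U : Set ℂ) (hU : IsOpen U)
    (hRU : RC a b c d ⊆ U) (P : Finset ℂ) (r : ℂ → ℂ) :
    ∀ f : ℂ → ℂ, (∀ p ∈ P, a < p.re ∧ p.re < b ∧ c < p.im ∧ p.im < d) →
    DifferentiableOn ℂ f (U \ P) →
    (∀ p ∈ P, Tendsto (fun s => (s - p) * f s) (nhdsWithin p {p}ᶜ) (nhds (r p))) →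
    RI f a b c d = 2 * Real.pi * I * ∑ p ∈ P, r p := by
  induction P using Finset.induction_on with
  | empty =>
    intro f _ hf _
    simp only [Finset.coe_empty, Set.sdiff_empty] at hf
    simpa using RI_holo hab hcd (hf.mono hRU)
  | insert q P hq ih =>
    intro f hin hf hlim
    have hqin := hin q (by simp)
    have hqU : q ∈ U := hRU ⟨⟨hqin.1.le, hqin.2.1.le⟩, ⟨hqin.2.2.1.le, hqin.2.2.2.le⟩⟩
    set F : ℂ → ℂ := fun s => f s - r q * (s - q)⁻¹ with hF
    have hopen : IsOpen (U \ (P : Set ℂ)) := hU.sdiff P.finite_toSet.isClosed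
    have hqm : U \ (P : Set ℂ) ∈ nhds q := hopen.mem_nhds ⟨hqU, by simpa using hq⟩
    have hset : (U \ (P : Set ℂ)) \ {q} = U \ ((insert q P : Finset ℂ) : Set ℂ) := by
      ext s; simp; tauto
    have hinv : DifferentiableOn ℂ (fun s => r q * (s - q)⁻¹) {q}ᶜ := by
      intro s hs
      have : s - q ≠ 0 := sub_ne_zero.mpr hs
      exact (DifferentiableAt.const_mul (DifferentiableAt.fun_inv (h := fun s : ℂ => s - q) (by fun_prop) this) _).differentiableWithinAt
    have hFd : DifferentiableOn ℂ F ((U \ (P : Set ℂ)) \ {q}) := by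
      rw [hset]
      refine hf.sub (hinv.mono ?_)
      intro s hs; simp at hs ⊢; tauto
    have hFo : (fun z => F z - F q) =o[nhdsWithin q {q}ᶜ] fun z => (z - q)⁻¹ := by
      rw [Asymptotics.isLittleO_iff_tendsto']
      · have h1 : Tendsto (fun s => (s - q) * f s - r q - (s - q) * F q) (nhdsWithin q {q}ᶜ)
            (nhds (r q - r q - (q - q) * F q)) := by
          refine ((hlim q (by simp)).sub tendsto_const_nhds).sub ?_
          apply Tendsto.mono_left _ nhdsWithin_le_nhds
          exact Continuous.tendsto (by fun_prop) q
        simp only [sub_self, zero_mul] at h1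
        refine h1.congr' ?_
        filter_upwards [self_mem_nhdsWithin] with s hs
        have : s - q ≠ 0 := sub_ne_zero.mpr hs
        simp only [hF]
        field_simp
      · filter_upwards [self_mem_nhdsWithin] with s hs h
        have : s - q ≠ 0 := sub_ne_zero.mpr hs
        simp at h; exact absurd h this
    have hG := Complex.differentiableOn_update_limUnder_of_isLittleO hqm hFd hFo
    set G := Function.update F q (limUnder (nhdsWithin q {q}ᶜ) F) with hGdef
    have hGF : ∀ s, s ≠ q → G s = F s := fun s hs => Function.update_of_ne hs _ _
    have hRG := ih G (fun p hp => hin p (by simp [hp])) hG (by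
      intro p hp
      have hpq : p ≠ q := by rintro rfl; exact hq hp
      have h1 : Tendsto (fun s => (s - p) * f s - (s - p) * (r q * (s - q)⁻¹)) (nhdsWithin p {p}ᶜ)
          (nhds (r p - (p - p) * (r q * (p - q)⁻¹))) := by
        refine (hlim p (by simp [hp])).sub ?_
        apply Tendsto.mono_left _ nhdsWithin_le_nhds
        have : ContinuousAt (fun s : ℂ => (s - p) * (r q * (s - q)⁻¹)) p := by
          have : p - q ≠ 0 := sub_ne_zero.mpr hpq
          fun_prop (disch := assumption)
        exact this
      simp only [sub_self, zero_mul, sub_zero] at h1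
      refine h1.congr' ?_
      have : {q}ᶜ ∈ nhdsWithin p {p}ᶜ := nhdsWithin_le_nhds (isOpen_compl_singleton.mem_nhds hpq)
      filter_upwards [this] with s hs
      rw [hGF s hs]
      simp only [hF]; ring)
    have hBq : ∀ s ∈ RB a b c d, s ≠ q := by
      rintro s hs rfl
      rcases hs.2.2 with h | h | h | h <;> linarith [hqin.1, hqin.2.1, hqin.2.2.1, hqin.2.2.2]
    have hBP : RB a b c d ⊆ U \ (P : Set ℂ) := by
      intro s hs
      refine ⟨hRU (RB_sub_RC hs), fun hsP => ?_⟩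
      have := hin s (by simp at hsP; simp [hsP])
      rcases hs.2.2 with h | h | h | h <;> linarith [this.1, this.2.1, this.2.2.1, this.2.2.2]
    have e1 : RI f a b c d = RI (fun s => G s + r q * (s - q)⁻¹) a b c d := by
      apply RI_congr hab hcd
      intro s hs
      rw [hGF s (hBq s hs)]; simp [hF]
    rw [e1, RI_add hab hcd (hG.continuousOn.mono hBP)
      (hinv.continuousOn.mono (fun s hs => hBq s hs)), hRG,
      RI_const_mul, RI_inv hqin.1 hqin.2.1 hqin.2.2.1 hqin.2.2.2, Finset.sum_insert hq]
    ring

/-! ### The digamma function -/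

lemma norm_GammaSeq_le {z : ℂ} (hz : 0 < z.re) {n : ℕ} (hn : n ≠ 0) :
    ‖GammaSeq z n‖ ≤ Real.exp (Real.BohrMollerup.logGammaSeq z.re n) := by
  have hn' : (0:ℝ) < n := by positivity
  have e : Real.exp (Real.BohrMollerup.logGammaSeq z.re n) =
      (n:ℝ) ^ z.re * (n.factorial : ℝ) / ∏ j ∈ Finset.range (n + 1), (z.re + j) := by
    unfold Real.BohrMollerup.logGammaSeq
    rw [Real.exp_sub, Real.exp_add, Real.exp_log (by positivity), Real.exp_sum, mul_comm z.re,
      Real.rpow_def_of_pos hn']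
    congr 1
    apply Finset.prod_congr rfl
    intro j _
    rw [Real.exp_log (by positivity)]
  rw [e, GammaSeq, norm_div, norm_mul, norm_natCast, norm_prod, norm_natCast_cpow_of_pos (Nat.pos_of_ne_zero hn)]
  gcongr with j _
  have := Complex.re_le_norm (z + j)
  simpa using this

lemma GammaSeq_bdd {x1 x2 : ℝ} (h1 : 0 < x1) (h12 : x1 < x2) :
    ∃ B, ∀ z : ℂ, x1 ≤ z.re → z.re ≤ x2 → ∀ n : ℕ, n ≠ 0 → ‖GammaSeq z n‖ ≤ B := by
  obtain ⟨B1, hB1⟩ := (Real.BohrMollerup.tendsto_log_gamma h1).bddAbove_range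
  obtain ⟨B2, hB2⟩ := (Real.BohrMollerup.tendsto_log_gamma (h1.trans h12)).bddAbove_range
  refine ⟨Real.exp (max B1 B2), ?_⟩
  intro z hz1 hz2 n hn
  have hz0 : 0 < z.re := by linarith
  refine (norm_GammaSeq_le hz0 hn).trans (Real.exp_le_exp.mpr ?_)
  have b1 := hB1 ⟨n, rfl⟩
  have b2 := hB2 ⟨n, rfl⟩
  set θ := (z.re - x1) / (x2 - x1) with hθ
  have hd : 0 < x2 - x1 := by linarith
  have hθ0 : 0 ≤ θ := div_nonneg (by linarith) hd.le
  have hθ1 : θ ≤ 1 := by rw [hθ, div_le_one hd]; linarith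
  have hzθ : z.re = (1 - θ) * x1 + θ * x2 := by
    rw [hθ]; field_simp; ring
  have key : Real.BohrMollerup.logGammaSeq z.re n ≤
      (1 - θ) * Real.BohrMollerup.logGammaSeq x1 n + θ * Real.BohrMollerup.logGammaSeq x2 n := by
    unfold Real.BohrMollerup.logGammaSeq
    have : ∑ m ∈ Finset.range (n + 1), ((1 - θ) * Real.log (x1 + m) + θ * Real.log (x2 + m)) ≤
        ∑ m ∈ Finset.range (n + 1), Real.log (z.re + m) := by
      apply Finset.sum_le_sum
      intro m _
      have := strictConcaveOn_log_Ioi.concaveOn.2 (x := x1 + m) (y := x2 + m)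
        (by simp; positivity) (by simp; linarith [(Nat.cast_nonneg m : (0:ℝ) ≤ m)])
        (by linarith : 0 ≤ 1 - θ) hθ0 (by ring)
      simp only [smul_eq_mul] at this
      convert this using 2
      rw [hzθ]; ring
    rw [Finset.sum_add_distrib, ← Finset.mul_sum, ← Finset.mul_sum] at this
    rw [hzθ] at this ⊢
    linarith
  have m1 := le_max_left B1 B2
  have m2 := le_max_right B1 B2
  nlinarith

lemma deriv_GammaSeq {s : ℂ} (hs : 0 < s.re) {n : ℕ} (hn : n ≠ 0) :
    HasDerivAt (fun z => GammaSeq z n)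
      (GammaSeq s n * (Complex.log n - ∑ k ∈ Finset.range (n + 1), (s + k)⁻¹)) s := by
  have hne : ∀ k : ℕ, s + k ≠ 0 := by
    intro k h
    have := congrArg Complex.re h
    simp at this
    linarith [(Nat.cast_nonneg k : (0:ℝ) ≤ k)]
  have hn' : (n : ℂ) ≠ 0 := by exact_mod_cast hn
  have h1 : HasDerivAt (fun z : ℂ => (n:ℂ) ^ z) ((n:ℂ) ^ s * Complex.log n) s := by
    simpa using (hasDerivAt_id s).const_cpow (Or.inl hn')
  have h2 : ∀ N : ℕ, HasDerivAt (fun z : ℂ => ∏ j ∈ Finset.range N, (z + j))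
      ((∏ j ∈ Finset.range N, (s + j)) * ∑ k ∈ Finset.range N, (s + k)⁻¹) s := by
    intro N
    induction N with
    | zero => simpa using hasDerivAt_const s (1:ℂ)
    | succ N ih =>
      simp only [Finset.prod_range_succ, Finset.sum_range_succ]
      refine (ih.mul ((hasDerivAt_id' s).add_const (N:ℂ))).congr_deriv ?_
      have := hne N
      field_simp
  have h3 : ∏ j ∈ Finset.range (n + 1), (s + j) ≠ 0 := Finset.prod_ne_zero_iff.mpr fun j _ => hne j
  have := (h1.mul_const (n.factorial : ℂ)).div (h2 (n + 1)) h3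
  refine this.congr_deriv ?_
  unfold GammaSeq
  field_simp

lemma Gamma_ne_zero_of_re {s : ℂ} (hs : 0 < s.re) : Gamma s ≠ 0 := Complex.Gamma_ne_zero_of_re_pos hs

lemma tendsto_digamma {s : ℂ} (hs : 0 < s.re) :
    Tendsto (fun n : ℕ => Complex.log n - ∑ k ∈ Finset.range (n + 1), (s + k)⁻¹) atTop
      (nhds (digamma s)) := by
  set r := s.re / 2 with hr
  have hr0 : 0 < r := by positivity
  obtain ⟨B, hB⟩ := GammaSeq_bdd (x1 := r) (x2 := 3 * r) hr0 (by linarith)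
  have hU : IsOpen {z : ℂ | 0 < z.re} := isOpen_lt continuous_const Complex.continuous_re
  have hball : Metric.closedBall s r ⊆ {z : ℂ | r ≤ z.re ∧ z.re ≤ 3 * r} := by
    intro z hz
    rw [Metric.mem_closedBall, dist_eq_norm] at hz
    have := (Complex.abs_re_le_norm (z - s)).trans hz
    rw [abs_le] at this
    simp at this
    constructor <;> linarith [this.1, this.2]
  have hballU : Metric.closedBall s r ⊆ {z : ℂ | 0 < z.re} := fun z hz =>
    lt_of_lt_of_le hr0 (hball hz).1
  have hs0 : s ∈ Metric.ball s r := Metric.mem_ball_self hr0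
  have dΓ : DifferentiableOn ℂ Gamma {z : ℂ | 0 < z.re} := by
    intro z hz
    refine (Complex.differentiableAt_Gamma z ?_).differentiableWithinAt
    intro m h
    simp only [Set.mem_setOf_eq, h] at hz
    simp at hz
    linarith [(Nat.cast_nonneg m : (0:ℝ) ≤ m)]
  have e1 := two_pi_I_inv_smul_circleIntegral_sub_sq_inv_smul_of_differentiable hU hballU dΓ hs0
  have e2 : ∀ n : ℕ, n ≠ 0 → ((2 * Real.pi * I : ℂ)⁻¹ •
      ∮ z in C(s, r), ((z - s) ^ 2)⁻¹ • GammaSeq z n) = deriv (fun z => GammaSeq z n) s := by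
    intro n hn
    exact two_pi_I_inv_smul_circleIntegral_sub_sq_inv_smul_of_differentiable hU hballU
      (fun z hz => (deriv_GammaSeq hz hn).differentiableAt.differentiableWithinAt) hs0
  have hlim : Tendsto (fun n : ℕ => deriv (fun z => GammaSeq z n) s) atTop (nhds (deriv Gamma s)) := by
    rw [← e1]
    refine Tendsto.congr' (f₁ := fun n : ℕ => ((2 * Real.pi * I : ℂ)⁻¹ •
      ∮ z in C(s, r), ((z - s) ^ 2)⁻¹ • GammaSeq z n)) ?_ ?_
    · filter_upwards [eventually_ne_atTop 0] with n hn using e2 n hn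
    · refine Tendsto.const_smul ?_ _
      unfold circleIntegral
      apply intervalIntegral.tendsto_integral_filter_of_dominated_convergence
        (fun _ => r * ((r ^ 2)⁻¹ * B))
      · filter_upwards [eventually_ne_atTop 0] with n hn
        apply Continuous.aestronglyMeasurable
        rw [continuous_iff_continuousAt]
        intro θ
        have hm : circleMap s r θ ∈ Metric.closedBall s r :=
          Metric.sphere_subset_closedBall (circleMap_mem_sphere s hr0.le θ)
        have c1 : ContinuousAt (fun θ => GammaSeq (circleMap s r θ) n) θ := by
          have := (deriv_GammaSeq (hballU hm) hn).continuousAt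
          exact ContinuousAt.comp' (g := fun z => GammaSeq z n) this
            (continuous_circleMap s r).continuousAt
        have c2 : ContinuousAt (fun θ => ((circleMap s r θ - s) ^ 2)⁻¹) θ := by
          apply ContinuousAt.inv₀
          · exact (((continuous_circleMap s r).sub continuous_const).pow 2).continuousAt
          · simp [hr0.ne']
        have c3 : ContinuousAt (fun θ => deriv (circleMap s r) θ) θ := by
          simp only [deriv_circleMap]
          exact ((continuous_circleMap 0 r).mul continuous_const).continuousAt
        exact c3.smul (c2.smul c1)
      · filter_upwards [eventually_ne_atTop 0] with n hn
        refine Filter.Eventually.of_forall fun θ _ => ?_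
        have hm := hball (Metric.sphere_subset_closedBall (circleMap_mem_sphere s hr0.le θ))
        rw [norm_smul, norm_smul]
        have : ‖deriv (circleMap s r) θ‖ = r := by
          simp [deriv_circleMap, abs_of_pos hr0]
        rw [this]
        have : ‖((circleMap s r θ - s) ^ 2)⁻¹‖ = (r ^ 2)⁻¹ := by
          simp
        rw [this]
        have := hB _ hm.1 hm.2 n hn
        gcongr
      · exact intervalIntegrable_const
      · refine Filter.Eventually.of_forall fun θ _ => ?_
        refine Tendsto.const_smul ?_ _
        refine Tendsto.const_smul ?_ _
        exact GammaSeq_tendsto_Gamma _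
  have hΓ := Gamma_ne_zero_of_re hs
  have := hlim.div (GammaSeq_tendsto_Gamma s) hΓ
  rw [digamma_def, logDeriv_apply]
  refine this.congr' ?_
  filter_upwards [eventually_ne_atTop 0] with n hn
  rw [Pi.div_apply, (deriv_GammaSeq hs hn).deriv]
  have : GammaSeq s n ≠ 0 := by
    unfold GammaSeq
    have h3 : ∏ j ∈ Finset.range (n + 1), (s + j) ≠ 0 := Finset.prod_ne_zero_iff.mpr fun j _ => by
      intro h
      have := congrArg Complex.re h
      simp at this
      linarith [(Nat.cast_nonneg j : (0:ℝ) ≤ j)]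
    have h4 : (n:ℂ) ^ s ≠ 0 := by
      rw [Complex.cpow_ne_zero_iff]; left; exact_mod_cast hn
    have h5 : (n.factorial : ℂ) ≠ 0 := by exact_mod_cast n.factorial_ne_zero
    positivity
  field_simp

lemma log_succ_bound {s : ℂ} (hs : 0 < s.re) (ht : 2 ≤ |s.im|) :
    ‖s⁻¹ - (Complex.log (s + 1) - Complex.log s)‖ ≤ 1 / ‖s‖ ^ 2 := by
  have hs0 : s ≠ 0 := by rintro rfl; simp at hs
  have hn2 : 2 ≤ ‖s‖ := ht.trans (Complex.abs_im_le_norm s)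
  have h1 : s + 1 = s * (1 + s⁻¹) := by field_simp
  have hre : 0 < (s⁻¹).re := by
    rw [Complex.inv_re]; exact div_pos hs (Complex.normSq_pos.mpr hs0)
  have hre2 : 0 < (1 + s⁻¹).re := by simp; linarith [hre, (by simp : (s⁻¹).re = s.re / normSq s)]
  have hne : 1 + s⁻¹ ≠ 0 := by intro h; rw [h] at hre2; simp at hre2
  have a1 : |arg s| < Real.pi / 2 := Complex.abs_arg_lt_pi_div_two_iff.mpr (Or.inl hs)
  have a2 : |arg (1 + s⁻¹)| < Real.pi / 2 := Complex.abs_arg_lt_pi_div_two_iff.mpr (Or.inl hre2)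
  rw [abs_lt] at a1 a2
  rw [h1, Complex.log_mul hs0 hne ⟨by linarith [a1.1, a2.1], by linarith [a1.2, a2.2]⟩]
  have hinv : ‖s⁻¹‖ ≤ 1 / 2 := by
    rw [norm_inv, ← one_div]
    exact one_div_le_one_div_of_le (by norm_num) hn2
  have := Complex.norm_log_one_add_sub_self_le (z := s⁻¹) (by linarith)
  have e : s⁻¹ - (Complex.log s + Complex.log (1 + s⁻¹) - Complex.log s) =
      -(Complex.log (1 + s⁻¹) - s⁻¹) := by ring
  rw [e, norm_neg]
  refine this.trans ?_
  have h3 : (1 - ‖s⁻¹‖)⁻¹ ≤ 2 := by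
    rw [inv_le_comm₀ (by linarith) (by norm_num)]; linarith
  calc ‖s⁻¹‖ ^ 2 * (1 - ‖s⁻¹‖)⁻¹ / 2 ≤ ‖s⁻¹‖ ^ 2 * 2 / 2 := by gcongr
    _ = 1 / ‖s‖ ^ 2 := by rw [norm_inv]; field_simp

lemma sum_inv_sq_bound {s : ℂ} (hs : 0 < s.re) (ht : 2 ≤ |s.im|) (n : ℕ) :
    ∑ k ∈ Finset.range n, 1 / ‖s + k‖ ^ 2 ≤ 4 / |s.im| := by
  set t := |s.im| with htd
  have h : ∀ k : ℕ, 1 / ‖s + k‖ ^ 2 ≤ 2 * (1 / (k + t - 1) - 1 / (((k + 1 : ℕ) : ℝ) + t - 1)) := by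
    intro k
    have hk : (0:ℝ) ≤ k := Nat.cast_nonneg k
    have e1 : ‖s + k‖ ^ 2 = (s.re + k) ^ 2 + t ^ 2 := by
      rw [← Complex.normSq_eq_norm_sq, Complex.normSq_apply, htd, sq_abs]; simp; ring
    have e2 : (k + t) ^ 2 ≤ 2 * ‖s + k‖ ^ 2 := by
      rw [e1]; nlinarith [sq_nonneg ((k:ℝ) - t)]
    have p1 : (0:ℝ) < k + t - 1 := by linarith
    have p2 : (0:ℝ) < k + t := by linarith
    have : 2 * (1 / (k + t - 1) - 1 / (((k + 1 : ℕ) : ℝ) + t - 1)) = 2 / ((k + t - 1) * (k + t)) := by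
      push_cast
      have : (k:ℝ) + 1 + t - 1 = k + t := by ring
      rw [this]; field_simp; ring
    rw [this, div_le_div_iff₀ (by nlinarith) (by positivity)]
    nlinarith
  calc ∑ k ∈ Finset.range n, 1 / ‖s + k‖ ^ 2
      ≤ ∑ k ∈ Finset.range n, 2 * (1 / ((k:ℝ) + t - 1) - 1 / (((k + 1 : ℕ) : ℝ) + t - 1)) :=
        Finset.sum_le_sum fun k _ => h k
    _ = 2 * (1 / (t - 1) - 1 / ((n:ℝ) + t - 1)) := by
        rw [← Finset.mul_sum, Finset.sum_range_sub' (fun k : ℕ => 1 / ((k:ℝ) + t - 1))]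
        simp
    _ ≤ 4 / t := by
        have : 0 ≤ 1 / ((n:ℝ) + t - 1) := by
          have : (0:ℝ) ≤ n := Nat.cast_nonneg n
          apply div_nonneg <;> linarith
        have h2 : 2 * (1 / (t - 1)) ≤ 4 / t := by
          rw [mul_one_div, div_le_div_iff₀ (by linarith) (by linarith)]; linarith
        linarith

lemma digamma_sub_log {s : ℂ} (hs : 0 < s.re) (ht : 2 ≤ |s.im|) :
    ‖digamma s - Complex.log s‖ ≤ 4 / |s.im| := by
  have h1 : Tendsto (fun n : ℕ => (Complex.log n - ∑ k ∈ Finset.range (n + 1), (s + k)⁻¹)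
      - Complex.log s + (Complex.log (s + (n + 1 : ℕ)) - Complex.log n)) atTop
      (nhds (digamma s - Complex.log s + 0)) := by
    refine ((tendsto_digamma hs).sub_const _).add ?_
    have h2 : Tendsto (fun n : ℕ => 1 + (s + 1) / (n:ℂ)) atTop (nhds (1 + 0)) :=
      tendsto_const_nhds.add (tendsto_const_div_atTop_nhds_zero_nat (s + 1))
    have h3 : Tendsto (fun n : ℕ => Complex.log (1 + (s + 1) / (n:ℂ))) atTop (nhds 0) := by
      have := (h2.clog (by simp [Complex.slitPlane]))
      simpa using this
    refine h3.congr' ?_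
    filter_upwards [eventually_ne_atTop 0] with n hn
    have hn' : (0:ℝ) < n := by positivity
    have hnc : (n:ℂ) ≠ 0 := by exact_mod_cast hn
    have e : s + (n + 1 : ℕ) = ((n:ℝ):ℂ) * (1 + (s + 1) / (n:ℂ)) := by
      push_cast; field_simp; ring
    have hne : 1 + (s + 1) / (n:ℂ) ≠ 0 := by
      intro h
      rw [h] at e
      have := congrArg Complex.re e
      simp at this
      linarith
    rw [e, Complex.log_ofReal_mul hn' hne, ← Complex.natCast_log]
    simp
  rw [add_zero] at h1
  refine le_of_tendsto h1.norm (Filter.Eventually.of_forall fun n => ?_)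
  have e : (Complex.log n - ∑ k ∈ Finset.range (n + 1), (s + k)⁻¹)
      - Complex.log s + (Complex.log (s + (n + 1 : ℕ)) - Complex.log n) =
      -∑ k ∈ Finset.range (n + 1), ((s + k)⁻¹ - (Complex.log (s + k + 1) - Complex.log (s + k))) := by
    rw [Finset.sum_sub_distrib]
    have := Finset.sum_range_sub (fun k : ℕ => Complex.log (s + k)) (n + 1)
    simp only [Nat.cast_zero, add_zero, Nat.cast_add, Nat.cast_one, ← add_assoc] at this
    rw [this]
    push_cast
    rw [← add_assoc]
    ring
  rw [e, norm_neg]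
  refine (norm_sum_le _ _).trans (le_trans ?_ (sum_inv_sq_bound hs ht (n + 1)))
  apply Finset.sum_le_sum
  intro k _
  apply log_succ_bound
  · simp; positivity
  · simpa using ht

lemma log_sub_bound {s : ℂ} (h1 : |s.re| ≤ 4) (ht : 2 ≤ |s.im|) :
    ‖Complex.log s - Real.log |s.im|‖ ≤ 6 := by
  have hn : |s.im| ≤ ‖s‖ := Complex.abs_im_le_norm s
  have hpos : 0 < |s.im| := by linarith
  have hu : ‖s‖ ≤ 3 * |s.im| := by
    have := Complex.norm_le_abs_re_add_abs_im s
    linarith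
  have e : Complex.log s - Real.log |s.im| = (Real.log ‖s‖ - Real.log |s.im| : ℝ) + arg s * I := by
    rw [Complex.log]; push_cast; ring
  rw [e]
  refine (norm_add_le _ _).trans ?_
  have h2 : abs (Real.log ‖s‖ - Real.log (abs s.im)) ≤ 2 := by
    rw [← Real.log_div (by linarith) hpos.ne', abs_of_nonneg (Real.log_nonneg (by rw [le_div_iff₀ hpos]; linarith))]
    calc Real.log (‖s‖ / |s.im|) ≤ ‖s‖ / |s.im| - 1 := Real.log_le_sub_one_of_pos (div_pos (by linarith) hpos)
      _ ≤ 2 := by rw [sub_le_iff_le_add, div_le_iff₀ hpos]; linarith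
  have h3 := Complex.abs_arg_le_pi s
  rw [Complex.norm_real, Real.norm_eq_abs, norm_mul, Complex.norm_I, mul_one, Complex.norm_real, Real.norm_eq_abs]
  linarith [Real.pi_lt_d2]

lemma Gamma_half_bound (t : ℝ) : ‖Gamma (1/2 + t * I)‖ ≤ 3 * Real.exp (-(Real.pi * |t| / 2)) := by
  have h1 := Complex.Gamma_mul_Gamma_one_sub (1/2 + t * I)
  have e1 : (1 - (1/2 + t * I) : ℂ) = (starRingEnd ℂ) (1/2 + t * I) := by
    apply Complex.ext <;> simp; norm_num
  have e2 : Complex.sin (Real.pi * (1/2 + t * I)) = Real.cosh (Real.pi * t) := by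
    have : (Real.pi * (1/2 + t * I) : ℂ) = (Real.pi * t : ℂ) * I + Real.pi / 2 := by ring
    rw [this, Complex.sin_add_pi_div_two, Complex.cos_mul_I]; push_cast; rfl
  rw [e1, Complex.Gamma_conj, Complex.mul_conj, e2, Complex.normSq_eq_norm_sq] at h1
  have h2 : ‖Gamma (1/2 + t * I)‖ ^ 2 = Real.pi / Real.cosh (Real.pi * t) := by exact_mod_cast h1
  have h3 : Real.exp (Real.pi * |t|) / 2 ≤ Real.cosh (Real.pi * t) := by
    rw [← Real.cosh_abs, abs_mul, abs_of_pos Real.pi_pos, Real.cosh_eq]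
    have := Real.exp_pos (-(Real.pi * |t|))
    linarith
  apply abs_le_of_sq_le_sq' _ (by positivity) |>.2
  rw [h2, mul_pow, ← Real.exp_nat_mul]
  have e3 : (2:ℕ) * -(Real.pi * |t| / 2) = -(Real.pi * |t|) := by push_cast; ring
  rw [e3, Real.exp_neg, ← div_eq_mul_inv, div_le_div_iff₀ (Real.cosh_pos _) (Real.exp_pos _)]
  have := Real.pi_lt_d2
  have := Real.exp_pos (Real.pi * |t|)
  nlinarith

/-- Uniform upper bound for the Gamma function in a vertical strip. -/
lemma Gamma_strip_bound : ∃ C : ℝ, 0 < C ∧ ∀ s : ℂ, 1/2 ≤ s.re → s.re ≤ 4 → 2 ≤ |s.im| →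
    ‖Gamma s‖ ≤ C * Real.exp (-(Real.pi * |s.im| / 2)) * |s.im| ^ (s.re - 1/2) := by
  refine ⟨3 * Real.exp (8 * 4), by positivity, ?_⟩
  intro s h1 h2 ht
  set t := s.im with htd
  have hpos : 0 < |t| := by linarith
  have hp : ∀ x : ℝ, 1/2 ≤ x → HasDerivAt (fun x : ℝ => Gamma (x + t * I) * Complex.exp (-(x - 1/2) * Real.log |t|))
      (Gamma (x + t * I) * Complex.exp (-(x - 1/2) * Real.log |t|) *
        (digamma (x + t * I) - Real.log |t|)) x := by
    intro x hx
    have hre : 0 < ((x:ℂ) + t * I).re := by simp; linarith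
    have hΓ := Gamma_ne_zero_of_re hre
    have d1 : HasDerivAt Gamma (Gamma (x + t * I) * digamma (x + t * I)) ((x:ℂ) + t * I) := by
      have := (Complex.differentiableAt_Gamma ((x:ℂ) + t * I) (by
        intro m h
        rw [h] at hre
        simp at hre
        linarith [(Nat.cast_nonneg m : (0:ℝ) ≤ m)])).hasDerivAt
      refine this.congr_deriv ?_
      rw [digamma_def, logDeriv_apply]; field_simp
    have d2 : HasDerivAt (fun z : ℂ => Gamma (z + t * I)) (Gamma (x + t * I) * digamma (x + t * I)) (x:ℂ) :=
      d1.comp_add_const (x:ℂ) _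
    have d3 : HasDerivAt (fun z : ℂ => Complex.exp (-(z - 1/2) * Real.log |t|))
        (Complex.exp (-(x - 1/2) * Real.log |t|) * (-1 * Real.log |t|)) (x:ℂ) := by
      exact ((((hasDerivAt_id' (x:ℂ)).sub_const (1/2)).neg).mul_const _).cexp
    refine ((d2.mul d3).comp_ofReal).congr_deriv ?_
    ring
  have hg := norm_le_gronwallBound_of_norm_deriv_right_le (a := 1/2) (b := 4)
    (f := fun x : ℝ => Gamma (x + t * I) * Complex.exp (-(x - 1/2) * Real.log |t|))
    (f' := fun x : ℝ => Gamma (x + t * I) * Complex.exp (-(x - 1/2) * Real.log |t|) *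
        (digamma (x + t * I) - Real.log |t|))
    (δ := 3 * Real.exp (-(Real.pi * |t| / 2))) (K := 8) (ε := 0)
    (fun x hx => (hp x hx.1).continuousAt.continuousWithinAt)
    (fun x hx => (hp x hx.1).hasDerivWithinAt)
    (by simpa using Gamma_half_bound t)
    (by
      intro x hx
      rw [norm_mul, mul_comm, add_zero]
      gcongr
      have b1 := digamma_sub_log (s := (x:ℂ) + t * I) (by simp; linarith [hx.1]) (by simpa using ht)
      have b2 := log_sub_bound (s := (x:ℂ) + t * I) (by simp; rw [abs_of_nonneg] <;> linarith [hx.1, hx.2]) (by simpa using ht)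
      simp only [add_im, ofReal_im, mul_im, ofReal_re, I_im, mul_one, I_re, mul_zero, add_zero, zero_add] at b1 b2
      have e : digamma (x + t * I) - Real.log |t| = (digamma (x + t * I) - Complex.log (x + t * I)) +
        (Complex.log (x + t * I) - Real.log |t|) := by ring
      rw [e]
      refine (norm_add_le _ _).trans ?_
      have : 4 / |t| ≤ 2 := by rw [div_le_iff₀ hpos]; linarith
      linarith)
    s.re ⟨h1, h2⟩
  rw [gronwallBound_ε0, norm_mul] at hg
  have e1 : (s.re : ℂ) + t * I = s := Complex.re_add_im s
  have e2 : ‖Complex.exp (-(s.re - 1/2) * Real.log |t|)‖ = |t| ^ (-(s.re - 1/2)) := by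
    rw [Complex.norm_exp, Real.rpow_def_of_pos hpos]
    congr 1
    have : (-((s.re:ℂ) - 1/2) * (Real.log |t| : ℂ)) = ((-(s.re - 1/2) * Real.log |t| : ℝ) : ℂ) := by push_cast; ring
    rw [this, Complex.ofReal_re]; ring
  rw [e1, e2, Real.rpow_neg hpos.le, ← div_eq_mul_inv, div_le_iff₀ (by positivity)] at hg
  refine hg.trans ?_
  have : Real.exp (8 * (s.re - 1/2)) ≤ Real.exp (8 * 4) := Real.exp_le_exp.mpr (by linarith)
  have h0 : 0 ≤ Real.exp (-(Real.pi * |t| / 2)) := (Real.exp_pos _).le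
  have hr : 0 ≤ |t| ^ (s.re - 1/2) := by positivity
  calc _ ≤ 3 * Real.exp (-(Real.pi * |t| / 2)) * Real.exp (8 * 4) * |t| ^ (s.re - 1/2) := by gcongr
    _ = _ := by ring

/-! ### The functional equation factor -/

noncomputable def chiX (s : ℂ) : ℂ :=
  2 * (2 * Real.pi : ℂ) ^ (-s) * Gamma s * Complex.cos (Real.pi * s / 2)

noncomputable def mX (s : ℂ) : ℂ :=
  -Complex.log (2 * Real.pi) + digamma s - Real.pi / 2 * Complex.tan (Real.pi * s / 2)

lemma ne_neg_nat_of_im {s : ℂ} (h : s.im ≠ 0) (m : ℕ) : s ≠ -m := by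
  rintro rfl; simp at h

lemma ne_one_of_im {s : ℂ} (h : s.im ≠ 0) : s ≠ 1 := by
  rintro rfl; simp at h

lemma zeta_one_sub_chiX {s : ℂ} (h : s.im ≠ 0) : riemannZeta (1 - s) = chiX s * riemannZeta s := by
  rw [riemannZeta_one_sub (ne_neg_nat_of_im h) (ne_one_of_im h)]; rfl

lemma norm_cos_le (z : ℂ) : ‖Complex.cos z‖ ≤ Real.exp |z.im| := by
  rw [Complex.cos]
  have h1 : ‖Complex.exp (z * I)‖ ≤ Real.exp |z.im| := by
    rw [Complex.norm_exp]; apply Real.exp_le_exp.mpr; simp; exact neg_le_abs _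
  have h2 : ‖Complex.exp (-z * I)‖ ≤ Real.exp |z.im| := by
    rw [Complex.norm_exp]; apply Real.exp_le_exp.mpr; simp; exact le_abs_self _
  rw [norm_div]
  have := norm_add_le (Complex.exp (z * I)) (Complex.exp (-z * I))
  simp only [Complex.norm_ofNat]
  linarith

lemma two_pi_ne : (2 * Real.pi : ℂ) ≠ 0 := by
  have := Real.pi_ne_zero
  simp [this]

lemma norm_two_pi_cpow (s : ℂ) : ‖(2 * Real.pi : ℂ) ^ s‖ = (2 * Real.pi) ^ s.re := by
  have : (2 * Real.pi : ℂ) = ((2 * Real.pi : ℝ) : ℂ) := by push_cast; ring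
  rw [this, Complex.norm_cpow_eq_rpow_re_of_pos (by positivity)]

lemma chiX_bound : ∃ C : ℝ, 0 < C ∧ ∀ s : ℂ, 1/2 ≤ s.re → s.re ≤ 4 → 2 ≤ |s.im| →
    ‖chiX s‖ ≤ C * |s.im| ^ (s.re - 1/2) := by
  obtain ⟨C, hC, h⟩ := Gamma_strip_bound
  refine ⟨2 * C, by positivity, ?_⟩
  intro s h1 h2 ht
  unfold chiX
  rw [norm_mul, norm_mul, norm_mul, norm_two_pi_cpow]
  have b1 : (2 * Real.pi) ^ (-s).re ≤ 1 := by
    apply Real.rpow_le_one_of_one_le_of_nonpos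
    · linarith [Real.pi_gt_three]
    · simp; linarith
  have b2 := h s h1 h2 ht
  have b3 := norm_cos_le (Real.pi * s / 2)
  have e3 : |((Real.pi * s / 2 : ℂ)).im| = Real.pi * |s.im| / 2 := by
    have : (Real.pi * s / 2 : ℂ) = ((Real.pi / 2 : ℝ) : ℂ) * s := by push_cast; ring
    rw [this, Complex.im_ofReal_mul, abs_mul, abs_of_pos (by positivity)]; ring
  rw [e3] at b3
  calc ‖(2:ℂ)‖ * (2 * Real.pi) ^ (-s).re * ‖Gamma s‖ * ‖Complex.cos (Real.pi * s / 2)‖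
      ≤ 2 * 1 * (C * Real.exp (-(Real.pi * |s.im| / 2)) * |s.im| ^ (s.re - 1/2)) *
        Real.exp (Real.pi * |s.im| / 2) := by
        rw [Complex.norm_ofNat]
        gcongr
    _ = 2 * C * |s.im| ^ (s.re - 1/2) * (Real.exp (-(Real.pi * |s.im| / 2)) * Real.exp (Real.pi * |s.im| / 2)) := by ring
    _ = _ := by rw [← Real.exp_add]; simp

lemma cos_ne_zero_of_im {z : ℂ} (h : z.im ≠ 0) : Complex.cos z ≠ 0 := by
  intro h0
  rw [Complex.cos_eq_zero_iff] at h0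
  obtain ⟨k, hk⟩ := h0
  apply h
  rw [hk]
  have : ((2 * k + 1) * Real.pi / 2 : ℂ) = (((2 * k + 1) * Real.pi / 2 : ℝ) : ℂ) := by push_cast; ring
  rw [this, Complex.ofReal_im]

lemma pi_half_im {s : ℂ} (h : s.im ≠ 0) : ((Real.pi * s / 2 : ℂ)).im ≠ 0 := by
  have : (Real.pi * s / 2 : ℂ) = ((Real.pi / 2 : ℝ) : ℂ) * s := by push_cast; ring
  rw [this, Complex.im_ofReal_mul]
  have := Real.pi_pos
  positivity

lemma hasDerivAt_Gamma_digamma {s : ℂ} (h : s.im ≠ 0) :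
    HasDerivAt Gamma (Gamma s * digamma s) s := by
  refine (Complex.differentiableAt_Gamma s (ne_neg_nat_of_im h)).hasDerivAt.congr_deriv ?_
  have := Complex.Gamma_ne_zero (ne_neg_nat_of_im h)
  rw [digamma_def, logDeriv_apply]; field_simp

lemma hasDerivAt_chiX {s : ℂ} (h : s.im ≠ 0) : HasDerivAt chiX (mX s * chiX s) s := by
  have d1 : HasDerivAt (fun s : ℂ => (2 * Real.pi : ℂ) ^ (-s))
      ((2 * Real.pi : ℂ) ^ (-s) * Complex.log (2 * Real.pi) * (-1)) s :=
    (hasDerivAt_neg s).const_cpow (Or.inl two_pi_ne)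
  have d2 := hasDerivAt_Gamma_digamma h
  have hc := cos_ne_zero_of_im (pi_half_im h)
  have d3 : HasDerivAt (fun s : ℂ => Complex.cos (Real.pi * s / 2))
      (-Complex.sin (Real.pi * s / 2) * (Real.pi * 1 / 2)) s := by
    exact (((hasDerivAt_id' s).const_mul (Real.pi : ℂ)).div_const 2).ccos
  have := ((d1.const_mul 2).mul d2).mul d3
  refine this.congr_deriv ?_
  unfold mX chiX
  rw [Complex.tan]
  simp only [Pi.mul_apply]
  field_simp
  ring

lemma chiX_ne_zero {s : ℂ} (h : s.im ≠ 0) : chiX s ≠ 0 := by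
  unfold chiX
  have h1 := Complex.Gamma_ne_zero (ne_neg_nat_of_im h)
  have hc := cos_ne_zero_of_im (pi_half_im h)
  have h2 : (2 * Real.pi : ℂ) ^ (-s) ≠ 0 := by
    rw [Complex.cpow_ne_zero_iff]; left; exact two_pi_ne
  simp [h1, hc, h2]

lemma tan_add_I_bound {z : ℂ} (h : z.im ≤ -1) : ‖Complex.tan z + I‖ ≤ 4 / |z.im| := by
  have hc := cos_ne_zero_of_im (z := z) (by linarith)
  have e : Complex.tan z + I = I * Complex.exp (-z * I) / Complex.cos z := by
    rw [Complex.tan, eq_div_iff hc, add_mul, div_mul_cancel₀ _ hc]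
    have : -z * I = (-z) * I := rfl
    rw [Complex.exp_mul_I]
    simp
    linear_combination Complex.sin z * Complex.I_mul_I
  set y := |z.im| with hy
  have hyz : z.im = -y := by rw [hy, abs_of_nonpos (by linarith)]; ring
  have hy1 : 1 ≤ y := by linarith
  have n1 : ‖Complex.exp (-z * I)‖ = Real.exp (-y) := by
    rw [Complex.norm_exp]; simp [hyz]
  have n2 : ‖Complex.exp (z * I)‖ = Real.exp y := by
    rw [Complex.norm_exp]; simp [hyz]
  have n3 : (Real.exp y - Real.exp (-y)) / 2 ≤ ‖Complex.cos z‖ := by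
    rw [Complex.cos, norm_div, Complex.norm_ofNat]
    have := norm_sub_le_norm_add (Complex.exp (z * I)) (Complex.exp (-z * I))
    rw [n1, n2] at this
    linarith
  have b1 : y + 1 ≤ Real.exp y := Real.add_one_le_exp y
  have b2 : Real.exp (-y) ≤ 1 := Real.exp_le_one_iff.mpr (by linarith)
  rw [e, norm_div, norm_mul, Complex.norm_I, one_mul, n1, div_le_div_iff₀ (by linarith) (by linarith)]
  nlinarith

lemma mX_bound : ∃ C : ℝ, 0 < C ∧ ∀ s : ℂ, -3/2 ≤ s.re → s.re ≤ 4 → s.im ≤ -16 →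
    ‖mX s - Real.log (|s.im| / (2 * Real.pi))‖ ≤ C / |s.im| := by
  refine ⟨100, by norm_num, ?_⟩
  intro s h1 h2 ht
  set t := |s.im| with htd
  have hst : s.im = -t := by rw [htd, abs_of_nonpos (by linarith)]; ring
  have ht16 : 16 ≤ t := by linarith
  have him : s.im ≠ 0 := by linarith
  have r1 := digamma_apply_add_one s (ne_neg_nat_of_im him)
  have r2 := digamma_apply_add_one (s + 1) (ne_neg_nat_of_im (by simpa using him))
  have e2 : s + 1 + 1 = s + 2 := by ring
  rw [e2] at r2
  have a1 := digamma_sub_log (s := s + 2) (by simp; linarith) (by simp; rw [← htd]; linarith)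
  have him2 : |(s + 2).im| = t := by simp [htd]
  rw [him2] at a1
  have n1 : ‖s⁻¹‖ ≤ 1 / t := by
    rw [norm_inv, ← one_div]
    exact one_div_le_one_div_of_le (by linarith) (Complex.abs_im_le_norm s)
  have n2 : ‖(s + 1)⁻¹‖ ≤ 1 / t := by
    rw [norm_inv, ← one_div]
    refine one_div_le_one_div_of_le (by linarith) ?_
    have := Complex.abs_im_le_norm (s + 1)
    simpa using this
  have l1 : Complex.log (s + 2) = Real.log t + Complex.log (1 + ((s.re + 2) / t : ℝ) * I) - I * Real.pi / 2 := by
    have c := log_corner (x := t) (y := s.re + 2) (by linarith) (by linarith)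
    have e3 : (((s.re + 2 : ℝ) : ℂ) - (t:ℝ) * I) = s + 2 := by
      apply Complex.ext <;> simp [hst]
    have e4 : ((t:ℂ) + ((s.re + 2 : ℝ) : ℂ) * I) = (t:ℂ) * (1 + ((s.re + 2) / t : ℝ) * I) := by
      have : (t:ℂ) ≠ 0 := by exact_mod_cast (by linarith : t ≠ 0)
      push_cast
      field_simp
    rw [e3, e4, Complex.log_ofReal_mul (by linarith)] at c
    · linear_combination -c
    · intro h
      have := congrArg Complex.re h
      simp at this
  have l2 : ‖Complex.log (1 + ((s.re + 2) / t : ℝ) * I)‖ ≤ 9 / t := by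
    have hz : ‖(((s.re + 2) / t : ℝ) : ℂ) * I‖ = (s.re + 2) / t := by
      rw [norm_mul, Complex.norm_I, mul_one, Complex.norm_real, Real.norm_of_nonneg]
      apply div_nonneg <;> linarith
    have hz2 : (s.re + 2) / t ≤ 6 / t := by gcongr; linarith
    have hz3 : 6 / t ≤ 1 / 2 := by rw [div_le_div_iff₀ (by linarith) (by norm_num)]; linarith
    have := Complex.norm_log_one_add_half_le_self (z := (((s.re + 2) / t : ℝ) : ℂ) * I) (by rw [hz]; linarith)
    rw [hz] at this
    calc _ ≤ 3/2 * ((s.re + 2) / t) := this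
      _ ≤ 3/2 * (6 / t) := by gcongr
      _ = 9 / t := by ring
  have hzim : ((Real.pi * s / 2 : ℂ)).im = -(Real.pi / 2 * t) := by
    have : (Real.pi * s / 2 : ℂ) = ((Real.pi / 2 : ℝ) : ℂ) * s := by push_cast; ring
    rw [this, Complex.im_ofReal_mul, hst]; ring
  have hpi := Real.pi_gt_three
  have hpi2 := Real.pi_lt_d2
  have t1 := tan_add_I_bound (z := Real.pi * s / 2) (by rw [hzim]; nlinarith)
  have t2 : ‖Complex.tan (Real.pi * s / 2) + I‖ ≤ 4 / t := by
    refine t1.trans ?_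
    rw [hzim, abs_neg, abs_of_pos (by positivity)]
    apply div_le_div_of_nonneg_left <;> nlinarith
  have e5 : mX s - Real.log (t / (2 * Real.pi)) =
      (digamma (s + 2) - Complex.log (s + 2)) - s⁻¹ - (s + 1)⁻¹ +
        Complex.log (1 + ((s.re + 2) / t : ℝ) * I) - Real.pi / 2 * (Complex.tan (Real.pi * s / 2) + I) := by
    rw [Real.log_div (by linarith) (by positivity)]
    have : Complex.log (2 * Real.pi) = Real.log (2 * Real.pi) := by
      rw [Complex.ofReal_log (by positivity)]; push_cast; rfl
    unfold mX
    rw [this]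
    push_cast
    push_cast at l1
    linear_combination l1 - r1 - r2
  rw [e5]
  have t3 : ‖(Real.pi / 2 : ℂ) * (Complex.tan (Real.pi * s / 2) + I)‖ ≤ 2 * (4 / t) := by
    rw [norm_mul]
    have : ‖(Real.pi / 2 : ℂ)‖ = Real.pi / 2 := by
      have : (Real.pi / 2 : ℂ) = ((Real.pi / 2 : ℝ) : ℂ) := by push_cast; rfl
      rw [this, Complex.norm_real, Real.norm_of_nonneg (by positivity)]
    rw [this]
    gcongr
    linarith
  have k1 := norm_sub_le (digamma (s + 2) - Complex.log (s + 2) - s⁻¹ - (s + 1)⁻¹ +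
        Complex.log (1 + ((s.re + 2) / t : ℝ) * I)) (Real.pi / 2 * (Complex.tan (Real.pi * s / 2) + I))
  have k2 := norm_add_le (digamma (s + 2) - Complex.log (s + 2) - s⁻¹ - (s + 1)⁻¹)
    (Complex.log (1 + ((s.re + 2) / t : ℝ) * I))
  have k3 := norm_sub_le (digamma (s + 2) - Complex.log (s + 2) - s⁻¹) (s + 1)⁻¹
  have k4 := norm_sub_le (digamma (s + 2) - Complex.log (s + 2)) s⁻¹
  have tot : 4 / t + 1 / t + 1 / t + 9 / t + 2 * (4 / t) ≤ 100 / t := by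
    have : 0 < 1 / t := by positivity
    have e : ∀ c : ℝ, c / t = c * (1 / t) := fun c => by ring
    rw [e 4, e 9, e 100]; nlinarith
  linarith

/-! ### Growth of zeta in the critical strip -/

lemma hasDerivAt_real_cpow (r : ℂ) {x : ℝ} (hx : 0 < x) :
    HasDerivAt (fun y : ℝ => (y : ℂ) ^ r) (r * (x : ℂ) ^ (r - 1)) x := by
  have h := (hasDerivAt_id (x : ℂ)).cpow_const (c := r) (by simp [Complex.slitPlane, hx])
  have := h.comp_ofReal
  simpa using this

lemma norm_real_cpow {x : ℝ} (hx : 0 < x) (s : ℂ) : ‖(x : ℂ) ^ s‖ = x ^ s.re :=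
  Complex.norm_cpow_eq_rpow_re_of_pos hx s

lemma cpow_neg_sub_bound {s : ℂ} (hs : 0 < s.re) {n x : ℝ} (hn : 0 < n) (hx : n ≤ x) :
    ‖(x : ℂ) ^ (-s) - (n : ℂ) ^ (-s)‖ ≤ ‖s‖ / s.re * (n ^ (-s.re) - x ^ (-s.re)) := by
  have := image_norm_le_of_norm_deriv_right_le_deriv_boundary' (a := n) (b := x)
    (f := fun y : ℝ => (y : ℂ) ^ (-s) - (n : ℂ) ^ (-s))
    (f' := fun y : ℝ => (-s) * (y : ℂ) ^ (-s - 1))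
    (B := fun y : ℝ => ‖s‖ / s.re * (n ^ (-s.re) - y ^ (-s.re)))
    (B' := fun y : ℝ => ‖s‖ * y ^ (-s.re - 1)) ?_ ?_ (by simp) ?_ ?_ ?_
    (x := x) ⟨hx, le_rfl⟩
  · exact this
  · intro y hy
    exact ((hasDerivAt_real_cpow (-s) (lt_of_lt_of_le hn hy.1)).sub_const
      _).continuousAt.continuousWithinAt
  · intro y hy
    exact ((hasDerivAt_real_cpow (-s) (lt_of_lt_of_le hn hy.1)).sub_const _).hasDerivWithinAt
  · intro y hy
    have hy0 : 0 < y := lt_of_lt_of_le hn hy.1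
    exact ((continuousAt_const.sub (Real.continuousAt_rpow_const _ _ (Or.inl
      hy0.ne'))).const_mul _).continuousWithinAt
  · intro y hy
    have hy0 : 0 < y := lt_of_lt_of_le hn hy.1
    have := ((Real.hasDerivAt_rpow_const (p := -s.re) (Or.inl hy0.ne')).const_sub
      (n ^ (-s.re))).const_mul (‖s‖ / s.re)
    refine HasDerivAt.hasDerivWithinAt (this.congr_deriv ?_)
    field_simp
  · intro y hy
    have hy0 : 0 < y := lt_of_lt_of_le hn hy.1
    rw [norm_mul, norm_real_cpow hy0]
    simp

noncomputable def zE (k : ℕ) (s : ℂ) : ℂ :=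
  (s - 1) * ((k + 1 : ℝ) : ℂ) ^ (-s) - ((k + 1 : ℝ) : ℂ) ^ (1 - s) + ((k + 2 : ℝ) : ℂ) ^ (1 - s)

lemma zE_bound {s : ℂ} (hs : 0 < s.re) (k : ℕ) :
    ‖zE k s‖ ≤ ‖s - 1‖ * (‖s‖ / s.re * ((k + 1 : ℝ) ^ (-s.re) - (k + 2 : ℝ) ^ (-s.re))) := by
  have hk : (0 : ℝ) < k + 1 := by positivity
  have := norm_image_sub_le_of_norm_deriv_le_segment'
    (f := fun y : ℝ => (s - 1) * (((k + 1 : ℝ) : ℂ) ^ (-s)) * (y : ℂ) + (y : ℂ) ^ (1 - s))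
    (f' := fun y : ℝ => (s - 1) * (((k + 1 : ℝ) : ℂ) ^ (-s)) * 1 + (1 - s) * (y : ℂ) ^ (1 - s - 1))
    (a := (k + 1 : ℝ)) (b := (k + 2 : ℝ))
    (C := ‖s - 1‖ * (‖s‖ / s.re * ((k + 1 : ℝ) ^ (-s.re) - (k + 2 : ℝ) ^ (-s.re)))) ?_ ?_
    (k + 2 : ℝ) ⟨by linarith, le_rfl⟩
  · refine le_trans (le_of_eq ?_) (this.trans (le_of_eq (by ring)))
    congr 1
    rw [zE]; push_cast; ring
  · intro y hy
    have hy0 : 0 < y := lt_of_lt_of_le hk hy.1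
    exact (((hasDerivAt_id y).ofReal_comp.const_mul _).add
      (hasDerivAt_real_cpow (1 - s) hy0)).hasDerivWithinAt
  · intro y hy
    have hy0 : 0 < y := lt_of_lt_of_le hk hy.1
    have e : (s - 1) * (((k + 1 : ℝ) : ℂ) ^ (-s)) * 1 + (1 - s) * (y : ℂ) ^ (1 - s - 1)
        = -((s - 1) * ((y : ℂ) ^ (-s) - ((k + 1 : ℝ) : ℂ) ^ (-s))) := by
      rw [show 1 - s - 1 = -s by ring]; ring
    simp only [e, norm_neg, norm_mul]
    refine mul_le_mul_of_nonneg_left ((cpow_neg_sub_bound hs hk hy.1).trans ?_) (norm_nonneg _)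
    refine mul_le_mul_of_nonneg_left ?_ (by positivity)
    have : (k + 2 : ℝ) ^ (-s.re) ≤ y ^ (-s.re) :=
      Real.rpow_le_rpow_of_nonpos hy0 hy.2.le (by linarith)
    linarith

lemma rpow_neg_diff_le {σ : ℝ} (hσ : 0 < σ) (k : ℕ) :
    (k + 1 : ℝ) ^ (-σ) - (k + 2 : ℝ) ^ (-σ) ≤ σ * (k + 1 : ℝ) ^ (-σ - 1) := by
  have hk : (0 : ℝ) < k + 1 := by positivity
  have e : (k + 2 : ℝ) = (k + 1) * (1 + 1 / (k + 1)) := by field_simp; ring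
  have h1 : (0 : ℝ) < 1 + 1 / (k + 1) := by positivity
  have h2 : 1 - σ / (k + 1) ≤ (1 + 1 / (k + 1 : ℝ)) ^ (-σ) := by
    rw [Real.rpow_def_of_pos h1]
    have a1 := Real.add_one_le_exp (Real.log (1 + 1 / (k + 1 : ℝ)) * -σ)
    have a2 : Real.log (1 + 1 / (k + 1 : ℝ)) ≤ 1 / (k + 1) := by
      have := Real.log_le_sub_one_of_pos h1; linarith
    have a3 := mul_le_mul_of_nonneg_left a2 hσ.le
    have a4 : σ * (1 / (k + 1 : ℝ)) = σ / (k + 1) := by ring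
    linarith
  rw [e, Real.mul_rpow hk.le h1.le, Real.rpow_sub_one hk.ne']
  have h3 := mul_le_mul_of_nonneg_left h2 (Real.rpow_nonneg hk.le (-σ))
  have : σ * ((k + 1 : ℝ) ^ (-σ) / (k + 1)) = (k + 1 : ℝ) ^ (-σ) * (σ / (k + 1)) := by ring
  linarith

lemma zE_bound' {s : ℂ} (hs : 0 < s.re) (k : ℕ) :
    ‖zE k s‖ ≤ ‖s - 1‖ * ‖s‖ * (k + 1 : ℝ) ^ (-s.re - 1) := by
  refine (zE_bound hs k).trans ?_
  rw [mul_assoc]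
  refine mul_le_mul_of_nonneg_left ?_ (norm_nonneg _)
  calc _ ≤ ‖s‖ / s.re * (s.re * (k + 1 : ℝ) ^ (-s.re - 1)) :=
        mul_le_mul_of_nonneg_left (rpow_neg_diff_le hs k) (by positivity)
    _ = _ := by field_simp

lemma summable_succ_rpow {ε : ℝ} (hε : 0 < ε) : Summable (fun k : ℕ => (k + 1 : ℝ) ^ (-ε - 1)) := by
  have := (summable_nat_add_iff 1).mpr (Real.summable_nat_rpow (p := -ε - 1) |>.mpr (by linarith))
  simpa using this

lemma zE_summable {s : ℂ} (hs : 0 < s.re) : Summable (fun k => zE k s) :=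
  Summable.of_norm_bounded ((summable_succ_rpow hs).mul_left _) (zE_bound' hs)

lemma zE_partial (s : ℂ) (M : ℕ) : ∑ k ∈ range M, zE k s =
    (s - 1) * ∑ k ∈ range M, ((k + 1 : ℝ) : ℂ) ^ (-s) + ((M + 1 : ℝ) : ℂ) ^ (1 - s) - 1 := by
  induction M with
  | zero => simp
  | succ M ih =>
    rw [sum_range_succ, sum_range_succ, ih, zE]; push_cast
    rw [show (M : ℂ) + 1 + 1 = M + 2 by ring]; ring

lemma zE_tsum_of_one_lt {s : ℂ} (hs : 1 < s.re) : ∑' k, zE k s = riemannZeta₁ s - 1 := by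
  have hs1 : s ≠ 1 := by rintro rfl; simp at hs
  have h1 := (zE_summable (by linarith : 0 < s.re)).hasSum.tendsto_sum_nat
  refine tendsto_nhds_unique h1 ?_
  simp_rw [zE_partial]
  have h2 : riemannZeta₁ s - 1 = (s - 1) * riemannZeta s + 0 - 1 := by
    rw [riemannZeta_eq_inv_sub_mul hs1]
    have := sub_ne_zero.mpr hs1
    field_simp
    ring
  rw [h2]
  refine Tendsto.sub_const (Tendsto.add (Tendsto.const_mul _ ?_) ?_) _
  · rw [zeta_eq_tsum_one_div_nat_add_one_cpow hs]
    have hsum : Summable (fun n : ℕ => 1 / ((n : ℂ) + 1) ^ s) := by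
      have := (summable_nat_add_iff 1).mpr (Complex.summable_one_div_nat_cpow.mpr hs)
      simpa using this
    refine hsum.hasSum.tendsto_sum_nat.congr fun n => ?_
    refine sum_congr rfl fun k _ => ?_
    rw [Complex.cpow_neg]; push_cast; simp
  · rw [tendsto_zero_iff_norm_tendsto_zero]
    have h3 : Tendsto (fun M : ℕ => ((M : ℝ) + 1) ^ (-(s.re - 1))) atTop (nhds 0) :=
      (tendsto_rpow_neg_atTop (by linarith)).comp
        (tendsto_atTop_add_const_right _ _ tendsto_natCast_atTop_atTop)
    refine h3.congr fun M => ?_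
    rw [norm_real_cpow (by positivity)]; simp

lemma zE_tsum {s : ℂ} (hs : 0 < s.re) : ∑' k, zE k s = riemannZeta₁ s - 1 := by
  have hU : IsOpen {z : ℂ | 0 < z.re} := isOpen_lt continuous_const Complex.continuous_re
  have hconv : Convex ℝ {z : ℂ | 0 < z.re} := convex_halfSpace_re_gt 0
  have hd : DifferentiableOn ℂ (fun z => ∑' k, zE k z) {z : ℂ | 0 < z.re} := by
    intro z hz
    have hz' : 0 < z.re := hz
    set V : Set ℂ := {w | z.re / 2 < w.re} ∩ Metric.ball 0 (‖z‖ + 1) with hV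
    have hVo : IsOpen V := (isOpen_lt continuous_const Complex.continuous_re).inter
      Metric.isOpen_ball
    have hzV : z ∈ V := ⟨by simp; linarith, by simp⟩
    have : DifferentiableOn ℂ (fun z => ∑' k, zE k z) V := by
      refine Complex.differentiableOn_tsum_of_summable_norm
        (u := fun k => (‖z‖ + 2) * (‖z‖ + 1) * (k + 1 : ℝ) ^ (-(z.re / 2) - 1))
        ((summable_succ_rpow (by linarith)).mul_left _) ?_ hVo ?_
      · intro k
        have hk : ((k + 1 : ℝ) : ℂ) ≠ 0 := by
          rw [Complex.ofReal_ne_zero]; positivity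
        have hk2 : ((k + 2 : ℝ) : ℂ) ≠ 0 := by
          rw [Complex.ofReal_ne_zero]; positivity
        intro w _
        apply DifferentiableAt.differentiableWithinAt
        unfold zE
        refine DifferentiableAt.add (DifferentiableAt.sub (DifferentiableAt.mul (by fun_prop) ?_) ?_) ?_
        · exact DifferentiableAt.const_cpow (by fun_prop) (Or.inl hk)
        · exact DifferentiableAt.const_cpow (by fun_prop) (Or.inl hk)
        · exact DifferentiableAt.const_cpow (by fun_prop) (Or.inl hk2)
      · intro k w hw
        have hw1 : z.re / 2 < w.re := hw.1
        have hw2 : ‖w‖ < ‖z‖ + 1 := by simpa using hw.2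
        refine (zE_bound' (by linarith) k).trans ?_
        have h1 : ‖w - 1‖ ≤ ‖z‖ + 2 := by
          have := norm_sub_le w 1; simp at this; linarith
        have h2 : (k + 1 : ℝ) ^ (-w.re - 1) ≤ (k + 1 : ℝ) ^ (-(z.re / 2) - 1) :=
          Real.rpow_le_rpow_of_exponent_le (by simp) (by linarith)
        gcongr
    exact (this.differentiableAt (hVo.mem_nhds hzV)).differentiableWithinAt
  have h2 : AnalyticOnNhd ℂ (fun z => ∑' k, zE k z) {z : ℂ | 0 < z.re} := hd.analyticOnNhd hU
  have h3 : AnalyticOnNhd ℂ (fun z => riemannZeta₁ z - 1) {z : ℂ | 0 < z.re} :=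
    (by fun_prop : Differentiable ℂ (fun z => riemannZeta₁ z - 1)).differentiableOn.analyticOnNhd hU
  refine h2.eqOn_of_preconnected_of_eventuallyEq h3 hconv.isPreconnected (z₀ := 2) (by simp) ?_ hs
  have : {z : ℂ | 1 < z.re} ∈ nhds (2 : ℂ) :=
    (isOpen_lt continuous_const Complex.continuous_re).mem_nhds (by simp)
  filter_upwards [this] with z hz using zE_tsum_of_one_lt hz

lemma zE_tail {s : ℂ} (hs : 0 < s.re) (M : ℕ) :
    ‖∑' k, zE (k + M) s‖ ≤ ‖s - 1‖ * (‖s‖ / s.re * (M + 1 : ℝ) ^ (-s.re)) := by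
  set c := fun k : ℕ => ((k + M : ℕ) + 1 : ℝ) ^ (-s.re) with hc
  have hlim : Tendsto c atTop (nhds 0) := by
    have : Tendsto (fun k : ℕ => ((k : ℝ) + (M + 1))) atTop atTop :=
      tendsto_atTop_add_const_right _ _ tendsto_natCast_atTop_atTop
    refine ((tendsto_rpow_neg_atTop hs).comp this).congr fun k => ?_
    simp [hc, add_assoc]
  have hsum : HasSum (fun k => c k - c (k + 1)) (c 0 - 0) := by
    rw [hasSum_iff_tendsto_nat_of_nonneg]
    · simp_rw [Finset.sum_range_sub']
      exact hlim.const_sub _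
    · intro k
      simp only [hc, sub_nonneg]
      refine Real.rpow_le_rpow_of_nonpos (by positivity) (by push_cast; linarith) (by linarith)
  have := hsum.mul_left (‖s - 1‖ * (‖s‖ / s.re))
  refine (tsum_of_norm_bounded this fun k => ?_).trans (le_of_eq ?_)
  · refine (zE_bound hs (k + M)).trans (le_of_eq ?_)
    simp only [hc]; push_cast; ring_nf
  · simp only [hc]; simp; ring

lemma zeta_approx {s : ℂ} (hs : 0 < s.re) (hs1 : s ≠ 1) (M : ℕ) :
    ‖riemannZeta s - (∑ k ∈ range M, ((k + 1 : ℝ) : ℂ) ^ (-s) + ((M + 1 : ℝ) : ℂ) ^ (1 - s) / (s - 1))‖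
      ≤ ‖s‖ / s.re * (M + 1 : ℝ) ^ (-s.re) := by
  have h0 : s - 1 ≠ 0 := sub_ne_zero.mpr hs1
  have h1 := (zE_summable hs).sum_add_tsum_nat_add M
  rw [zE_tsum hs, zE_partial] at h1
  have h2 := zE_tail hs M
  have e : riemannZeta s - (∑ k ∈ range M, ((k + 1 : ℝ) : ℂ) ^ (-s) + ((M + 1 : ℝ) : ℂ) ^ (1 - s) / (s - 1))
      = (∑' k, zE (k + M) s) / (s - 1) := by
    rw [riemannZeta_eq_inv_sub_mul hs1]
    field_simp
    linear_combination -h1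
  rw [e, norm_div, div_le_iff₀ (norm_pos_iff.mpr h0)]
  linarith

lemma zeta_bound : ∃ C : ℝ, 0 < C ∧ ∀ s : ℂ, 1/4 ≤ s.re → s.re ≤ 5 → 2 ≤ |s.im| →
    ‖riemannZeta s‖ ≤ C * |s.im| ^ (max (1 - s.re) 0) * Real.log |s.im| := by
  refine ⟨27 + 27, by norm_num, fun s h1 h2 h3 => ?_⟩
  set t := |s.im| with ht
  have ht0 : 0 < t := by linarith
  set μ := max (1 - s.re) 0 with hμ
  have hμ1 : μ ≤ 1 := by rw [hμ]; exact max_le (by linarith) zero_le_one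
  have hμ0 : 0 ≤ μ := le_max_right _ _
  have hlog : 1/2 ≤ Real.log t := by
    have := Real.log_two_gt_d9
    have := Real.log_le_log (by norm_num) h3
    linarith
  have hs1 : s ≠ 1 := by rintro rfl; simp [ht] at h3; linarith
  set M := ⌊t⌋₊ with hM
  have hM1 : (M : ℝ) ≤ t := Nat.floor_le ht0.le
  have hM2 : t < M + 1 := Nat.lt_floor_add_one t
  have hMpos : 1 ≤ M := Nat.le_floor (by norm_num; linarith)
  have hsn : ‖s‖ ≤ 4 * t := by
    have := Complex.norm_le_abs_re_add_abs_im s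
    rw [abs_of_nonneg (by linarith : 0 ≤ s.re)] at this
    linarith
  have hs1n : t ≤ ‖s - 1‖ := by
    have := Complex.abs_im_le_norm (s - 1)
    simpa using this
  have hP1 : 1 ≤ t ^ μ := Real.one_le_rpow (by linarith) hμ0
  have key := zeta_approx (by linarith : 0 < s.re) hs1 M
  have b1 : ‖∑ k ∈ range M, ((k + 1 : ℝ) : ℂ) ^ (-s)‖ ≤ t ^ μ * (1 + Real.log t) := by
    refine (norm_sum_le _ _).trans ?_
    have hh : ∑ k ∈ range M, ((k : ℝ) + 1)⁻¹ ≤ 1 + Real.log t := by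
      have := harmonic_le_one_add_log M
      rw [harmonic] at this; push_cast at this
      have l : Real.log M ≤ Real.log t := Real.log_le_log (by exact_mod_cast hMpos) hM1
      linarith
    refine le_trans ?_ (mul_le_mul_of_nonneg_left hh (by positivity))
    rw [mul_sum]
    refine sum_le_sum fun k hk => ?_
    have hk' : (k : ℝ) + 1 ≤ t := by
      have : k + 1 ≤ M := Finset.mem_range.mp hk
      have : ((k + 1 : ℕ) : ℝ) ≤ M := by exact_mod_cast this
      push_cast at this; linarith
    have hk0 : (0 : ℝ) < k + 1 := by positivity
    rw [norm_real_cpow hk0, Complex.neg_re]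
    have : ((k : ℝ) + 1) ^ (-s.re) = ((k : ℝ) + 1) ^ (1 - s.re) * ((k : ℝ) + 1)⁻¹ := by
      rw [← Real.rpow_neg_one, ← Real.rpow_add hk0]; ring_nf
    rw [this]
    refine mul_le_mul_of_nonneg_right ?_ (by positivity)
    calc ((k : ℝ) + 1) ^ (1 - s.re) ≤ ((k : ℝ) + 1) ^ μ :=
          Real.rpow_le_rpow_of_exponent_le (by simp) (le_max_left _ _)
      _ ≤ t ^ μ := Real.rpow_le_rpow hk0.le hk' hμ0
  have b2 : ‖((M + 1 : ℝ) : ℂ) ^ (1 - s) / (s - 1)‖ ≤ 2 * t ^ μ := by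
    rw [norm_div, norm_real_cpow (by positivity), div_le_iff₀ (by linarith)]
    have e1 : (M + 1 : ℝ) ^ (1 - s).re ≤ 2 * t ^ μ := by
      calc (M + 1 : ℝ) ^ (1 - s).re ≤ (M + 1 : ℝ) ^ μ :=
            Real.rpow_le_rpow_of_exponent_le (by simp) (by simp [hμ])
        _ ≤ (2 * t) ^ μ := Real.rpow_le_rpow (by positivity) (by linarith) hμ0
        _ = 2 ^ μ * t ^ μ := Real.mul_rpow (by norm_num) ht0.le
        _ ≤ 2 * t ^ μ := by
          have : (2 : ℝ) ^ μ ≤ 2 ^ (1 : ℝ) := Real.rpow_le_rpow_of_exponent_le (by norm_num) hμ1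
          rw [Real.rpow_one] at this
          gcongr
    nlinarith [mul_nonneg (by positivity : 0 ≤ 2 * t ^ μ) (by linarith : 0 ≤ ‖s - 1‖ - 1)]
  have b3 : ‖s‖ / s.re * (M + 1 : ℝ) ^ (-s.re) ≤ 16 * t ^ μ := by
    have e1 : ‖s‖ / s.re ≤ 16 * t := by
      rw [div_le_iff₀ (by linarith)]; nlinarith
    have e2 : (M + 1 : ℝ) ^ (-s.re) ≤ t ^ (-s.re) :=
      Real.rpow_le_rpow_of_nonpos ht0 hM2.le (by linarith)
    have e3 : t * t ^ (-s.re) ≤ t ^ μ := by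
      rw [show t * t ^ (-s.re) = t ^ (1 - s.re) by
        rw [sub_eq_add_neg, Real.rpow_add ht0, Real.rpow_one]]
      exact Real.rpow_le_rpow_of_exponent_le (by linarith) (le_max_left _ _)
    calc _ ≤ 16 * t * t ^ (-s.re) := by gcongr
      _ = 16 * (t * t ^ (-s.re)) := by ring
      _ ≤ _ := by gcongr
  have tri : ‖riemannZeta s‖ ≤ 16 * t ^ μ + (t ^ μ * (1 + Real.log t) + 2 * t ^ μ) := by
    have := norm_add_le (riemannZeta s - (∑ k ∈ range M, ((k + 1 : ℝ) : ℂ) ^ (-s) +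
      ((M + 1 : ℝ) : ℂ) ^ (1 - s) / (s - 1))) (∑ k ∈ range M, ((k + 1 : ℝ) : ℂ) ^ (-s) +
      ((M + 1 : ℝ) : ℂ) ^ (1 - s) / (s - 1))
    rw [sub_add_cancel] at this
    have := norm_add_le (∑ k ∈ range M, ((k + 1 : ℝ) : ℂ) ^ (-s))
      (((M + 1 : ℝ) : ℂ) ^ (1 - s) / (s - 1))
    linarith
  nlinarith

/-- Bound to the left of the critical line. -/
lemma zeta_bound_left : ∃ C : ℝ, 0 < C ∧ ∀ s : ℂ, -3 ≤ s.re → s.re ≤ 1/2 → 2 ≤ |s.im| →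
    ‖riemannZeta s‖ ≤ C * |s.im| ^ (1/2 + max (-s.re) 0) * Real.log |s.im| := by
  obtain ⟨C1, hC1, H1⟩ := zeta_bound
  obtain ⟨C2, hC2, H2⟩ := chiX_bound
  refine ⟨C2 * C1, by positivity, fun s h1 h2 h3 => ?_⟩
  have him : (1 - s).im ≠ 0 := by
    intro h; simp at h; rw [h] at h3; simp at h3; linarith
  have e : |(1 - s).im| = |s.im| := by simp
  have e' : (1 - s).re = 1 - s.re := by simp
  have k1 := H1 (1 - s) (by rw [e']; linarith) (by rw [e']; linarith) (by rw [e]; exact h3)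
  have k2 := H2 (1 - s) (by rw [e']; linarith) (by rw [e']; linarith) (by rw [e]; exact h3)
  rw [e, e'] at k1 k2
  have := zeta_one_sub_chiX him
  rw [sub_sub_cancel] at this
  rw [this, norm_mul]
  have ht0 : 0 < |s.im| := by linarith
  calc _ ≤ (C2 * |s.im| ^ (1 - s.re - 1/2)) * (C1 * |s.im| ^ (max (1 - (1 - s.re)) 0) * Real.log |s.im|) := by
        gcongr
    _ = C2 * C1 * (|s.im| ^ (1 - s.re - 1/2) * |s.im| ^ (max (1 - (1 - s.re)) 0)) * Real.log |s.im| := by ring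
    _ = _ := by
      rw [← Real.rpow_add ht0]
      congr 3
      rcases le_total s.re 0 with h | h
      · rw [max_eq_right (by linarith), max_eq_left (by linarith)]; ring
      · rw [max_eq_left (by linarith), max_eq_right (by linarith)]; ring

/-! ### The function `ζ'^2/ζ`: functional equation and local bound -/

noncomputable def fZ (s : ℂ) : ℂ := deriv riemannZeta s ^ 2 / riemannZeta s

noncomputable def gZ (w : ℂ) : ℂ :=
  -(mX (1 - w)) ^ 2 * riemannZeta w - 2 * mX (1 - w) * deriv riemannZeta w

lemma deriv_zeta_fe {w : ℂ} (hw : w.im ≠ 0) : chiX (1 - w) * deriv riemannZeta (1 - w) =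
    -(deriv riemannZeta w + mX (1 - w) * riemannZeta w) := by
  have him : (1 - w).im ≠ 0 := by simpa using hw
  have h1 : HasDerivAt (fun z => chiX (1 - z) * riemannZeta (1 - z))
      (-(mX (1 - w) * chiX (1 - w)) * riemannZeta (1 - w) +
        chiX (1 - w) * (-deriv riemannZeta (1 - w))) w := by
    have a1 : HasDerivAt (fun z : ℂ => 1 - z) (-1) w := by
      simpa using (hasDerivAt_id w).const_sub 1
    have a2 := (hasDerivAt_chiX him).comp w a1
    have a3 := ((differentiableAt_riemannZeta (ne_one_of_im him)).hasDerivAt).comp w a1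
    refine (a2.mul a3).congr_deriv ?_
    simp
  have h2 : deriv riemannZeta w = -(mX (1 - w) * chiX (1 - w)) * riemannZeta (1 - w) +
        chiX (1 - w) * (-deriv riemannZeta (1 - w)) := by
    rw [← h1.deriv]
    apply Filter.EventuallyEq.deriv_eq
    have : {z : ℂ | z.im ≠ 0} ∈ nhds w :=
      (isOpen_ne_fun Complex.continuous_im continuous_const).mem_nhds hw
    filter_upwards [this] with z hz
    have := zeta_one_sub_chiX (s := 1 - z) (by simpa using hz)
    rw [sub_sub_cancel] at this; exact this
  have h3 := zeta_one_sub_chiX him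
  rw [sub_sub_cancel] at h3
  rw [h2, h3]; ring

lemma fZ_fe {w : ℂ} (hw : w.im ≠ 0) (h0 : riemannZeta w ≠ 0) :
    fZ w = chiX (1 - w) * fZ (1 - w) + gZ w := by
  have him : (1 - w).im ≠ 0 := by simpa using hw
  have h3 := zeta_one_sub_chiX him
  rw [sub_sub_cancel] at h3
  have hX := chiX_ne_zero him
  have hz : riemannZeta (1 - w) ≠ 0 := by
    intro h; rw [h, mul_zero] at h3; exact h0 h3
  have h4 := deriv_zeta_fe hw
  have e : chiX (1 - w) * fZ (1 - w) =
      (chiX (1 - w) * deriv riemannZeta (1 - w)) ^ 2 / riemannZeta w := by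
    rw [fZ, h3]; field_simp
  rw [e, h4, fZ, gZ]; field_simp; ring

lemma exists_sqrt_ball {F : ℂ → ℂ} {s : ℂ} {R : ℝ} (hR : 0 < R)
    (hF : DifferentiableOn ℂ F (Metric.ball s R)) (h0 : ∀ z ∈ Metric.ball s R, F z ≠ 0) :
    ∃ h : ℂ → ℂ, DifferentiableOn ℂ h (Metric.ball s R) ∧ ∀ z ∈ Metric.ball s R, h z ^ 2 = F z := by
  have hd : DifferentiableOn ℂ (deriv F) (Metric.ball s R) := hF.deriv Metric.isOpen_ball
  have hq : DifferentiableOn ℂ (fun z => deriv F z / F z) (Metric.ball s R) := hd.div hF h0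
  obtain ⟨G, hGs, hG⟩ := (hq.isExactOn_ball).with_val_at s (Complex.log (F s))
  have hs : s ∈ Metric.ball s R := Metric.mem_ball_self hR
  have hE : ∀ z ∈ Metric.ball s R, F z * Complex.exp (-G z) = F s * Complex.exp (-G s) := by
    intro z hz
    refine (convex_ball s R).is_const_of_fderivWithin_eq_zero (𝕜 := ℂ)
      (f := fun z => F z * Complex.exp (-G z)) ?_ ?_ hz hs
    · intro y hy
      exact (hF y hy).mul ((hG y hy).differentiableAt.neg.cexp).differentiableWithinAt
    · intro y hy
      have hFd : HasDerivAt F (deriv F y) y :=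
        (hF.differentiableAt (Metric.isOpen_ball.mem_nhds hy)).hasDerivAt
      have := hFd.mul ((hG y hy).neg.cexp)
      have h2 : HasDerivAt (fun z => F z * Complex.exp (-G z)) 0 y := by
        refine this.congr_deriv ?_
        have := h0 y hy
        simp only [Pi.neg_apply]
        field_simp; ring
      rw [fderivWithin_eq_fderiv (Metric.isOpen_ball.uniqueDiffWithinAt hy) h2.differentiableAt]
      have := h2.hasFDerivAt.fderiv
      rw [this]; ext; simp
  refine ⟨fun z => Complex.exp (G z / 2), fun y hy =>
    ((hG y hy).differentiableAt.div_const 2).cexp.differentiableWithinAt, fun z hz => ?_⟩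
  have := hE z hz
  rw [hGs, Complex.exp_neg (Complex.log _), Complex.exp_log (h0 s hs),
    mul_inv_cancel₀ (h0 s hs), Complex.exp_neg] at this
  rw [← Complex.exp_nat_mul]
  have e : ((2 : ℕ) : ℂ) * (G z / 2) = G z := by push_cast; ring
  rw [e]
  field_simp at this
  exact this.symm

lemma avg_sq_le {u : ℝ → ℝ} (hu : Continuous u) :
    (∫ θ in (0:ℝ)..2 * Real.pi, u θ) ^ 2 ≤ 2 * Real.pi * ∫ θ in (0:ℝ)..2 * Real.pi, u θ ^ 2 := by
  have hpi := Real.pi_pos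
  set A := ∫ θ in (0:ℝ)..2 * Real.pi, u θ with hA
  set c := A / (2 * Real.pi) with hc
  have h1 : 0 ≤ ∫ θ in (0:ℝ)..2 * Real.pi, (u θ - c) ^ 2 :=
    intervalIntegral.integral_nonneg (by positivity) fun _ _ => sq_nonneg _
  have h2 : ∫ θ in (0:ℝ)..2 * Real.pi, (u θ - c) ^ 2 =
      (∫ θ in (0:ℝ)..2 * Real.pi, u θ ^ 2) - 2 * c * A + c ^ 2 * (2 * Real.pi) := by
    have : ∀ θ, (u θ - c) ^ 2 = u θ ^ 2 - 2 * c * u θ + c ^ 2 := fun θ => by ring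
    simp_rw [this]
    rw [intervalIntegral.integral_add, intervalIntegral.integral_sub,
      intervalIntegral.integral_const_mul]
    · simp; ring
    all_goals exact Continuous.intervalIntegrable (by fun_prop) _ _
  rw [h2] at h1
  have e : A = c * (2 * Real.pi) := by rw [hc]; field_simp
  rw [e] at h1 ⊢
  nlinarith [mul_le_mul_of_nonneg_left h1 (by positivity : 0 ≤ 2 * Real.pi)]

lemma local_bound {F : ℂ → ℂ} {s : ℂ} {r R : ℝ} (hr : 0 < r) (hrR : r < R)
    (hF : DifferentiableOn ℂ F (Metric.ball s R)) (h0 : ∀ z ∈ Metric.ball s R, F z ≠ 0) :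
    ‖deriv F s ^ 2 / F s‖ ≤
      4 / r ^ 2 * ((2 * Real.pi)⁻¹ * ∫ θ in (0:ℝ)..2 * Real.pi, ‖F (circleMap s r θ)‖) := by
  have hR : 0 < R := hr.trans hrR
  obtain ⟨h, hh, hsq⟩ := exists_sqrt_ball hR hF h0
  have hs : s ∈ Metric.ball s R := Metric.mem_ball_self hR
  have hcb : Metric.closedBall s r ⊆ Metric.ball s R := Metric.closedBall_subset_ball hrR
  have hd : deriv F s = 2 * h s * deriv h s := by
    have hda : HasDerivAt h (deriv h s) s :=
      (hh.differentiableAt (Metric.isOpen_ball.mem_nhds hs)).hasDerivAt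
    have := hda.pow 2
    have e : deriv F s = deriv (h ^ 2) s := by
      apply Filter.EventuallyEq.deriv_eq
      filter_upwards [Metric.isOpen_ball.mem_nhds hs] with z hz
      simp [hsq z hz]
    rw [e, this.deriv]; simp
  have hhs : h s ≠ 0 := by
    intro h1; have := hsq s hs; rw [h1] at this; exact h0 s hs (by rw [← this]; simp)
  have e1 : deriv F s ^ 2 / F s = 4 * deriv h s ^ 2 := by
    rw [hd, ← hsq s hs]; field_simp; ring
  have hcm : ∀ θ, circleMap s r θ ∈ Metric.ball s R := fun θ =>
    hcb (circleMap_mem_closedBall s hr.le θ)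
  have hcont : Continuous (fun θ => ‖h (circleMap s r θ)‖) :=
    (hh.continuousOn.comp_continuous (continuous_circleMap s r) hcm).norm
  have hC := two_pi_I_inv_smul_circleIntegral_sub_sq_inv_smul_of_differentiable
    Metric.isOpen_ball hcb hh (Metric.mem_ball_self hr)
  have hb : ‖deriv h s‖ ≤ (2 * Real.pi)⁻¹ * (r⁻¹ * ∫ θ in (0:ℝ)..2 * Real.pi, ‖h (circleMap s r θ)‖) := by
    rw [← hC, norm_smul, circleIntegral]
    have : ‖(2 * Real.pi * I : ℂ)⁻¹‖ = (2 * Real.pi)⁻¹ := by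
      simp [abs_of_pos Real.pi_pos]
    rw [this]
    refine mul_le_mul_of_nonneg_left ?_ (by positivity)
    rw [← intervalIntegral.integral_const_mul]
    refine intervalIntegral.norm_integral_le_of_norm_le (by positivity) ?_
      ((hcont.const_smul r⁻¹).intervalIntegrable _ _)
    refine Eventually.of_forall fun θ _ => le_of_eq ?_
    rw [norm_smul, norm_smul, norm_inv, norm_pow, deriv_circleMap, norm_mul]
    simp [abs_of_pos hr]
    field_simp
  have hsq2 : ∀ θ, ‖h (circleMap s r θ)‖ ^ 2 = ‖F (circleMap s r θ)‖ := fun θ => by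
    rw [← norm_pow, hsq _ (hcm θ)]
  have hcs := avg_sq_le hcont
  simp_rw [hsq2] at hcs
  rw [e1, norm_mul, norm_pow]
  simp only [Complex.norm_ofNat]
  have hb2 := pow_le_pow_left₀ (norm_nonneg _) hb 2
  calc _ ≤ 4 * ((2 * Real.pi)⁻¹ * (r⁻¹ * ∫ θ in (0:ℝ)..2 * Real.pi, ‖h (circleMap s r θ)‖)) ^ 2 := by gcongr
    _ = 4 * ((2 * Real.pi)⁻¹) ^ 2 * (r⁻¹) ^ 2 * (∫ θ in (0:ℝ)..2 * Real.pi, ‖h (circleMap s r θ)‖) ^ 2 := by ring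
    _ ≤ 4 * ((2 * Real.pi)⁻¹) ^ 2 * (r⁻¹) ^ 2 *
        (2 * Real.pi * ∫ θ in (0:ℝ)..2 * Real.pi, ‖F (circleMap s r θ)‖) := by gcongr
    _ = _ := by
      have := Real.pi_pos
      field_simp

lemma local_bound_sup {F : ℂ → ℂ} {s : ℂ} {r R B : ℝ} (hr : 0 < r) (hrR : r < R)
    (hF : DifferentiableOn ℂ F (Metric.ball s R)) (h0 : ∀ z ∈ Metric.ball s R, F z ≠ 0)
    (hB : ∀ z ∈ Metric.closedBall s r, ‖F z‖ ≤ B) :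
    ‖deriv F s ^ 2 / F s‖ ≤ 4 / r ^ 2 * B := by
  refine (local_bound hr hrR hF h0).trans ?_
  refine mul_le_mul_of_nonneg_left ?_ (by positivity)
  have hcb : Metric.closedBall s r ⊆ Metric.ball s R := Metric.closedBall_subset_ball hrR
  have hcont : Continuous (fun θ => ‖F (circleMap s r θ)‖) :=
    (hF.continuousOn.comp_continuous (continuous_circleMap s r) fun θ =>
      hcb (circleMap_mem_closedBall s hr.le θ)).norm
  have : ∫ θ in (0:ℝ)..2 * Real.pi, ‖F (circleMap s r θ)‖ ≤ ∫ θ in (0:ℝ)..2 * Real.pi, B :=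
    intervalIntegral.integral_mono_on (by positivity) (hcont.intervalIntegrable _ _)
      (by simp) fun θ _ => hB _ (circleMap_mem_closedBall s hr.le θ)
  have hpi := Real.pi_pos
  calc _ ≤ (2 * Real.pi)⁻¹ * ∫ θ in (0:ℝ)..2 * Real.pi, B := by gcongr
    _ = B := by simp; field_simp

/-! ### The Dirichlet coefficients of `ζ'^2/ζ` -/

noncomputable def bZ (n : ℕ) : ℝ :=
  ∑ p ∈ n.divisorsAntidiagonal, ArithmeticFunction.vonMangoldt p.1 * Real.log p.2

lemma bZ_zero : bZ 0 = 0 := by simp [bZ]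

lemma bZ_one : bZ 1 = 0 := by simp [bZ]

lemma bZ_nonneg (n : ℕ) : 0 ≤ bZ n :=
  sum_nonneg fun p _ => mul_nonneg ArithmeticFunction.vonMangoldt_nonneg (Real.log_natCast_nonneg _)

lemma bZ_le (n : ℕ) : bZ n ≤ Real.log n ^ 2 := by
  have h1 : bZ n ≤ ∑ p ∈ n.divisorsAntidiagonal, ArithmeticFunction.vonMangoldt p.1 * Real.log n := by
    refine sum_le_sum fun p hp => mul_le_mul_of_nonneg_left ?_ ArithmeticFunction.vonMangoldt_nonneg
    have h2 := Nat.mem_divisorsAntidiagonal.mp hp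
    have h3 : p.2 ≠ 0 := by rintro h; rw [h] at h2; simp at h2; exact h2.2 h2.1.symm
    have h4 : p.2 ≤ n := Nat.le_of_dvd (Nat.pos_of_ne_zero h2.2) ⟨p.1, by rw [← h2.1]; ring⟩
    exact Real.log_le_log (by exact_mod_cast Nat.pos_of_ne_zero h3) (by exact_mod_cast h4)
  refine h1.trans (le_of_eq ?_)
  rw [← sum_mul, Nat.sum_divisorsAntidiagonal (f := fun i _ => ArithmeticFunction.vonMangoldt i),
    ArithmeticFunction.vonMangoldt_sum]; ring

lemma bZ_conv : (fun n : ℕ => (bZ n : ℂ)) =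
    LSeries.convolution (fun n => (ArithmeticFunction.vonMangoldt n : ℂ)) (LSeries.logMul 1) := by
  rw [LSeries.convolution_def]
  funext n
  simp only [bZ, LSeries.logMul]; push_cast
  refine sum_congr rfl fun p _ => ?_
  simp

lemma bZ_LS {s : ℂ} (hs : 1 < s.re) :
    LSeriesSummable (fun n : ℕ => (bZ n : ℂ)) s ∧ LSeries (fun n : ℕ => (bZ n : ℂ)) s = fZ s := by
  have h1 : LSeriesSummable (fun n => (ArithmeticFunction.vonMangoldt n : ℂ)) s :=
    ArithmeticFunction.LSeriesSummable_vonMangoldt hs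
  have habs : LSeries.abscissaOfAbsConv (1 : ℕ → ℂ) < s.re := by
    rw [LSeries.abscissaOfAbsConv_one]; exact_mod_cast hs
  have h2 : LSeriesSummable (LSeries.logMul 1) s := LSeriesSummable_logMul_of_lt_re habs
  rw [bZ_conv]
  refine ⟨h1.convolution h2, ?_⟩
  rw [LSeries_convolution' h1 h2, ArithmeticFunction.LSeries_vonMangoldt_eq_deriv_riemannZeta_div hs]
  have h3 := LSeries_deriv habs
  have h4 : deriv (LSeries 1) s = deriv riemannZeta s := by
    apply Filter.EventuallyEq.deriv_eq
    have : {z : ℂ | 1 < z.re} ∈ nhds s :=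
      (isOpen_lt continuous_const Complex.continuous_re).mem_nhds hs
    filter_upwards [this] with z hz using LSeries_one_eq_riemannZeta hz
  rw [h4] at h3
  rw [fZ, h3]; ring

lemma bZ_hasSum {s : ℂ} (hs : 1 < s.re) : HasSum (fun n : ℕ => (bZ n : ℂ) * (n : ℂ) ^ (-s)) (fZ s) := by
  obtain ⟨h1, h2⟩ := bZ_LS hs
  have h3 := h1.LSeriesHasSum
  rw [h2] at h3
  have e : (fun n : ℕ => (bZ n : ℂ) * (n : ℂ) ^ (-s)) = LSeries.term (fun n : ℕ => (bZ n : ℂ)) s := by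
    funext n; rw [LSeries.term_def₀ (by simp [bZ_zero])]
  rw [e]; exact h3

lemma bZ_summable {a : ℝ} (ha : 1 < a) : Summable (fun n : ℕ => bZ n * (n : ℝ) ^ (-a)) := by
  have := (bZ_hasSum (s := a) (by simpa using ha)).summable.norm
  refine this.congr fun n => ?_
  rw [norm_mul, Complex.norm_real, Real.norm_of_nonneg (bZ_nonneg n)]
  rcases Nat.eq_zero_or_pos n with rfl | hn
  · simp [bZ_zero]
  · rw [Complex.norm_natCast_cpow_of_pos hn]; simp

lemma fZ_near_one {s : ℂ} (hs : s ≠ 1) : fZ s =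
    (deriv riemannZeta₁ s * (s - 1) - riemannZeta₁ s) ^ 2 / riemannZeta₁ s / (s - 1) ^ 3 := by
  have h0 : s - 1 ≠ 0 := sub_ne_zero.mpr hs
  rw [fZ, deriv_riemannZeta_eq_neg_inv_sub_sq_mul_add hs, riemannZeta_eq_inv_sub_mul hs]
  by_cases h : riemannZeta₁ s = 0
  · simp [h]
  · field_simp; ring

lemma zeta1_ne_zero_of_one_le {s : ℂ} (hs : 1 ≤ s.re) : riemannZeta₁ s ≠ 0 := by
  by_cases h : s = 1
  · rw [h]; simp
  · have := riemannZeta_ne_zero_of_one_le_re hs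
    rw [riemannZeta_eq_inv_sub_mul h] at this
    exact right_ne_zero_of_mul this

lemma bZ_tsum_bound : ∃ C : ℝ, 0 < C ∧ ∀ a : ℝ, 1 < a → a ≤ 2 →
    ∑' n : ℕ, bZ n * (n : ℝ) ^ (-a) ≤ C / (a - 1) ^ 3 := by
  have hc : ContinuousOn (fun a : ℝ => ‖(deriv riemannZeta₁ a * ((a : ℂ) - 1) - riemannZeta₁ a) ^ 2
      / riemannZeta₁ a‖) (Set.Icc 1 2) := by
    have hd : Continuous (deriv riemannZeta₁) := differentiable_riemannZeta₁.deriv.continuous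
    have hd' : Continuous riemannZeta₁ := differentiable_riemannZeta₁.continuous
    refine ContinuousOn.norm (ContinuousOn.div (by fun_prop) (by fun_prop) fun a ha => ?_)
    exact zeta1_ne_zero_of_one_le (by simpa using ha.1)
  obtain ⟨C, hC⟩ := isCompact_Icc.exists_bound_of_continuousOn hc
  refine ⟨|C| + 1, by positivity, fun a h1 h2 => ?_⟩
  have hne : (a : ℂ) ≠ 1 := by
    intro h; have := Complex.ofReal_injective (h.trans Complex.ofReal_one.symm); linarith
  have e := bZ_hasSum (s := a) (by simpa using h1)
  have e2 : ((∑' n : ℕ, bZ n * (n : ℝ) ^ (-a) : ℝ) : ℂ) = fZ a := by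
    rw [← e.tsum_eq]; push_cast
    refine tsum_congr fun n => ?_
    rw [Complex.ofReal_cpow (by positivity)]; push_cast; rfl
  have e3 := congrArg norm e2
  rw [Complex.norm_real, Real.norm_of_nonneg (tsum_nonneg fun n => mul_nonneg (bZ_nonneg n)
    (by positivity)), fZ_near_one hne, norm_div] at e3
  rw [e3]
  have e4 : ‖((a : ℂ) - 1) ^ 3‖ = (a - 1) ^ 3 := by
    rw [norm_pow, ← Complex.ofReal_one, ← Complex.ofReal_sub, Complex.norm_real,
      Real.norm_of_nonneg (by linarith)]
  rw [e4]
  have := hC a ⟨h1.le, h2⟩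
  rw [norm_norm] at this
  have hp : 0 < (a - 1) ^ 3 := pow_pos (by linarith) 3
  gcongr
  exact this.trans ((le_abs_self C).trans (by linarith))

/-- abscissa used for all contours -/
noncomputable def aX (x : ℝ) : ℝ := 1 + 1 / Real.log x

lemma log_ge_one {x : ℝ} (hx : 3 ≤ x) : 1 ≤ Real.log x := by
  rw [Real.le_log_iff_exp_le (by linarith)]
  have := Real.exp_one_lt_d9; linarith

lemma aX_gt {x : ℝ} (hx : 3 ≤ x) : 1 < aX x := by
  have := log_ge_one hx; simp only [aX]; have : 0 < 1 / Real.log x := by positivity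
  linarith

lemma aX_le {x : ℝ} (hx : 3 ≤ x) : aX x ≤ 2 := by
  have := log_ge_one hx; simp only [aX]
  have : 1 / Real.log x ≤ 1 := by rw [div_le_one (by linarith)]; exact this
  linarith

lemma rpow_aX {x : ℝ} (hx : 3 ≤ x) : x ^ aX x = x * Real.exp 1 := by
  have := log_ge_one hx
  rw [aX, Real.rpow_add (by linarith), Real.rpow_one, Real.rpow_def_of_pos (by linarith)]
  congr 2; field_simp

noncomputable def wX (x : ℝ) (n : ℕ) : ℝ := if 1 ≤ |(n : ℝ) - x| then max x n / |(n : ℝ) - x| else 0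

lemma wX_nonneg {x : ℝ} (hx : 0 ≤ x) (n : ℕ) : 0 ≤ wX x n := by
  unfold wX; split_ifs
  · exact div_nonneg (le_trans hx (le_max_left _ _)) (abs_nonneg _)
  · exact le_rfl

lemma sum_inv_dist (m N : ℕ) (hN : 1 ≤ N) (hm : m ≤ N) :
    ∑ n ∈ range N, (if n = m then 0 else 1 / |(n : ℝ) - m|) ≤ 2 * (1 + Real.log N) := by
  have hh : ∑ k ∈ range N, ((k : ℝ) + 1)⁻¹ ≤ 1 + Real.log N := by
    have := harmonic_le_one_add_log N
    rw [harmonic] at this; push_cast at this; exact this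
  have h1 : ∑ n ∈ range m, (if n = m then 0 else 1 / |(n : ℝ) - m|) ≤ ∑ k ∈ range N, ((k : ℝ) + 1)⁻¹ := by
    rw [← Finset.sum_range_reflect]
    refine (sum_le_sum (g := fun k : ℕ => ((k : ℝ) + 1)⁻¹) fun k hk => ?_).trans
      (sum_le_sum_of_subset_of_nonneg (range_mono hm) fun _ _ _ => by positivity)
    have hk' : k < m := mem_range.mp hk
    rw [if_neg (by omega), Nat.cast_sub (by omega), Nat.cast_sub (by omega)]
    rw [one_div, abs_sub_comm, abs_of_nonneg] <;> simp <;> [apply le_of_eq; skip]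
    · ring
    · linarith
  have h2 : ∑ n ∈ Ico m N, (if n = m then 0 else 1 / |(n : ℝ) - m|) ≤ ∑ k ∈ range N, ((k : ℝ) + 1)⁻¹ := by
    rw [Finset.sum_Ico_eq_sum_range]
    refine (sum_le_sum (g := fun k : ℕ => if k = 0 then 0 else ((k : ℝ))⁻¹) fun k hk => ?_).trans ?_
    · by_cases hk0 : k = 0
      · simp [hk0]
      · simp [hk0]
    · refine (sum_le_sum_of_subset_of_nonneg (t := range (N + 1)) (range_mono (by omega))
        fun k _ _ => by split_ifs <;> positivity).trans ?_
      rw [sum_range_succ']; simp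
  have := Finset.sum_range_add_sum_Ico (fun n : ℕ => (if n = m then 0 else 1 / |(n : ℝ) - m|)) hm
  linarith

lemma bZ_weighted : ∃ C : ℝ, 0 < C ∧ ∀ x : ℝ, 3 ≤ x →
    Summable (fun n : ℕ => bZ n * (x / n) ^ aX x * wX x n) ∧
    ∑' n : ℕ, bZ n * (x / n) ^ aX x * wX x n ≤ C * x * Real.log x ^ 3 := by
  obtain ⟨C0, hC0, H0⟩ := bZ_tsum_bound
  refine ⟨4 * Real.exp 1 * C0 + 1000, by positivity, fun x hx => ?_⟩
  have hL := log_ge_one hx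
  set L := Real.log x with hLdef
  set a := aX x with ha
  have ha1 : 1 < a := aX_gt hx
  have ha2 : a ≤ 2 := aX_le hx
  set m := ⌊x⌋₊ with hm
  have hm1 : (m : ℝ) ≤ x := Nat.floor_le (by linarith)
  have hm2 : x < m + 1 := Nat.lt_floor_add_one x
  set N := 2 * m + 2 with hN
  set u : ℕ → ℝ := fun n => if n ∈ range N then
    (64 * L ^ 2 * x) * (if n = m then 0 else 1 / |(n : ℝ) - m|) else 0 with hu
  have hu0 : ∀ n, 0 ≤ u n := fun n => by
    simp only [hu]; split_ifs <;> positivity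
  have hlogx2 : ∀ n : ℕ, (n : ℝ) ≤ 2 * x → Real.log n ≤ 2 * L := by
    intro n hn
    rcases Nat.eq_zero_or_pos n with rfl | h
    · simp; linarith
    · have : Real.log n ≤ Real.log (x ^ 2) := by
        apply Real.log_le_log (by exact_mod_cast h); nlinarith
      rw [Real.log_pow] at this; push_cast at this; linarith
  have hpt : ∀ n : ℕ, bZ n * (x / n) ^ a * wX x n ≤
      4 * (x * Real.exp 1) * (bZ n * (n : ℝ) ^ (-a)) + u n := by
    intro n
    rcases Nat.eq_zero_or_pos n with rfl | hn
    · simp [bZ_zero, hu0]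
    have hn0 : (0 : ℝ) < n := by exact_mod_cast hn
    have e1 : (x / n) ^ a = (x * Real.exp 1) * (n : ℝ) ^ (-a) := by
      rw [Real.div_rpow (by linarith) hn0.le, rpow_aX hx, Real.rpow_neg hn0.le]; rfl
    have hfirst : 0 ≤ 4 * (x * Real.exp 1) * (bZ n * (n : ℝ) ^ (-a)) := by
      have := bZ_nonneg n
      positivity
    by_cases hw : wX x n ≤ 4
    · calc _ ≤ bZ n * (x / n) ^ a * 4 := by
            have := bZ_nonneg n
            gcongr
        _ = 4 * (x * Real.exp 1) * (bZ n * (n : ℝ) ^ (-a)) := by rw [e1]; ring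
        _ ≤ _ := by linarith [hu0 n]
    · push Not at hw
      have hd : 1 ≤ |(n : ℝ) - x| := by
        by_contra h; rw [wX, if_neg h] at hw; linarith
      rw [wX, if_pos hd] at hw ⊢
      rw [lt_div_iff₀ (by linarith)] at hw
      have hmax : max x (n : ℝ) ≤ 2 * x ∧ 3 * x ≤ 4 * (n : ℝ) := by
        rcases le_total x n with h | h
        · rw [max_eq_right h, abs_of_nonneg (by linarith)] at *
          constructor <;> linarith
        · rw [max_eq_left h] at *; rw [abs_of_nonpos (by linarith)] at *
          constructor <;> linarith
      have hn2 : (n : ℝ) ≤ 2 * x := (le_max_right _ _).trans hmax.1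
      have hmem : n ∈ range N := by
        rw [mem_range]
        have : (n : ℝ) < N := by rw [hN]; push_cast; linarith
        exact_mod_cast this
      have hnm : n ≠ m := by
        rintro rfl
        rw [abs_of_nonpos (by linarith)] at hd; linarith
      have e2 : (x / n) ^ a ≤ 4 := by
        have q : x / n ≤ 4 / 3 := by rw [div_le_iff₀ hn0]; linarith
        calc (x / n) ^ a ≤ (4 / 3 : ℝ) ^ a := Real.rpow_le_rpow (by positivity) q (by linarith)
          _ ≤ (4 / 3 : ℝ) ^ (2 : ℝ) := Real.rpow_le_rpow_of_exponent_le (by norm_num) ha2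
          _ ≤ 4 := by norm_num
      have e3 : bZ n ≤ (2 * L) ^ 2 := (bZ_le n).trans
        (pow_le_pow_left₀ (Real.log_natCast_nonneg n) (hlogx2 n hn2) 2)
      have e4 : 1 / |(n : ℝ) - x| ≤ 2 * (1 / |(n : ℝ) - m|) := by
        have p : 0 < |(n : ℝ) - m| := abs_pos.mpr (sub_ne_zero.mpr (by exact_mod_cast hnm))
        rw [mul_one_div, div_le_div_iff₀ (by linarith) p]
        have : |(n : ℝ) - m| ≤ |(n : ℝ) - x| + |x - m| := abs_sub_le _ _ _
        rw [abs_of_nonneg (by linarith : 0 ≤ x - m)] at this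
        linarith
      have hun : u n = (64 * L ^ 2 * x) * (1 / |(n : ℝ) - m|) := by
        simp only [hu]; rw [if_pos hmem, if_neg hnm]
      rw [hun]
      have := bZ_nonneg n
      calc _ = bZ n * (x / n) ^ a * (max x n * (1 / |(n : ℝ) - x|)) := by ring
        _ ≤ (2 * L) ^ 2 * 4 * ((2 * x) * (2 * (1 / |(n : ℝ) - m|))) := by
          have : 0 ≤ 1 / |(n : ℝ) - x| := by positivity
          have := hmax.1
          gcongr
        _ = (64 * L ^ 2 * x) * (1 / |(n : ℝ) - m|) := by ring
        _ ≤ _ := by linarith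
  have hsu : HasSum u (∑ n ∈ range N, u n) := hasSum_sum_of_ne_finset_zero fun n hn => by
    simp only [hu]; rw [if_neg hn]
  have hs1 : Summable (fun n : ℕ => 4 * (x * Real.exp 1) * (bZ n * (n : ℝ) ^ (-a)) + u n) :=
    ((bZ_summable ha1).mul_left _).add hsu.summable
  have hs2 : Summable (fun n : ℕ => bZ n * (x / n) ^ a * wX x n) :=
    Summable.of_nonneg_of_le (fun n => mul_nonneg (mul_nonneg (bZ_nonneg n) (by positivity))
      (wX_nonneg (by linarith) n)) hpt hs1
  refine ⟨hs2, (hs2.tsum_le_tsum hpt hs1).trans ?_⟩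
  rw [Summable.tsum_add ((bZ_summable ha1).mul_left _) hsu.summable, tsum_mul_left, hsu.tsum_eq]
  have h1 : ∑' n : ℕ, bZ n * (n : ℝ) ^ (-a) ≤ C0 * L ^ 3 := by
    have := H0 a ha1 ha2
    have e : a - 1 = 1 / L := by rw [ha, aX]; ring
    rw [e] at this
    refine this.trans (le_of_eq ?_)
    field_simp
  have h2 : ∑ n ∈ range N, u n ≤ (64 * L ^ 2 * x) * (2 * (1 + 3 * L)) := by
    have e : ∑ n ∈ range N, u n = (64 * L ^ 2 * x) * ∑ n ∈ range N, (if n = m then 0 else 1 / |(n : ℝ) - m|) := by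
      rw [mul_sum]; refine sum_congr rfl fun n hn => ?_
      simp only [hu]; rw [if_pos hn]
    rw [e]
    have h3 := sum_inv_dist m N (by omega) (by omega)
    have h4 : Real.log N ≤ 3 * L := by
      have : Real.log N ≤ Real.log (x ^ 3) := by
        apply Real.log_le_log (by rw [hN]; positivity)
        rw [hN]; push_cast; nlinarith [sq_nonneg (x - 3), mul_pos (by linarith : 0 < x) (by linarith : 0 < x)]
      rw [Real.log_pow] at this; push_cast at this; linarith
    refine mul_le_mul_of_nonneg_left (h3.trans (by linarith)) (by positivity)
  have h3 : (64 * L ^ 2 * x) * (2 * (1 + 3 * L)) ≤ 1000 * x * L ^ 3 := by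
    have : L ^ 2 ≤ L ^ 3 := pow_le_pow_right₀ hL (by norm_num)
    have := mul_le_mul_of_nonneg_left this (by linarith : 0 ≤ x)
    nlinarith [mul_nonneg (by linarith : 0 ≤ x) (by positivity : 0 ≤ L ^ 3)]
  have h4 : 4 * (x * Real.exp 1) * ∑' n : ℕ, bZ n * (n : ℝ) ^ (-a) ≤ 4 * (x * Real.exp 1) * (C0 * L ^ 3) :=
    mul_le_mul_of_nonneg_left h1 (by positivity)
  linarith

/-! ### The Gamma kernel integral: shifting to the left -/

noncomputable def GJ (z : ℝ) (s : ℂ) : ℂ :=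
  Gamma s * Complex.exp (-((Real.log z : ℂ) + I * Real.pi / 2) * s)

lemma norm_GJ {z : ℝ} (hz : 0 < z) (s : ℂ) :
    ‖GJ z s‖ = ‖Gamma s‖ * (z ^ (-s.re) * Real.exp (Real.pi * s.im / 2)) := by
  rw [GJ, norm_mul, Complex.norm_exp, Real.rpow_def_of_pos hz, ← Real.exp_add]
  congr 2
  have : (I * (Real.pi : ℂ) / 2) = ((Real.pi / 2 : ℝ) : ℂ) * I := by push_cast; ring
  rw [this]
  simp
  ring

lemma GJ_rec {z : ℝ} (hz : 0 < z) {s : ℂ} (hs : s ≠ 0) : GJ z s = I * z / s * GJ z (s + 1) := by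
  rw [GJ, GJ, Complex.Gamma_add_one s hs, mul_add, mul_one, Complex.exp_add, neg_add,
    Complex.exp_add (-(Real.log z : ℂ)), ← Complex.ofReal_neg, ← Complex.ofReal_exp, Real.exp_neg,
    Real.exp_log hz]
  have e : Complex.exp (-(I * Real.pi / 2)) = -I := by
    rw [show -(I * (Real.pi : ℂ) / 2) = (-(Real.pi / 2 : ℝ) : ℂ) * I by push_cast; ring,
      ← Complex.ofReal_neg, Complex.exp_mul_I, ← Complex.ofReal_cos, ← Complex.ofReal_sin]
    simp
  rw [e]
  have hz' : (z : ℂ) ≠ 0 := by exact_mod_cast hz.ne'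
  push_cast
  field_simp
  linear_combination (Gamma s) * Complex.I_sq

lemma norm_GJ_rec {z : ℝ} (hz : 0 < z) {s : ℂ} (hs : s ≠ 0) :
    ‖GJ z s‖ = z / ‖s‖ * ‖GJ z (s + 1)‖ := by
  rw [GJ_rec hz hs, norm_mul, norm_div, norm_mul]; simp [abs_of_pos hz]

lemma GJ_bound : ∃ C : ℝ, 0 < C ∧ ∀ z : ℝ, 0 < z → ∀ s : ℂ, s.re ≤ 4 → 2 ≤ |s.im| →
    ‖GJ z s‖ ≤ C * |s.im| ^ (-(1/2) : ℝ) * (|s.im| / z) ^ s.re := by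
  obtain ⟨C, hC, H⟩ := Gamma_strip_bound
  refine ⟨C, hC, fun z hz => ?_⟩
  have key : ∀ k : ℕ, ∀ s : ℂ, 1/2 - (k : ℝ) ≤ s.re → s.re ≤ 4 → 2 ≤ |s.im| →
      ‖GJ z s‖ ≤ C * |s.im| ^ (-(1/2) : ℝ) * (|s.im| / z) ^ s.re := by
    intro k
    induction k with
    | zero =>
      intro s h1 h2 h3
      have ht : 0 < |s.im| := by linarith
      have := H s (by simpa using h1) h2 h3
      rw [norm_GJ hz]
      calc _ ≤ (C * Real.exp (-(Real.pi * |s.im| / 2)) * |s.im| ^ (s.re - 1/2)) *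
            (z ^ (-s.re) * Real.exp (Real.pi * |s.im| / 2)) := by
            have : s.im ≤ |s.im| := le_abs_self _
            have := Real.pi_pos
            gcongr
        _ = C * (Real.exp (-(Real.pi * |s.im| / 2)) * Real.exp (Real.pi * |s.im| / 2)) *
            (|s.im| ^ (s.re - 1/2) * z ^ (-s.re)) := by ring
        _ = _ := by
          rw [← Real.exp_add, neg_add_cancel, Real.exp_zero, Real.div_rpow ht.le hz.le,
            Real.rpow_neg hz.le, sub_eq_add_neg, Real.rpow_add ht]; ring
    | succ k ih =>
      intro s h1 h2 h3
      by_cases hk : 1/2 - (k : ℝ) ≤ s.re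
      · exact ih s hk h2 h3
      push Not at hk
      have ht : 0 < |s.im| := by linarith
      have hs0 : s ≠ 0 := by rintro rfl; simp at ht
      have h4 := ih (s + 1) (by push_cast at h1; simp; linarith)
        (by simp; have : (0 : ℝ) ≤ k := Nat.cast_nonneg k; linarith) (by simpa using h3)
      simp only [add_im, one_im, add_zero, add_re, one_re] at h4
      rw [norm_GJ_rec hz hs0]
      have h5 : |s.im| ≤ ‖s‖ := Complex.abs_im_le_norm s
      calc _ ≤ z / |s.im| * (C * |s.im| ^ (-(1/2) : ℝ) * (|s.im| / z) ^ (s.re + 1)) := by gcongr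
        _ = _ := by
          rw [Real.rpow_add (by positivity), Real.rpow_one]; field_simp
  intro s h2 h3
  obtain ⟨k, hk⟩ := exists_nat_ge (1/2 - s.re)
  exact key k s (by linarith) h2 h3

lemma GJ_diff (z : ℝ) {s : ℂ} (hs : ∀ m : ℕ, s ≠ -m) : DifferentiableAt ℂ (GJ z) s := by
  unfold GJ
  exact (Complex.differentiableAt_Gamma s hs).mul (by fun_prop)

lemma GJ_residue {z : ℝ} (hz : 0 < z) (k : ℕ) :
    Tendsto (fun s => (s - (-(k : ℂ))) * GJ z s) (nhdsWithin (-(k : ℂ)) {-(k : ℂ)}ᶜ)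
      (nhds ((-(I * z)) ^ k / k.factorial)) := by
  induction k with
  | zero =>
    have h := Complex.tendsto_self_mul_Gamma_nhds_zero
    have h2 : Tendsto (fun s : ℂ => Complex.exp (-((Real.log z : ℂ) + I * Real.pi / 2) * s))
        (nhdsWithin 0 {0}ᶜ) (nhds 1) := by
      have : Continuous (fun s : ℂ => Complex.exp (-((Real.log z : ℂ) + I * Real.pi / 2) * s)) := by
        fun_prop
      have := this.tendsto 0
      simp only [mul_zero, Complex.exp_zero] at this
      exact this.mono_left nhdsWithin_le_nhds
    have := h.mul h2
    simp only [Nat.cast_zero, neg_zero, sub_zero, pow_zero, Nat.factorial_zero, Nat.cast_one, div_one]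
    rw [mul_one] at this
    refine this.congr fun s => ?_
    rw [GJ]; ring
  | succ k ih =>
    have hne : -((k + 1 : ℕ) : ℂ) ≠ 0 := by
      rw [neg_ne_zero]; exact_mod_cast Nat.succ_ne_zero k
    have hshift : Tendsto (fun s : ℂ => s + 1) (nhdsWithin (-((k + 1 : ℕ) : ℂ)) {-((k + 1 : ℕ) : ℂ)}ᶜ)
        (nhdsWithin (-(k : ℂ)) {-(k : ℂ)}ᶜ) := by
      refine tendsto_nhdsWithin_of_tendsto_nhds_of_eventually_within _ ?_ ?_
      · have : Continuous (fun s : ℂ => s + 1) := by fun_prop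
        have := this.tendsto (-((k + 1 : ℕ) : ℂ))
        rw [show -((k + 1 : ℕ) : ℂ) + 1 = -(k : ℂ) by push_cast; ring] at this
        exact this.mono_left nhdsWithin_le_nhds
      · filter_upwards [self_mem_nhdsWithin] with s hs
        simp only [Set.mem_compl_iff, Set.mem_singleton_iff] at hs ⊢
        intro h; apply hs; push_cast; linear_combination h
    have h1 := ih.comp hshift
    have h2 : Tendsto (fun s : ℂ => I * z / s) (nhdsWithin (-((k + 1 : ℕ) : ℂ)) {-((k + 1 : ℕ) : ℂ)}ᶜ)
        (nhds (I * z / (-((k + 1 : ℕ) : ℂ)))) :=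
      ((continuousAt_const.div continuousAt_id hne).tendsto).mono_left nhdsWithin_le_nhds
    have h3 := h2.mul h1
    have e : I * z / (-((k + 1 : ℕ) : ℂ)) * ((-(I * z)) ^ k / k.factorial) =
        (-(I * z)) ^ (k + 1) / (k + 1).factorial := by
      have : (k.factorial : ℂ) ≠ 0 := by exact_mod_cast k.factorial_ne_zero
      rw [Nat.factorial_succ]; push_cast at hne ⊢
      have h' : (k : ℂ) + 1 ≠ 0 := neg_ne_zero.mp hne
      field_simp; ring
    rw [e] at h3
    refine h3.congr' ?_
    have : {s : ℂ | s ≠ 0} ∈ nhdsWithin (-((k + 1 : ℕ) : ℂ)) {-((k + 1 : ℕ) : ℂ)}ᶜ :=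
      mem_nhdsWithin_of_mem_nhds (isOpen_ne.mem_nhds hne)
    filter_upwards [this] with s hs
    rw [GJ_rec hz hs]
    simp only [Function.comp]
    push_cast; ring

lemma RI_GJ {z : ℝ} (hz : 0 < z) (K : ℕ) {a T : ℝ} (ha : 0 < a) (hT : 0 < T) :
    RI (GJ z) (-(K : ℝ) - 1/2) a (-T) T =
      2 * Real.pi * I * ∑ k ∈ range (K + 1), (-(I * z)) ^ k / k.factorial := by
  have hinj : Set.InjOn (fun k : ℕ => -(k : ℂ)) (range (K + 1)) := by
    intro i _ j _ h; simpa using h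
  have hK : (0 : ℝ) ≤ K := Nat.cast_nonneg K
  set r : ℂ → ℂ := fun p => (-(I * z)) ^ (⌊-p.re⌋₊) / (⌊-p.re⌋₊).factorial with hr
  have hr' : ∀ k : ℕ, r (-(k : ℂ)) = (-(I * z)) ^ k / k.factorial := by
    intro k; simp [hr]
  have := RI_residues (a := -(K : ℝ) - 1/2) (b := a) (c := -T) (d := T) (by linarith) (by linarith)
    {s | -(K : ℝ) - 1 < s.re} (isOpen_lt continuous_const Complex.continuous_re)
    (fun s hs => by have := hs.1.1; simp; linarith)
    ((range (K + 1)).image (fun k : ℕ => -(k : ℂ))) r (GJ z) ?_ ?_ ?_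
  · rw [this, sum_image hinj]
    simp only [hr']
  · intro p hp
    obtain ⟨k, hk, rfl⟩ := mem_image.mp hp
    have : (k : ℝ) ≤ K := by exact_mod_cast Nat.lt_succ_iff.mp (mem_range.mp hk)
    have : (0 : ℝ) ≤ k := Nat.cast_nonneg k
    refine ⟨?_, ?_, ?_, ?_⟩ <;> simp <;> linarith
  · intro s hs
    refine (GJ_diff z fun m hm => ?_).differentiableWithinAt
    apply hs.2
    rw [hm]
    have h1 : -(K : ℝ) - 1 < s.re := hs.1
    rw [hm] at h1; simp at h1
    have h2 : m < K + 1 := by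
      have : (m : ℝ) < K + 1 := by linarith
      exact_mod_cast this
    simp only [coe_image, Set.mem_image]
    exact ⟨m, by simpa using h2, rfl⟩
  · intro p hp
    obtain ⟨k, hk, rfl⟩ := mem_image.mp hp
    rw [hr']
    exact GJ_residue hz k

lemma integral_rpow_exponent {Q : ℝ} (hQ : 1 < Q) (l a : ℝ) :
    ∫ σ in l..a, Q ^ σ ≤ Q ^ a / Real.log Q := by
  have hlog := Real.log_pos hQ
  have hQ0 : 0 < Q := by linarith
  have : ∫ σ in l..a, Q ^ σ = Q ^ a / Real.log Q - Q ^ l / Real.log Q := by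
    refine intervalIntegral.integral_eq_sub_of_hasDerivAt (f := fun σ => Q ^ σ / Real.log Q) ?_ ?_
    · intro σ _
      refine ((Real.hasStrictDerivAt_const_rpow hQ0 σ).hasDerivAt.div_const _).congr_deriv ?_
      field_simp
    · exact (Real.continuous_const_rpow hQ0.ne').intervalIntegrable _ _
  rw [this]
  have : 0 ≤ Q ^ l / Real.log Q := by positivity
  linarith

lemma GJ_left_tendsto {z : ℝ} (hz : 0 < z) {T : ℝ} (hT : 0 < T) :
    Tendsto (fun K : ℕ => ∫ y in (-T)..T, GJ z (((-(K : ℝ) - 1/2 : ℝ) : ℂ) + y * I)) atTop (nhds 0) := by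
  have hc : ContinuousOn (fun y : ℝ => GJ z (1/2 + y * I)) (Set.Icc (-T) T) := by
    intro y _
    have : ContinuousAt (GJ z) (1/2 + y * I) := by
      refine (GJ_diff z fun m hm => ?_).continuousAt
      have := congrArg Complex.re hm
      simp at this
      have : (0 : ℝ) ≤ m := Nat.cast_nonneg m
      linarith
    exact (ContinuousAt.comp (f := fun y : ℝ => (1/2 + y * I : ℂ)) this
      (by fun_prop)).continuousWithinAt
  obtain ⟨M, hM⟩ := isCompact_Icc.exists_bound_of_continuousOn hc
  have hM0 : 0 ≤ M := (norm_nonneg _).trans (hM 0 ⟨by linarith, by linarith⟩)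
  have key : ∀ K : ℕ, ∀ y ∈ Set.Icc (-T) T, ‖GJ z (((-(K : ℝ) - 1/2 : ℝ) : ℂ) + y * I)‖ ≤
      2 * M * z * (z ^ K / K.factorial) := by
    intro K
    induction K with
    | zero =>
      intro y hy
      have hs0 : (((-((0 : ℕ) : ℝ) - 1/2 : ℝ) : ℂ) + y * I) ≠ 0 := by
        intro h; have := congrArg Complex.re h; simp at this
      rw [norm_GJ_rec hz hs0]
      have e : (((-((0 : ℕ) : ℝ) - 1/2 : ℝ) : ℂ) + y * I) + 1 = 1/2 + y * I := by push_cast; ring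
      rw [e]
      have h1 : 1/2 ≤ ‖(((-((0 : ℕ) : ℝ) - 1/2 : ℝ) : ℂ) + y * I)‖ := by
        refine le_trans ?_ (Complex.abs_re_le_norm _)
        simp only [add_re, ofReal_re, mul_re, I_re, mul_zero, ofReal_im, I_im, Nat.cast_zero]
        rw [abs_of_nonpos] <;> norm_num
      calc _ ≤ z / (1/2) * M := by gcongr; exact hM y hy
        _ = _ := by simp; ring
    | succ K ih =>
      intro y hy
      have hs0 : (((-((K + 1 : ℕ) : ℝ) - 1/2 : ℝ) : ℂ) + y * I) ≠ 0 := by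
        intro h; have := congrArg Complex.re h; simp at this
        have : (0 : ℝ) ≤ K := Nat.cast_nonneg K
        linarith
      rw [norm_GJ_rec hz hs0]
      have e : (((-((K + 1 : ℕ) : ℝ) - 1/2 : ℝ) : ℂ) + y * I) + 1 = (((-(K : ℝ) - 1/2 : ℝ) : ℂ) + y * I) := by
        push_cast; ring
      rw [e]
      have h1 : (K : ℝ) + 1 ≤ ‖(((-((K + 1 : ℕ) : ℝ) - 1/2 : ℝ) : ℂ) + y * I)‖ := by
        refine le_trans ?_ (Complex.abs_re_le_norm _)
        have : (0 : ℝ) ≤ K := Nat.cast_nonneg K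
        simp only [add_re, ofReal_re, mul_re, I_re, mul_zero, ofReal_im, I_im, Nat.cast_add, Nat.cast_one]
        rw [abs_of_nonpos] <;> linarith
      calc _ ≤ z / (K + 1) * (2 * M * z * (z ^ K / K.factorial)) := by gcongr; exact ih y hy
        _ = _ := by rw [Nat.factorial_succ]; push_cast; field_simp; ring
  have hlim : Tendsto (fun K : ℕ => 2 * M * z * (z ^ K / K.factorial) * |T - -T|) atTop (nhds 0) := by
    have := ((FloorSemiring.tendsto_pow_div_factorial_atTop z).const_mul (2 * M * z)).mul_const (|T - -T|)
    simpa using this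
  refine squeeze_zero_norm (fun K => ?_) hlim
  refine intervalIntegral.norm_integral_le_of_norm_le_const fun y hy => key K y ?_
  rw [Set.uIoc_of_le (by linarith)] at hy
  exact ⟨hy.1.le, hy.2⟩

lemma exp_neg_I_two_pi (n : ℕ) : Complex.exp (-(I * ((2 * Real.pi * n : ℝ) : ℂ))) = 1 := by
  rw [Complex.exp_eq_one_iff]
  exact ⟨-n, by push_cast; ring⟩

lemma J_left : ∃ C : ℝ, 0 < C ∧ ∀ n : ℕ, 1 ≤ n → ∀ T a : ℝ, 2 ≤ T → 2 * Real.pi * n < T → 1 ≤ a → a ≤ 2 →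
    ‖(∫ y in (-T)..T, GJ (2 * Real.pi * n) (a + y * I)) - 2 * Real.pi‖ ≤
      C * T ^ (-(1/2) : ℝ) * (T / (2 * Real.pi * n)) ^ a * (T / (T - 2 * Real.pi * n)) := by
  obtain ⟨C, hC, H⟩ := GJ_bound
  refine ⟨2 * C, by positivity, fun n hn T a hT hnT ha1 ha2 => ?_⟩
  set z := 2 * Real.pi * (n : ℝ) with hzdef
  have hz : 0 < z := by
    have : (0 : ℝ) < n := by exact_mod_cast hn
    have := Real.pi_pos; positivity
  have hT0 : 0 < T := by linarith
  set Q := T / z with hQ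
  have hQ1 : 1 < Q := by rw [hQ, one_lt_div hz]; exact hnT
  have hlogQ : (T - z) / T ≤ Real.log Q := by
    have := Real.one_sub_inv_le_log_of_pos (by linarith : 0 < Q)
    rw [hQ, inv_div] at this
    have e : (T - z) / T = 1 - z / T := by field_simp
    rw [e]; exact this
  have hlogpos : 0 < Real.log Q := Real.log_pos hQ1
  set E := C * T ^ (-(1/2) : ℝ) * (Q ^ a / Real.log Q) with hE
  have hor : ∀ (K : ℕ) (c : ℝ), |c| = T → ‖∫ x in (-(K : ℝ) - 1/2)..a, GJ z (x + c * I)‖ ≤ E := by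
    intro K c hc
    have hK : (0 : ℝ) ≤ K := Nat.cast_nonneg K
    have := intervalIntegral.norm_integral_le_of_norm_le (f := fun x : ℝ => GJ z (x + c * I))
      (g := fun x : ℝ => C * T ^ (-(1/2) : ℝ) * Q ^ x) (a := -(K : ℝ) - 1/2) (b := a)
      (μ := MeasureTheory.volume) (by linarith)
      (Eventually.of_forall fun x hx => by
        have := H z hz (x + c * I) (by simp; linarith [hx.2]) (by simp [hc]; linarith)
        simpa [hc] using this)
      ((continuous_const.mul (Real.continuous_const_rpow (by linarith : 0 < Q).ne')).intervalIntegrable _ _)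
    refine this.trans ?_
    rw [intervalIntegral.integral_const_mul]
    exact mul_le_mul_of_nonneg_left (integral_rpow_exponent hQ1 _ _) (by positivity)
  have hbound : ∀ K : ℕ, ‖(∫ y in (-T)..T, GJ z (a + y * I)) -
      2 * Real.pi * ∑ k ∈ range (K + 1), (-(I * z)) ^ k / (k.factorial : ℂ) -
      ∫ y in (-T)..T, GJ z (((-(K : ℝ) - 1/2 : ℝ) : ℂ) + y * I)‖ ≤ 2 * E := by
    intro K
    have h1 := RI_GJ hz K (by linarith : 0 < a) hT0
    have h2 := hor K (-T) (by rw [abs_neg, abs_of_pos hT0])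
    have h3 := hor K T (abs_of_pos hT0)
    rw [RI] at h1
    set B1 := ∫ x in (-(K : ℝ) - 1/2)..a, GJ z (x + ((-T : ℝ) : ℂ) * I)
    set B2 := ∫ x in (-(K : ℝ) - 1/2)..a, GJ z (x + (T : ℂ) * I)
    have e : (∫ y in (-T)..T, GJ z (a + y * I)) -
      2 * Real.pi * ∑ k ∈ range (K + 1), (-(I * z)) ^ k / (k.factorial : ℂ) -
      ∫ y in (-T)..T, GJ z (((-(K : ℝ) - 1/2 : ℝ) : ℂ) + y * I) = I * (B1 - B2) := by
      have hI : I * I = -1 := Complex.I_mul_I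
      linear_combination (-I) * h1 + (-(∫ y in (-T)..T, GJ z (a + y * I)) +
        2 * Real.pi * ∑ k ∈ range (K + 1), (-(I * z)) ^ k / (k.factorial : ℂ) +
        ∫ y in (-T)..T, GJ z (((-(K : ℝ) - 1/2 : ℝ) : ℂ) + y * I)) * (-1) * hI
    rw [e, norm_mul, Complex.norm_I, one_mul]
    exact (norm_sub_le _ _).trans (by linarith)
  have hlim : Tendsto (fun K : ℕ => ‖(∫ y in (-T)..T, GJ z (a + y * I)) -
      2 * Real.pi * ∑ k ∈ range (K + 1), (-(I * z)) ^ k / (k.factorial : ℂ) -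
      ∫ y in (-T)..T, GJ z (((-(K : ℝ) - 1/2 : ℝ) : ℂ) + y * I)‖) atTop
      (nhds ‖(∫ y in (-T)..T, GJ z (a + y * I)) - 2 * Real.pi * 1 - 0‖) := by
    refine (Tendsto.sub (Tendsto.sub tendsto_const_nhds (Tendsto.const_mul _ ?_))
      (GJ_left_tendsto hz hT0)).norm
    have := (NormedSpace.expSeries_div_hasSum_exp (𝔸 := ℂ) (-(I * z))).tendsto_sum_nat
    rw [← Complex.exp_eq_exp_ℂ, exp_neg_I_two_pi n] at this
    exact (tendsto_add_atTop_iff_nat 1).mpr this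
  have hfin := le_of_tendsto hlim (Eventually.of_forall hbound)
  rw [sub_zero, mul_one] at hfin
  refine hfin.trans ?_
  have hTz : 0 < T - z := by linarith
  have e1 : Q ^ a / Real.log Q ≤ Q ^ a * (T / (T - z)) := by
    rw [div_eq_mul_inv]
    refine mul_le_mul_of_nonneg_left ?_ (by positivity)
    rw [show T / (T - z) = ((T - z) / T)⁻¹ by rw [inv_div]]
    exact inv_anti₀ (by positivity) hlogQ
  calc 2 * E ≤ 2 * (C * T ^ (-(1/2) : ℝ) * (Q ^ a * (T / (T - z)))) := by
        rw [hE]; gcongr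
    _ = _ := by ring

/-! ### The Gamma kernel integral: shifting to the right, small parts, summary -/

lemma integral_exp_decay {l : ℝ} (hl : 0 < l) (c a b : ℝ) :
    ∫ x in a..b, Real.exp (l * (c - x)) ≤ Real.exp (l * (c - a)) / l := by
  have h : ∀ x ∈ Set.uIcc a b, HasDerivAt (fun x => -(Real.exp (l * (c - x)) / l)) (Real.exp (l * (c - x))) x := by
    intro x _
    have h1 : HasDerivAt (fun x : ℝ => l * (c - x)) (l * (0 - 1)) x :=
      ((hasDerivAt_const x c).sub (hasDerivAt_id x)).const_mul l
    refine ((h1.exp.div_const l).neg).congr_deriv ?_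
    field_simp; ring
  rw [intervalIntegral.integral_eq_sub_of_hasDerivAt h
    ((Continuous.intervalIntegrable (by fun_prop) _ _))]
  have : 0 < Real.exp (l * (c - b)) / l := by positivity
  linarith

set_option maxHeartbeats 1000000 in
lemma J_right : ∃ C : ℝ, 0 < C ∧ ∀ z T a t0 : ℝ, 100 ≤ T → T < z → T ≤ (z - T) ^ 2 → 1 ≤ a → a ≤ 2 →
    2 ≤ t0 → t0 ≤ T →
    ‖∫ y in t0..T, GJ z (a + y * I)‖ ≤ C * T ^ (-(1/2) : ℝ) * (T / z) ^ a * (z / (z - T)) := by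
  obtain ⟨C, hC, H⟩ := GJ_bound
  refine ⟨C * 1000000, by positivity, fun z T a t0 hT hz hD ha1 ha2 ht0 ht0T => ?_⟩
  set D := z - T with hDdef
  have hD0 : 0 < D := by linarith
  have hT0 : 0 < T := by linarith
  have hz0 : 0 < z := by linarith
  have hD10 : 10 ≤ D := by nlinarith
  set A := √(T * D) with hA
  have hAsq : A ^ 2 = T * D := Real.sq_sqrt (by positivity)
  have hA0 : 0 ≤ A := Real.sqrt_nonneg _
  have hA4 : 4 ≤ A := by
    apply Real.le_sqrt_of_sq_le; nlinarith
  set l := D / (2 * z) with hl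
  have hl0 : 0 < l := by positivity
  have hl1 : l ≤ 1/2 := by rw [hl, div_le_div_iff₀ (by positivity) (by norm_num)]; linarith
  set B := T ^ (-(1/2) : ℝ) * (T / z) ^ a with hB
  have hB0 : 0 < B := by positivity
  have key : ∀ k : ℕ, ∀ s : ℂ, a ≤ s.re → s.re ≤ a + 1 + k → s.re ≤ A → 2 ≤ s.im → s.im ≤ T →
      ‖GJ z s‖ ≤ C * B * Real.exp (l * (1 + a - s.re)) := by
    intro k
    have base : ∀ s : ℂ, a ≤ s.re → s.re ≤ a + 1 → s.re ≤ A → 2 ≤ s.im → s.im ≤ T →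
      ‖GJ z s‖ ≤ C * B * Real.exp (l * (1 + a - s.re)) := by
      intro s h1 h2 h3 h4 h5
      have hs0 : 0 < s.im := by linarith
      have := H z hz0 s (by linarith) (by rw [abs_of_pos hs0]; exact h4)
      rw [abs_of_pos hs0] at this
      have e1 : s.im ^ (-(1/2) : ℝ) * (s.im / z) ^ s.re ≤ B := by
        have e2 : ∀ u : ℝ, 0 < u → u ^ (-(1/2) : ℝ) * (u / z) ^ s.re = u ^ (s.re - 1/2) * z ^ (-s.re) := by
          intro u hu
          rw [Real.div_rpow hu.le hz0.le, Real.rpow_neg hz0.le, sub_eq_add_neg, Real.rpow_add hu]; ring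
        rw [e2 _ hs0]
        calc _ ≤ T ^ (s.re - 1/2) * z ^ (-s.re) := by
              gcongr; linarith
          _ = T ^ (-(1/2) : ℝ) * (T / z) ^ s.re := (e2 T hT0).symm
          _ ≤ B := by
            refine mul_le_mul_of_nonneg_left ?_ (by positivity)
            exact Real.rpow_le_rpow_of_exponent_ge (by positivity) ((div_le_one hz0).mpr hz.le) h1
      calc _ ≤ C * (s.im ^ (-(1/2) : ℝ) * (s.im / z) ^ s.re) := by rw [← mul_assoc]; exact this
        _ ≤ C * B * 1 := by rw [mul_one]; gcongr
        _ ≤ _ := by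
          have : 1 ≤ Real.exp (l * (1 + a - s.re)) := Real.one_le_exp (mul_nonneg hl0.le (by linarith))
          gcongr
    induction k with
    | zero => intro s h1 h2; exact base s h1 (by simpa using h2)
    | succ k ih =>
      intro s h1 h2 h3 h4 h5
      by_cases h6 : s.re ≤ a + 1
      · exact base s h1 h6 h3 h4 h5
      push Not at h6
      push_cast at h2
      have hs : s - 1 ≠ 0 := fun h => by
        have := congrArg Complex.im h; simp at this; linarith
      have hrec := norm_GJ_rec hz0 hs
      rw [sub_add_cancel] at hrec
      have hn : 0 < ‖s - 1‖ := norm_pos_iff.mpr hs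
      have h7 := ih (s - 1) (by simp; linarith) (by simp; linarith) (by simp; linarith) (by simpa using h4)
        (by simpa using h5)
      have e3 : ‖GJ z s‖ = ‖s - 1‖ / z * ‖GJ z (s - 1)‖ := by rw [hrec]; field_simp
      have e4 : ‖s - 1‖ ≤ T + D / 2 := by
        refine (pow_le_pow_iff_left₀ (norm_nonneg _) (by positivity) two_ne_zero).mp ?_
        rw [Complex.sq_norm, Complex.normSq_apply]
        simp only [sub_re, one_re, sub_im, one_im, sub_zero]
        have : (s.re - 1) ^ 2 ≤ A ^ 2 := by apply sq_le_sq'  <;> linarith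
        have : s.im ^ 2 ≤ T ^ 2 := by apply sq_le_sq' <;> linarith
        nlinarith [sq_nonneg D]
      have e5 : ‖s - 1‖ / z ≤ Real.exp (-l) := by
        have : ‖s - 1‖ / z ≤ 1 - l := by
          rw [hl, div_le_iff₀ hz0]
          have : (1 - D / (2 * z)) * z = z - D / 2 := by field_simp
          rw [this]; linarith
        linarith [Real.add_one_le_exp (-l)]
      rw [e3]
      calc _ ≤ Real.exp (-l) * (C * B * Real.exp (l * (1 + a - (s - 1).re))) := by gcongr
        _ = C * B * (Real.exp (-l) * Real.exp (l * (1 + a - (s - 1).re))) := by ring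
        _ = _ := by rw [← Real.exp_add]; congr 2; simp; ring
  have key' : ∀ s : ℂ, a ≤ s.re → s.re ≤ A → 2 ≤ s.im → s.im ≤ T →
      ‖GJ z s‖ ≤ C * B * Real.exp (l * (1 + a - s.re)) := by
    intro s h1 h2 h3 h4
    obtain ⟨k, hk⟩ := exists_nat_ge A
    exact key k s h1 (by linarith) h2 h3 h4
  have hRI : RI (GJ z) a A t0 T = 0 := by
    refine RI_holo (by linarith) ht0T ?_
    intro s hs
    simp only [RC, Set.mem_setOf_eq, Complex.mem_reProdIm, Set.mem_Icc] at hs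
    have : 0 < s.im := by linarith [hs.2.1]
    refine (DifferentiableAt.mul (Complex.differentiableAt_Gamma _ fun m h => ?_) (by fun_prop)).differentiableWithinAt
    have := congrArg Complex.im h; simp at this; linarith
  have hexp1 : Real.exp l ≤ 3 := by
    have := Real.exp_one_lt_d9
    have : Real.exp l ≤ Real.exp 1 := Real.exp_le_exp.mpr (by linarith)
    linarith
  have hor : ∀ c : ℝ, 2 ≤ c → c ≤ T → ‖∫ x in a..A, GJ z (x + c * I)‖ ≤ C * B * (3 / l) := by
    intro c hc1 hc2
    have := intervalIntegral.norm_integral_le_of_norm_le (f := fun x : ℝ => GJ z (x + c * I))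
      (g := fun x : ℝ => C * B * Real.exp (l * ((1 + a) - x))) (a := a) (b := A)
      (μ := MeasureTheory.volume) (by linarith)
      (Eventually.of_forall fun x hx => by
        have := key' (x + c * I) (by simp; linarith [hx.1]) (by simp; linarith [hx.2]) (by simpa using hc1)
          (by simpa using hc2)
        simpa using this)
      (Continuous.intervalIntegrable (by fun_prop) _ _)
    refine this.trans ?_
    rw [intervalIntegral.integral_const_mul]
    refine mul_le_mul_of_nonneg_left ((integral_exp_decay hl0 _ _ _).trans ?_) (by positivity)
    have : l * (1 + a - a) = l := by ring
    rw [this]; gcongr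
  have hv : T ≤ 256 * (A * l) ^ 4 := by
    have e : (A * l) ^ 4 = (T * D) ^ 2 * D ^ 4 / (16 * z ^ 4) := by
      rw [← hAsq, hl]; field_simp; norm_num
    rw [e, show 256 * ((T * D) ^ 2 * D ^ 4 / (16 * z ^ 4)) = (16 * T ^ 2 * D ^ 6) / z ^ 4 by field_simp; norm_num,
      le_div_iff₀ (by positivity)]
    have hzz : z = T + D := by rw [hDdef]; ring
    have e1 : (T + D) ^ 4 ≤ 8 * (T ^ 4 + D ^ 4) := by
      have h1 : (T + D) ^ 2 ≤ 2 * (T ^ 2 + D ^ 2) := by nlinarith [sq_nonneg (T - D)]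
      calc (T + D) ^ 4 = ((T + D) ^ 2) ^ 2 := by ring
        _ ≤ (2 * (T ^ 2 + D ^ 2)) ^ 2 := by gcongr
        _ ≤ _ := by nlinarith [sq_nonneg (T ^ 2 - D ^ 2)]
    have e2 : T ^ 4 ≤ T * D ^ 6 := by
      calc T ^ 4 = T * T ^ 3 := by ring
        _ ≤ T * (D ^ 2) ^ 3 := by gcongr
        _ = _ := by ring
    have e3 : D ^ 4 ≤ T * D ^ 6 := by
      calc D ^ 4 = 1 * D ^ 4 * 1 := by ring
        _ ≤ T * D ^ 4 * D ^ 2 := by gcongr <;> nlinarith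
        _ = _ := by ring
    calc T * z ^ 4 ≤ T * (8 * (T ^ 4 + D ^ 4)) := by rw [hzz]; gcongr
      _ ≤ T * (8 * (T * D ^ 6 + T * D ^ 6)) := by gcongr
      _ = _ := by ring
  have hTe : T * Real.exp (-(A * l)) ≤ 6144 := by
    have h1 : (A * l) ^ 4 / 24 ≤ Real.exp (A * l) := by
      have := Real.pow_div_factorial_le_exp (A * l) (by positivity) 4
      simpa [Nat.factorial] using this
    rw [Real.exp_neg, ← div_eq_mul_inv, div_le_iff₀ (Real.exp_pos _)]
    linarith
  have hright : ‖∫ y in t0..T, GJ z (A + y * I)‖ ≤ C * B * (81 * 6144) := by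
    have := intervalIntegral.norm_integral_le_of_norm_le_const (f := fun y : ℝ => GJ z (A + y * I))
      (a := t0) (b := T) (C := C * B * Real.exp (l * (1 + a - A))) (fun y hy => by
        rw [Set.uIoc_of_le ht0T] at hy
        have := key' (A + y * I) (by simp; linarith) (by simp) (by simp; linarith [hy.1]) (by simpa using hy.2)
        simpa using this)
    refine this.trans ?_
    have e1 : Real.exp (l * (1 + a - A)) ≤ 81 * Real.exp (-(A * l)) := by
      calc _ ≤ Real.exp (4 * l + -(A * l)) := Real.exp_le_exp.mpr (by nlinarith)
        _ = Real.exp l ^ 4 * Real.exp (-(A * l)) := by rw [Real.exp_add, ← Real.exp_nat_mul]; norm_num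
        _ ≤ 3 ^ 4 * Real.exp (-(A * l)) := by gcongr
        _ = _ := by norm_num
    have e2 : |T - t0| ≤ T := by rw [abs_of_nonneg (by linarith)]; linarith
    calc _ ≤ C * B * (81 * Real.exp (-(A * l))) * T := by gcongr
      _ = C * B * (81 * (T * Real.exp (-(A * l)))) := by ring
      _ ≤ _ := by gcongr
  have h1 := hor t0 ht0 ht0T
  have h2 := hor T (by linarith) le_rfl
  rw [RI] at hRI
  set b1 := ∫ x in a..A, GJ z (x + t0 * I)
  set b2 := ∫ x in a..A, GJ z (x + T * I)
  set b3 := ∫ y in t0..T, GJ z (A + y * I)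
  set b4 := ∫ y in t0..T, GJ z (a + y * I)
  have e : I * b4 = b1 - b2 + I * b3 := by linear_combination -hRI
  have e' : ‖b4‖ ≤ ‖b1‖ + ‖b2‖ + ‖b3‖ := by
    calc ‖b4‖ = ‖I * b4‖ := by simp
      _ ≤ ‖b1 - b2‖ + ‖I * b3‖ := by rw [e]; exact norm_add_le _ _
      _ ≤ _ := by
        have := norm_sub_le b1 b2
        simp only [norm_mul, Complex.norm_I, one_mul]; linarith
  have hzD : 1 ≤ z / D := by rw [one_le_div hD0]; linarith
  have hlz : 3 / l = 6 * (z / D) := by rw [hl]; field_simp; norm_num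
  calc ‖b4‖ ≤ C * B * (3 / l) + C * B * (3 / l) + C * B * (81 * 6144) := by linarith
    _ = C * B * (12 * (z / D)) + C * B * (81 * 6144) * 1 := by rw [hlz]; ring
    _ ≤ C * B * (12 * (z / D)) + C * B * (81 * 6144) * (z / D) := by gcongr
    _ ≤ C * 1000000 * B * (z / D) := by
        have : 0 ≤ C * B * (z / D) := by positivity
        nlinarith
    _ = _ := by rw [hB]; ring

open ComplexConjugate in
lemma chiX_mul {n : ℕ} (hn : 1 ≤ n) (s : ℂ) :
    chiX s * (n : ℂ) ^ (-s) = GJ (2 * Real.pi * n) s + conj (GJ (2 * Real.pi * n) (conj s)) := by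
  have hn0 : (0 : ℝ) < n := by exact_mod_cast hn
  have hp := Real.pi_pos
  have h2 : (2 * (Real.pi : ℂ)) = ((2 * Real.pi : ℝ) : ℂ) := by push_cast; ring
  have e1 : (2 * Real.pi : ℂ) ^ (-s) = Complex.exp (-(Real.log (2 * Real.pi) * s)) := by
    rw [Complex.cpow_def_of_ne_zero (by rw [h2]; exact_mod_cast (by positivity)), h2, Complex.ofReal_log (by positivity)]
    ring_nf
  have e2 : (n : ℂ) ^ (-s) = Complex.exp (-(Real.log n * s)) := by
    rw [Complex.cpow_def_of_ne_zero (by exact_mod_cast hn0.ne'), Complex.natCast_log]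
    ring_nf
  have e3 : Complex.cos (Real.pi * s / 2) = (Complex.exp (I * Real.pi / 2 * s) + Complex.exp (-(I * Real.pi / 2 * s))) / 2 := by
    rw [Complex.cos]; ring_nf
  have e4 : conj (GJ (2 * Real.pi * n) (conj s)) =
      Gamma s * Complex.exp (-((Real.log (2 * Real.pi * n) : ℂ) - I * Real.pi / 2) * s) := by
    rw [GJ, map_mul, Complex.Gamma_conj, Complex.conj_conj, ← Complex.exp_conj]
    congr 2
    simp only [map_mul, map_neg, map_add, map_div₀, Complex.conj_conj, Complex.conj_ofReal, Complex.conj_I, map_ofNat]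
    ring
  rw [e4, chiX, e1, e2, e3, GJ, Real.log_mul (by positivity) hn0.ne', Complex.ofReal_add]
  have e5 : Complex.exp (-((Real.log (2 * Real.pi) : ℂ) + Real.log n + I * Real.pi / 2) * s) =
     Complex.exp (-(Real.log (2 * Real.pi) * s)) * Complex.exp (-(Real.log n * s)) * Complex.exp (-(I * Real.pi / 2 * s)) := by
    rw [← Complex.exp_add, ← Complex.exp_add]; ring_nf
  have e6 : Complex.exp (-((Real.log (2 * Real.pi) : ℂ) + Real.log n - I * Real.pi / 2) * s) =
     Complex.exp (-(Real.log (2 * Real.pi) * s)) * Complex.exp (-(Real.log n * s)) * Complex.exp ((I * Real.pi / 2 * s)) := by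
    rw [← Complex.exp_add, ← Complex.exp_add]; ring_nf
  rw [e5, e6]; ring

open ComplexConjugate in
lemma chiX_conj (s : ℂ) : chiX (conj s) = conj (chiX s) := by
  have h1 := chiX_mul (le_refl 1) s
  have h2 := chiX_mul (le_refl 1) (conj s)
  simp only [Nat.cast_one, Complex.one_cpow, mul_one, Complex.conj_conj] at h1 h2
  rw [h1, h2, map_add, Complex.conj_conj]; ring

lemma GJ_small : ∃ C : ℝ, 0 < C ∧ ∀ z a t : ℝ, 0 < z → 1 ≤ a → a ≤ 2 → t ≤ 17 →
    ‖GJ z (a + t * I)‖ ≤ C * z ^ (-a) * Real.exp t := by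
  obtain ⟨C, hC, H⟩ := Gamma_strip_bound
  have hcomp : IsCompact (Set.Icc (1:ℝ) 2 ×ˢ Set.Icc (-17:ℝ) 17) := isCompact_Icc.prod isCompact_Icc
  have hcont : ContinuousOn (fun p : ℝ × ℝ => Gamma (p.1 + p.2 * I)) (Set.Icc (1:ℝ) 2 ×ˢ Set.Icc (-17:ℝ) 17) := by
    intro p hp
    have h1 : ContinuousAt Gamma ((p.1 : ℂ) + p.2 * I) := by
      refine (Complex.differentiableAt_Gamma _ fun m h => ?_).continuousAt
      have := congrArg Complex.re h
      have h3 := hp.1.1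
      simp at this; have h4 : (0:ℝ) ≤ m := Nat.cast_nonneg m
      linarith
    exact (ContinuousAt.comp (f := fun p : ℝ × ℝ => (p.1 : ℂ) + p.2 * I) h1 (by fun_prop)).continuousWithinAt
  obtain ⟨M, hM⟩ := hcomp.exists_bound_of_continuousOn hcont
  have hM0 : 0 ≤ M := (norm_nonneg _).trans (hM (1, 0) (by constructor <;> constructor <;> norm_num))
  refine ⟨4 * C + M * Real.exp 100, by positivity, fun z a t hz ha1 ha2 ht => ?_⟩
  rw [norm_GJ hz]
  have hre : ((a : ℂ) + t * I).re = a := by simp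
  have him : ((a : ℂ) + t * I).im = t := by simp
  rw [hre, him]
  have hp := Real.pi_gt_three
  have hp4 := Real.pi_lt_four
  have hza : 0 < z ^ (-a) := by positivity
  suffices h : ‖Gamma (a + t * I)‖ * Real.exp (Real.pi * t / 2) ≤ (4 * C + M * Real.exp 100) * Real.exp t by
    calc _ = z ^ (-a) * (‖Gamma (a + t * I)‖ * Real.exp (Real.pi * t / 2)) := by ring
      _ ≤ z ^ (-a) * ((4 * C + M * Real.exp 100) * Real.exp t) := by gcongr
      _ = _ := by ring
  by_cases h : -17 ≤ t
  · have h1 := hM (a, t) ⟨⟨ha1, ha2⟩, ⟨h, ht⟩⟩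
    have h2 : Real.exp (Real.pi * t / 2) ≤ Real.exp 100 * Real.exp t := by
      rw [← Real.exp_add]; apply Real.exp_le_exp.mpr; nlinarith
    calc _ ≤ M * (Real.exp 100 * Real.exp t) := by gcongr
      _ ≤ _ := by nlinarith [Real.exp_pos t]
  · push Not at h
    have habs : |t| = -t := abs_of_neg (by linarith)
    have h1 := H (a + t * I) (by rw [hre]; linarith) (by rw [hre]; linarith) (by rw [him, habs]; linarith)
    rw [hre, him, habs] at h1
    have h2 : (-t) ^ (a - 1/2) ≤ 4 * Real.exp (-t) := by
      have h3 : (-t) ^ (a - 1/2) ≤ (-t) ^ (2 : ℝ) := Real.rpow_le_rpow_of_exponent_le (by linarith) (by linarith)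
      have h4 := Real.pow_div_factorial_le_exp (-t) (by linarith) 2
      simp [Nat.factorial] at h4
      rw [Real.rpow_two] at h3
      have h5 : 0 < Real.exp (-t) := Real.exp_pos _
      have h6 : (-t)^2 = t^2 := by ring
      rw [h6] at h3
      linarith
    calc _ ≤ (C * Real.exp (-(Real.pi * -t / 2)) * (4 * Real.exp (-t))) * Real.exp (Real.pi * t / 2) := by
          have := (h1.trans (mul_le_mul_of_nonneg_left h2 (by positivity)))
          gcongr
      _ = 4 * C * (Real.exp (-(Real.pi * -t / 2)) * Real.exp (-t) * Real.exp (Real.pi * t / 2)) := by ring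
      _ ≤ 4 * C * Real.exp t := by
          rw [← Real.exp_add, ← Real.exp_add]
          gcongr; nlinarith
      _ ≤ _ := by
          have : 0 ≤ M * Real.exp 100 * Real.exp t := by positivity
          linarith

lemma integral_exp_le (a b : ℝ) : ∫ x in a..b, Real.exp x ≤ Real.exp b := by
  rw [integral_exp]; linarith [Real.exp_pos a]

lemma GJ_cont (z a : ℝ) (ha : 0 < a) : Continuous (fun t : ℝ => GJ z (a + t * I)) := by
  rw [continuous_iff_continuousAt]
  intro t
  refine ContinuousAt.comp (f := fun t : ℝ => (a : ℂ) + t * I) (GJ_diff z fun m h => ?_).continuousAt (by fun_prop)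
  have := congrArg Complex.re h
  simp at this; have h4 : (0:ℝ) ≤ m := Nat.cast_nonneg m
  linarith

noncomputable def JX (t0 x : ℝ) (n : ℕ) : ℂ :=
  ∫ t in t0..(2 * Real.pi * x), chiX (aX x + t * I) * (n : ℂ) ^ (-((aX x : ℂ) + t * I))

open ComplexConjugate in
/-- reduction of `JX` to the `GJ` integral -/
lemma JX_red : ∃ C : ℝ, 0 < C ∧ ∀ t0 x : ℝ, ∀ n : ℕ, 2 ≤ t0 → t0 ≤ 17 → 3 ≤ x → 1 ≤ n →
    ‖JX t0 x n - ∫ t in t0..(2 * Real.pi * x), GJ (2 * Real.pi * n) (aX x + t * I)‖ ≤ C * (n : ℝ) ^ (-aX x) ∧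
    ‖∫ t in (-(2 * Real.pi * x))..t0, GJ (2 * Real.pi * n) (aX x + t * I)‖ ≤ C * (n : ℝ) ^ (-aX x) := by
  obtain ⟨C, hC, H⟩ := GJ_small
  refine ⟨C * Real.exp 17, by positivity, fun t0 x n h2 h17 hx hn => ?_⟩
  have hn0 : (0 : ℝ) < n := by exact_mod_cast hn
  have hp := Real.pi_gt_three
  have hT : t0 ≤ 2 * Real.pi * x := by nlinarith
  have ha1 := aX_gt hx
  have ha2 := aX_le hx
  set z := 2 * Real.pi * (n : ℝ) with hz
  have hz0 : 0 < z := by positivity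
  set a := aX x
  set T := 2 * Real.pi * x
  have hzn : z ^ (-a) ≤ (n : ℝ) ^ (-a) :=
    Real.rpow_le_rpow_of_nonpos hn0 (by rw [hz]; nlinarith) (by linarith)
  have hc := GJ_cont z a (by linarith)
  have hc2 : Continuous (fun t : ℝ => conj (GJ z (conj ((a : ℂ) + t * I)))) := by
    have : (fun t : ℝ => conj (GJ z (conj ((a : ℂ) + t * I)))) = fun t : ℝ => conj (GJ z (a + ((-t : ℝ) : ℂ) * I)) := by
      funext t
      congr 2
      simp
    rw [this]
    exact Complex.continuous_conj.comp (hc.comp continuous_neg)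
  constructor
  · have e : JX t0 x n - ∫ t in t0..T, GJ z (a + t * I) = ∫ t in t0..T, conj (GJ z (conj ((a : ℂ) + t * I))) := by
      rw [JX]
      simp_rw [chiX_mul hn]
      rw [intervalIntegral.integral_add (hc.intervalIntegrable _ _) (hc2.intervalIntegrable _ _)]
      ring
    rw [e]
    have := intervalIntegral.norm_integral_le_of_norm_le (f := fun t : ℝ => conj (GJ z (conj ((a : ℂ) + t * I))))
      (g := fun t : ℝ => C * z ^ (-a) * Real.exp (1 * (0 - t))) (a := t0) (b := T)
      (μ := MeasureTheory.volume) hT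
      (Eventually.of_forall fun t ht => by
        have := H z a (-t) hz0 ha1.le ha2 (by linarith [ht.1])
        rw [RCLike.norm_conj]
        simpa [sub_eq_add_neg] using this)
      (Continuous.intervalIntegrable (by fun_prop) _ _)
    refine this.trans ?_
    rw [intervalIntegral.integral_const_mul]
    have h3 := integral_exp_decay one_pos 0 t0 T
    have h4 : Real.exp (1 * (0 - t0)) / 1 ≤ Real.exp 17 := by
      rw [div_one]; apply Real.exp_le_exp.mpr; linarith
    calc _ ≤ C * (n : ℝ) ^ (-a) * Real.exp 17 := by
          gcongr
          · exact intervalIntegral.integral_nonneg hT fun u _ => (Real.exp_pos _).le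
          · exact h3.trans h4
      _ = _ := by ring
  · have := intervalIntegral.norm_integral_le_of_norm_le (f := fun t : ℝ => GJ z ((a : ℂ) + t * I))
      (g := fun t : ℝ => C * z ^ (-a) * Real.exp t) (a := -T) (b := t0)
      (μ := MeasureTheory.volume) (by linarith)
      (Eventually.of_forall fun t ht => H z a t hz0 ha1.le ha2 (by linarith [ht.2]))
      (Continuous.intervalIntegrable (by fun_prop) _ _)
    refine this.trans ?_
    rw [intervalIntegral.integral_const_mul]
    have h3 := integral_exp_le (-T) t0
    have h4 : Real.exp t0 ≤ Real.exp 17 := Real.exp_le_exp.mpr h17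
    calc _ ≤ C * (n : ℝ) ^ (-a) * Real.exp 17 := by
          gcongr
          · exact intervalIntegral.integral_nonneg (by linarith) fun u _ => (Real.exp_pos _).le
          · exact h3.trans h4
      _ = _ := by ring

lemma rpow_neg_half_mul {x c : ℝ} (hx : 0 < x) (hc : 1 ≤ c) : (c * x) ^ (-(1/2) : ℝ) ≤ x ^ (-(1/2) : ℝ) :=
  Real.rpow_le_rpow_of_nonpos hx (by nlinarith) (by norm_num)

lemma J_near : ∃ C : ℝ, 0 < C ∧ ∀ x : ℝ, ∀ n : ℕ, 100 ≤ x → |(n : ℝ) - x| < √x →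
    ‖∫ t in (-(2 * Real.pi * x))..(2 * Real.pi * x), GJ (2 * Real.pi * n) (aX x + t * I)‖ ≤ C := by
  obtain ⟨C1, hC1, H1⟩ := J_left
  obtain ⟨C2, hC2, H2⟩ := GJ_bound
  refine ⟨2 * Real.pi + C1 * 100 + C2 * 1000, by positivity, fun x n hx hnx => ?_⟩
  have hp := Real.pi_gt_three
  have hp4 := Real.pi_lt_four
  have hx0 : 0 < x := by linarith
  set r := √x with hr
  have hr2 : r ^ 2 = x := Real.sq_sqrt hx0.le
  have hr10 : 10 ≤ r := by apply Real.le_sqrt_of_sq_le; linarith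
  rw [abs_lt] at hnx
  have hn1 : (9/10) * x ≤ n := by nlinarith [hnx.1]
  have hn0 : (0 : ℝ) < n := by linarith
  have hnn : 1 ≤ n := by exact_mod_cast (Nat.one_le_cast (α := ℝ)).mp (by linarith)
  have ha1 := aX_gt (by linarith : 3 ≤ x)
  have ha2 := aX_le (by linarith : 3 ≤ x)
  set a := aX x
  set z := 2 * Real.pi * (n : ℝ) with hz
  have hz0 : 0 < z := by positivity
  set T := 2 * Real.pi * x with hT
  have hT0 : 0 < T := by positivity
  set T' := 2 * Real.pi * (x + 2 * r) with hT'
  have hTT' : T ≤ T' := by rw [hT, hT']; gcongr; linarith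
  have hc := GJ_cont z a (by linarith)
  have hT'x : x + 2 * r ≤ (6/5) * x := by nlinarith
  have hq : T' / z ≤ 4/3 := by
    rw [div_le_iff₀ hz0, hT', hz]
    have : x + 2 * r ≤ 4/3 * n := by linarith
    nlinarith
  have hqa : ∀ q : ℝ, 0 ≤ q → q ≤ 4/3 → q ^ a ≤ 2 := by
    intro q h0 h1
    calc q ^ a ≤ (4/3 : ℝ) ^ a := by gcongr
      _ ≤ (4/3 : ℝ) ^ (2 : ℝ) := Real.rpow_le_rpow_of_exponent_le (by norm_num) ha2
      _ ≤ 2 := by norm_num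
  have hdiff : 2 * Real.pi * r ≤ T' - z := by rw [hT', hz]; nlinarith
  have h1 := H1 n hnn T' a (by rw [hT']; nlinarith) (by have : 0 < 2 * Real.pi * r := by positivity
                                                        linarith) ha1.le ha2
  have hhalf : ∀ u : ℝ, T ≤ u → u ^ (-(1/2) : ℝ) ≤ 1 / r := by
    intro u hu
    have : u ^ (-(1/2) : ℝ) ≤ x ^ (-(1/2) : ℝ) :=
      Real.rpow_le_rpow_of_nonpos hx0 (by rw [hT] at hu; nlinarith) (by norm_num)
    rw [Real.rpow_neg hx0.le, ← Real.sqrt_eq_rpow] at this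
    rw [one_div (r)]; exact this
  have h1' : C1 * T' ^ (-(1/2) : ℝ) * (T' / z) ^ a * (T' / (T' - z)) ≤ C1 * 100 := by
    have e1 : T' / (T' - z) ≤ 2 * r := by
      rw [div_le_iff₀ (by have : 0 < 2 * Real.pi * r := by positivity
                          linarith)]
      calc T' ≤ 2 * r * (2 * Real.pi * r) := by rw [hT']; nlinarith
        _ ≤ _ := by gcongr
    calc _ ≤ C1 * (1 / r) * 2 * (2 * r) := by
          have : 0 ≤ T' / (T' - z) := by
            have : 0 < 2 * Real.pi * r := by positivity
            exact div_nonneg (by positivity) (by linarith)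
          gcongr
          · exact hhalf T' hTT'
          · exact hqa _ (by positivity) hq
      _ = C1 * 4 := by field_simp; norm_num
      _ ≤ _ := by linarith
  have h3 : ‖∫ t in T..T', GJ z (a + t * I)‖ ≤ C2 * 200 := by
    have := intervalIntegral.norm_integral_le_of_norm_le_const (f := fun y : ℝ => GJ z (a + y * I))
      (a := T) (b := T') (C := C2 * (1 / r) * 2) (fun y hy => by
        rw [Set.uIoc_of_le hTT'] at hy
        have hy0 : 0 < y := by linarith [hy.1]
        have := H2 z hz0 (a + y * I) (by simp; linarith) (by simp; rw [abs_of_pos hy0]; nlinarith [hy.1])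
        simp only [add_im, ofReal_im, mul_im, ofReal_re, I_im, mul_one, I_re, mul_zero, add_zero, zero_add, add_re, mul_re, sub_zero, abs_of_pos hy0] at this
        refine this.trans ?_
        gcongr
        · exact hhalf y hy.1.le
        · refine hqa _ (by positivity) (le_trans ?_ hq)
          gcongr; exact hy.2)
    refine this.trans ?_
    rw [abs_of_nonneg (by linarith)]
    have : T' - T = 4 * Real.pi * r := by rw [hT, hT']; ring
    rw [this]
    calc _ = C2 * (8 * Real.pi) := by field_simp; ring
      _ ≤ _ := by gcongr; linarith
  have h4 : ‖∫ t in (-T')..(-T), GJ z (a + t * I)‖ ≤ C2 * 200 := by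
    have := intervalIntegral.norm_integral_le_of_norm_le_const (f := fun y : ℝ => GJ z (a + y * I))
      (a := -T') (b := -T) (C := C2 * (1 / r) * 2) (fun y hy => by
        rw [Set.uIoc_of_le (by linarith)] at hy
        have hy0 : y < 0 := by linarith [hy.2]
        have := H2 z hz0 (a + y * I) (by simp; linarith) (by simp; rw [abs_of_neg hy0]; nlinarith [hy.2])
        simp only [add_im, ofReal_im, mul_im, ofReal_re, I_im, mul_one, I_re, mul_zero, add_zero, zero_add, add_re, mul_re, sub_zero, abs_of_neg hy0] at this
        refine this.trans ?_
        have : 0 < -y := by linarith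
        gcongr
        · exact hhalf (-y) (by linarith [hy.2])
        · refine hqa _ (by positivity) (le_trans ?_ hq)
          gcongr; linarith [hy.1])
    refine this.trans ?_
    rw [abs_of_nonneg (by linarith)]
    have : -T - -T' = 4 * Real.pi * r := by rw [hT, hT']; ring
    rw [this]
    calc _ = C2 * (8 * Real.pi) := by field_simp; ring
      _ ≤ _ := by gcongr; linarith
  have hsplit : (∫ t in (-T)..T, GJ z (a + t * I)) = ((∫ t in (-T')..T', GJ z (a + t * I)) - 2 * Real.pi)
      + 2 * Real.pi - (∫ t in (-T')..(-T), GJ z (a + t * I)) - ∫ t in T..T', GJ z (a + t * I) := by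
    rw [← intervalIntegral.integral_add_adjacent_intervals (hc.intervalIntegrable (-T') (-T)) (hc.intervalIntegrable (-T) T'),
      ← intervalIntegral.integral_add_adjacent_intervals (hc.intervalIntegrable (-T) T) (hc.intervalIntegrable T T')]
    ring
  rw [hsplit]
  have e2 : ‖(2 * Real.pi : ℂ)‖ = 2 * Real.pi := by
    rw [norm_mul, Complex.norm_real]; simp [abs_of_pos Real.pi_pos]
  refine (norm_sub_le _ _).trans ?_
  refine (add_le_add_left (norm_sub_le _ _) _).trans ?_
  refine (add_le_add_left (add_le_add_left (norm_add_le _ _) _) _).trans ?_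
  rw [e2]
  linarith [h1.trans h1']

lemma J_main : ∃ C : ℝ, 0 < C ∧ ∀ t0 x : ℝ, ∀ n : ℕ, 2 ≤ t0 → t0 ≤ 17 → 100 ≤ x → 1 ≤ n →
    ‖JX t0 x n - (if (n : ℝ) ≤ x then 2 * Real.pi else 0 : ℂ)‖ ≤
      C * (x ^ (-(1/2) : ℝ) * ((x / n) ^ aX x * wX x n) + (n : ℝ) ^ (-aX x) +
        if |(n : ℝ) - x| < √x then 1 else 0) := by
  obtain ⟨C0, hC0, H0⟩ := JX_red
  obtain ⟨C1, hC1, H1⟩ := J_left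
  obtain ⟨C2, hC2, H2⟩ := J_right
  obtain ⟨C3, hC3, H3⟩ := J_near
  refine ⟨2 * C0 + C1 + C2 + C3 + 2 * Real.pi, by positivity, fun t0 x n h2 h17 hx hn => ?_⟩
  have hp := Real.pi_gt_three
  have hx0 : 0 < x := by linarith
  have hn0 : (0 : ℝ) < n := by exact_mod_cast hn
  have hr2 : √x ^ 2 = x := Real.sq_sqrt hx0.le
  have hr10 : 10 ≤ √x := by apply Real.le_sqrt_of_sq_le; linarith
  have ha1 := aX_gt (by linarith : 3 ≤ x)
  have ha2 := aX_le (by linarith : 3 ≤ x)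
  obtain ⟨h3, h4⟩ := H0 t0 x n h2 h17 (by linarith) hn
  have hc := GJ_cont (2 * Real.pi * n) (aX x) (by linarith)
  have hsplit := intervalIntegral.integral_add_adjacent_intervals
    (hc.intervalIntegrable (μ := MeasureTheory.volume) (-(2 * Real.pi * x)) t0) (hc.intervalIntegrable t0 (2 * Real.pi * x))
  have hw : 0 ≤ x ^ (-(1/2) : ℝ) * ((x / n) ^ aX x * wX x n) := by
    have := wX_nonneg hx0.le n; positivity
  have hN : 0 ≤ (n : ℝ) ^ (-aX x) := by positivity
  have e2 : ‖(2 * Real.pi : ℂ)‖ = 2 * Real.pi := by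
    rw [norm_mul, Complex.norm_real]; simp [abs_of_pos Real.pi_pos]
  have hTx : (2 * Real.pi * x) ^ (-(1/2) : ℝ) ≤ x ^ (-(1/2) : ℝ) := rpow_neg_half_mul hx0 (by linarith)
  have hratio : 2 * Real.pi * x / (2 * Real.pi * n) = x / n := by field_simp
  set G := ∫ t in t0..(2 * Real.pi * x), GJ (2 * Real.pi * n) (aX x + t * I)
  set G1 := ∫ t in (-(2 * Real.pi * x))..t0, GJ (2 * Real.pi * n) (aX x + t * I)
  set W := x ^ (-(1/2) : ℝ) * ((x / n) ^ aX x * wX x n) with hW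
  set N := (n : ℝ) ^ (-aX x)
  by_cases hnear : |(n : ℝ) - x| < √x
  · rw [if_pos hnear]
    have h5 := H3 x n hx hnear
    rw [← hsplit] at h5
    have e3 : ‖((if (n : ℝ) ≤ x then 2 * Real.pi else 0 : ℂ))‖ ≤ 2 * Real.pi := by
      split_ifs
      · exact e2.le
      · simp; positivity
    have e4 : JX t0 x n - (if (n : ℝ) ≤ x then 2 * Real.pi else 0 : ℂ) =
      (JX t0 x n - G) + (G1 + G) - G1 - (if (n : ℝ) ≤ x then 2 * Real.pi else 0 : ℂ) := by ring
    have e5 : ‖JX t0 x n - (if (n : ℝ) ≤ x then 2 * Real.pi else 0 : ℂ)‖ ≤ C0 * N + C3 + C0 * N + 2 * Real.pi := by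
      rw [e4]
      refine (norm_sub_le _ _).trans (add_le_add ((norm_sub_le _ _).trans (add_le_add ((norm_add_le _ _).trans
        (add_le_add h3 h5)) h4)) e3)
    refine e5.trans ?_
    have := mul_nonneg hC1.le hw
    have := mul_nonneg hC2.le hw
    have := mul_nonneg hC3.le hw
    have := mul_nonneg hC0.le hw
    have := mul_nonneg hC1.le hN
    have := mul_nonneg hC2.le hN
    have := mul_nonneg hC3.le hN
    have := mul_nonneg Real.pi_pos.le hN
    have := mul_nonneg Real.pi_pos.le hw
    nlinarith
  · rw [if_neg hnear, add_zero]
    push Not at hnear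
    have hw1 : wX x n = max x n / |(n : ℝ) - x| := by rw [wX, if_pos (by linarith)]
    have hCW : ∀ c : ℝ, 0 < c → c ≤ 2 * C0 + C1 + C2 + C3 + 2 * Real.pi - 2 * C0 →
        c * W + 2 * (C0 * N) ≤ (2 * C0 + C1 + C2 + C3 + 2 * Real.pi) * (W + N) := by
      intro c h0 h1
      have a1 : c * W ≤ (2 * C0 + C1 + C2 + C3 + 2 * Real.pi) * W := mul_le_mul_of_nonneg_right (by linarith) hw
      have a2 : 2 * C0 * N ≤ (2 * C0 + C1 + C2 + C3 + 2 * Real.pi) * N :=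
        mul_le_mul_of_nonneg_right (by linarith) hN
      linarith
    by_cases hnx : (n : ℝ) ≤ x
    · rw [if_pos hnx]
      rw [abs_of_nonpos (by linarith)] at hnear hw1
      have hlt : (n : ℝ) < x := by linarith
      have h5 := H1 n hn (2 * Real.pi * x) (aX x) (by nlinarith) (by nlinarith) ha1.le ha2
      rw [← hsplit, hratio] at h5
      have e3 : 2 * Real.pi * x / (2 * Real.pi * x - 2 * Real.pi * n) = wX x n := by
        rw [hw1, max_eq_left hnx, ← mul_sub]
        rw [mul_div_mul_left _ _ (by positivity)]
        congr 1; ring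
      rw [e3] at h5
      have h6 : ‖G1 + G - 2 * Real.pi‖ ≤ C1 * W := by
        refine h5.trans ?_
        have := wX_nonneg hx0.le n
        rw [hW, mul_assoc C1, mul_assoc C1, mul_assoc]
        gcongr
      have e4 : JX t0 x n - 2 * Real.pi = (JX t0 x n - G) + (G1 + G - 2 * Real.pi) - G1 := by ring
      rw [e4]
      refine ((norm_sub_le _ _).trans (add_le_add ((norm_add_le _ _).trans (add_le_add h3 h6)) h4)).trans ?_
      have := hCW C1 hC1 (by linarith)
      linarith
    · rw [if_neg hnx, sub_zero]
      push Not at hnx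
      rw [abs_of_nonneg (by linarith)] at hnear hw1
      have h5 := H2 (2 * Real.pi * n) (2 * Real.pi * x) (aX x) t0 (by nlinarith) (by nlinarith) (by
        rw [← mul_sub, mul_pow]
        have : x ≤ ((n : ℝ) - x) ^ 2 := by nlinarith
        have h9 : 2 * Real.pi ≤ (2 * Real.pi) ^ 2 := by nlinarith
        gcongr) ha1.le ha2 h2 (by nlinarith)
      have e3 : 2 * Real.pi * n / (2 * Real.pi * n - 2 * Real.pi * x) = wX x n := by
        rw [hw1, max_eq_right hnx.le, ← mul_sub]
        rw [mul_div_mul_left _ _ (by positivity)]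
      rw [e3, hratio] at h5
      have h6 : ‖G‖ ≤ C2 * W := by
        refine h5.trans ?_
        have := wX_nonneg hx0.le n
        rw [hW, mul_assoc C2, mul_assoc C2, mul_assoc]
        gcongr
      have e4 : JX t0 x n = (JX t0 x n - G) + G := by ring
      rw [e4]
      refine ((norm_add_le _ _).trans (add_le_add h3 h6)).trans ?_
      have := hCW C2 hC2 (by linarith)
      have := mul_nonneg hC0.le hN
      linarith

lemma norm_nat_cpow_neg {n : ℕ} (hn : 1 ≤ n) (s : ℂ) : ‖(n : ℂ) ^ (-s)‖ = (n : ℝ) ^ (-s.re) := by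
  have := norm_real_cpow (x := (n : ℝ)) (by exact_mod_cast hn) (-s)
  simpa using this

lemma JX_hasSum {t0 x : ℝ} (h2 : 2 ≤ t0) (hx : 3 ≤ x) :
    HasSum (fun n : ℕ => (bZ n : ℂ) * JX t0 x n)
      (∫ t in t0..(2 * Real.pi * x), chiX (aX x + t * I) * fZ (aX x + t * I)) := by
  have ha1 := aX_gt hx
  set T := 2 * Real.pi * x with hT
  have hcont : ContinuousOn (fun t : ℝ => chiX (aX x + t * I)) (Set.uIcc t0 T) := by
    intro t ht
    have hp := Real.pi_gt_three
    by_cases h : t0 ≤ T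
    · rw [Set.uIcc_of_le h] at ht
      have him : ((aX x : ℂ) + t * I).im ≠ 0 := by simp; linarith [ht.1]
      exact (ContinuousAt.comp (f := fun t : ℝ => (aX x : ℂ) + t * I) (hasDerivAt_chiX him).continuousAt
        (by fun_prop)).continuousWithinAt
    · rw [Set.uIcc_of_ge (by linarith)] at ht
      have him : ((aX x : ℂ) + t * I).im ≠ 0 := by
        simp; have := ht.1; nlinarith
      exact (ContinuousAt.comp (f := fun t : ℝ => (aX x : ℂ) + t * I) (hasDerivAt_chiX him).continuousAt
        (by fun_prop)).continuousWithinAt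
  obtain ⟨M, hM⟩ := isCompact_uIcc.exists_bound_of_continuousOn hcont
  have hM0 : 0 ≤ M := (norm_nonneg _).trans (hM t0 Set.left_mem_uIcc)
  have hterm : ∀ n : ℕ, ContinuousOn (fun t : ℝ => (bZ n : ℂ) * (chiX (aX x + t * I) * (n : ℂ) ^ (-((aX x : ℂ) + t * I))))
      (Set.uIcc t0 T) := by
    intro n
    rcases Nat.eq_zero_or_pos n with rfl | hn
    · simp only [bZ_zero, Complex.ofReal_zero, zero_mul]; exact continuousOn_const
    · refine continuousOn_const.mul (hcont.mul ?_)
      have : (n : ℂ) ≠ 0 := by exact_mod_cast hn.ne'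
      have : Continuous (fun t : ℝ => (n : ℂ) ^ (-((aX x : ℂ) + t * I))) :=
        Continuous.const_cpow (by fun_prop) (Or.inl this)
      exact this.continuousOn
  have key := intervalIntegral.hasSum_integral_of_dominated_convergence (μ := MeasureTheory.volume) (a := t0) (b := T)
    (F := fun (n : ℕ) (t : ℝ) => (bZ n : ℂ) * (chiX (aX x + t * I) * (n : ℂ) ^ (-((aX x : ℂ) + t * I))))
    (f := fun t : ℝ => chiX (aX x + t * I) * fZ (aX x + t * I))
    (fun (n : ℕ) (_ : ℝ) => M * (bZ n * (n : ℝ) ^ (-aX x)))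
    (fun n => ((hterm n).mono Set.uIoc_subset_uIcc).aestronglyMeasurable measurableSet_uIoc)
    (fun n => Eventually.of_forall fun t ht => by
      rcases Nat.eq_zero_or_pos n with rfl | hn
      · simp [bZ_zero]
      · rw [norm_mul, norm_mul, norm_nat_cpow_neg hn, Complex.norm_real, Real.norm_of_nonneg (bZ_nonneg n)]
        have := hM t (Set.uIoc_subset_uIcc ht)
        have hb := bZ_nonneg n
        simp only [add_re, ofReal_re, mul_re, I_re, mul_zero, ofReal_im, I_im, mul_one, sub_zero, add_zero]
        calc _ ≤ bZ n * (M * (n : ℝ) ^ (-aX x)) := by gcongr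
          _ = _ := by ring)
    (Eventually.of_forall fun t _ => (bZ_summable ha1).mul_left M)
    (by simp)
    (Eventually.of_forall fun t _ => by
      have := (bZ_hasSum (s := (aX x : ℂ) + t * I) (by simpa using ha1)).mul_left (chiX (aX x + t * I))
      have e : (fun n : ℕ => (bZ n : ℂ) * (chiX (aX x + t * I) * (n : ℂ) ^ (-((aX x : ℂ) + t * I)))) =
        fun n : ℕ => chiX (aX x + t * I) * ((bZ n : ℂ) * (n : ℂ) ^ (-((aX x : ℂ) + t * I))) := by
        funext n; ring
      rw [e]; exact this)
  have e : (fun n : ℕ => (bZ n : ℂ) * JX t0 x n) = fun n : ℕ =>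
    ∫ t in t0..T, (bZ n : ℂ) * (chiX (aX x + t * I) * (n : ℂ) ^ (-((aX x : ℂ) + t * I))) := by
    funext n; rw [JX, intervalIntegral.integral_const_mul]
  rw [e]; exact key

noncomputable def DX (x : ℝ) : ℝ := ∑ n ∈ range (⌊x⌋₊ + 1), bZ n

lemma DX_hasSum {x : ℝ} (hx : 0 ≤ x) : HasSum (fun n : ℕ => if (n : ℝ) ≤ x then bZ n else 0) (DX x) := by
  have : DX x = ∑ n ∈ range (⌊x⌋₊ + 1), (if (n : ℝ) ≤ x then bZ n else 0) := by
    refine Finset.sum_congr rfl fun n hn => ?_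
    rw [if_pos]
    exact (Nat.le_floor_iff hx).mp (by have := Finset.mem_range.mp hn; omega)
  rw [this]
  refine hasSum_sum_of_ne_finset_zero fun n hn => ?_
  rw [if_neg]
  intro h
  exact hn (Finset.mem_range.mpr (by have := (Nat.le_floor_iff hx).mpr h; omega))

/-- the contribution of the terms close to `x` -/
lemma bZ_near {x r : ℝ} (hx : 3 ≤ x) (hr : 1 ≤ r) (hrx : r ≤ x) :
    Summable (fun n : ℕ => bZ n * (if |(n : ℝ) - x| < r then 1 else 0)) ∧
    ∑' n : ℕ, bZ n * (if |(n : ℝ) - x| < r then 1 else 0) ≤ 12 * r * Real.log x ^ 2 := by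
  set S := Finset.Icc ⌈x - r⌉₊ ⌊x + r⌋₊ with hS
  have hout : ∀ n ∉ S, bZ n * (if |(n : ℝ) - x| < r then 1 else 0) = 0 := by
    intro n hn
    rw [if_neg, mul_zero]
    intro h
    rw [abs_lt] at h
    apply hn
    rw [hS, Finset.mem_Icc]
    exact ⟨Nat.ceil_le.mpr (by linarith), Nat.le_floor (by linarith)⟩
  refine ⟨summable_of_ne_finset_zero hout, ?_⟩
  rw [tsum_eq_sum hout]
  have hlog := log_ge_one hx
  have h2 : Real.log (2 * x) ≤ 2 * Real.log x := by
    rw [Real.log_mul (by norm_num) (by linarith)]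
    have : Real.log 2 ≤ Real.log x := Real.log_le_log (by norm_num) (by linarith)
    linarith
  have hterm : ∀ n ∈ S, bZ n * (if |(n : ℝ) - x| < r then 1 else 0) ≤ 4 * Real.log x ^ 2 := by
    intro n hn
    rw [hS, Finset.mem_Icc] at hn
    have h3 : (n : ℝ) ≤ x + r := (Nat.le_floor_iff (by linarith)).mp hn.2
    have h4 : bZ n ≤ 4 * Real.log x ^ 2 := by
      refine (bZ_le n).trans ?_
      rcases Nat.eq_zero_or_pos n with rfl | hn0
      · simp; positivity
      · have h5 : Real.log n ≤ Real.log (2 * x) := Real.log_le_log (by exact_mod_cast hn0) (by linarith)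
        have h6 : 0 ≤ Real.log n := Real.log_natCast_nonneg n
        nlinarith
    split_ifs
    · simpa using h4
    · simp; positivity
  refine (Finset.sum_le_card_nsmul S _ _ hterm).trans ?_
  rw [nsmul_eq_mul]
  have hcard : (S.card : ℝ) ≤ 2 * r + 1 := by
    rw [hS, Nat.card_Icc]
    have h1 : (⌊x + r⌋₊ : ℝ) ≤ x + r := Nat.floor_le (by linarith)
    have h2 : x - r ≤ ⌈x - r⌉₊ := Nat.le_ceil _
    rcases le_total ⌈x - r⌉₊ (⌊x + r⌋₊ + 1) with h | h
    · rw [Nat.cast_sub h]; push_cast; linarith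
    · rw [Nat.sub_eq_zero_of_le h]; simp; linarith
  calc _ ≤ (2 * r + 1) * (4 * Real.log x ^ 2) := by gcongr
    _ ≤ (3 * r) * (4 * Real.log x ^ 2) := by gcongr; linarith
    _ = _ := by ring

lemma J_sum : ∃ C : ℝ, 0 < C ∧ ∀ t0 x : ℝ, 2 ≤ t0 → t0 ≤ 17 → 100 ≤ x →
    ‖(∫ t in t0..(2 * Real.pi * x), chiX (aX x + t * I) * fZ (aX x + t * I)) - 2 * Real.pi * DX x‖ ≤
      C * √x * Real.log x ^ 3 := by
  obtain ⟨C, hC, H⟩ := J_main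
  obtain ⟨C1, hC1, H1⟩ := bZ_weighted
  obtain ⟨C2, _, H2⟩ := bZ_tsum_bound
  refine ⟨C * (C1 + |C2| + 12), by positivity, fun t0 x h2 h17 hx => ?_⟩
  have hx3 : 3 ≤ x := by linarith
  have hx0 : 0 < x := by linarith
  have ha1 := aX_gt hx3
  have ha2 := aX_le hx3
  have hr10 : 10 ≤ √x := by apply Real.le_sqrt_of_sq_le; linarith
  have hrx : √x ≤ x := by
    have hr2 : √x ^ 2 = x := Real.sq_sqrt hx0.le
    nlinarith
  obtain ⟨hs1, hb1⟩ := H1 x hx3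
  have hs2 := bZ_summable ha1
  have hb2 := H2 (aX x) ha1 ha2
  obtain ⟨hs3, hb3⟩ := bZ_near hx3 (by linarith) hrx
  have hlog := log_ge_one hx3
  have hbig := (((hs1.mul_left (x ^ (-(1/2) : ℝ))).add hs2).add hs3).mul_left C
  have hD := (Complex.hasSum_ofReal.mpr (DX_hasSum hx0.le)).mul_left (2 * Real.pi : ℂ)
  have hsub := (JX_hasSum h2 hx3).sub hD
  have hle : ∀ n : ℕ, ‖(bZ n : ℂ) * JX t0 x n - 2 * Real.pi * ((if (n : ℝ) ≤ x then bZ n else 0 : ℝ) : ℂ)‖ ≤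
      C * (x ^ (-(1/2) : ℝ) * (bZ n * (x / n) ^ aX x * wX x n) + bZ n * (n : ℝ) ^ (-aX x) +
        bZ n * (if |(n : ℝ) - x| < √x then 1 else 0)) := by
    intro n
    rcases Nat.eq_zero_or_pos n with rfl | hn
    · simp [bZ_zero]
    · have h := H t0 x n h2 h17 hx hn
      have e : (bZ n : ℂ) * JX t0 x n - 2 * Real.pi * ((if (n : ℝ) ≤ x then bZ n else 0 : ℝ) : ℂ) =
        (bZ n : ℂ) * (JX t0 x n - (if (n : ℝ) ≤ x then 2 * Real.pi else 0 : ℂ)) := by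
        split_ifs
        · ring
        · simp
      rw [e, norm_mul, Complex.norm_real, Real.norm_of_nonneg (bZ_nonneg n)]
      refine (mul_le_mul_of_nonneg_left h (bZ_nonneg n)).trans (le_of_eq ?_)
      ring
  have hfin := tsum_of_norm_bounded hbig.hasSum hle
  rw [hsub.tsum_eq] at hfin
  refine hfin.trans ?_
  rw [tsum_mul_left, ((hs1.mul_left (x ^ (-(1/2) : ℝ))).add hs2).tsum_add hs3, (hs1.mul_left (x ^ (-(1/2) : ℝ))).tsum_add hs2,
    tsum_mul_left]
  have e1 : x ^ (-(1/2) : ℝ) * x = √x := by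
    rw [Real.sqrt_eq_rpow, ← Real.rpow_add_one hx0.ne']; norm_num
  have e2 : C2 / (aX x - 1) ^ 3 = C2 * Real.log x ^ 3 := by
    rw [aX]; field_simp; ring
  rw [e2] at hb2
  have h5 : C2 * Real.log x ^ 3 ≤ |C2| * √x * Real.log x ^ 3 := by
    have h6 := le_abs_self C2
    have h7 : |C2| ≤ |C2| * √x := le_mul_of_one_le_right (abs_nonneg _) (by linarith)
    gcongr; linarith
  have h8 : Real.log x ^ 2 ≤ Real.log x ^ 3 := pow_le_pow_right₀ hlog (by norm_num)
  calc _ ≤ C * (x ^ (-(1/2) : ℝ) * (C1 * x * Real.log x ^ 3) + |C2| * √x * Real.log x ^ 3 + 12 * √x * Real.log x ^ 3) := by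
        gcongr
        · exact hb2.trans h5
        · exact hb3.trans (by gcongr)
    _ = C * ((x ^ (-(1/2) : ℝ) * x) * (C1 * Real.log x ^ 3) + |C2| * √x * Real.log x ^ 3 + 12 * √x * Real.log x ^ 3) := by ring
    _ = _ := by rw [e1]; ring

/-! ### Perron kernel -/

noncomputable def PK (y : ℝ) (s : ℂ) : ℂ := (y : ℂ) ^ s / s

lemma norm_PK_le {y : ℝ} (hy : 0 < y) {s : ℂ} {X : ℝ} (hX : 0 < X) (h : X ≤ ‖s‖) :
    ‖PK y s‖ ≤ y ^ s.re / X := by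
  rw [PK, norm_div, norm_real_cpow hy]
  gcongr

lemma PK_diff {y : ℝ} (hy : 0 < y) {s : ℂ} (hs : s ≠ 0) : DifferentiableAt ℂ (PK y) s := by
  have : (y : ℂ) ≠ 0 := by exact_mod_cast hy.ne'
  unfold PK
  exact (differentiableAt_id.const_cpow (Or.inl this)).div differentiableAt_id hs

lemma PK_gt {y a X : ℝ} (hy : 1 < y) (ha : 0 < a) (hX : 0 < X) :
    ‖(∫ t in (-X)..X, PK y (a + t * I)) - 2 * Real.pi‖ ≤ 2 * (y ^ a / (X * Real.log y)) := by
  have hy0 : 0 < y := by linarith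
  have hlog := Real.log_pos hy
  have hyc : (y : ℂ) ≠ 0 := by exact_mod_cast hy0.ne'
  have hRI : ∀ R : ℝ, 0 < R → RI (PK y) (-R) a (-X) X = 2 * Real.pi * I := by
    intro R hR
    have := RI_residues (by linarith : -R ≤ a) (by linarith : -X ≤ X) Set.univ isOpen_univ (Set.subset_univ _)
      {0} (fun _ => 1) (PK y) (fun p hp => by
        rw [Finset.mem_singleton] at hp; subst hp
        refine ⟨?_, ?_, ?_, ?_⟩ <;> simp <;> linarith)
      (fun s hs => (PK_diff hy0 (by simpa using hs)).differentiableWithinAt)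
      (fun p hp => by
        rw [Finset.mem_singleton] at hp; subst hp
        have h1 : Tendsto (fun s : ℂ => (y : ℂ) ^ s) (nhdsWithin 0 {0}ᶜ) (nhds ((y : ℂ) ^ (0 : ℂ))) :=
          ((Continuous.const_cpow continuous_id (Or.inl hyc)).tendsto 0).mono_left nhdsWithin_le_nhds
        rw [Complex.cpow_zero] at h1
        refine h1.congr' ?_
        filter_upwards [self_mem_nhdsWithin] with s hs
        have : s ≠ 0 := hs
        simp only [PK, sub_zero]; field_simp)
    simpa using this
  set E := y ^ a / (X * Real.log y) with hE
  have hor : ∀ R c : ℝ, 0 < R → |c| = X → ‖∫ x in (-R)..a, PK y (x + c * I)‖ ≤ E := by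
    intro R c hR hc
    have := intervalIntegral.norm_integral_le_of_norm_le (f := fun x : ℝ => PK y (x + c * I))
      (g := fun x : ℝ => X⁻¹ * y ^ x) (a := -R) (b := a)
      (μ := MeasureTheory.volume) (by linarith)
      (Eventually.of_forall fun x hx => by
        have h1 : X ≤ ‖(x : ℂ) + c * I‖ := by
          rw [← hc]; have := Complex.abs_im_le_norm ((x : ℂ) + c * I); simpa using this
        have := norm_PK_le hy0 hX h1
        simp only [add_re, ofReal_re, mul_re, I_re, mul_zero, ofReal_im, I_im, mul_one, sub_zero, add_zero] at this
        rw [div_eq_inv_mul] at this; exact this)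
      ((continuous_const.mul (Real.continuous_const_rpow hy0.ne')).intervalIntegrable _ _)
    refine this.trans ?_
    rw [intervalIntegral.integral_const_mul]
    refine (mul_le_mul_of_nonneg_left (integral_rpow_exponent hy _ _) (by positivity)).trans (le_of_eq ?_)
    rw [hE]; field_simp
  have hleft : ∀ R : ℝ, 0 < R → ‖∫ t in (-X)..X, PK y (((-R : ℝ) : ℂ) + t * I)‖ ≤ 2 * X / R := by
    intro R hR
    have := intervalIntegral.norm_integral_le_of_norm_le_const (f := fun t : ℝ => PK y (((-R : ℝ) : ℂ) + t * I))
      (a := -X) (b := X) (C := 1 / R) (fun t _ => by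
        have h1 : R ≤ ‖((-R : ℝ) : ℂ) + t * I‖ := by
          have := Complex.abs_re_le_norm (((-R : ℝ) : ℂ) + t * I)
          simp only [add_re, ofReal_re, mul_re, I_re, mul_zero, ofReal_im, I_im, mul_one, sub_zero, add_zero, abs_neg, abs_of_pos hR] at this
          exact this
        refine (norm_PK_le hy0 hR h1).trans ?_
        gcongr
        apply Real.rpow_le_one_of_one_le_of_nonpos hy.le
        simp; linarith)
    refine this.trans (le_of_eq ?_)
    rw [abs_of_nonneg (by linarith)]; ring
  have hb : ∀ R : ℝ, 0 < R → ‖(∫ t in (-X)..X, PK y (a + t * I)) - 2 * Real.pi‖ ≤ 2 * E + 2 * X / R := by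
    intro R hR
    have h1 := hRI R hR
    rw [RI] at h1
    have h2 := hor R (-X) hR (by rw [abs_neg, abs_of_pos hX])
    have h3 := hor R X hR (abs_of_pos hX)
    have h4 := hleft R hR
    set b1 := ∫ x in (-R)..a, PK y (x + ((-X : ℝ) : ℂ) * I)
    set b2 := ∫ x in (-R)..a, PK y (x + (X : ℂ) * I)
    set b3 := ∫ t in (-X)..X, PK y (((-R : ℝ) : ℂ) + t * I)
    set b4 := ∫ t in (-X)..X, PK y (a + t * I)
    have e : I * (b4 - 2 * Real.pi) = b2 - b1 + I * b3 := by linear_combination h1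
    calc _ = ‖I * (b4 - 2 * Real.pi)‖ := by simp
      _ ≤ ‖b2 - b1‖ + ‖I * b3‖ := by rw [e]; exact norm_add_le _ _
      _ ≤ _ := by
        have := norm_sub_le b2 b1
        simp only [norm_mul, Complex.norm_I, one_mul]; linarith
  have hlim : Tendsto (fun R : ℝ => 2 * E + 2 * X / R) atTop (nhds (2 * E + 0)) :=
    tendsto_const_nhds.add (tendsto_const_nhds.div_atTop tendsto_id)
  rw [add_zero] at hlim
  refine ge_of_tendsto hlim ?_
  filter_upwards [eventually_gt_atTop 0] with R hR using hb R hR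

lemma PK_lt {y a X : ℝ} (hy0 : 0 < y) (hy : y < 1) (ha : 0 < a) (hX : 0 < X) :
    ‖∫ t in (-X)..X, PK y (a + t * I)‖ ≤ 2 * (y ^ a / (X * (-Real.log y))) := by
  have hlog : 0 < -Real.log y := by have := Real.log_neg hy0 hy; linarith
  have hRI : ∀ R : ℝ, a ≤ R → RI (PK y) a R (-X) X = 0 := by
    intro R hR
    refine RI_holo hR (by linarith) fun s hs => (PK_diff hy0 fun h => ?_).differentiableWithinAt
    simp only [RC, Set.mem_setOf_eq, Complex.mem_reProdIm, Set.mem_Icc] at hs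
    rw [h] at hs; simp at hs; linarith [hs.1.1]
  set E := y ^ a / (X * (-Real.log y)) with hE
  have hexp : ∀ u : ℝ, y ^ u = Real.exp (-Real.log y * (0 - u)) := by
    intro u; rw [Real.rpow_def_of_pos hy0]; ring_nf
  have hor : ∀ R c : ℝ, a ≤ R → |c| = X → ‖∫ x in a..R, PK y (x + c * I)‖ ≤ E := by
    intro R c hR hc
    have := intervalIntegral.norm_integral_le_of_norm_le (f := fun x : ℝ => PK y (x + c * I))
      (g := fun x : ℝ => X⁻¹ * Real.exp (-Real.log y * (0 - x))) (a := a) (b := R)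
      (μ := MeasureTheory.volume) (by linarith)
      (Eventually.of_forall fun x hx => by
        have h1 : X ≤ ‖(x : ℂ) + c * I‖ := by
          rw [← hc]; have := Complex.abs_im_le_norm ((x : ℂ) + c * I); simpa using this
        have := norm_PK_le hy0 hX h1
        simp only [add_re, ofReal_re, mul_re, I_re, mul_zero, ofReal_im, I_im, mul_one, sub_zero, add_zero] at this
        rw [div_eq_inv_mul, hexp] at this; exact this)
      (Continuous.intervalIntegrable (by fun_prop) _ _)
    refine this.trans ?_
    rw [intervalIntegral.integral_const_mul]
    refine (mul_le_mul_of_nonneg_left (integral_exp_decay hlog _ _ _) (by positivity)).trans (le_of_eq ?_)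
    rw [hE, ← hexp]; field_simp
  have hright : ∀ R : ℝ, a ≤ R → ‖∫ t in (-X)..X, PK y ((R : ℂ) + t * I)‖ ≤ 2 * X / R := by
    intro R hR
    have hR0 : 0 < R := by linarith
    have := intervalIntegral.norm_integral_le_of_norm_le_const (f := fun t : ℝ => PK y ((R : ℂ) + t * I))
      (a := -X) (b := X) (C := 1 / R) (fun t _ => by
        have h1 : R ≤ ‖(R : ℂ) + t * I‖ := by
          have := Complex.abs_re_le_norm ((R : ℂ) + t * I)
          simp only [add_re, ofReal_re, mul_re, I_re, mul_zero, ofReal_im, I_im, mul_one, sub_zero, add_zero, abs_of_pos hR0] at this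
          exact this
        refine (norm_PK_le hy0 hR0 h1).trans ?_
        gcongr
        apply Real.rpow_le_one hy0.le hy.le
        simp; linarith)
    refine this.trans (le_of_eq ?_)
    rw [abs_of_nonneg (by linarith)]; ring
  have hb : ∀ R : ℝ, a ≤ R → ‖∫ t in (-X)..X, PK y (a + t * I)‖ ≤ 2 * E + 2 * X / R := by
    intro R hR
    have h1 := hRI R hR
    rw [RI] at h1
    have h2 := hor R (-X) hR (by rw [abs_neg, abs_of_pos hX])
    have h3 := hor R X hR (abs_of_pos hX)
    have h4 := hright R hR
    set b1 := ∫ x in a..R, PK y (x + ((-X : ℝ) : ℂ) * I)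
    set b2 := ∫ x in a..R, PK y (x + (X : ℂ) * I)
    set b3 := ∫ t in (-X)..X, PK y ((R : ℂ) + t * I)
    set b4 := ∫ t in (-X)..X, PK y (a + t * I)
    have e : I * b4 = b1 - b2 + I * b3 := by linear_combination -h1
    calc _ = ‖I * b4‖ := by simp
      _ ≤ ‖b1 - b2‖ + ‖I * b3‖ := by rw [e]; exact norm_add_le _ _
      _ ≤ _ := by
        have := norm_sub_le b1 b2
        simp only [norm_mul, Complex.norm_I, one_mul]; linarith
  have hlim : Tendsto (fun R : ℝ => 2 * E + 2 * X / R) atTop (nhds (2 * E + 0)) :=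
    tendsto_const_nhds.add (tendsto_const_nhds.div_atTop tendsto_id)
  rw [add_zero] at hlim
  refine ge_of_tendsto hlim ?_
  filter_upwards [eventually_ge_atTop a] with R hR using hb R hR

lemma PK_cont {y a : ℝ} (hy : 0 < y) (ha : 0 < a) : Continuous (fun t : ℝ => PK y (a + t * I)) := by
  rw [continuous_iff_continuousAt]
  intro t
  refine ContinuousAt.comp (f := fun t : ℝ => (a : ℂ) + t * I) (PK_diff hy fun h => ?_).continuousAt (by fun_prop)
  have := congrArg Complex.re h
  simp at this; linarith

lemma PK_triv {y a X : ℝ} (hy : 0 < y) (ha : 1 ≤ a) (hX : 1 ≤ X) :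
    ‖∫ t in (-X)..X, PK y (a + t * I)‖ ≤ y ^ a * (2 + 2 * Real.log X) := by
  have hc := PK_cont hy (by linarith : 0 < a)
  have h1 : ∀ c d : ℝ, c ≤ d → 1 ≤ c → (∀ s : ℝ, |s| = 1 →
      ‖∫ t in c..d, PK y (a + (s * t : ℝ) * I)‖ ≤ y ^ a * (Real.log (d / c))) := by
    intro c d hcd hc1 s hs
    have := intervalIntegral.norm_integral_le_of_norm_le (f := fun t : ℝ => PK y (a + (s * t : ℝ) * I))
      (g := fun t : ℝ => y ^ a * t⁻¹) (a := c) (b := d)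
      (μ := MeasureTheory.volume) hcd
      (Eventually.of_forall fun t ht => by
        have ht0 : 0 < t := by linarith [ht.1]
        have h1 : t ≤ ‖(a : ℂ) + (s * t : ℝ) * I‖ := by
          have := Complex.abs_im_le_norm ((a : ℂ) + (s * t : ℝ) * I)
          simp only [add_im, ofReal_im, mul_im, ofReal_re, I_im, mul_one, I_re, mul_zero, add_zero, zero_add, abs_mul, hs, one_mul, abs_of_pos ht0] at this
          exact this
        have := norm_PK_le hy ht0 h1
        simp only [add_re, ofReal_re, mul_re, I_re, mul_zero, ofReal_im, I_im, mul_one, sub_zero, add_zero] at this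
        rw [div_eq_mul_inv] at this; exact this)
      (ContinuousOn.intervalIntegrable (by
        rw [Set.uIcc_of_le hcd]
        exact continuousOn_const.mul (continuousOn_id.inv₀ fun t ht => by have := ht.1; simp; linarith)))
    refine this.trans ?_
    rw [intervalIntegral.integral_const_mul, integral_inv_of_pos (by linarith) (by linarith)]
  have h2 := h1 1 X hX le_rfl 1 (by simp)
  have h3 := h1 1 X hX le_rfl (-1) (by simp)
  simp only [one_mul, div_one] at h2 h3
  have h4 : ‖∫ t in (-1 : ℝ)..1, PK y (a + t * I)‖ ≤ y ^ a * 2 := by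
    have := intervalIntegral.norm_integral_le_of_norm_le_const (f := fun t : ℝ => PK y (a + t * I))
      (a := -1) (b := 1) (C := y ^ a) (fun t _ => by
        have h1 : 1 ≤ ‖(a : ℂ) + t * I‖ := by
          refine ha.trans ((le_abs_self a).trans ?_)
          have := Complex.abs_re_le_norm ((a : ℂ) + t * I)
          simpa using this
        have := norm_PK_le hy one_pos h1
        simpa using this)
    refine this.trans (le_of_eq ?_)
    norm_num
  have h5 : ∫ t in (1 : ℝ)..X, PK y (a + (-1 * t : ℝ) * I) = ∫ t in (-X)..(-1), PK y (a + t * I) := by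
    have := intervalIntegral.integral_comp_neg (a := 1) (b := X) (fun t : ℝ => PK y (a + t * I))
    rw [← this]; simp
  rw [h5] at h3
  rw [← intervalIntegral.integral_add_adjacent_intervals (hc.intervalIntegrable (-X) (-1)) (hc.intervalIntegrable (-1) X),
    ← intervalIntegral.integral_add_adjacent_intervals (hc.intervalIntegrable (-1) 1) (hc.intervalIntegrable 1 X)]
  refine (norm_add_le _ _).trans ((add_le_add h3 ((norm_add_le _ _).trans (add_le_add h4 h2))).trans (le_of_eq ?_))
  ring

lemma PK_div {x : ℝ} (hx : 0 < x) {n : ℕ} (hn : 1 ≤ n) (s : ℂ) : PK (x / n) s = (n : ℂ) ^ (-s) * PK x s := by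
  have hn0 : (0 : ℝ) < n := by exact_mod_cast hn
  have hnc : (n : ℂ) ≠ 0 := by exact_mod_cast hn0.ne'
  have h : (x : ℂ) ^ s = ((x / n : ℝ) : ℂ) ^ s * ((n : ℝ) : ℂ) ^ s := by
    rw [← Complex.mul_cpow_ofReal_nonneg (by positivity) hn0.le, ← Complex.ofReal_mul, div_mul_cancel₀ _ hn0.ne']
  rw [PK, PK, h, Complex.cpow_neg]
  have : (n : ℂ) ^ s ≠ 0 := by simp [Complex.cpow_eq_zero_iff, hnc]
  simp only [Complex.ofReal_natCast]
  field_simp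

lemma perron_hasSum {x : ℝ} (hx : 3 ≤ x) :
    HasSum (fun n : ℕ => (bZ n : ℂ) * ∫ t in (-x)..x, PK (x / n) (aX x + t * I))
      (∫ t in (-x)..x, fZ (aX x + t * I) * PK x (aX x + t * I)) := by
  have ha1 := aX_gt hx
  have hx0 : 0 < x := by linarith
  have hcont : Continuous (fun t : ℝ => PK x (aX x + t * I)) := PK_cont hx0 (by linarith)
  obtain ⟨M, hM⟩ := (isCompact_uIcc (a := -x) (b := x)).exists_bound_of_continuousOn hcont.continuousOn
  have hterm : ∀ n : ℕ, Continuous (fun t : ℝ => (bZ n : ℂ) * PK (x / n) (aX x + t * I)) := by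
    intro n
    rcases Nat.eq_zero_or_pos n with rfl | hn
    · simp only [bZ_zero, Complex.ofReal_zero, zero_mul]; exact continuous_const
    · have hn0 : (0 : ℝ) < n := by exact_mod_cast hn
      exact continuous_const.mul (PK_cont (by positivity) (by linarith))
  have key := intervalIntegral.hasSum_integral_of_dominated_convergence (μ := MeasureTheory.volume) (a := -x) (b := x)
    (F := fun (n : ℕ) (t : ℝ) => (bZ n : ℂ) * PK (x / n) (aX x + t * I))
    (f := fun t : ℝ => fZ (aX x + t * I) * PK x (aX x + t * I))
    (fun (n : ℕ) (_ : ℝ) => M * (bZ n * (n : ℝ) ^ (-aX x)))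
    (fun n => (hterm n).aestronglyMeasurable)
    (fun n => Eventually.of_forall fun t ht => by
      rcases Nat.eq_zero_or_pos n with rfl | hn
      · simp [bZ_zero]
      · rw [PK_div hx0 hn, norm_mul, norm_mul, norm_nat_cpow_neg hn, Complex.norm_real, Real.norm_of_nonneg (bZ_nonneg n)]
        have := hM t (Set.uIoc_subset_uIcc ht)
        have hb := bZ_nonneg n
        simp only [add_re, ofReal_re, mul_re, I_re, mul_zero, ofReal_im, I_im, mul_one, sub_zero, add_zero]
        calc _ ≤ bZ n * ((n : ℝ) ^ (-aX x) * M) := by gcongr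
          _ = _ := by ring)
    (Eventually.of_forall fun t _ => (bZ_summable ha1).mul_left M)
    (by simp)
    (Eventually.of_forall fun t _ => by
      have := (bZ_hasSum (s := (aX x : ℂ) + t * I) (by simpa using ha1)).mul_right (PK x (aX x + t * I))
      refine this.congr_fun fun n => ?_
      rcases Nat.eq_zero_or_pos n with rfl | hn
      · simp [bZ_zero]
      · rw [PK_div hx0 hn]; ring)
  have e : (fun n : ℕ => (bZ n : ℂ) * ∫ t in (-x)..x, PK (x / n) (aX x + t * I)) = fun n : ℕ =>
    ∫ t in (-x)..x, (bZ n : ℂ) * PK (x / n) (aX x + t * I) := by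
    funext n; rw [intervalIntegral.integral_const_mul]
  rw [e]; exact key

lemma perron_term {x : ℝ} (hx : 3 ≤ x) {n : ℕ} (hn : 1 ≤ n) :
    ‖(∫ t in (-x)..x, PK (x / n) (aX x + t * I)) - (if (n : ℝ) ≤ x then 2 * Real.pi else 0 : ℂ)‖ ≤
      2 / x * ((x / n) ^ aX x * wX x n) + 20 * Real.log x * (if |(n : ℝ) - x| < 1 then 1 else 0) := by
  have hn0 : (0 : ℝ) < n := by exact_mod_cast hn
  have hx0 : 0 < x := by linarith
  have ha1 := aX_gt hx
  have ha2 := aX_le hx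
  have hlog := log_ge_one hx
  have hy : 0 < x / n := by positivity
  have e2 : ‖(2 * Real.pi : ℂ)‖ = 2 * Real.pi := by
    rw [norm_mul, Complex.norm_real]; simp [abs_of_pos Real.pi_pos]
  by_cases h : |(n : ℝ) - x| < 1
  · rw [if_pos h]
    have hw : wX x n = 0 := by rw [wX, if_neg (by linarith)]
    rw [hw, mul_zero, mul_zero, zero_add, mul_one]
    have h1 := PK_triv hy ha1.le (by linarith : 1 ≤ x)
    rw [abs_lt] at h
    have h2 : x / n ≤ 3/2 := by rw [div_le_iff₀ hn0]; linarith
    have h3 : (x / n) ^ aX x ≤ 9/4 := by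
      calc _ ≤ (3/2 : ℝ) ^ aX x := by gcongr
        _ ≤ (3/2 : ℝ) ^ (2 : ℝ) := Real.rpow_le_rpow_of_exponent_le (by norm_num) ha2
        _ = 9/4 := by norm_num
    have e3 : ‖((if (n : ℝ) ≤ x then 2 * Real.pi else 0 : ℂ))‖ ≤ 2 * Real.pi := by
      split_ifs
      · exact e2.le
      · simp; positivity
    have := Real.pi_lt_four
    refine ((norm_sub_le _ _).trans (add_le_add h1 e3)).trans ?_
    have : (x / n) ^ aX x * (2 + 2 * Real.log x) ≤ 9/4 * (2 + 2 * Real.log x) := by gcongr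
    linarith
  · rw [if_neg h, mul_zero, add_zero]
    push Not at h
    have hw1 : wX x n = max x n / |(n : ℝ) - x| := by rw [wX, if_pos (by linarith)]
    by_cases hnx : (n : ℝ) ≤ x
    · rw [if_pos hnx]
      rw [abs_of_nonpos (by linarith)] at h hw1
      have hy1 : 1 < x / n := by rw [one_lt_div hn0]; linarith
      refine (PK_gt hy1 (by linarith) hx0).trans ?_
      have hl := Real.one_sub_inv_le_log_of_pos hy
      rw [inv_div] at hl
      have hl2 : (x - n) / x ≤ Real.log (x / n) := by
        have : (x - n) / x = 1 - n / x := by field_simp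
        rw [this]; exact hl
      have hxn : 0 < x - n := by linarith
      rw [hw1, max_eq_left hnx, neg_sub]
      calc 2 * ((x / n) ^ aX x / (x * Real.log (x / n))) ≤ 2 * ((x / n) ^ aX x / (x * ((x - n) / x))) := by gcongr
        _ = _ := by field_simp
    · rw [if_neg hnx, sub_zero]
      push Not at hnx
      rw [abs_of_nonneg (by linarith)] at h hw1
      have hy1 : x / n < 1 := by rw [div_lt_one hn0]; linarith
      refine (PK_lt hy hy1 (by linarith) hx0).trans ?_
      have hl := Real.log_le_sub_one_of_pos hy
      have hl2 : (n - x) / n ≤ -Real.log (x / n) := by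
        have : (n - x) / n = 1 - x / n := by field_simp
        rw [this]; linarith
      have hxn : 0 < n - x := by linarith
      rw [hw1, max_eq_right hnx.le]
      calc 2 * ((x / n) ^ aX x / (x * -Real.log (x / n))) ≤ 2 * ((x / n) ^ aX x / (x * ((n - x) / n))) := by gcongr
        _ = _ := by field_simp

lemma perron : ∃ C : ℝ, 0 < C ∧ ∀ x : ℝ, 3 ≤ x →
    ‖(∫ t in (-x)..x, fZ (aX x + t * I) * PK x (aX x + t * I)) - 2 * Real.pi * DX x‖ ≤
      C * Real.log x ^ 3 := by
  obtain ⟨C1, hC1, H1⟩ := bZ_weighted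
  refine ⟨2 * C1 + 240, by positivity, fun x hx3 => ?_⟩
  have hx0 : 0 < x := by linarith
  obtain ⟨hs1, hb1⟩ := H1 x hx3
  obtain ⟨hs3, hb3⟩ := bZ_near hx3 le_rfl (by linarith)
  have hlog := log_ge_one hx3
  have hbig := (hs1.mul_left (2 / x)).add (hs3.mul_left (20 * Real.log x))
  have hD := (Complex.hasSum_ofReal.mpr (DX_hasSum hx0.le)).mul_left (2 * Real.pi : ℂ)
  have hsub := (perron_hasSum hx3).sub hD
  have hle : ∀ n : ℕ, ‖(bZ n : ℂ) * (∫ t in (-x)..x, PK (x / n) (aX x + t * I)) - 2 * Real.pi * ((if (n : ℝ) ≤ x then bZ n else 0 : ℝ) : ℂ)‖ ≤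
      2 / x * (bZ n * (x / n) ^ aX x * wX x n) + 20 * Real.log x * (bZ n * (if |(n : ℝ) - x| < 1 then 1 else 0)) := by
    intro n
    rcases Nat.eq_zero_or_pos n with rfl | hn
    · simp [bZ_zero]
    · have h := perron_term hx3 hn
      have e : (bZ n : ℂ) * (∫ t in (-x)..x, PK (x / n) (aX x + t * I)) - 2 * Real.pi * ((if (n : ℝ) ≤ x then bZ n else 0 : ℝ) : ℂ) =
        (bZ n : ℂ) * ((∫ t in (-x)..x, PK (x / n) (aX x + t * I)) - (if (n : ℝ) ≤ x then 2 * Real.pi else 0 : ℂ)) := by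
        split_ifs
        · ring
        · simp
      rw [e, norm_mul, Complex.norm_real, Real.norm_of_nonneg (bZ_nonneg n)]
      refine (mul_le_mul_of_nonneg_left h (bZ_nonneg n)).trans (le_of_eq ?_)
      ring
  have hfin := tsum_of_norm_bounded hbig.hasSum hle
  rw [hsub.tsum_eq] at hfin
  refine hfin.trans ?_
  rw [(hs1.mul_left (2 / x)).tsum_add (hs3.mul_left (20 * Real.log x)), tsum_mul_left, tsum_mul_left]
  calc _ ≤ 2 / x * (C1 * x * Real.log x ^ 3) + 20 * Real.log x * (12 * 1 * Real.log x ^ 2) := by gcongr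
    _ = _ := by field_simp; ring

/-! ### The triple pole -/

lemma RI_of_primitive {f F : ℂ → ℂ} {a b c d : ℝ} (hab : a ≤ b) (hcd : c ≤ d)
    (hF : ∀ s ∈ RB a b c d, HasDerivAt F (f s) s) (hc : ContinuousOn f (RB a b c d)) : RI f a b c d = 0 := by
  have hx : ∀ e : ℝ, e = c ∨ e = d → ∫ x in a..b, f (x + e * I) = F (b + e * I) - F (a + e * I) := by
    intro e he
    have hm : ∀ x ∈ Set.uIcc a b, ((x : ℂ) + e * I) ∈ RB a b c d := by
      intro x hx; rw [Set.uIcc_of_le hab] at hx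
      refine ⟨by simpa using hx, ?_, ?_⟩
      · rcases he with rfl | rfl <;> simp [hcd]
      · rcases he with rfl | rfl <;> simp
    refine intervalIntegral.integral_eq_sub_of_hasDerivAt (f := fun x : ℝ => F (x + e * I)) (fun x hx => ?_) ?_
    · have h1 : HasDerivAt (fun x : ℝ => (x : ℂ) + e * I) 1 x := by
        simpa using (Complex.ofRealCLM.hasDerivAt (x := x)).add_const ((e : ℂ) * I)
      have := (hF _ (hm x hx)).scomp x h1
      rw [one_smul] at this
      exact this
    · refine (hc.comp (f := fun x : ℝ => (x : ℂ) + e * I) (by fun_prop) hm).intervalIntegrable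
  have hy : ∀ e : ℝ, e = a ∨ e = b → I * ∫ y in c..d, f (e + y * I) = F (e + d * I) - F (e + c * I) := by
    intro e he
    have hm : ∀ y ∈ Set.uIcc c d, ((e : ℂ) + (y : ℝ) * I) ∈ RB a b c d := by
      intro x hx; rw [Set.uIcc_of_le hcd] at hx
      refine ⟨?_, by simpa using hx, ?_⟩
      · rcases he with rfl | rfl <;> simp [hab]
      · rcases he with rfl | rfl <;> simp
    rw [← intervalIntegral.integral_const_mul]
    refine intervalIntegral.integral_eq_sub_of_hasDerivAt (f := fun y : ℝ => F (e + y * I)) (fun y hy => ?_) ?_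
    · have h1 : HasDerivAt (fun y : ℝ => (e : ℂ) + y * I) I y := by
        simpa using ((Complex.ofRealCLM.hasDerivAt (x := y)).mul_const I).const_add (e : ℂ)
      have := (hF _ (hm y hy)).scomp y h1
      rw [smul_eq_mul] at this
      exact this
    · exact (continuousOn_const.mul (hc.comp (f := fun y : ℝ => (e : ℂ) + y * I) (by fun_prop) hm)).intervalIntegrable
  rw [RI, hx c (Or.inl rfl), hx d (Or.inr rfl), hy a (Or.inl rfl), hy b (Or.inr rfl)]
  ring

lemma RI_triple {a b c d : ℝ} {p : ℂ} (ha : a < p.re) (hb : p.re < b) (hc : c < p.im) (hd : p.im < d)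
    {V : Set ℂ} (hV : IsOpen V) (hRV : RC a b c d ⊆ V) {U : ℂ → ℂ} (hU : DifferentiableOn ℂ U V) :
    RI (fun s => U s / (s - p) ^ 3) a b c d = Real.pi * I * deriv (deriv U) p := by
  have hab : a ≤ b := by linarith
  have hcd : c ≤ d := by linarith
  have hpV : p ∈ V := hRV ⟨⟨ha.le, hb.le⟩, ⟨hc.le, hd.le⟩⟩
  have hVn : V ∈ nhds p := hV.mem_nhds hpV
  set U1 := dslope U p with hU1
  have d1 : DifferentiableOn ℂ U1 V := (Complex.differentiableOn_dslope hVn).mpr hU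
  set U2 := dslope U1 p with hU2
  have d2 : DifferentiableOn ℂ U2 V := (Complex.differentiableOn_dslope hVn).mpr d1
  set U3 := dslope U2 p with hU3
  have d3 : DifferentiableOn ℂ U3 V := (Complex.differentiableOn_dslope hVn).mpr d2
  have ex : ∀ (f : ℂ → ℂ) (s : ℂ), f s = f p + (s - p) * dslope f p s := by
    intro f s
    have := sub_smul_dslope f p s
    rw [smul_eq_mul] at this; rw [this]; ring
  have hne : ∀ s ∈ RB a b c d, s - p ≠ 0 := by
    intro s hs h
    have : s = p := by linear_combination h
    rw [this] at hs
    rcases hs.2.2 with h | h | h | h <;> linarith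
  -- second derivative
  have hsecond : deriv (deriv U) p = 2 * U2 p := by
    have hev : deriv U =ᶠ[nhds p] fun s => U1 s + (s - p) * deriv U1 s := by
      filter_upwards [hVn] with s hs
      have h1 : DifferentiableAt ℂ U1 s := d1.differentiableAt (hV.mem_nhds hs)
      have h2 : U = fun s => U p + (s - p) * U1 s := funext (ex U)
      have h3 : HasDerivAt (fun s => U p + (s - p) * U1 s) (1 * U1 s + (s - p) * deriv U1 s) s :=
        (((hasDerivAt_id s).sub_const p).mul h1.hasDerivAt).const_add (U p)
      rw [h2]; rw [h3.deriv, one_mul]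
    rw [hev.deriv_eq]
    have h1 : DifferentiableAt ℂ U1 p := d1.differentiableAt hVn
    have h2 : DifferentiableAt ℂ (deriv U1) p := (d1.deriv hV).differentiableAt hVn
    have h3 : HasDerivAt (fun s => U1 s + (s - p) * deriv U1 s)
        (deriv U1 p + (1 * deriv U1 p + (p - p) * deriv (deriv U1) p)) p :=
      h1.hasDerivAt.add (((hasDerivAt_id p).sub_const p).mul h2.hasDerivAt)
    rw [h3.deriv, hU2, dslope_same]; ring
  have hsplit : RI (fun s => U s / (s - p) ^ 3) a b c d =
      RI (fun s => (U p / (s - p) ^ 3 + U1 p / (s - p) ^ 2) + (U2 p * (s - p)⁻¹ + U3 s)) a b c d := by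
    refine RI_congr hab hcd fun s hs => ?_
    have h0 := hne s hs
    have e1 := ex U s
    have e2 := ex U1 s
    have e3 := ex U2 s
    rw [e1, ← hU1, e2, ← hU2, e3, ← hU3]
    field_simp
    ring
  have c1 : ContinuousOn (fun s : ℂ => U p / (s - p) ^ 3 + U1 p / (s - p) ^ 2) (RB a b c d) :=
    (continuousOn_const.div (by fun_prop) fun s hs => pow_ne_zero _ (hne s hs)).add
      (continuousOn_const.div (by fun_prop) fun s hs => pow_ne_zero _ (hne s hs))
  have c2 : ContinuousOn (fun s : ℂ => U2 p * (s - p)⁻¹) (RB a b c d) :=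
    continuousOn_const.mul (ContinuousOn.inv₀ (by fun_prop) hne)
  have c3 : ContinuousOn U3 (RB a b c d) := d3.continuousOn.mono (RB_sub_RC.trans hRV)
  have z1 : RI (fun s : ℂ => U p / (s - p) ^ 3 + U1 p / (s - p) ^ 2) a b c d = 0 := by
    refine RI_of_primitive (F := fun s => -(U p / 2) * ((s - p) ^ 2)⁻¹ - U1 p * (s - p)⁻¹) hab hcd (fun s hs => ?_) c1
    have h0 := hne s hs
    have h1 : HasDerivAt (fun s : ℂ => s - p) 1 s := (hasDerivAt_id s).sub_const p
    have h2 : HasDerivAt (fun s : ℂ => (s - p) ^ 2) (2 * (s - p)) s :=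
      (h1.pow 2).congr_deriv (by simp)
    have h3 := ((h2.inv (pow_ne_zero 2 h0)).const_mul (-(U p / 2))).sub ((h1.inv h0).const_mul (U1 p))
    refine h3.congr_deriv ?_
    field_simp
    ring
  have c23 : ContinuousOn (fun s => U2 p * (s - p)⁻¹ + U3 s) (RB a b c d) := c2.add c3
  rw [hsplit, RI_add hab hcd c1 c23, z1, RI_add hab hcd c2 c3, RI_const_mul, RI_inv ha hb hc hd,
    RI_holo hab hcd (d3.mono hRV), hsecond]
  ring

/-! ### Jets of the zeta function at one -/

lemma zeta1_jet (C : ℕ → ℂ) (hC : ∀ᶠ s in nhdsWithin (1 : ℂ) {1}ᶜ,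
      HasSum (fun j : ℕ => C j * (s - 1) ^ j) (riemannZeta s - 1 / (s - 1))) :
    deriv riemannZeta₁ 1 = C 0 ∧ deriv (deriv riemannZeta₁) 1 = 2 * C 1 := by
  have hd := differentiable_riemannZeta₁
  set H := dslope riemannZeta₁ 1 with hH
  have hHd : Differentiable ℂ H := by
    rw [← differentiableOn_univ]
    exact (Complex.differentiableOn_dslope univ_mem).mpr hd.differentiableOn
  set f : ℂ → ℂ := fun s => if s = 1 then C 0 else riemannZeta s - 1 / (s - 1) with hf
  set P := FormalMultilinearSeries.ofScalars ℂ C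
  have hP : HasFPowerSeriesAt f P 1 := by
    rw [hasFPowerSeriesAt_iff]
    rw [eventually_nhdsWithin_iff] at hC
    have h1 : Tendsto (fun z : ℂ => 1 + z) (nhds 0) (nhds 1) := by
      have : Continuous (fun z : ℂ => 1 + z) := by fun_prop
      simpa using this.tendsto 0
    filter_upwards [h1.eventually hC] with z hz
    by_cases h0 : z = 0
    · subst h0
      have : HasSum (fun n : ℕ => (0 : ℂ) ^ n • P.coeff n) ((0 : ℂ) ^ 0 • P.coeff 0) :=
        hasSum_single 0 fun n hn => by simp [hn]
      simpa [hf, P] using this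
    · have := hz (by simpa using h0)
      simp only [hf, add_eq_left, h0, if_false]
      refine this.congr_fun fun n => ?_
      simp [P, mul_comm]
  have hfH : f =ᶠ[nhds 1] H := by
    have hpun : ∀ᶠ s in nhdsWithin (1 : ℂ) {1}ᶜ, f s = H s := by
      filter_upwards [self_mem_nhdsWithin] with s hs
      have hs' : s ≠ 1 := hs
      have h1 : s - 1 ≠ 0 := sub_ne_zero.mpr hs'
      simp only [hf, if_neg hs', hH, dslope_of_ne _ hs', slope_def_field, riemannZeta₁_one]
      rw [riemannZeta_eq_inv_sub_mul hs']
      field_simp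
    have h1 : f 1 = H 1 := by
      have t1 : Tendsto f (nhdsWithin 1 {1}ᶜ) (nhds (f 1)) := hP.continuousAt.tendsto.mono_left nhdsWithin_le_nhds
      have t2 : Tendsto H (nhdsWithin 1 {1}ᶜ) (nhds (H 1)) := hHd.continuous.continuousAt.tendsto.mono_left nhdsWithin_le_nhds
      exact tendsto_nhds_unique (t1.congr' hpun) t2
    rw [eventually_nhdsWithin_iff] at hpun
    filter_upwards [hpun] with s hs
    by_cases h : s = 1
    · rw [h, h1]
    · exact hs h
  have h0 : H 1 = C 0 := by rw [← hfH.eq_of_nhds]; simp [hf]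
  have h1 : deriv H 1 = C 1 := by
    rw [← hfH.deriv_eq, hP.deriv]
    simp [P, FormalMultilinearSeries.ofScalars]
  constructor
  · rw [← h0, hH, dslope_same]
  · have ex : riemannZeta₁ = fun s => riemannZeta₁ 1 + (s - 1) * H s := by
      funext s
      have := sub_smul_dslope riemannZeta₁ 1 s
      rw [smul_eq_mul] at this; rw [hH, this]; ring
    have e1 : deriv riemannZeta₁ = fun s => H s + (s - 1) * deriv H s := by
      funext s
      have h3 : HasDerivAt (fun s => riemannZeta₁ 1 + (s - 1) * H s) (1 * H s + (s - 1) * deriv H s) s :=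
        (((hasDerivAt_id s).sub_const 1).mul hHd.differentiableAt.hasDerivAt).const_add _
      rw [ex, h3.deriv, one_mul]
    rw [e1]
    have h2 : DifferentiableAt ℂ (deriv H) 1 := hHd.deriv.differentiableAt
    have h3 : HasDerivAt (fun s => H s + (s - 1) * deriv H s)
        (deriv H 1 + (1 * deriv H 1 + (1 - 1) * deriv (deriv H) 1)) 1 :=
      hHd.differentiableAt.hasDerivAt.add (((hasDerivAt_id (1 : ℂ)).sub_const 1).mul h2.hasDerivAt)
    rw [h3.deriv, h1]; ring

/-! ### A three lines theorem for the mean of the modulus -/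

/-- mean of the modulus on a vertical line -/
noncomputable def AL (F : ℂ → ℂ) (σ : ℝ) : ℝ := ∫ t : ℝ, ‖F (σ + t * I)‖

lemma AL_nonneg (F : ℂ → ℂ) (σ : ℝ) : 0 ≤ AL F σ := MeasureTheory.integral_nonneg fun _ => norm_nonneg _

lemma line_cont {F : ℂ → ℂ} (hF : DifferentiableOn ℂ F {s | -1 < s.re}) {σ : ℝ} (hσ : 0 ≤ σ) :
    Continuous fun t : ℝ => F (σ + t * I) := by
  refine hF.continuousOn.comp_continuous (by fun_prop) fun t => ?_
  simp only [Set.mem_setOf_eq, add_re, ofReal_re, mul_re, I_re, mul_zero, ofReal_im, I_im, mul_one, sub_zero, add_zero]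
  linarith

lemma AL_integrable {F : ℂ → ℂ} (hF : DifferentiableOn ℂ F {s | -1 < s.re}) {σ : ℝ} (hσ : 0 ≤ σ)
    {B : ℝ} (hB : ∀ t : ℝ, ‖F (σ + t * I)‖ ≤ B * (1 + t ^ 2)⁻¹) :
    MeasureTheory.Integrable fun t : ℝ => ‖F (σ + t * I)‖ := by
  refine (integrable_inv_one_add_sq.const_mul B).mono' (line_cont hF hσ).norm.aestronglyMeasurable ?_
  filter_upwards with t
  simpa using hB t

lemma holo_param {F φ : ℂ → ℂ} (hF : DifferentiableOn ℂ F {s | -1 < s.re}) (hφ : Continuous fun u : ℝ => φ u)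
    (R : ℝ) {s : ℂ} (hs : -1 < s.re) :
    DifferentiableAt ℂ (fun s => ∫ u in (-R)..R, F (s + u * I) * φ u) s := by
  have hopen : IsOpen {s : ℂ | -1 < s.re} := isOpen_lt continuous_const continuous_re
  obtain ⟨r, hr, hrs⟩ : ∃ r > 0, ∀ z ∈ Metric.closedBall s r, -1 < z.re := by
    obtain ⟨r, hr, h⟩ := Metric.nhds_basis_closedBall.mem_iff.mp (hopen.mem_nhds hs)
    exact ⟨r, hr, fun z hz => h hz⟩
  have hre : ∀ (z : ℂ) (u : ℝ), (z + u * I).re = z.re := by intro z u; simp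
  have hdc : ContinuousOn (deriv F) {s | -1 < s.re} := (hF.deriv hopen).continuousOn
  have hcf : ∀ (G : ℂ → ℂ), ContinuousOn G {s | -1 < s.re} → ∀ z : ℂ, -1 < z.re →
      Continuous fun u : ℝ => G (z + u * I) * φ u := by
    intro G hG z hz
    refine (hG.comp_continuous (by fun_prop) fun u => ?_).mul hφ
    rw [Set.mem_setOf_eq, hre]; exact hz
  obtain ⟨M, hM⟩ : ∃ M, ∀ q ∈ Metric.closedBall s r ×ˢ Set.Icc (-|R|) |R|,
      ‖(fun q : ℂ × ℝ => deriv F (q.1 + q.2 * I) * φ q.2) q‖ ≤ M := by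
    refine IsCompact.exists_bound_of_continuousOn ((isCompact_closedBall s r).prod isCompact_Icc) ?_
    refine ContinuousOn.mul (hdc.comp (by fun_prop) fun q hq => ?_) (hφ.comp continuous_snd).continuousOn
    rw [Set.mem_setOf_eq, hre]; exact hrs _ hq.1
  have hI : ∀ u ∈ Set.uIoc (-R) R, u ∈ Set.Icc (-|R|) |R| := by
    intro u hu
    have := Set.uIoc_subset_uIcc hu
    rw [Set.mem_uIcc] at this
    constructor <;> rcases this with h | h <;> linarith [le_abs_self R, neg_abs_le R]
  refine (intervalIntegral.hasDerivAt_integral_of_dominated_loc_of_deriv_le (bound := fun _ => M)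
    (F' := fun z u => deriv F (z + u * I) * φ u)
    (Metric.closedBall_mem_nhds s hr) ?_ ?_ ?_ ?_ ?_ ?_).2.differentiableAt
  · filter_upwards [Metric.closedBall_mem_nhds s hr] with z hz
    exact (hcf F hF.continuousOn z (hrs z hz)).aestronglyMeasurable
  · exact (hcf F hF.continuousOn s hs).intervalIntegrable _ _
  · exact (hcf _ hdc s hs).aestronglyMeasurable
  · filter_upwards with u hu z hz
    exact hM (z, u) ⟨hz, hI u hu⟩
  · exact intervalIntegrable_const
  · filter_upwards with u hu z hz
    have h1 : HasDerivAt F (deriv F (z + u * I)) (z + u * I) :=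
      (hF.differentiableAt (hopen.mem_nhds (by rw [Set.mem_setOf_eq, hre]; exact hrs z hz))).hasDerivAt
    have h2 : HasDerivAt (fun z : ℂ => z + u * I) 1 z := (hasDerivAt_id z).add_const _
    have h3 := h1.comp z h2
    rw [mul_one] at h3
    exact h3.mul_const _

lemma AL_three_lines {F : ℂ → ℂ} (hF : DifferentiableOn ℂ F {s | -1 < s.re}) {l u σ B : ℝ} (hl : 0 ≤ l)
    (hlσ : l ≤ σ) (hσu : σ ≤ u) (hlu : l < u)
    (hB : ∀ s : ℂ, l ≤ s.re → s.re ≤ u → ‖F s‖ ≤ B * (1 + s.im ^ 2)⁻¹) :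
    AL F σ ≤ AL F l ^ (1 - (σ - l) / (u - l)) * AL F u ^ ((σ - l) / (u - l)) := by
  have hBl : ∀ v : ℝ, l ≤ v → v ≤ u → ∀ t : ℝ, ‖F (v + t * I)‖ ≤ B * (1 + t ^ 2)⁻¹ := by
    intro v h1 h2 t
    have := hB (v + t * I) (by simpa using h1) (by simpa using h2)
    simpa using this
  have hint : ∀ v : ℝ, l ≤ v → v ≤ u → MeasureTheory.Integrable fun t : ℝ => ‖F (v + t * I)‖ :=
    fun v h1 h2 => AL_integrable hF (hl.trans h1) (hBl v h1 h2)
  have hB0 : 0 ≤ B := by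
    have := (norm_nonneg _).trans (hBl l le_rfl hlu.le 0)
    simpa using this
  set G := AL F l ^ (1 - (σ - l) / (u - l)) * AL F u ^ ((σ - l) / (u - l)) with hG
  have key : ∀ R : ℝ, 0 ≤ R → ∫ t in (-R)..R, ‖F (σ + t * I)‖ ≤ G := by
    intro R hR
    have hcσ := line_cont hF (hl.trans hlσ)
    refine le_of_forall_pos_le_add fun ε hε => ?_
    set η := ε / (2 * R + 1) with hη
    have hη0 : 0 < η := by positivity
    set φ : ℂ → ℂ := fun v => (starRingEnd ℂ) (F (σ + v * I)) / ((‖F (σ + v * I)‖ + η : ℝ) : ℂ) with hφ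
    have hφc : Continuous fun v : ℝ => φ v := by
      simp only [hφ]
      refine Continuous.div (Complex.continuous_conj.comp hcσ) (Complex.continuous_ofReal.comp (hcσ.norm.add continuous_const)) fun v => ?_
      have := norm_nonneg (F (σ + v * I))
      exact_mod_cast (by positivity : (‖F (σ + v * I)‖ + η) ≠ 0)
    have hφ1 : ∀ v : ℝ, ‖φ v‖ ≤ 1 := by
      intro v
      have := norm_nonneg (F (σ + v * I))
      simp only [hφ, norm_div, RCLike.norm_conj, Complex.norm_real, Real.norm_eq_abs]
      rw [abs_of_pos (by positivity), div_le_one (by positivity)]; linarith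
    set Φ : ℂ → ℂ := fun s => ∫ v in (-R)..R, F (s + v * I) * φ v with hΦ
    have hline : ∀ (s : ℂ) (v : ℝ), s + v * I = ((s.re : ℝ) : ℂ) + ((s.im + v : ℝ) : ℂ) * I := by
      intro s v; apply Complex.ext <;> simp
    have hΦb : ∀ s : ℂ, l ≤ s.re → s.re ≤ u → ‖Φ s‖ ≤ AL F s.re := by
      intro s h1 h2
      have hc := line_cont hF (hl.trans h1)
      calc ‖Φ s‖ ≤ ∫ v in (-R)..R, ‖F (((s.re : ℝ) : ℂ) + ((s.im + v : ℝ) : ℂ) * I)‖ := by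
            refine intervalIntegral.norm_integral_le_of_norm_le (by linarith) ?_ ?_
            · filter_upwards with v hv
              rw [norm_mul, ← hline]
              exact mul_le_of_le_one_right (norm_nonneg _) (hφ1 v)
            · exact ((hc.comp (continuous_const.add continuous_id)).norm).intervalIntegrable _ _
        _ = ∫ t in (s.im + -R)..(s.im + R), ‖F (((s.re : ℝ) : ℂ) + (t : ℂ) * I)‖ :=
            intervalIntegral.integral_comp_add_left (fun t : ℝ => ‖F (((s.re : ℝ) : ℂ) + (t : ℂ) * I)‖) s.im
        _ ≤ AL F s.re := by
            rw [intervalIntegral.integral_of_le (by linarith)]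
            exact MeasureTheory.setIntegral_le_integral (hint _ h1 h2) (Eventually.of_forall fun _ => norm_nonneg _)
    have hunif : ∀ s : ℂ, l ≤ s.re → s.re ≤ u → ‖Φ s‖ ≤ B * |R - -R| := by
      intro s h1 h2
      refine intervalIntegral.norm_integral_le_of_norm_le_const fun v hv => ?_
      rw [norm_mul]
      refine (mul_le_of_le_one_right (norm_nonneg _) (hφ1 v)).trans ?_
      refine (hB _ (by simpa using h1) (by simpa using h2)).trans ?_
      refine mul_le_of_le_one_right hB0 (inv_le_one_of_one_le₀ ?_)
      nlinarith [sq_nonneg (s + v * I).im]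
    have hd : DiffContOnCl ℂ Φ (Complex.HadamardThreeLines.verticalStrip l u) := by
      have hdif : DifferentiableOn ℂ Φ (closure (Complex.HadamardThreeLines.verticalStrip l u)) := by
        intro s hs
        have hcl : closure (Complex.HadamardThreeLines.verticalStrip l u) ⊆ {s : ℂ | l ≤ s.re} := by
          refine closure_minimal (fun z hz => ?_) (isClosed_le continuous_const continuous_re)
          exact (Set.mem_Ioo.mp hz).1.le
        have h1 : l ≤ s.re := hcl hs
        exact (holo_param hF hφc R (by linarith)).differentiableWithinAt
      exact hdif.diffContOnCl
    have had := Complex.HadamardThreeLines.norm_le_interp_of_mem_verticalClosedStrip' (f := Φ) (z := (σ : ℂ))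
      (a := AL F l) (b := AL F u) hlu ⟨by simpa using hlσ, by simpa using hσu⟩ hd ?_ ?_ ?_
    rotate_left
    · refine ⟨B * |R - -R|, ?_⟩
      rintro _ ⟨s, hs, rfl⟩
      exact hunif s hs.1 hs.2
    · intro z hz
      have hz' : z.re = l := hz
      have := hΦb z hz'.ge (by rw [hz']; exact hlu.le)
      rwa [hz'] at this
    · intro z hz
      have hz' : z.re = u := hz
      have := hΦb z (by rw [hz']; exact hlu.le) hz'.le
      rwa [hz'] at this
    rw [ofReal_re] at had
    have hval : Φ σ = ((∫ v in (-R)..R, ‖F (σ + v * I)‖ ^ 2 / (‖F (σ + v * I)‖ + η) : ℝ) : ℂ) := by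
      rw [hΦ, ← intervalIntegral.integral_ofReal]
      refine intervalIntegral.integral_congr fun v _ => ?_
      simp only [hφ]
      rw [← mul_div_assoc, Complex.mul_conj, Complex.normSq_eq_norm_sq]
      push_cast; rfl
    have hlow : (∫ v in (-R)..R, ‖F (σ + v * I)‖) - 2 * R * η ≤
        ∫ v in (-R)..R, ‖F (σ + v * I)‖ ^ 2 / (‖F (σ + v * I)‖ + η) := by
      have e1 : (∫ v in (-R)..R, ‖F (σ + v * I)‖) - 2 * R * η = ∫ v in (-R)..R, (‖F (σ + v * I)‖ - η) := by
        rw [intervalIntegral.integral_sub (hcσ.norm.intervalIntegrable _ _) intervalIntegrable_const]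
        rw [intervalIntegral.integral_const, smul_eq_mul]; ring
      rw [e1]
      refine intervalIntegral.integral_mono_on (by linarith) ((hcσ.norm.sub continuous_const).intervalIntegrable _ _) ?_ fun v _ => ?_
      · refine Continuous.intervalIntegrable ?_ _ _
        refine (hcσ.norm.pow 2).div (hcσ.norm.add continuous_const) fun v => ?_
        have := norm_nonneg (F (σ + v * I))
        positivity
      · have := norm_nonneg (F (σ + v * I))
        rw [le_div_iff₀ (by positivity)]
        nlinarith [sq_nonneg η]
    have hle : ∫ v in (-R)..R, ‖F (σ + v * I)‖ ^ 2 / (‖F (σ + v * I)‖ + η) ≤ G := by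
      refine le_trans ?_ had
      rw [hval, Complex.norm_real]
      exact Real.le_norm_self _
    have : 2 * R * η ≤ ε := by
      rw [hη, mul_div_assoc', div_le_iff₀ (by positivity)]; nlinarith
    linarith
  have hlim := MeasureTheory.intervalIntegral_tendsto_integral (hint σ hlσ hσu) tendsto_neg_atTop_atBot tendsto_id
  refine le_of_tendsto hlim ?_
  filter_upwards [eventually_ge_atTop 0] with R hR
  exact key R hR

/-! ### Generalised divisor functions -/

/-- the coefficients of `(1 - X)^(-a)` -/
noncomputable def hA (a : ℝ) (k : ℕ) : ℝ := ∏ j ∈ range k, (a + j) / (j + 1)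

lemma hA_zero (a : ℝ) : hA a 0 = 1 := by simp [hA]

lemma hA_succ (a : ℝ) (k : ℕ) : ((k : ℝ) + 1) * hA a (k + 1) = (a + k) * hA a k := by
  rw [hA, prod_range_succ, ← hA]; field_simp

lemma hA_one (k : ℕ) : hA 1 k = 1 := by
  rw [hA]; refine prod_eq_one fun j _ => ?_
  rw [add_comm]; exact div_self (by positivity)

lemma hA_nonneg {a : ℝ} (ha : 0 ≤ a) (k : ℕ) : 0 ≤ hA a k := prod_nonneg fun j _ => by positivity

lemma hA_le_one {a : ℝ} (ha : 0 ≤ a) (h1 : a ≤ 1) (k : ℕ) : hA a k ≤ 1 := by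
  refine prod_le_one (fun j _ => by positivity) fun j _ => ?_
  rw [div_le_one (by positivity)]; linarith

lemma hA_sq (k : ℕ) : hA (1 / 2) k ^ 2 ≤ hA (1 / 4) k := by
  rw [hA, hA, ← prod_pow]
  refine prod_le_prod (fun j _ => by positivity) fun j _ => ?_
  rw [div_pow, div_le_div_iff₀ (by positivity) (by positivity)]
  have hj : (0 : ℝ) ≤ j := by positivity
  nlinarith [mul_nonneg hj hj]

lemma hA_conv (a b : ℝ) (k : ℕ) : ∑ q ∈ antidiagonal k, hA a q.1 * hA b q.2 = hA (a + b) k := by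
  induction k with
  | zero => simp [hA_zero]
  | succ k ih =>
    have hk : ((k : ℝ) + 1) ≠ 0 := by positivity
    refine mul_left_cancel₀ hk ?_
    rw [hA_succ, ← ih, mul_sum, mul_sum]
    have e1 : ∑ q ∈ antidiagonal (k + 1), ((k : ℝ) + 1) * (hA a q.1 * hA b q.2) =
        ∑ q ∈ antidiagonal (k + 1), ((q.1 : ℝ) * hA a q.1 * hA b q.2) +
        ∑ q ∈ antidiagonal (k + 1), (hA a q.1 * ((q.2 : ℝ) * hA b q.2)) := by
      rw [← sum_add_distrib]
      refine sum_congr rfl fun q hq => ?_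
      have : ((q.1 : ℝ) + q.2) = k + 1 := by exact_mod_cast mem_antidiagonal.mp hq
      rw [← this]; ring
    rw [e1, Nat.sum_antidiagonal_succ, Nat.sum_antidiagonal_succ']
    simp only [Nat.cast_zero, zero_mul, zero_add, mul_zero, add_zero, Nat.cast_add, Nat.cast_one]
    rw [← sum_add_distrib]
    refine sum_congr rfl fun q hq => ?_
    have : ((q.1 : ℝ) + q.2) = k := by exact_mod_cast mem_antidiagonal.mp hq
    rw [hA_succ, hA_succ, ← this]; ring

/-- the generalised divisor function, with Dirichlet series `ζ^a` -/
noncomputable def dA (a : ℝ) : ArithmeticFunction ℝ where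
  toFun n := if n = 0 then 0 else n.factorization.prod fun _ k => hA a k
  map_zero' := by simp

lemma dA_apply (a : ℝ) {n : ℕ} (hn : n ≠ 0) : dA a n = n.factorization.prod fun _ k => hA a k := by
  simp [dA, hn]

lemma dA_mult (a : ℝ) : (dA a).IsMultiplicative := by
  rw [ArithmeticFunction.IsMultiplicative.iff_ne_zero]
  refine ⟨by simp [dA_apply], fun {m n} hm hn hmn => ?_⟩
  rw [dA_apply a hm, dA_apply a hn, dA_apply a (mul_ne_zero hm hn), Nat.factorization_mul_of_coprime hmn]
  exact Finsupp.prod_add_index_of_disjoint hmn.disjoint_primeFactors _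

lemma dA_pow (a : ℝ) {p : ℕ} (hp : p.Prime) (k : ℕ) : dA a (p ^ k) = hA a k := by
  rw [dA_apply a (pow_ne_zero k hp.ne_zero), hp.factorization_pow]
  exact Finsupp.prod_single_index (h := fun _ k => hA a k) (hA_zero a)

lemma dA_mul (a b : ℝ) : dA a * dA b = dA (a + b) := by
  rw [ArithmeticFunction.IsMultiplicative.eq_iff_eq_on_prime_powers _ ((dA_mult a).mul (dA_mult b)) _ (dA_mult (a + b))]
  intro p k hp
  rw [dA_pow _ hp, ← hA_conv, ArithmeticFunction.mul_apply, Nat.sum_divisorsAntidiagonal (fun i j => dA a i * dA b j),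
    Nat.sum_divisors_prime_pow hp, Nat.sum_antidiagonal_eq_sum_range_succ (fun i j => hA a i * hA b j)]
  refine sum_congr rfl fun i hi => ?_
  rw [Nat.pow_div (Nat.lt_succ_iff.mp (mem_range.mp hi)) hp.pos, dA_pow _ hp, dA_pow _ hp]

lemma dA_one {n : ℕ} (hn : n ≠ 0) : dA 1 n = 1 := by
  rw [dA_apply 1 hn, Finsupp.prod]; exact prod_eq_one fun p _ => hA_one _

lemma dA_nonneg {a : ℝ} (ha : 0 ≤ a) (n : ℕ) : 0 ≤ dA a n := by
  rcases eq_or_ne n 0 with rfl | hn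
  · simp
  · rw [dA_apply a hn]; exact prod_nonneg fun p _ => hA_nonneg ha _

lemma dA_le_one {a : ℝ} (ha : 0 ≤ a) (h1 : a ≤ 1) (n : ℕ) : dA a n ≤ 1 := by
  rcases eq_or_ne n 0 with rfl | hn
  · simp
  · rw [dA_apply a hn]; exact prod_le_one (fun p _ => hA_nonneg ha _) fun p _ => hA_le_one ha h1 _

lemma dA_sq (n : ℕ) : dA (1 / 2) n ^ 2 ≤ dA (1 / 4) n := by
  rcases eq_or_ne n 0 with rfl | hn
  · simp
  · rw [dA_apply _ hn, dA_apply _ hn, Finsupp.prod, Finsupp.prod, ← prod_pow]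
    exact prod_le_prod (fun p _ => by positivity) fun p _ => hA_sq _

lemma conv_sum_le {f g : ArithmeticFunction ℝ} (hf : ∀ n, 0 ≤ f n) (hg : ∀ n, 0 ≤ g n) (N M : ℕ) :
    (∑ n ∈ Icc 1 N, f n / n) * (∑ m ∈ Icc 1 M, g m / m) ≤ ∑ k ∈ Icc 1 (N * M), (f * g) k / k := by
  rw [sum_mul_sum, ← sum_product']
  have hmap : ∀ q ∈ Icc 1 N ×ˢ Icc 1 M, q.1 * q.2 ∈ Icc 1 (N * M) := by
    intro q hq
    simp only [mem_product, mem_Icc] at hq ⊢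
    exact ⟨Nat.one_le_iff_ne_zero.mpr (mul_ne_zero (by omega) (by omega)), Nat.mul_le_mul hq.1.2 hq.2.2⟩
  rw [← sum_fiberwise_of_maps_to hmap]
  refine sum_le_sum fun k hk => ?_
  rw [ArithmeticFunction.mul_apply, sum_div]
  have hk0 : k ≠ 0 := by have := (mem_Icc.mp hk).1; omega
  calc _ ≤ ∑ q ∈ k.divisorsAntidiagonal, f q.1 / q.1 * (g q.2 / q.2) := by
        refine sum_le_sum_of_subset_of_nonneg (fun q hq => ?_) fun q _ _ => ?_
        · rw [mem_filter] at hq; exact Nat.mem_divisorsAntidiagonal.mpr ⟨hq.2, hk0⟩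
        · have := hf q.1; have := hg q.2; positivity
    _ = _ := by
        refine sum_congr rfl fun q hq => ?_
        rw [← (Nat.mem_divisorsAntidiagonal.mp hq).1, div_mul_div_comm]; push_cast; rfl

lemma dA_sum_sq (N : ℕ) (hN : 1 ≤ N) :
    ∑ n ∈ Icc 1 N, dA (1 / 2) n ^ 2 / n ≤ (1 + 4 * Real.log N) ^ ((1 : ℝ) / 4) := by
  set s := ∑ n ∈ Icc 1 N, dA (1 / 4) n / n with hs
  have hs0 : 0 ≤ s := sum_nonneg fun n _ => div_nonneg (dA_nonneg (by norm_num) n) (by positivity)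
  have h0 : ∑ n ∈ Icc 1 N, dA (1 / 2) n ^ 2 / n ≤ s :=
    sum_le_sum fun n _ => div_le_div_of_nonneg_right (dA_sq n) (by positivity)
  have h1 := conv_sum_le (fun n => dA_nonneg (a := 1 / 4) (by norm_num) n) (fun n => dA_nonneg (a := 1 / 4) (by norm_num) n) N N
  rw [dA_mul, ← hs, show (1 / 4 + 1 / 4 : ℝ) = 1 / 2 by norm_num] at h1
  have h2 := conv_sum_le (fun n => dA_nonneg (a := 1 / 2) (by norm_num) n) (fun n => dA_nonneg (a := 1 / 2) (by norm_num) n) (N * N) (N * N)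
  rw [dA_mul, show (1 / 2 + 1 / 2 : ℝ) = 1 by norm_num] at h2
  have h3 : ∑ k ∈ Icc 1 (N * N * (N * N)), dA 1 k / k ≤ 1 + 4 * Real.log N := by
    have := harmonic_le_one_add_log (N * N * (N * N))
    rw [harmonic_eq_sum_Icc] at this
    push_cast at this
    have e : Real.log ((N : ℝ) * N * (N * N)) = 4 * Real.log N := by
      rw [show (N : ℝ) * N * (N * N) = (N : ℝ) ^ 4 by ring, Real.log_pow]; norm_num
    rw [e] at this
    refine le_trans (le_of_eq (sum_congr rfl fun k hk => ?_)) this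
    rw [dA_one (by have := (mem_Icc.mp hk).1; omega), one_div]
  have h4 : s ^ (4 : ℕ) ≤ 1 + 4 * Real.log N := by
    refine le_trans ?_ (h2.trans h3)
    calc s ^ 4 = (s * s) * (s * s) := by ring
      _ ≤ _ := mul_le_mul h1 h1 (by positivity) ((mul_nonneg hs0 hs0).trans h1)
  refine h0.trans ?_
  calc s = (s ^ (4 : ℕ)) ^ ((1 : ℝ) / 4) := by
        rw [← Real.rpow_natCast, ← Real.rpow_mul hs0]; norm_num
    _ ≤ _ := Real.rpow_le_rpow (by positivity) h4 (by norm_num)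

/-! ### The Dirichlet polynomial -/

/-- partial sum of the Dirichlet series of the square root of zeta -/
noncomputable def SD (N : ℕ) (s : ℂ) : ℂ := ∑ n ∈ Icc 1 N, (dA (1 / 2) n : ℂ) * (n : ℂ) ^ (-s)

lemma SD_diff (N : ℕ) : Differentiable ℂ (SD N) := by
  unfold SD
  refine Differentiable.fun_sum fun n hn => ?_
  have hn0 : (n : ℂ) ≠ 0 := by have := (mem_Icc.mp hn).1; exact_mod_cast (by omega : n ≠ 0)
  intro s
  exact (DifferentiableAt.const_cpow (by fun_prop) (Or.inl hn0)).const_mul _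

lemma tail_four (N : ℕ) (hN : 1 ≤ N) (m : ℕ) :
    ∑ n ∈ range m, ((n + (N + 1) : ℕ) : ℝ) ^ (-(4 : ℝ)) ≤ ((N : ℝ) ^ 3)⁻¹ - (((N + m : ℕ) : ℝ) ^ 3)⁻¹ := by
  induction m with
  | zero => simp
  | succ m ih =>
    rw [sum_range_succ]
    have hy : (1 : ℝ) ≤ ((N + m : ℕ) : ℝ) := by exact_mod_cast (by omega : 1 ≤ N + m)
    set y : ℝ := ((N + m : ℕ) : ℝ) with hyd
    have e1 : ((m + (N + 1) : ℕ) : ℝ) = y + 1 := by rw [hyd]; push_cast; ring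
    have e2 : ((N + (m + 1) : ℕ) : ℝ) = y + 1 := by rw [hyd]; push_cast; ring
    rw [e1, e2]
    have e3 : (y + 1) ^ (-(4 : ℝ)) = ((y + 1) ^ 4)⁻¹ := by
      rw [Real.rpow_neg (by positivity)]; norm_cast
    rw [e3]
    have : ((y + 1) ^ 4)⁻¹ + ((y + 1) ^ 3)⁻¹ ≤ (y ^ 3)⁻¹ := by
      rw [← sub_nonneg]
      have : (y ^ 3)⁻¹ - (((y + 1) ^ 4)⁻¹ + ((y + 1) ^ 3)⁻¹) = ((y + 1) ^ 4 - y ^ 3 * (y + 2)) / (y ^ 3 * (y + 1) ^ 4) := by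
        field_simp; ring
      rw [this]
      refine div_nonneg ?_ (by positivity)
      have : (y + 1) ^ 4 - y ^ 3 * (y + 2) = 2 * y ^ 3 + 6 * y ^ 2 + 4 * y + 1 := by ring
      rw [this]; positivity
    linarith

lemma SD_approx (N : ℕ) (hN : 1 ≤ N) (t : ℝ) :
    ‖riemannZeta (4 + t * I) - SD N (4 + t * I) ^ 2‖ ≤ 4 * ((N : ℝ) ^ 3)⁻¹ := by
  set s : ℂ := 4 + t * I with hs
  have hre : s.re = 4 := by simp [hs]
  set f : ℕ → ℂ := fun n => (dA (1 / 2) n : ℂ) with hf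
  have hle : ∀ n, n ≠ 0 → ‖f n‖ ≤ 1 := by
    intro n _
    simp only [hf, Complex.norm_real, Real.norm_of_nonneg (dA_nonneg (by norm_num : (0 : ℝ) ≤ 1 / 2) n)]
    exact dA_le_one (by norm_num) (by norm_num) n
  have hsum : LSeriesSummable f s := LSeriesSummable_of_bounded_of_one_lt_re hle (by rw [hre]; norm_num)
  have hz : riemannZeta s = LSeries f s ^ 2 := by
    rw [sq, ← LSeries_convolution' hsum hsum, ← LSeries_one_eq_riemannZeta (by rw [hre]; norm_num)]
    refine LSeries_congr (fun {n} hn => ?_) s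
    have h1 := dA_one hn
    rw [show (1 : ℝ) = 1 / 2 + 1 / 2 by norm_num, ← dA_mul, ArithmeticFunction.mul_apply] at h1
    rw [LSeries.convolution_def]
    simp only [hf, Pi.one_apply]
    exact_mod_cast (by rw [h1]; norm_num : (1 : ℝ) = _)
  have hterm : ∀ n : ℕ, LSeries.term f s n = f n * (n : ℂ) ^ (-s) := fun n => by
    rw [LSeries.term_def₀ (by simp [hf])]
  have hnorm : ∀ n : ℕ, ‖LSeries.term f s n‖ ≤ (n : ℝ) ^ (-(4 : ℝ)) := by
    intro n
    rcases Nat.eq_zero_or_pos n with rfl | hn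
    · simp
    · rw [hterm, norm_mul, Complex.norm_natCast_cpow_of_pos hn, neg_re, hre]
      exact mul_le_of_le_one_left (by positivity) (hle n hn.ne')
  have hS : SD N s = ∑ n ∈ range (N + 1), LSeries.term f s n := by
    have h0 : insert 0 (Icc 1 N) = range (N + 1) := by
      ext n; simp only [mem_insert, mem_Icc, mem_range]; omega
    rw [← h0, sum_insert (by simp), LSeries.term_zero, zero_add, SD]
    exact sum_congr rfl fun n _ => (hterm n).symm
  have htail : ‖LSeries f s - SD N s‖ ≤ ((N : ℝ) ^ 3)⁻¹ := by
    have h1 := hsum.sum_add_tsum_nat_add (N + 1)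
    have h2 : LSeries f s - SD N s = ∑' n, LSeries.term f s (n + (N + 1)) := by
      rw [LSeries, ← h1, hS]; ring
    rw [h2]
    have hsr : ∀ m, ∑ n ∈ range m, ‖LSeries.term f s (n + (N + 1))‖ ≤ ((N : ℝ) ^ 3)⁻¹ := by
      intro m
      refine (sum_le_sum fun n _ => hnorm (n + (N + 1))).trans ((tail_four N hN m).trans ?_)
      have : (0 : ℝ) ≤ (((N + m : ℕ) : ℝ) ^ 3)⁻¹ := by positivity
      linarith
    refine (norm_tsum_le_tsum_norm (summable_of_sum_range_le (fun _ => norm_nonneg _) hsr)).trans ?_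
    exact Real.tsum_le_of_sum_range_le (fun _ => norm_nonneg _) hsr
  have hSb : ‖LSeries f s‖ ≤ 2 := by
    have h1 := hsum.sum_add_tsum_nat_add 2
    have hsr : ∀ m, ∑ n ∈ range m, ‖LSeries.term f s (n + 2)‖ ≤ 1 := by
      intro m
      refine (sum_le_sum fun n _ => hnorm (n + 2)).trans ((tail_four 1 le_rfl m).trans ?_)
      have : (0 : ℝ) ≤ (((1 + m : ℕ) : ℝ) ^ 3)⁻¹ := by positivity
      simp only [Nat.cast_one, one_pow, inv_one]; linarith
    rw [LSeries, ← h1]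
    refine (norm_add_le _ _).trans ?_
    have h3 : ‖∑ i ∈ range 2, LSeries.term f s i‖ ≤ 1 := by
      rw [sum_range_succ, sum_range_one, LSeries.term_zero, zero_add]
      simpa using hnorm 1
    have h4 := (norm_tsum_le_tsum_norm (summable_of_sum_range_le (fun _ => norm_nonneg _) hsr)).trans
      (Real.tsum_le_of_sum_range_le (fun _ => norm_nonneg _) hsr)
    linarith
  have hSb2 : ‖SD N s‖ ≤ 2 := by
    rw [hS]
    refine (norm_sum_le _ _).trans ?_
    rw [sum_range_succ', LSeries.term_zero, norm_zero, add_zero]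
    rcases Nat.exists_eq_add_of_le' hN with ⟨M, rfl⟩
    rw [sum_range_succ']
    have h1 : ∑ k ∈ range M, ‖LSeries.term f s (k + 1 + 1)‖ ≤ 1 := by
      refine (sum_le_sum fun n _ => hnorm (n + (1 + 1))).trans ((tail_four 1 le_rfl M).trans ?_)
      have : (0 : ℝ) ≤ (((1 + M : ℕ) : ℝ) ^ 3)⁻¹ := by positivity
      simp only [Nat.cast_one, one_pow, inv_one]; linarith
    have h2 : ‖LSeries.term f s (0 + 1)‖ ≤ 1 := by simpa using hnorm 1
    linarith
  rw [hz, sq_sub_sq, norm_mul]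
  have h5 : ‖LSeries f s + SD N s‖ ≤ 4 := (norm_add_le _ _).trans (by linarith)
  exact mul_le_mul h5 htail (norm_nonneg _) (by norm_num)

/-! ### Gaussian mean value of the Dirichlet polynomial -/

lemma gauss_int {τ : ℝ} (hτ : 0 < τ) (ξ : ℝ) :
    MeasureTheory.Integrable (fun t : ℝ => cexp (-(((τ ^ 2)⁻¹ : ℝ) : ℂ) * (t : ℂ) ^ 2 + (((2 / τ : ℝ) : ℂ) + ξ * I) * t + (-1))) ∧
    ‖∫ t : ℝ, cexp (-(((τ ^ 2)⁻¹ : ℝ) : ℂ) * (t : ℂ) ^ 2 + (((2 / τ : ℝ) : ℂ) + ξ * I) * t + (-1))‖ ≤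
      2 * τ * Real.exp (-(τ ^ 2 * ξ ^ 2 / 4)) := by
  have hb : (-(((τ ^ 2)⁻¹ : ℝ) : ℂ)).re < 0 := by
    rw [neg_re, ofReal_re]; have : 0 < (τ ^ 2)⁻¹ := by positivity
    linarith
  refine ⟨integrable_cexp_quadratic' hb _ _, ?_⟩
  rw [integral_cexp_quadratic hb, norm_mul, Complex.norm_exp]
  have hτc : (τ : ℂ) ≠ 0 := by exact_mod_cast hτ.ne'
  have e1 : (Real.pi : ℂ) / - -(((τ ^ 2)⁻¹ : ℝ) : ℂ) = ((Real.pi * τ ^ 2 : ℝ) : ℂ) := by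
    push_cast; field_simp
  have e2 : ((-1 : ℂ) - (((2 / τ : ℝ) : ℂ) + ξ * I) ^ 2 / (4 * -(((τ ^ 2)⁻¹ : ℝ) : ℂ))) =
      ((-(τ ^ 2 * ξ ^ 2 / 4) : ℝ) : ℂ) + ((τ * ξ : ℝ) : ℂ) * I := by
    push_cast; field_simp; ring_nf; simp only [I_sq]; ring
  rw [e1, e2, norm_real_cpow (by positivity)]
  have e3 : ((((-(τ ^ 2 * ξ ^ 2 / 4) : ℝ) : ℂ) + ((τ * ξ : ℝ) : ℂ) * I)).re = -(τ ^ 2 * ξ ^ 2 / 4) := by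
    simp only [add_re, ofReal_re, mul_re, I_re, mul_zero, ofReal_im, I_im, mul_one, sub_zero, add_zero]
  rw [e3]
  refine mul_le_mul_of_nonneg_right ?_ (Real.exp_pos _).le
  have e4 : ((1 : ℂ) / 2).re = 1 / 2 := by norm_num
  rw [e4, ← Real.sqrt_eq_rpow]
  rw [Real.sqrt_le_left (by positivity)]
  nlinarith [Real.pi_lt_four, sq_nonneg τ]

lemma log_gap {m n N : ℕ} (hm : 1 ≤ m) (hn : 1 ≤ n) (hmN : m ≤ N) (hnN : n ≤ N) (hmn : m ≠ n) :
    ((N : ℝ)⁻¹) ^ 2 ≤ (Real.log n - Real.log m) ^ 2 := by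
  have key : ∀ p q : ℕ, 1 ≤ p → p < q → q ≤ N → (N : ℝ)⁻¹ ≤ Real.log q - Real.log p := by
    intro p q hp hpq hq
    have hp' : (0 : ℝ) < p := by exact_mod_cast hp
    have hq' : (0 : ℝ) < q := by exact_mod_cast (by omega : 0 < q)
    have h1 := Real.one_sub_inv_le_log_of_pos (x := (q : ℝ) / p) (by positivity)
    rw [Real.log_div hq'.ne' hp'.ne', inv_div] at h1
    refine le_trans ?_ h1
    have : (p : ℝ) + 1 ≤ q := by exact_mod_cast hpq
    have h2 : (q : ℝ)⁻¹ ≤ 1 - p / q := by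
      rw [inv_eq_one_div, le_sub_iff_add_le, ← add_div, div_le_one hq']; linarith
    refine le_trans (inv_anti₀ hq' ?_) h2
    exact_mod_cast hq
  have hN : (0 : ℝ) ≤ (N : ℝ)⁻¹ := by positivity
  rcases lt_or_gt_of_ne hmn with h | h
  · exact pow_le_pow_left₀ hN (key m n hm h hnN) 2
  · rw [← neg_sub, neg_sq]; exact pow_le_pow_left₀ hN (key n m hn h hmN) 2

lemma SD_mean {τ σ : ℝ} (hτ : 0 < τ) (hσ : 1 / 2 ≤ σ) (N : ℕ) :
    MeasureTheory.Integrable (fun t : ℝ => ‖SD N (σ + t * I)‖ ^ 2 * Real.exp (-((t - τ) / τ) ^ 2)) ∧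
    ∫ t : ℝ, ‖SD N (σ + t * I)‖ ^ 2 * Real.exp (-((t - τ) / τ) ^ 2) ≤
      2 * τ * (∑ n ∈ Icc 1 N, dA (1 / 2) n ^ 2 / n + N ^ 2 * Real.exp (-(τ ^ 2 * ((N : ℝ)⁻¹) ^ 2 / 4))) := by
  set a : ℕ → ℝ := fun n => dA (1 / 2) n * (n : ℝ) ^ (-σ) with ha
  have ha0 : ∀ n, 0 ≤ a n := fun n => mul_nonneg (dA_nonneg (by norm_num) n) (by positivity)
  set Q : ℕ → ℕ → ℝ → ℂ := fun m n t => cexp (-(((τ ^ 2)⁻¹ : ℝ) : ℂ) * (t : ℂ) ^ 2 +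
    (((2 / τ : ℝ) : ℂ) + ((Real.log n - Real.log m : ℝ) : ℂ) * I) * t + (-1)) with hQ
  have hQi : ∀ m n, MeasureTheory.Integrable (Q m n) := fun m n => (gauss_int hτ _).1
  have hexp : ∀ t : ℝ, ((‖SD N (σ + t * I)‖ ^ 2 * Real.exp (-((t - τ) / τ) ^ 2) : ℝ) : ℂ) =
      ∑ m ∈ Icc 1 N, ∑ n ∈ Icc 1 N, ((a m * a n : ℝ) : ℂ) * Q m n t := by
    intro t
    have hterm : ∀ n ∈ Icc 1 N, (dA (1 / 2) n : ℂ) * (n : ℂ) ^ (-(σ + t * I)) = (a n : ℂ) * cexp (-(t * Real.log n : ℝ) * I) := by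
      intro n hn
      have hn0 : 0 < n := (mem_Icc.mp hn).1
      have hn' : (n : ℂ) ≠ 0 := by exact_mod_cast hn0.ne'
      simp only [ha]
      push_cast
      rw [Complex.ofReal_cpow (by positivity), mul_assoc, Complex.cpow_def_of_ne_zero hn', ofReal_natCast,
        Complex.cpow_def_of_ne_zero hn', ← Complex.exp_add]
      congr 2
      push_cast; ring
    have hS : SD N (σ + t * I) = ∑ n ∈ Icc 1 N, (a n : ℂ) * cexp (-(t * Real.log n : ℝ) * I) := by
      rw [SD]; exact sum_congr rfl hterm
    have hSc : (starRingEnd ℂ) (SD N (σ + t * I)) = ∑ n ∈ Icc 1 N, (a n : ℂ) * cexp ((t * Real.log n : ℝ) * I) := by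
      rw [hS, map_sum]
      refine sum_congr rfl fun n _ => ?_
      rw [map_mul, conj_ofReal, ← Complex.exp_conj]
      congr 2
      simp only [map_mul, map_neg, conj_ofReal, conj_I]; ring
    have h1 : ((‖SD N (σ + t * I)‖ ^ 2 : ℝ) : ℂ) = SD N (σ + t * I) * (starRingEnd ℂ) (SD N (σ + t * I)) := by
      rw [Complex.mul_conj, Complex.normSq_eq_norm_sq]
    rw [ofReal_mul, h1, hSc, hS, sum_mul_sum, sum_mul]
    refine sum_congr rfl fun m _ => ?_
    rw [sum_mul]
    refine sum_congr rfl fun n _ => ?_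
    have e : ((Real.exp (-((t - τ) / τ) ^ 2) : ℝ) : ℂ) = cexp (-(((τ ^ 2)⁻¹ : ℝ) : ℂ) * (t : ℂ) ^ 2 + ((2 / τ : ℝ) : ℂ) * t + (-1)) := by
      have hτc : (τ : ℂ) ≠ 0 := by exact_mod_cast hτ.ne'
      rw [Complex.ofReal_exp]; congr 1; push_cast; field_simp; ring
    rw [e, mul_mul_mul_comm, ← Complex.exp_add, mul_assoc, ← Complex.exp_add, ← ofReal_mul]
    simp only [hQ]
    congr 2
    push_cast; ring
  have hint1 : MeasureTheory.Integrable (fun t : ℝ => ∑ m ∈ Icc 1 N, ∑ n ∈ Icc 1 N, ((a m * a n : ℝ) : ℂ) * Q m n t) :=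
    MeasureTheory.integrable_finset_sum _ fun m _ => MeasureTheory.integrable_finset_sum _ fun n _ => (hQi m n).const_mul _
  constructor
  · have h2 := hint1.re
    refine h2.congr ?_
    filter_upwards with t
    rw [← hexp t]; exact ofReal_re _
  have hval : ((∫ t : ℝ, ‖SD N (σ + t * I)‖ ^ 2 * Real.exp (-((t - τ) / τ) ^ 2) : ℝ) : ℂ) =
      ∑ m ∈ Icc 1 N, ∑ n ∈ Icc 1 N, ((a m * a n : ℝ) : ℂ) * ∫ t : ℝ, Q m n t := by
    refine (integral_ofReal (𝕜 := ℂ)).symm.trans ?_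
    refine (MeasureTheory.integral_congr_ae (Eventually.of_forall hexp)).trans ?_
    rw [MeasureTheory.integral_finset_sum _ fun m _ => MeasureTheory.integrable_finset_sum _ fun n _ => (hQi m n).const_mul _]
    refine sum_congr rfl fun m _ => ?_
    rw [MeasureTheory.integral_finset_sum _ fun n _ => (hQi m n).const_mul _]
    refine sum_congr rfl fun n _ => ?_
    rw [MeasureTheory.integral_const_mul]
  set E := Real.exp (-(τ ^ 2 * ((N : ℝ)⁻¹) ^ 2 / 4)) with hE
  have hn1 : ∀ n ∈ Icc 1 N, (1 : ℝ) ≤ n := fun n hn => by exact_mod_cast (mem_Icc.mp hn).1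
  have ha1 : ∀ n ∈ Icc 1 N, a n ≤ 1 := by
    intro n hn
    exact mul_le_one₀ (dA_le_one (by norm_num) (by norm_num) n) (by positivity)
      (Real.rpow_le_one_of_one_le_of_nonpos (hn1 n hn) (by linarith))
  have ha2 : ∀ n ∈ Icc 1 N, a n * a n ≤ dA (1 / 2) n ^ 2 / n := by
    intro n hn
    have h0 : (0 : ℝ) < n := by linarith [hn1 n hn]
    have : a n * a n = dA (1 / 2) n ^ 2 * ((n : ℝ) ^ (-σ) * (n : ℝ) ^ (-σ)) := by simp only [ha]; ring
    rw [this, ← Real.rpow_add h0, div_eq_mul_inv]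
    refine mul_le_mul_of_nonneg_left ?_ (sq_nonneg _)
    rw [← Real.rpow_neg_one]
    exact Real.rpow_le_rpow_of_exponent_le (hn1 n hn) (by linarith)
  calc ∫ t : ℝ, ‖SD N (σ + t * I)‖ ^ 2 * Real.exp (-((t - τ) / τ) ^ 2)
      ≤ ‖((∫ t : ℝ, ‖SD N (σ + t * I)‖ ^ 2 * Real.exp (-((t - τ) / τ) ^ 2) : ℝ) : ℂ)‖ := by
        rw [Complex.norm_real]; exact Real.le_norm_self _
    _ ≤ ∑ m ∈ Icc 1 N, ∑ n ∈ Icc 1 N, ((if m = n then 2 * τ * (dA (1 / 2) m ^ 2 / m) else 0) + 2 * τ * E) := by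
        rw [hval]
        refine (norm_sum_le _ _).trans (sum_le_sum fun m hm => (norm_sum_le _ _).trans (sum_le_sum fun n hn => ?_))
        rw [norm_mul, Complex.norm_real, Real.norm_of_nonneg (mul_nonneg (ha0 m) (ha0 n))]
        have hg := (gauss_int hτ (Real.log n - Real.log m)).2
        have hE0 : 0 ≤ E := (Real.exp_pos _).le
        by_cases hmn : m = n
        · rw [if_pos hmn]; subst hmn
          have h1 : ‖∫ t : ℝ, Q m m t‖ ≤ 2 * τ := by
            refine hg.trans (mul_le_of_le_one_right (by positivity) ?_)
            rw [Real.exp_le_one_iff]; simp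
          have h2 : a m * a m * ‖∫ t : ℝ, Q m m t‖ ≤ (dA (1 / 2) m ^ 2 / m) * (2 * τ) :=
            mul_le_mul (ha2 m hm) h1 (norm_nonneg _) (by positivity)
          have : 0 ≤ 2 * τ * E := by positivity
          linarith
        · rw [if_neg hmn, zero_add]
          have h1 : ‖∫ t : ℝ, Q m n t‖ ≤ 2 * τ * E := by
            refine hg.trans (mul_le_mul_of_nonneg_left ?_ (by positivity))
            rw [hE, Real.exp_le_exp, neg_le_neg_iff]
            have := log_gap (mem_Icc.mp hm).1 (mem_Icc.mp hn).1 (mem_Icc.mp hm).2 (mem_Icc.mp hn).2 hmn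
            gcongr
          have h2 : a m * a n ≤ 1 := mul_le_one₀ (ha1 m hm) (ha0 n) (ha1 n hn)
          calc _ ≤ 1 * (2 * τ * E) := mul_le_mul h2 h1 (norm_nonneg _) (by norm_num)
            _ = _ := one_mul _
    _ = _ := by
        simp only [sum_add_distrib, sum_const, Nat.card_Icc, nsmul_eq_mul, add_tsub_cancel_right]
        rw [mul_add, mul_sum]
        congr 1
        · refine sum_congr rfl fun m hm => ?_
          rw [sum_ite_eq, if_pos hm]
        · ring

/-! ### Smoothed first moment of zeta: preparations -/

/-- Gaussian weight -/
noncomputable def WG (τ : ℝ) (s : ℂ) : ℂ := cexp (((s - τ * I) / τ) ^ 2)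
/-- smoothed zeta -/
noncomputable def FG (τ : ℝ) (s : ℂ) : ℂ := riemannZeta₁ s / (s + 1) * WG τ s
/-- smoothed square of the Dirichlet polynomial -/
noncomputable def QG (τ : ℝ) (N : ℕ) (s : ℂ) : ℂ := SD N s ^ 2 * ((s - 1) / (s + 1)) * WG τ s

lemma norm_WG {τ : ℝ} (hτ : 0 < τ) (s : ℂ) :
    ‖WG τ s‖ = Real.exp ((s.re / τ) ^ 2) * Real.exp (-((s.im - τ) / τ) ^ 2) := by
  have e : (s - τ * I) / τ = ((s.re / τ : ℝ) : ℂ) + (((s.im - τ) / τ : ℝ) : ℂ) * I := by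
    have hτc : (τ : ℂ) ≠ 0 := by exact_mod_cast hτ.ne'
    push_cast
    field_simp
    apply Complex.ext <;> simp
  rw [WG, Complex.norm_exp, e, ← Real.exp_add]
  congr 1
  rw [sq, mul_re]
  simp only [add_re, ofReal_re, mul_re, I_re, mul_zero, ofReal_im, I_im, mul_one, sub_zero, add_zero, add_im, mul_im, zero_add]
  ring

lemma WG_le {τ : ℝ} (hτ : 4 ≤ τ) {s : ℂ} (h0 : 0 ≤ s.re) (h4 : s.re ≤ 4) :
    ‖WG τ s‖ ≤ 3 * Real.exp (-((s.im - τ) / τ) ^ 2) := by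
  rw [norm_WG (by linarith)]
  refine mul_le_mul_of_nonneg_right ?_ (Real.exp_pos _).le
  have h1 : (s.re / τ) ^ 2 ≤ 1 := by
    rw [sq_le_one_iff₀ (by positivity), div_le_one (by linarith)]; linarith
  exact (Real.exp_le_exp.mpr h1).trans Real.exp_one_lt_three.le

lemma re_add_one_ne {s : ℂ} (hs : -1 < s.re) : s + 1 ≠ 0 := by
  intro h
  have := congrArg Complex.re h
  simp at this; linarith

lemma FG_diff (τ : ℝ) : DifferentiableOn ℂ (FG τ) {s | -1 < s.re} := by
  intro s hs
  refine DifferentiableAt.differentiableWithinAt ?_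
  unfold FG WG
  exact ((differentiable_riemannZeta₁ s).div (by fun_prop) (re_add_one_ne hs)).mul (by fun_prop)

lemma QG_diff (τ : ℝ) (N : ℕ) : DifferentiableOn ℂ (QG τ N) {s | -1 < s.re} := by
  intro s hs
  refine DifferentiableAt.differentiableWithinAt ?_
  unfold QG WG
  exact (((SD_diff N s).pow 2).mul (DifferentiableAt.div (by fun_prop) (by fun_prop) (re_add_one_ne hs))).mul (by fun_prop)

lemma q_le_one {s : ℂ} (hs : 0 ≤ s.re) : ‖(s - 1) / (s + 1)‖ ≤ 1 := by
  rw [norm_div]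
  refine div_le_one_of_le₀ ?_ (norm_nonneg _)
  rw [← sq_le_sq₀ (norm_nonneg _) (norm_nonneg _), ← Complex.normSq_eq_norm_sq, ← Complex.normSq_eq_norm_sq,
    Complex.normSq_apply, Complex.normSq_apply]
  simp only [sub_re, add_re, one_re, sub_im, add_im, one_im, sub_zero, add_zero]
  nlinarith

lemma q_ge {s : ℂ} (h0 : 0 ≤ s.re) (h1 : s.re ≤ 1) (ht : 2 ≤ |s.im|) : 1 / 2 ≤ ‖(s - 1) / (s + 1)‖ := by
  have hne : 0 < ‖s + 1‖ := norm_pos_iff.mpr (re_add_one_ne (by linarith))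
  rw [norm_div, le_div_iff₀ hne]
  have h4 : 4 ≤ s.im ^ 2 := by rw [← sq_abs]; nlinarith
  rw [← sq_le_sq₀ (by positivity) (norm_nonneg _), mul_pow, ← Complex.normSq_eq_norm_sq, ← Complex.normSq_eq_norm_sq,
    Complex.normSq_apply, Complex.normSq_apply]
  simp only [sub_re, add_re, one_re, sub_im, add_im, one_im, sub_zero, add_zero]
  nlinarith [sq_nonneg (s.re - 1)]

lemma FG_eq (τ : ℝ) {s : ℂ} (hs : s ≠ 1) : FG τ s = riemannZeta s * ((s - 1) / (s + 1)) * WG τ s := by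
  have h0 : s - 1 ≠ 0 := sub_ne_zero.mpr hs
  rw [FG, riemannZeta_eq_inv_sub_mul hs]
  field_simp

lemma Zq_bound : ∃ C > 0, ∀ s : ℂ, 1 / 4 ≤ s.re → s.re ≤ 4 → ‖riemannZeta₁ s / (s + 1)‖ ≤ C * (1 + s.im ^ 2) := by
  obtain ⟨C, hC, hz⟩ := zeta_bound
  have hK : IsCompact {s : ℂ | s.re ∈ Set.Icc (1 / 4 : ℝ) 4 ∧ s.im ∈ Set.Icc (-2 : ℝ) 2} := by
    have := (isCompact_Icc (a := (1 / 4 : ℝ)) (b := 4)).reProdIm (isCompact_Icc (a := (-2 : ℝ)) (b := 2))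
    exact this
  obtain ⟨M, hM⟩ := hK.exists_bound_of_continuousOn (f := fun s => riemannZeta₁ s / (s + 1))
    (differentiable_riemannZeta₁.continuous.continuousOn.div (by fun_prop) fun s hs => re_add_one_ne (by linarith [hs.1.1]))
  refine ⟨C + |M|, by positivity, fun s h1 h2 => ?_⟩
  rcases le_or_gt 2 |s.im| with ht | ht
  · have hs1 : s ≠ 1 := fun h => by rw [h] at ht; simp at ht; linarith
    have h0 : s - 1 ≠ 0 := sub_ne_zero.mpr hs1
    have e : riemannZeta₁ s / (s + 1) = riemannZeta s * ((s - 1) / (s + 1)) := by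
      rw [riemannZeta_eq_inv_sub_mul hs1]; field_simp
    rw [e, norm_mul]
    have hb := hz s h1 (by linarith) ht
    have h3 : |s.im| ^ (max (1 - s.re) 0) ≤ |s.im| := by
      nth_rewrite 2 [← Real.rpow_one |s.im|]
      exact Real.rpow_le_rpow_of_exponent_le (by linarith) (max_le (by linarith) (by norm_num))
    have h4 : Real.log |s.im| ≤ |s.im| := (Real.log_le_sub_one_of_pos (by linarith)).trans (by linarith)
    have h5 : 0 ≤ Real.log |s.im| := Real.log_nonneg (by linarith)
    have h6 : ‖riemannZeta s‖ ≤ C * s.im ^ 2 := by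
      refine hb.trans ?_
      rw [mul_assoc, ← sq_abs, sq]
      exact mul_le_mul_of_nonneg_left (mul_le_mul h3 h4 h5 (by positivity)) hC.le
    have h7 := q_le_one (s := s) (by linarith)
    calc _ ≤ ‖riemannZeta s‖ * 1 := mul_le_mul_of_nonneg_left h7 (norm_nonneg _)
      _ ≤ C * s.im ^ 2 := by linarith
      _ ≤ _ := by nlinarith [abs_nonneg M, sq_nonneg s.im, mul_nonneg (abs_nonneg M) (sq_nonneg s.im)]
  · have := hM s ⟨⟨h1, h2⟩, ⟨by linarith [neg_abs_le s.im], by linarith [le_abs_self s.im]⟩⟩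
    refine this.trans ((le_abs_self M).trans ?_)
    nlinarith [abs_nonneg M, sq_nonneg s.im, mul_nonneg (abs_nonneg M) (sq_nonneg s.im), mul_nonneg hC.le (sq_nonneg s.im)]

lemma gauss_poly (v : ℝ) : (1 + v ^ 2) ^ 2 * Real.exp (-v ^ 2) ≤ 6 := by
  have h1 := Real.pow_div_factorial_le_exp (x := 1 + v ^ 2) (by positivity) 2
  rw [Real.exp_add] at h1
  have h2 : Real.exp (v ^ 2) * Real.exp (-v ^ 2) = 1 := by rw [← Real.exp_add]; simp
  have h3 : (1 + v ^ 2) ^ 2 ≤ 6 * Real.exp (v ^ 2) := by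
    norm_num at h1
    nlinarith [Real.exp_one_lt_three, Real.exp_pos (v ^ 2)]
  calc _ ≤ 6 * Real.exp (v ^ 2) * Real.exp (-v ^ 2) := mul_le_mul_of_nonneg_right h3 (Real.exp_pos _).le
    _ = _ := by rw [mul_assoc, h2, mul_one]

lemma gauss_decay {τ : ℝ} (hτ : 0 < τ) (t : ℝ) :
    (1 + t ^ 2) ^ 2 * Real.exp (-((t - τ) / τ) ^ 2) ≤ 6 * (1 + 2 * τ ^ 2) ^ 2 := by
  set v := (t - τ) / τ with hv
  have ht : t = τ * (1 + v) := by rw [hv]; field_simp; ring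
  have h1 : 1 + t ^ 2 ≤ (1 + 2 * τ ^ 2) * (1 + v ^ 2) := by
    rw [ht]; nlinarith [mul_nonneg (sq_nonneg τ) (sq_nonneg (1 - v)), sq_nonneg v]
  calc _ ≤ ((1 + 2 * τ ^ 2) * (1 + v ^ 2)) ^ 2 * Real.exp (-v ^ 2) := by gcongr
    _ = (1 + 2 * τ ^ 2) ^ 2 * ((1 + v ^ 2) ^ 2 * Real.exp (-v ^ 2)) := by ring
    _ ≤ _ := by rw [mul_comm 6]; exact mul_le_mul_of_nonneg_left (gauss_poly v) (by positivity)

lemma FG_decay {τ : ℝ} (hτ : 4 ≤ τ) : ∃ B, ∀ s : ℂ, 1 / 4 ≤ s.re → s.re ≤ 4 → ‖FG τ s‖ ≤ B * (1 + s.im ^ 2)⁻¹ := by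
  obtain ⟨C, hC, h⟩ := Zq_bound
  refine ⟨C * 3 * (6 * (1 + 2 * τ ^ 2) ^ 2), fun s h1 h2 => ?_⟩
  rw [← div_eq_mul_inv, le_div_iff₀ (by positivity), FG, norm_mul]
  calc _ ≤ C * (1 + s.im ^ 2) * (3 * Real.exp (-((s.im - τ) / τ) ^ 2)) * (1 + s.im ^ 2) := by
        gcongr
        · exact h s h1 h2
        · exact WG_le hτ (by linarith) h2
    _ = C * 3 * ((1 + s.im ^ 2) ^ 2 * Real.exp (-((s.im - τ) / τ) ^ 2)) := by ring
    _ ≤ _ := mul_le_mul_of_nonneg_left (gauss_decay (by linarith) _) (by positivity)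

lemma SD_le (N : ℕ) {s : ℂ} (hs : 0 ≤ s.re) : ‖SD N s‖ ≤ N := by
  refine (norm_sum_le _ _).trans ?_
  calc _ ≤ ∑ n ∈ Icc 1 N, (1 : ℝ) := by
        refine sum_le_sum fun n hn => ?_
        have hn1 := (mem_Icc.mp hn).1
        rw [norm_mul, Complex.norm_natCast_cpow_of_pos hn1, Complex.norm_real, Real.norm_of_nonneg (dA_nonneg (by norm_num) n)]
        refine mul_le_one₀ (dA_le_one (by norm_num) (by norm_num) n) (by positivity) ?_
        exact Real.rpow_le_one_of_one_le_of_nonpos (by exact_mod_cast hn1) (by simpa using hs)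
    _ = N := by simp

lemma QG_le {τ : ℝ} (hτ : 4 ≤ τ) (N : ℕ) {s : ℂ} (h1 : 0 ≤ s.re) (h2 : s.re ≤ 4) :
    ‖QG τ N s‖ ≤ 3 * (‖SD N s‖ ^ 2 * Real.exp (-((s.im - τ) / τ) ^ 2)) := by
  rw [QG, norm_mul, norm_mul, norm_pow]
  calc _ ≤ ‖SD N s‖ ^ 2 * 1 * (3 * Real.exp (-((s.im - τ) / τ) ^ 2)) := by
        gcongr
        · exact q_le_one h1
        · exact WG_le hτ h1 h2
    _ = _ := by ring

lemma QG_decay {τ : ℝ} (hτ : 4 ≤ τ) (N : ℕ) :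
    ∃ B, ∀ s : ℂ, 1 / 4 ≤ s.re → s.re ≤ 4 → ‖QG τ N s‖ ≤ B * (1 + s.im ^ 2)⁻¹ := by
  refine ⟨3 * N ^ 2 * (6 * (1 + 2 * τ ^ 2) ^ 2), fun s h1 h2 => ?_⟩
  rw [← div_eq_mul_inv, le_div_iff₀ (by positivity)]
  have h3 := QG_le hτ N (s := s) (by linarith) h2
  have h4 := SD_le N (s := s) (by linarith)
  calc _ ≤ 3 * ((N : ℝ) ^ 2 * Real.exp (-((s.im - τ) / τ) ^ 2)) * (1 + s.im ^ 2) ^ 2 := by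
        refine mul_le_mul (h3.trans (by gcongr)) ?_ (by positivity) (by positivity)
        nlinarith [sq_nonneg s.im]
    _ = 3 * (N : ℝ) ^ 2 * ((1 + s.im ^ 2) ^ 2 * Real.exp (-((s.im - τ) / τ) ^ 2)) := by ring
    _ ≤ _ := mul_le_mul_of_nonneg_left (gauss_decay (by linarith) _) (by positivity)

lemma gauss_tail {τ t : ℝ} (hτ : 16 ≤ τ) (ht : τ ^ 5 ≤ t ^ 4) :
    Real.exp (-((t - τ) / τ) ^ 2) ≤ (Nat.factorial 10 : ℝ) * 4 ^ 10 / t ^ 4 := by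
  have hτ0 : 0 < τ := by linarith
  have ht4 : 0 < t ^ 4 := lt_of_lt_of_le (by positivity) ht
  have h2τ : (2 * τ) ^ 4 ≤ |t| ^ 4 := by
    have : |t| ^ 4 = t ^ 4 := by rw [show 4 = 2 * 2 by norm_num, pow_mul, sq_abs, ← pow_mul]
    rw [this]; refine le_trans ?_ ht
    have : 0 < τ ^ 4 := by positivity
    nlinarith
  have h2 : 2 * τ ≤ |t| := le_of_pow_le_pow_left₀ (by norm_num) (abs_nonneg t) h2τ
  have h3 : |t| / 2 ≤ |t - τ| := by
    have := abs_sub_abs_le_abs_sub t τ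
    rw [abs_of_pos hτ0] at this; linarith
  have h4 : t ^ 2 / (4 * τ ^ 2) ≤ ((t - τ) / τ) ^ 2 := by
    rw [div_pow, div_le_div_iff₀ (by positivity) (by positivity)]
    have : t ^ 2 / 4 ≤ (t - τ) ^ 2 := by
      rw [← sq_abs t, ← sq_abs (t - τ)]; nlinarith [abs_nonneg t]
    nlinarith [sq_nonneg τ]
  have h5 := Real.pow_div_factorial_le_exp (x := ((t - τ) / τ) ^ 2) (by positivity) 10
  rw [Real.exp_neg]
  have h6 : t ^ 4 / 4 ^ 10 ≤ (((t - τ) / τ) ^ 2) ^ 10 := by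
    refine le_trans ?_ (pow_le_pow_left₀ (by positivity) h4 10)
    rw [div_pow, div_le_div_iff₀ (by positivity) (by positivity)]
    have : (τ ^ 5) ^ 4 ≤ (t ^ 4) ^ 4 := pow_le_pow_left₀ (by positivity) ht 4
    calc t ^ 4 * (4 * τ ^ 2) ^ 10 = 4 ^ 10 * t ^ 4 * (τ ^ 5) ^ 4 := by ring
      _ ≤ 4 ^ 10 * t ^ 4 * (t ^ 4) ^ 4 := mul_le_mul_of_nonneg_left this (by positivity)
      _ = _ := by ring
  rw [inv_le_comm₀ (Real.exp_pos _) (by positivity)]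
  refine le_trans ?_ h5
  rw [inv_div, mul_comm, ← div_div]
  exact div_le_div_of_nonneg_right h6 (by positivity)

/-! ### Smoothed first moment of zeta: the bootstrap -/

lemma FG_reflect : ∃ C > 0, ∀ τ c : ℝ, 16 ≤ τ → 0 ≤ c → c / Real.log τ ≤ 1 / 4 →
    ∀ t : ℝ, ‖FG τ (((1 - (1 / 2 + c / Real.log τ) : ℝ) : ℂ) + t * I)‖ ≤
      C * Real.exp (5 * c / 4) * ‖FG τ (((1 / 2 + c / Real.log τ : ℝ) : ℂ) + t * I)‖ + C * (1 + t ^ 2)⁻¹ := by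
  obtain ⟨C1, hC1, hz⟩ := Zq_bound
  obtain ⟨C2, hC2, hX⟩ := chiX_bound
  obtain ⟨K, hK⟩ : ∃ K : ℝ, K = (Nat.factorial 10 : ℝ) * 4 ^ 10 := ⟨_, rfl⟩
  have hK1 : 1 ≤ K := by rw [hK]; norm_num [Nat.factorial]
  refine ⟨2 * C2 + 75 * C1 * K, by positivity, fun τ c hτ hc hcl t => ?_⟩
  have hl : 0 < Real.log τ := Real.log_pos (by linarith)
  set e := c / Real.log τ with he
  have he0 : 0 ≤ e := by positivity
  set s : ℂ := ((1 - (1 / 2 + e) : ℝ) : ℂ) + t * I with hs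
  set w : ℂ := ((1 / 2 + e : ℝ) : ℂ) + t * I with hw
  have hsre : s.re = 1 - (1 / 2 + e) := by simp [hs]
  have hsim : s.im = t := by simp [hs]
  have hwre : w.re = 1 / 2 + e := by simp [hw]
  have hwim : w.im = t := by simp [hw]
  have hF0 := norm_nonneg (FG τ w)
  have hzs := hz s (by rw [hsre]; linarith) (by rw [hsre]; linarith)
  have hWs := WG_le (τ := τ) (by linarith) (s := s) (by rw [hsre]; linarith) (by rw [hsre]; linarith)
  rw [hsim] at hzs hWs
  have hrest : 0 ≤ (2 * C2 + 75 * C1 * K) * Real.exp (5 * c / 4) * ‖FG τ w‖ := by positivity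
  have hpos : (0 : ℝ) < (1 + t ^ 2)⁻¹ := by positivity
  have hcase : (∃ G ≥ 0, Real.exp (-((t - τ) / τ) ^ 2) ≤ G ∧ (1 + t ^ 2) ^ 2 * G ≤ 25 * K) →
      ‖FG τ s‖ ≤ (2 * C2 + 75 * C1 * K) * Real.exp (5 * c / 4) * ‖FG τ w‖ + (2 * C2 + 75 * C1 * K) * (1 + t ^ 2)⁻¹ := by
    rintro ⟨G, hG0, hG, hG2⟩
    have h1 : ‖FG τ s‖ ≤ C1 * (1 + t ^ 2) * (3 * G) := by
      rw [FG, norm_mul]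
      exact mul_le_mul hzs (hWs.trans (by linarith)) (norm_nonneg _) (by positivity)
    have h2 : C1 * (1 + t ^ 2) * (3 * G) = 3 * C1 * ((1 + t ^ 2) ^ 2 * G) * (1 + t ^ 2)⁻¹ := by field_simp
    have h3 : 3 * C1 * ((1 + t ^ 2) ^ 2 * G) * (1 + t ^ 2)⁻¹ ≤ (2 * C2 + 75 * C1 * K) * (1 + t ^ 2)⁻¹ := by
      refine mul_le_mul_of_nonneg_right ?_ hpos.le
      have : 3 * C1 * ((1 + t ^ 2) ^ 2 * G) ≤ 3 * C1 * (25 * K) := mul_le_mul_of_nonneg_left hG2 (by positivity)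
      linarith
    linarith
  rcases le_or_gt 2 |t| with ht2 | ht2
  · rcases le_or_gt (τ ^ 5) (t ^ 4) with ht | ht
    · have ht1 : 4 ≤ t ^ 2 := by rw [← sq_abs]; nlinarith
      have ht4 : 0 < t ^ 4 := by nlinarith
      have hgt := gauss_tail hτ ht
      rw [← hK] at hgt
      refine hcase ⟨K / t ^ 4, by positivity, hgt, ?_⟩
      rw [mul_div_assoc', div_le_iff₀ ht4]
      have h8 : (1 + t ^ 2) ^ 2 ≤ 25 * t ^ 4 := by nlinarith
      have h9 := mul_le_mul_of_nonneg_right h8 (zero_le_one.trans hK1)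
      linarith
    · -- functional equation
      have hne : t ≠ 0 := fun h => by rw [h] at ht2; norm_num at ht2
      have hs1 : s ≠ 1 := fun h => by rw [h] at hsim; simp at hsim; exact hne hsim.symm
      have hw1 : w ≠ 1 := fun h => by rw [h] at hwim; simp at hwim; exact hne hwim.symm
      set z : ℂ := (starRingEnd ℂ) w with hzd
      have hzre : z.re = 1 / 2 + e := by rw [hzd, conj_re, hwre]
      have hzim : z.im = -t := by rw [hzd, conj_im, hwim]
      have hsz : s = 1 - z := by
        apply Complex.ext
        · rw [sub_re, hzre, hsre, one_re]
        · rw [sub_im, hzim, hsim, one_im]; ring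
      have hfe : ‖riemannZeta s‖ = ‖chiX z‖ * ‖riemannZeta w‖ := by
        rw [hsz, zeta_one_sub_chiX (by rw [hzim]; exact neg_ne_zero.mpr hne), norm_mul, hzd, riemannZeta_conj, RCLike.norm_conj]
      have hXz : ‖chiX z‖ ≤ C2 * Real.exp (5 * c / 4) := by
        have h1 := hX z (by rw [hzre]; linarith) (by rw [hzre]; linarith) (by rw [hzim, abs_neg]; exact ht2)
        rw [hzre, hzim, abs_neg, add_sub_cancel_left] at h1
        refine h1.trans (mul_le_mul_of_nonneg_left ?_ hC2.le)
        rw [Real.rpow_def_of_pos (by linarith), Real.exp_le_exp]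
        have h2 : 4 * Real.log |t| ≤ 5 * Real.log τ := by
          have h3 : Real.log (t ^ 4) ≤ Real.log (τ ^ 5) := Real.log_le_log (by positivity) ht.le
          rw [Real.log_pow, Real.log_pow, ← Real.log_abs] at h3
          push_cast at h3; exact h3
        have h4 : e * Real.log τ = c := by rw [he]; field_simp
        have h5 := mul_le_mul_of_nonneg_left h2 he0
        linarith
      rw [FG_eq τ hs1, norm_mul, norm_mul, hfe]
      have hq := q_le_one (s := s) (by rw [hsre]; linarith)
      have hqw := q_ge (s := w) (by rw [hwre]; linarith) (by rw [hwre]; linarith) (by rw [hwim]; exact ht2)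
      have hW : ‖WG τ s‖ ≤ ‖WG τ w‖ := by
        rw [norm_WG (by linarith), norm_WG (by linarith), hsre, hwre, hsim, hwim]
        refine mul_le_mul_of_nonneg_right (Real.exp_le_exp.mpr ?_) (Real.exp_pos _).le
        refine pow_le_pow_left₀ (div_nonneg (by linarith) (by linarith)) ?_ 2
        exact div_le_div_of_nonneg_right (by linarith) (by linarith)
      have hFw : ‖FG τ w‖ = ‖riemannZeta w‖ * ‖(w - 1) / (w + 1)‖ * ‖WG τ w‖ := by
        rw [FG_eq τ hw1, norm_mul, norm_mul]
      have h5 : ‖riemannZeta w‖ * ‖WG τ w‖ ≤ 2 * ‖FG τ w‖ := by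
        rw [hFw]
        have h6 := mul_le_mul_of_nonneg_left hqw (mul_nonneg (norm_nonneg (riemannZeta w)) (norm_nonneg (WG τ w)))
        linarith
      calc _ ≤ C2 * Real.exp (5 * c / 4) * ‖riemannZeta w‖ * 1 * ‖WG τ w‖ := by gcongr
        _ = C2 * Real.exp (5 * c / 4) * (‖riemannZeta w‖ * ‖WG τ w‖) := by ring
        _ ≤ C2 * Real.exp (5 * c / 4) * (2 * ‖FG τ w‖) := mul_le_mul_of_nonneg_left h5 (by positivity)
        _ ≤ (2 * C2 + 75 * C1 * K) * Real.exp (5 * c / 4) * ‖FG τ w‖ := by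
            have : 0 ≤ 75 * C1 * K * (Real.exp (5 * c / 4) * ‖FG τ w‖) := by positivity
            linarith
        _ ≤ _ := by
            have : 0 ≤ (2 * C2 + 75 * C1 * K) * (1 + t ^ 2)⁻¹ := by positivity
            linarith
  · refine hcase ⟨1, by norm_num, ?_, ?_⟩
    · rw [Real.exp_le_one_iff, neg_nonpos]; positivity
    · have : t ^ 2 ≤ 4 := by rw [← sq_abs]; nlinarith [abs_nonneg t]
      have h5 : (1 + t ^ 2) ^ 2 ≤ 25 := by nlinarith [sq_nonneg t]
      linarith

/-- the abstract bootstrap inequality -/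
lemma bootstrap_real {a D C3 P τ c θ L q : ℝ} (hC3 : 0 ≤ C3) (ha : 0 ≤ a) (hP : 0 ≤ P) (hτ : 0 ≤ τ)
    (hD0 : 0 ≤ D) (hD : D ≤ C3 * a + P) (hθ0 : 0 ≤ θ) (hθ1 : θ ≤ 1) (hL : 0 ≤ L)
    (haD : a ≤ D ^ (1 - θ) * (L * τ) ^ θ + P) (hLq : L ^ θ ≤ q) (hq : q * C3 ≤ 1 / 2) (hq1 : q ≤ 1) (hq0 : 0 ≤ q) :
    a ≤ 2 * (2 * P + τ) := by
  have h1 : D ^ (1 - θ) * (L * τ) ^ θ ≤ (D + τ) * q := by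
    rw [Real.mul_rpow hL hτ]
    calc D ^ (1 - θ) * (L ^ θ * τ ^ θ) ≤ (D + τ) ^ (1 - θ) * (q * (D + τ) ^ θ) := by
          gcongr
          · linarith
          · linarith
      _ = ((D + τ) ^ (1 - θ) * (D + τ) ^ θ) * q := by ring
      _ = _ := by
          congr 1
          rw [← Real.rpow_add_of_nonneg (by positivity) (by linarith) hθ0]
          simp
  have h2 : (D + τ) * q ≤ (C3 * a + P + τ) * q := mul_le_mul_of_nonneg_right (by linarith) hq0
  have h3 : (P + τ) * q ≤ P + τ := mul_le_of_le_one_right (by positivity) hq1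
  have h4 : q * C3 * a ≤ 1 / 2 * a := mul_le_mul_of_nonneg_right hq ha
  nlinarith

/-! ### The first moment of zeta near the critical line -/

lemma FG_int {τ : ℝ} (hτ : 4 ≤ τ) {σ : ℝ} (h1 : 1 / 4 ≤ σ) (h2 : σ ≤ 4) :
    MeasureTheory.Integrable fun t : ℝ => ‖FG τ (σ + t * I)‖ := by
  obtain ⟨B, hB⟩ := FG_decay hτ
  refine AL_integrable (B := B) (FG_diff τ) (by linarith) fun t => ?_
  have := hB (σ + t * I) (by simpa using h1) (by simpa using h2)
  simpa using this

lemma QG_int {τ : ℝ} (hτ : 4 ≤ τ) (N : ℕ) {σ : ℝ} (h1 : 1 / 4 ≤ σ) (h2 : σ ≤ 4) :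
    MeasureTheory.Integrable fun t : ℝ => ‖QG τ N (σ + t * I)‖ := by
  obtain ⟨B, hB⟩ := QG_decay hτ N
  refine AL_integrable (B := B) (QG_diff τ N) (by linarith) fun t => ?_
  have := hB (σ + t * I) (by simpa using h1) (by simpa using h2)
  simpa using this

noncomputable def DG (τ : ℝ) (N : ℕ) (s : ℂ) : ℂ := FG τ s - QG τ N s

lemma DG_diff (τ : ℝ) (N : ℕ) : DifferentiableOn ℂ (DG τ N) {s | -1 < s.re} :=
  (FG_diff τ).sub (QG_diff τ N)

lemma DG_decay {τ : ℝ} (hτ : 4 ≤ τ) (N : ℕ) :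
    ∃ B, ∀ s : ℂ, 1 / 4 ≤ s.re → s.re ≤ 4 → ‖DG τ N s‖ ≤ B * (1 + s.im ^ 2)⁻¹ := by
  obtain ⟨B, hB⟩ := FG_decay hτ
  obtain ⟨B', hB'⟩ := QG_decay hτ N
  refine ⟨B + B', fun s h1 h2 => ?_⟩
  refine (norm_sub_le _ _).trans ?_
  linarith [hB s h1 h2, hB' s h1 h2]

lemma DG_int {τ : ℝ} (hτ : 4 ≤ τ) (N : ℕ) {σ : ℝ} (h1 : 1 / 4 ≤ σ) (h2 : σ ≤ 4) :
    MeasureTheory.Integrable fun t : ℝ => ‖DG τ N (σ + t * I)‖ := by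
  obtain ⟨B, hB⟩ := DG_decay hτ N
  refine AL_integrable (B := B) (DG_diff τ N) (by linarith) fun t => ?_
  have := hB (σ + t * I) (by simpa using h1) (by simpa using h2)
  simpa using this

lemma AL_DG_le {τ : ℝ} (hτ : 4 ≤ τ) (N : ℕ) {σ : ℝ} (h1 : 1 / 4 ≤ σ) (h2 : σ ≤ 4) :
    AL (DG τ N) σ ≤ AL (FG τ) σ + AL (QG τ N) σ := by
  rw [AL, AL, AL, ← MeasureTheory.integral_add (FG_int hτ h1 h2) (QG_int hτ N h1 h2)]
  exact MeasureTheory.integral_mono (DG_int hτ N h1 h2) ((FG_int hτ h1 h2).add (QG_int hτ N h1 h2)) fun t => norm_sub_le _ _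

lemma AL_FG_le {τ : ℝ} (hτ : 4 ≤ τ) (N : ℕ) {σ : ℝ} (h1 : 1 / 4 ≤ σ) (h2 : σ ≤ 4) :
    AL (FG τ) σ ≤ AL (DG τ N) σ + AL (QG τ N) σ := by
  rw [AL, AL, AL, ← MeasureTheory.integral_add (DG_int hτ N h1 h2) (QG_int hτ N h1 h2)]
  refine MeasureTheory.integral_mono (FG_int hτ h1 h2) ((DG_int hτ N h1 h2).add (QG_int hτ N h1 h2)) fun t => ?_
  have := norm_add_le (DG τ N (σ + t * I)) (QG τ N (σ + t * I))
  rw [DG, sub_add_cancel] at this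
  exact this

lemma FG_half : ∃ C > 0, ∀ τ c : ℝ, 16 ≤ τ → 0 < c → c / Real.log τ ≤ 1 / 4 →
    AL (FG τ) (1 / 2) ≤ C * Real.exp (5 * c / 8) * AL (FG τ) (1 / 2 + c / Real.log τ) + C := by
  obtain ⟨C, hC, h⟩ := FG_reflect
  have hC0 : 0 < C + C * Real.pi := by positivity
  refine ⟨√(C + C * Real.pi), Real.sqrt_pos.mpr hC0, fun τ c hτ hc hcl => ?_⟩
  have hl : 0 < Real.log τ := Real.log_pos (by linarith)
  set e := c / Real.log τ with he
  have he0 : 0 < e := by positivity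
  set M := C + C * Real.pi with hM
  set a := AL (FG τ) (1 / 2 + e) with ha
  have ha0 : 0 ≤ a := AL_nonneg _ _
  have h1 : AL (FG τ) (1 - (1 / 2 + e)) ≤ M * Real.exp (5 * c / 4) * a + M := by
    have h2 : AL (FG τ) (1 - (1 / 2 + e)) ≤ ∫ t : ℝ, (C * Real.exp (5 * c / 4) * ‖FG τ (((1 / 2 + e : ℝ) : ℂ) + t * I)‖ + C * (1 + t ^ 2)⁻¹) := by
      refine MeasureTheory.integral_mono (FG_int (by linarith) (by linarith) (by linarith)) ?_ fun t => h τ c hτ hc.le hcl t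
      exact ((FG_int (by linarith) (by linarith) (by linarith)).const_mul _).add (integrable_inv_one_add_sq.const_mul _)
    rw [MeasureTheory.integral_add ((FG_int (by linarith) (by linarith) (by linarith)).const_mul _) (integrable_inv_one_add_sq.const_mul _),
      MeasureTheory.integral_const_mul, MeasureTheory.integral_const_mul, integral_univ_inv_one_add_sq] at h2
    refine h2.trans (add_le_add ?_ (by rw [hM]; linarith))
    refine mul_le_mul_of_nonneg_right (mul_le_mul_of_nonneg_right ?_ (Real.exp_pos _).le) ha0
    rw [hM]; have := Real.pi_pos; nlinarith
  obtain ⟨B, hB⟩ := FG_decay (τ := τ) (by linarith)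
  have h3 := AL_three_lines (FG_diff τ) (l := 1 - (1 / 2 + e)) (u := 1 / 2 + e) (σ := 1 / 2) (B := B) (by linarith) (by linarith) (by linarith)
    (by linarith) (fun s h1 h2 => hB s (by linarith) (by linarith))
  have e1 : (1 / 2 - (1 - (1 / 2 + e))) / (1 / 2 + e - (1 - (1 / 2 + e))) = 1 / 2 := by
    rw [div_eq_iff (by linarith)]; ring
  rw [e1, show (1 : ℝ) - 1 / 2 = 1 / 2 by norm_num, ← Real.mul_rpow (AL_nonneg _ _) (AL_nonneg _ _), ← Real.sqrt_eq_rpow] at h3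
  refine h3.trans ?_
  rw [Real.sqrt_le_left (by positivity)]
  set E := Real.exp (5 * c / 8) with hE
  have hE1 : 1 ≤ E := Real.one_le_exp (by positivity)
  have hEE : Real.exp (5 * c / 4) = E ^ 2 := by rw [hE, ← Real.exp_nat_mul]; congr 1; push_cast; ring
  rw [hEE] at h1
  have h4 : (√M * E * a + √M) ^ 2 = M * (E * a + 1) ^ 2 := by
    rw [show √M * E * a + √M = √M * (E * a + 1) by ring, mul_pow, Real.sq_sqrt hC0.le]
  rw [h4]
  calc _ ≤ (M * E ^ 2 * a + M) * a := mul_le_mul_of_nonneg_right h1 ha0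
    _ ≤ _ := by
      have : a ≤ E * a := by nlinarith
      have h5 : 0 ≤ M * (2 * (E * a) - a + 1) := by refine mul_nonneg hC0.le (by linarith)
      nlinarith

/-- length of the Dirichlet polynomial -/
noncomputable def NT (τ : ℝ) : ℕ := ⌊τ ^ (3 / 4 : ℝ)⌋₊

lemma NT_facts {τ : ℝ} (hτ : 16 ≤ τ) : 1 ≤ NT τ ∧ ((NT τ : ℝ)) ^ 4 ≤ τ ^ 3 ∧ τ ^ (3 / 4 : ℝ) / 2 ≤ NT τ ∧ (NT τ : ℝ) ≤ τ := by
  have hy : (8 : ℝ) ≤ τ ^ (3 / 4 : ℝ) := by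
    calc (8 : ℝ) = (16 : ℝ) ^ (3 / 4 : ℝ) := by
          rw [show (16 : ℝ) = 2 ^ (4 : ℝ) by norm_num, ← Real.rpow_mul (by norm_num)]; norm_num
      _ ≤ _ := Real.rpow_le_rpow (by norm_num) hτ (by norm_num)
  have h0 : 0 ≤ τ ^ (3 / 4 : ℝ) := by linarith
  have h1 : (NT τ : ℝ) ≤ τ ^ (3 / 4 : ℝ) := Nat.floor_le h0
  have h2 : τ ^ (3 / 4 : ℝ) < NT τ + 1 := Nat.lt_floor_add_one _
  refine ⟨?_, ?_, by linarith, h1.trans ?_⟩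
  · have : (0 : ℝ) < NT τ := by linarith
    exact_mod_cast this
  · calc _ ≤ (τ ^ (3 / 4 : ℝ)) ^ 4 := by gcongr
      _ = τ ^ 3 := by
        rw [← Real.rpow_natCast, ← Real.rpow_mul (by linarith), ← Real.rpow_natCast]; norm_num
  · calc _ ≤ τ ^ (1 : ℝ) := Real.rpow_le_rpow_of_exponent_le (by linarith) (by norm_num)
      _ = τ := Real.rpow_one τ

lemma log_ge_two {τ : ℝ} (hτ : 16 ≤ τ) : 2 ≤ Real.log τ := by
  have h1 : Real.log 16 ≤ Real.log τ := Real.log_le_log (by norm_num) hτ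
  have h2 : Real.log 16 = 4 * Real.log 2 := by rw [show (16 : ℝ) = 2 ^ 4 by norm_num, Real.log_pow]; norm_num
  linarith [Real.log_two_gt_d9]

lemma QG_AL {τ σ : ℝ} (hτ : 16 ≤ τ) (h1 : 1 / 2 ≤ σ) (h2 : σ ≤ 4) :
    AL (QG τ (NT τ)) σ ≤ 2400 * (τ * Real.log τ ^ (1 / 4 : ℝ)) := by
  obtain ⟨hN1, hN4, -, hNτ⟩ := NT_facts hτ
  set N := NT τ with hN
  have hτ0 : 0 < τ := by linarith
  have hl := log_ge_two hτ
  have hNr : (1 : ℝ) ≤ N := by exact_mod_cast hN1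
  obtain ⟨hi, hm⟩ := SD_mean (τ := τ) (σ := σ) hτ0 h1 N
  have h3 : AL (QG τ N) σ ≤ ∫ t : ℝ, 3 * (‖SD N (σ + t * I)‖ ^ 2 * Real.exp (-((t - τ) / τ) ^ 2)) := by
    refine MeasureTheory.integral_mono (QG_int (by linarith) N (by linarith) h2) (hi.const_mul _) fun t => ?_
    have := QG_le (τ := τ) (by linarith) N (s := σ + t * I) (by simp; linarith) (by simpa using h2)
    simpa using this
  rw [MeasureTheory.integral_const_mul] at h3
  have hL1 : 1 ≤ Real.log τ ^ (1 / 4 : ℝ) := Real.one_le_rpow (by linarith) (by norm_num)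
  have h4 : ∑ n ∈ Icc 1 N, dA (1 / 2) n ^ 2 / n ≤ 5 * Real.log τ ^ (1 / 4 : ℝ) := by
    refine (dA_sum_sq N hN1).trans ?_
    have h5 : Real.log N ≤ Real.log τ := Real.log_le_log (by linarith) hNτ
    have h6 : 0 ≤ Real.log N := Real.log_nonneg hNr
    calc _ ≤ (5 * Real.log τ) ^ (1 / 4 : ℝ) := Real.rpow_le_rpow (by linarith) (by linarith) (by norm_num)
      _ = 5 ^ (1 / 4 : ℝ) * Real.log τ ^ (1 / 4 : ℝ) := Real.mul_rpow (by norm_num) (by linarith)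
      _ ≤ _ := by
        gcongr
        calc (5 : ℝ) ^ (1 / 4 : ℝ) ≤ 5 ^ (1 : ℝ) := Real.rpow_le_rpow_of_exponent_le (by norm_num) (by norm_num)
          _ = 5 := Real.rpow_one 5
  have h5 : (N : ℝ) ^ 2 * Real.exp (-(τ ^ 2 * ((N : ℝ)⁻¹) ^ 2 / 4)) ≤ 384 := by
    rw [Real.exp_neg, ← div_eq_mul_inv, div_le_iff₀ (Real.exp_pos _)]
    have h6 := Real.pow_div_factorial_le_exp (x := τ ^ 2 * ((N : ℝ)⁻¹) ^ 2 / 4) (by positivity) 3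
    have h7 : (τ ^ 2 * ((N : ℝ)⁻¹) ^ 2 / 4) ^ 3 / (Nat.factorial 3 : ℝ) = τ ^ 6 / (384 * (N : ℝ) ^ 6) := by
      have : (Nat.factorial 3 : ℝ) = 6 := by norm_num [Nat.factorial]
      rw [this]; field_simp; norm_num
    rw [h7] at h6
    have h8 : (N : ℝ) ^ 2 ≤ 384 * (τ ^ 6 / (384 * (N : ℝ) ^ 6)) := by
      rw [mul_div_assoc', le_div_iff₀ (by positivity)]
      have : ((N : ℝ) ^ 4) ^ 2 ≤ (τ ^ 3) ^ 2 := by gcongr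
      nlinarith
    linarith
  have h6 : 2 * τ * (∑ n ∈ Icc 1 N, dA (1 / 2) n ^ 2 / n + N ^ 2 * Real.exp (-(τ ^ 2 * ((N : ℝ)⁻¹) ^ 2 / 4)))
      ≤ 2 * τ * (400 * Real.log τ ^ (1 / 4 : ℝ)) := by
    refine mul_le_mul_of_nonneg_left ?_ (by positivity)
    linarith
  linarith

lemma gauss_line {τ : ℝ} (hτ : 0 < τ) : MeasureTheory.Integrable (fun t : ℝ => Real.exp (-((t - τ) / τ) ^ 2)) ∧
    ∫ t : ℝ, Real.exp (-((t - τ) / τ) ^ 2) ≤ 2 * τ := by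
  have h0 : MeasureTheory.Integrable (fun t : ℝ => Real.exp (-1 * t ^ 2)) := integrable_exp_neg_mul_sq (by norm_num)
  have e : (fun t : ℝ => Real.exp (-((t - τ) / τ) ^ 2)) = fun t => (fun u : ℝ => (fun v => Real.exp (-1 * v ^ 2)) (u / τ)) (t - τ) := by
    funext t; simp
  constructor
  · rw [e]
    exact (h0.comp_div hτ.ne').comp_sub_right τ
  · rw [e, MeasureTheory.integral_sub_right_eq_self (fun u : ℝ => (fun v => Real.exp (-1 * v ^ 2)) (u / τ)) τ,
      MeasureTheory.Measure.integral_comp_div (fun v => Real.exp (-1 * v ^ 2)) τ, integral_gaussian, smul_eq_mul, abs_of_pos hτ, div_one]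
    have : √Real.pi ≤ 2 := by
      rw [Real.sqrt_le_left (by norm_num)]; linarith [Real.pi_lt_four]
    nlinarith

lemma DG_four {τ : ℝ} (hτ : 16 ≤ τ) : AL (DG τ (NT τ)) 4 ≤ 192 * τ ^ (-(9 / 4) : ℝ) * τ := by
  obtain ⟨hN1, -, hN2, -⟩ := NT_facts hτ
  set N := NT τ with hN
  have hτ0 : 0 < τ := by linarith
  obtain ⟨hi, hm⟩ := gauss_line hτ0
  have hNr : (1 : ℝ) ≤ N := by exact_mod_cast hN1
  have h3 : AL (DG τ N) 4 ≤ ∫ t : ℝ, 12 * ((N : ℝ) ^ 3)⁻¹ * Real.exp (-((t - τ) / τ) ^ 2) := by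
    refine MeasureTheory.integral_mono (DG_int (by linarith) N (by norm_num) le_rfl) (hi.const_mul _) fun t => ?_
    have hre : (((4 : ℝ) : ℂ) + t * I).re = 4 := by simp
    have him : (((4 : ℝ) : ℂ) + t * I).im = t := by simp
    have hne : ((4 : ℝ) : ℂ) + t * I ≠ 1 := fun h => by rw [h] at hre; norm_num at hre
    have e : DG τ N (((4 : ℝ) : ℂ) + t * I) = (riemannZeta (4 + t * I) - SD N (4 + t * I) ^ 2) *
        ((((4 : ℝ) : ℂ) + t * I - 1) / (((4 : ℝ) : ℂ) + t * I + 1)) * WG τ (((4 : ℝ) : ℂ) + t * I) := by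
      rw [DG, FG_eq τ hne, QG]; push_cast; ring
    have hq := q_le_one (s := ((4 : ℝ) : ℂ) + t * I) (by rw [hre]; norm_num)
    have hW := WG_le (τ := τ) (by linarith) (s := ((4 : ℝ) : ℂ) + t * I) (by rw [hre]; norm_num) (by rw [hre])
    rw [him] at hW
    show ‖DG τ N (((4 : ℝ) : ℂ) + t * I)‖ ≤ _
    rw [e, norm_mul, norm_mul]
    calc _ ≤ 4 * ((N : ℝ) ^ 3)⁻¹ * 1 * (3 * Real.exp (-((t - τ) / τ) ^ 2)) := by
          gcongr
          exact SD_approx N hN1 t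
      _ = _ := by ring
  rw [MeasureTheory.integral_const_mul] at h3
  refine h3.trans ?_
  have h4 : ((N : ℝ) ^ 3)⁻¹ ≤ 8 * τ ^ (-(9 / 4) : ℝ) := by
    have h5 : (τ ^ (3 / 4 : ℝ) / 2) ^ 3 ≤ (N : ℝ) ^ 3 := by gcongr
    have h6 : (τ ^ (3 / 4 : ℝ) / 2) ^ 3 = τ ^ (9 / 4 : ℝ) / 8 := by
      rw [div_pow, ← Real.rpow_natCast (τ ^ (3 / 4 : ℝ)), ← Real.rpow_mul hτ0.le]; norm_num
    rw [h6] at h5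
    have h7 : 0 < τ ^ (9 / 4 : ℝ) := by positivity
    rw [Real.rpow_neg hτ0.le, inv_le_comm₀ (by positivity) (by positivity)]
    rw [mul_inv, inv_inv]; linarith
  calc _ ≤ 12 * (8 * τ ^ (-(9 / 4) : ℝ)) * (2 * τ) := by gcongr
    _ = _ := by ring

lemma FG_first : ∃ C > 0, ∃ τ0 ≥ 16, ∀ τ ≥ τ0, AL (FG τ) (1 / 2) ≤ C * (τ * Real.log τ ^ (1 / 4 : ℝ)) := by
  obtain ⟨C, hC, hhalf⟩ := FG_half
  set c := 56 * Real.log (4 * C + 4) with hc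
  have hlog : 0 < Real.log (4 * C + 4) := Real.log_pos (by linarith)
  have hc0 : 0 < c := by positivity
  have hE : Real.exp (-(c / 56)) = (4 * C + 4)⁻¹ := by
    rw [Real.exp_neg, hc, mul_div_cancel_left₀ _ (by norm_num : (56 : ℝ) ≠ 0), Real.exp_log (by linarith)]
  set c3 := C * Real.exp (5 * c / 8) with hc3
  refine ⟨c3 * (2 * (2 * (2400 + C) + 1)) + C, by positivity, max 16 (Real.exp (4 * c + c * Real.log 192)), le_max_left _ _, fun τ hτ => ?_⟩
  have h16 : 16 ≤ τ := (le_max_left _ _).trans hτ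
  have hτ0 : 0 < τ := by linarith
  have h192 : 0 < Real.log 192 := Real.log_pos (by norm_num)
  have hlτ : 4 * c + c * Real.log 192 ≤ Real.log τ := by
    rw [Real.le_log_iff_exp_le hτ0]; exact (le_max_right _ _).trans hτ
  have hl2 := log_ge_two h16
  have hlp : 0 < Real.log τ := by linarith
  have hcl : c / Real.log τ ≤ 1 / 4 := by rw [div_le_iff₀ hlp]; nlinarith
  have h1 := hhalf τ c h16 hc0 hcl
  rw [← hc3] at h1
  set e := c / Real.log τ with he
  have he0 : 0 < e := by positivity
  set a := AL (FG τ) (1 / 2 + e) with ha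
  have ha0 : 0 ≤ a := AL_nonneg _ _
  set Λ := Real.log τ ^ (1 / 4 : ℝ) with hΛ
  have hΛ1 : 1 ≤ Λ := Real.one_le_rpow (by linarith) (by norm_num)
  have hτΛ : τ ≤ τ * Λ := by nlinarith
  set P := (2400 + C) * (τ * Λ) with hP
  have hD := AL_DG_le (τ := τ) (by linarith) (NT τ) (σ := 1 / 2) (by norm_num) (by norm_num)
  have hQ1 := QG_AL h16 (σ := 1 / 2) le_rfl (by norm_num)
  have hQ2 := QG_AL h16 (σ := 1 / 2 + e) (by linarith) (by linarith)
  have hA := AL_FG_le (τ := τ) (by linarith) (NT τ) (σ := 1 / 2 + e) (by linarith) (by linarith)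
  obtain ⟨B, hB⟩ := DG_decay (τ := τ) (by linarith) (NT τ)
  have h3 := AL_three_lines (DG_diff τ (NT τ)) (l := 1 / 2) (u := 4) (σ := 1 / 2 + e) (B := B) (by norm_num) (by linarith) (by linarith)
    (by norm_num) (fun s h1 h2 => hB s (by linarith) (by linarith))
  set θ := (1 / 2 + e - 1 / 2) / (4 - 1 / 2) with hθ
  have hθ' : θ = 2 * e / 7 := by rw [hθ]; ring
  have hCτ : C ≤ C * (τ * Λ) := by nlinarith
  have hboot := bootstrap_real (a := a) (D := AL (DG τ (NT τ)) (1 / 2)) (C3 := c3) (P := P) (τ := τ) (c := c) (θ := θ)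
    (L := 192 * τ ^ (-(9 / 4) : ℝ)) (q := 2 * Real.exp (-(9 * c / 14))) (by positivity) ha0 (by positivity) hτ0.le (AL_nonneg _ _)
    (by linarith) (by rw [hθ']; positivity) (by rw [hθ']; linarith) (by positivity)
    (by
      have h4 : AL (DG τ (NT τ)) 4 ^ θ ≤ (192 * τ ^ (-(9 / 4) : ℝ) * τ) ^ θ :=
        Real.rpow_le_rpow (AL_nonneg _ _) (DG_four h16) (by rw [hθ']; positivity)
      have h5 := mul_le_mul_of_nonneg_left h4 (Real.rpow_nonneg (AL_nonneg (DG τ (NT τ)) (1 / 2)) (1 - θ))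
      linarith)
    (by
      rw [Real.rpow_def_of_pos (by positivity), Real.log_mul (by norm_num) (by positivity), Real.log_rpow hτ0,
        show (2 : ℝ) * Real.exp (-(9 * c / 14)) = Real.exp (Real.log 2 + -(9 * c / 14)) by
          rw [Real.exp_add, Real.exp_log (by norm_num)], Real.exp_le_exp, hθ']
      have h4 : e * Real.log τ = c := by rw [he]; field_simp
      have h5 : e * Real.log 192 ≤ 1 := by
        rw [he, div_mul_eq_mul_div, div_le_one hlp]; linarith
      linarith [Real.log_two_gt_d9])
    (by
      have h4 : 2 * Real.exp (-(9 * c / 14)) * c3 = 2 * C * Real.exp (-(c / 56)) := by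
        rw [hc3, show -(c / 56) = -(9 * c / 14) + 5 * c / 8 by ring, Real.exp_add]; ring
      rw [h4, hE, ← div_eq_mul_inv, div_le_iff₀ (by linarith)]; linarith)
    (by
      have h4 : Real.exp (-(9 * c / 14)) ≤ Real.exp (-(c / 56)) := Real.exp_le_exp.mpr (by linarith)
      have h5 : (4 * C + 4)⁻¹ ≤ 1 / 4 := by rw [inv_le_comm₀ (by linarith) (by norm_num)]; linarith
      linarith)
    (by positivity)
  have hc30 : 0 ≤ c3 := by positivity
  have h4 : c3 * a ≤ c3 * (2 * (2 * P + τ * Λ)) := mul_le_mul_of_nonneg_left (by linarith) hc30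
  calc _ ≤ c3 * a + C := h1
    _ ≤ c3 * (2 * (2 * P + τ * Λ)) + C * (τ * Λ) := by linarith
    _ = _ := by rw [hP]; ring

lemma FG_strip : ∃ C > 0, ∃ τ0 ≥ 16, ∀ τ ≥ τ0, ∀ σ, 1 / 2 ≤ σ → σ ≤ 3 / 4 → AL (FG τ) σ ≤ C * (τ * Real.log τ ^ (1 / 4 : ℝ)) := by
  obtain ⟨C, hC, τ0, hτ0, h⟩ := FG_first
  refine ⟨C + 2592, by positivity, τ0, hτ0, fun τ hτ σ h1 h2 => ?_⟩
  have h16 : 16 ≤ τ := hτ0.trans hτ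
  have hl2 := log_ge_two h16
  set Λ := Real.log τ ^ (1 / 4 : ℝ) with hΛ
  have hΛ1 : 1 ≤ Λ := Real.one_le_rpow (by linarith) (by norm_num)
  set A := (C + 2592) * (τ * Λ) with hA
  have hτΛ : τ ≤ τ * Λ := by nlinarith
  have hA0 : 0 < A := by positivity
  have hhalf : AL (FG τ) (1 / 2) ≤ A := (h τ hτ).trans (by rw [hA]; nlinarith)
  have hfour : AL (FG τ) 4 ≤ A := by
    have h3 := AL_FG_le (τ := τ) (by linarith) (NT τ) (σ := 4) (by norm_num) le_rfl
    have h4 := DG_four h16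
    have h5 := QG_AL h16 (σ := 4) (by norm_num) le_rfl
    have h6 : τ ^ (-(9 / 4) : ℝ) ≤ 1 := Real.rpow_le_one_of_one_le_of_nonpos (by linarith) (by norm_num)
    have h7 : 192 * τ ^ (-(9 / 4) : ℝ) * τ ≤ 192 * τ := by nlinarith
    have h8 : 0 ≤ C * (τ * Λ) := by positivity
    rw [hA]; linarith
  obtain ⟨B, hB⟩ := FG_decay (τ := τ) (by linarith)
  have h3 := AL_three_lines (FG_diff τ) (l := 1 / 2) (u := 4) (σ := σ) (B := B) (by norm_num) (by linarith) (by linarith)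
    (by norm_num) (fun s h1 h2 => hB s (by linarith) (by linarith))
  set θ := (σ - 1 / 2) / (4 - 1 / 2) with hθ
  have hθ0 : 0 ≤ θ := div_nonneg (by linarith) (by norm_num)
  have hθ1 : θ ≤ 1 := by rw [hθ, div_le_one (by norm_num)]; linarith
  refine h3.trans ?_
  calc _ ≤ A ^ (1 - θ) * A ^ θ := by
        gcongr
        · exact Real.rpow_nonneg (AL_nonneg _ _) _
        · exact AL_nonneg _ _
        · exact AL_nonneg _ _
    _ = A := by rw [← Real.rpow_add hA0]; simp

lemma zeta_line_cont {σ : ℝ} (hσ : σ < 1) : Continuous fun t : ℝ => ‖riemannZeta (σ + t * I)‖ := by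
  refine continuous_iff_continuousAt.mpr fun t => ?_
  have hne : (σ : ℂ) + t * I ≠ 1 := fun h => by
    have := congrArg Complex.re h
    simp at this; linarith
  have h1 : ContinuousAt (fun t : ℝ => (σ : ℂ) + t * I) t := by fun_prop
  exact ((differentiableAt_riemannZeta hne).continuousAt.comp (f := fun t : ℝ => (σ : ℂ) + t * I) h1).norm

lemma first_moment : ∃ C > 0, ∃ τ0 ≥ (16 : ℝ), ∀ τ ≥ τ0, ∀ σ : ℝ, 1 / 2 ≤ σ → σ ≤ 3 / 4 →
    ∫ t in τ..(2 * τ), ‖riemannZeta (σ + t * I)‖ ≤ C * (τ * Real.log τ ^ (1 / 4 : ℝ)) := by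
  obtain ⟨C, hC, τ0, hτ0, h⟩ := FG_strip
  refine ⟨6 * C, by positivity, τ0, hτ0, fun τ hτ σ h1 h2 => ?_⟩
  have h16 : 16 ≤ τ := hτ0.trans hτ
  have h3 := h τ hτ σ h1 h2
  have hc := zeta_line_cont (σ := σ) (by linarith)
  have hi := FG_int (τ := τ) (by linarith) (σ := σ) (by linarith) (by linarith)
  have h4 : ∫ t in τ..(2 * τ), ‖riemannZeta (σ + t * I)‖ ≤ ∫ t in τ..(2 * τ), 6 * ‖FG τ (σ + t * I)‖ := by
    refine intervalIntegral.integral_mono_on (by linarith) (hc.intervalIntegrable _ _) (hi.const_mul 6).intervalIntegrable fun t ht => ?_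
    have hre : ((σ : ℂ) + t * I).re = σ := by simp
    have him : ((σ : ℂ) + t * I).im = t := by simp
    have hne : (σ : ℂ) + t * I ≠ 1 := fun h => by rw [h] at hre; norm_num at hre; linarith
    rw [FG_eq τ hne, norm_mul, norm_mul]
    have hq := q_ge (s := (σ : ℂ) + t * I) (by rw [hre]; linarith) (by rw [hre]; linarith)
      (by rw [him, abs_of_nonneg (by linarith [ht.1])]; linarith [ht.1])
    have hW : 1 / 3 ≤ ‖WG τ (σ + t * I)‖ := by
      rw [norm_WG (by linarith), him]
      have hv : ((t - τ) / τ) ^ 2 ≤ 1 := by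
        rw [sq_le_one_iff₀ (div_nonneg (by linarith [ht.1]) (by linarith)), div_le_one (by linarith)]; linarith [ht.2]
      have h5 : Real.exp (-1) ≤ Real.exp (-((t - τ) / τ) ^ 2) := Real.exp_le_exp.mpr (by linarith)
      have h6 : 1 ≤ Real.exp ((((σ : ℂ) + t * I).re / τ) ^ 2) := Real.one_le_exp (by positivity)
      have h7 : 1 / 3 ≤ Real.exp (-1) := by
        rw [Real.exp_neg, one_div]; exact inv_anti₀ (Real.exp_pos _) Real.exp_one_lt_three.le
      nlinarith
    have h8 : 1 / 2 * (1 / 3) ≤ ‖((σ : ℂ) + t * I - 1) / (σ + t * I + 1)‖ * ‖WG τ (σ + t * I)‖ :=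
      mul_le_mul hq hW (by norm_num) (norm_nonneg _)
    have h9 := mul_le_mul_of_nonneg_left h8 (norm_nonneg (riemannZeta (σ + t * I)))
    linarith
  refine h4.trans ?_
  rw [intervalIntegral.integral_const_mul, mul_assoc]
  refine mul_le_mul_of_nonneg_left (le_trans ?_ h3) (by norm_num)
  rw [intervalIntegral.integral_of_le (by linarith)]
  exact MeasureTheory.setIntegral_le_integral hi (Eventually.of_forall fun _ => norm_nonneg _)

/-- the first moment with a weight, in the form in which it is used -/
lemma FM : ∃ C > 0, ∀ σ Y : ℝ, 1 / 2 ≤ σ → σ ≤ 3 / 4 → 3 ≤ Y →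
    ∫ u in (1 : ℝ)..Y, ‖riemannZeta (σ + u * I)‖ / u ≤ C * Real.log Y ^ (5 / 4 : ℝ) := by
  obtain ⟨C, hC, τ0, hτ0, h⟩ := first_moment
  have hK : IsCompact {s : ℂ | s.re ∈ Set.Icc (1 / 2 : ℝ) (3 / 4) ∧ s.im ∈ Set.Icc (1 : ℝ) τ0} :=
    (isCompact_Icc (a := (1 / 2 : ℝ)) (b := 3 / 4)).reProdIm (isCompact_Icc (a := (1 : ℝ)) (b := τ0))
  obtain ⟨M, hM⟩ := hK.exists_bound_of_continuousOn (f := riemannZeta) fun s hs => by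
    refine (differentiableAt_riemannZeta fun h1 => ?_).continuousAt.continuousWithinAt
    have := hs.1.2
    rw [h1] at this; norm_num at this
  have hM0 : 0 ≤ M := (norm_nonneg _).trans (hM ⟨1 / 2, 1⟩ ⟨⟨le_rfl, by norm_num⟩, ⟨le_rfl, by show (1 : ℝ) ≤ τ0; linarith⟩⟩)
  have hlt : 0 < Real.log τ0 := Real.log_pos (by linarith)
  refine ⟨M * τ0 + C * 4 * (Real.log τ0 + 2), by positivity, fun σ Y h1 h2 hY => ?_⟩
  have hc := zeta_line_cont (σ := σ) (by linarith)
  have hint : ∀ a b : ℝ, 1 ≤ a → a ≤ b → IntervalIntegrable (fun u : ℝ => ‖riemannZeta (σ + u * I)‖ / u) MeasureTheory.volume a b := by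
    intro a b ha hab
    refine ContinuousOn.intervalIntegrable ?_
    rw [Set.uIcc_of_le hab]
    exact hc.continuousOn.div continuousOn_id fun u hu => by have := hu.1; simp; linarith
  have hpos : ∀ u : ℝ, 1 ≤ u → 0 ≤ ‖riemannZeta (σ + u * I)‖ / u := fun u hu => div_nonneg (norm_nonneg _) (by linarith)
  have hfirst : ∫ u in (1 : ℝ)..τ0, ‖riemannZeta (σ + u * I)‖ / u ≤ M * τ0 := by
    calc _ ≤ ∫ u in (1 : ℝ)..τ0, M := by
          refine intervalIntegral.integral_mono_on (by linarith) (hint _ _ le_rfl (by linarith)) (by simp) fun u hu => ?_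
          refine (div_le_self (norm_nonneg _) hu.1).trans (hM _ ⟨?_, ?_⟩)
          · simp; exact ⟨by linarith, h2⟩
          · simpa using hu
      _ ≤ _ := by simp; nlinarith
  have hind : ∀ k : ℕ, ∫ u in τ0..(τ0 * 2 ^ k), ‖riemannZeta (σ + u * I)‖ / u ≤ k * (C * Real.log (τ0 * 2 ^ k) ^ (1 / 4 : ℝ)) := by
    intro k
    induction k with
    | zero => simp
    | succ k ih =>
      have h2k : (1 : ℝ) ≤ 2 ^ k := one_le_pow₀ (by norm_num)
      set y := τ0 * 2 ^ k with hy
      have hyτ : τ0 ≤ y := by rw [hy]; nlinarith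
      have e : τ0 * 2 ^ (k + 1) = 2 * y := by rw [hy]; ring
      rw [e, ← intervalIntegral.integral_add_adjacent_intervals (hint τ0 y (by linarith) hyτ) (hint y (2 * y) (by linarith) (by linarith))]
      have h3 : ∫ u in y..(2 * y), ‖riemannZeta (σ + u * I)‖ / u ≤ C * Real.log y ^ (1 / 4 : ℝ) := by
        have h4 : ∫ u in y..(2 * y), ‖riemannZeta (σ + u * I)‖ / u ≤ ∫ u in y..(2 * y), ‖riemannZeta (σ + u * I)‖ / y := by
          refine intervalIntegral.integral_mono_on (by linarith) (hint _ _ (by linarith) (by linarith)) ?_ fun u hu => ?_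
          · exact (hc.div_const y).intervalIntegrable _ _
          · exact div_le_div_of_nonneg_left (norm_nonneg _) (by linarith) hu.1
        rw [intervalIntegral.integral_div] at h4
        refine h4.trans ?_
        rw [div_le_iff₀ (by linarith)]
        linarith [h y hyτ σ h1 h2]
      have h5 : Real.log y ^ (1 / 4 : ℝ) ≤ Real.log (2 * y) ^ (1 / 4 : ℝ) :=
        Real.rpow_le_rpow (Real.log_nonneg (by linarith)) (Real.log_le_log (by linarith) (by linarith)) (by norm_num)
      have h6 := mul_le_mul_of_nonneg_left h5 hC.le
      have h7 := mul_le_mul_of_nonneg_left h6 (Nat.cast_nonneg (α := ℝ) k)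
      push_cast
      linarith
  have hlY : 1 ≤ Real.log Y := log_ge_one hY
  set k := ⌈Real.logb 2 Y⌉₊ with hk
  have hlb : 0 ≤ Real.logb 2 Y := Real.logb_nonneg (by norm_num) (by linarith)
  have hk1 : Real.logb 2 Y ≤ k := Nat.le_ceil _
  have hk2 : (k : ℝ) < Real.logb 2 Y + 1 := Nat.ceil_lt_add_one hlb
  have hYk : Y ≤ 2 ^ k := by
    have := (Real.logb_le_iff_le_rpow (by norm_num) (by linarith)).mp hk1
    rwa [Real.rpow_natCast] at this
  have hlogb : Real.logb 2 Y ≤ 2 * Real.log Y := by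
    rw [Real.logb, div_le_iff₀ (by linarith [Real.log_two_gt_d9])]
    nlinarith [Real.log_two_gt_d9]
  have hk3 : (k : ℝ) ≤ 3 * Real.log Y := by linarith
  have hlk : Real.log (τ0 * 2 ^ k) ≤ (Real.log τ0 + 3) * Real.log Y := by
    rw [Real.log_mul (by linarith) (by positivity), Real.log_pow]
    nlinarith [Real.log_two_lt_d9, Real.log_two_gt_d9]
  have hbig : Y ≤ τ0 * 2 ^ k := by nlinarith
  have hτk : τ0 ≤ τ0 * 2 ^ k := by nlinarith
  calc _ ≤ ∫ u in (1 : ℝ)..(τ0 * 2 ^ k), ‖riemannZeta (σ + u * I)‖ / u := by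
        refine intervalIntegral.integral_mono_interval le_rfl (by linarith) hbig ?_ (hint _ _ le_rfl (by linarith))
        filter_upwards [MeasureTheory.self_mem_ae_restrict measurableSet_Ioc] with u hu
        exact hpos u hu.1.le
    _ = (∫ u in (1 : ℝ)..τ0, ‖riemannZeta (σ + u * I)‖ / u) + ∫ u in τ0..(τ0 * 2 ^ k), ‖riemannZeta (σ + u * I)‖ / u :=
        (intervalIntegral.integral_add_adjacent_intervals (hint _ _ le_rfl (by linarith)) (hint _ _ (by linarith) hτk)).symm
    _ ≤ M * τ0 + k * (C * Real.log (τ0 * 2 ^ k) ^ (1 / 4 : ℝ)) := add_le_add hfirst (hind k)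
    _ ≤ M * τ0 * Real.log Y ^ (5 / 4 : ℝ) + 3 * Real.log Y * (C * ((Real.log τ0 + 3) * Real.log Y ^ (1 / 4 : ℝ))) := by
        refine add_le_add ?_ ?_
        · exact le_mul_of_one_le_right (by positivity) (Real.one_le_rpow hlY (by norm_num))
        · refine mul_le_mul hk3 (mul_le_mul_of_nonneg_left ?_ hC.le) ?_ (by positivity)
          · calc _ ≤ ((Real.log τ0 + 3) * Real.log Y) ^ (1 / 4 : ℝ) :=
                  Real.rpow_le_rpow (Real.log_nonneg (by linarith)) hlk (by norm_num)
              _ = (Real.log τ0 + 3) ^ (1 / 4 : ℝ) * Real.log Y ^ (1 / 4 : ℝ) := Real.mul_rpow (by linarith) (by linarith)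
              _ ≤ _ := by
                gcongr
                calc (Real.log τ0 + 3) ^ (1 / 4 : ℝ) ≤ (Real.log τ0 + 3) ^ (1 : ℝ) :=
                      Real.rpow_le_rpow_of_exponent_le (by linarith) (by norm_num)
                  _ = _ := Real.rpow_one _
          · have : 0 ≤ Real.log (τ0 * 2 ^ k) := Real.log_nonneg (by linarith)
            positivity
    _ = (M * τ0 + C * 3 * (Real.log τ0 + 3)) * Real.log Y ^ (5 / 4 : ℝ) := by
        rw [show (5 / 4 : ℝ) = 1 + 1 / 4 by norm_num, Real.rpow_add (by linarith), Real.rpow_one]; ring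
    _ ≤ _ := by
        refine mul_le_mul_of_nonneg_right ?_ (by positivity)
        have h2' := log_ge_two hτ0
        nlinarith

/-! ### Consequences of RH and the residue at 1 -/

lemma zeta_ne_zero_RH (hRH : RiemannHypothesis) {s : ℂ} (hs : 1 / 2 < s.re) (h1 : s ≠ 1) : riemannZeta s ≠ 0 := by
  intro h0
  have h := hRH s h0 ?_ h1
  · linarith
  · rintro ⟨n, hn⟩
    have := congrArg Complex.re hn
    simp at this
    have hn0 : (0 : ℝ) ≤ n := Nat.cast_nonneg n
    linarith

lemma zeta1_ne_zero_RH (hRH : RiemannHypothesis) {s : ℂ} (hs : 1 / 2 < s.re) : riemannZeta₁ s ≠ 0 := by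
  by_cases h : s = 1
  · rw [h]; simp
  · have h1 := zeta_ne_zero_RH hRH hs h
    rw [riemannZeta_eq_inv_sub_mul h] at h1
    exact right_ne_zero_of_mul h1

noncomputable def NZ (s : ℂ) : ℂ := deriv riemannZeta₁ s * (s - 1) - riemannZeta₁ s

noncomputable def UZ (x : ℝ) (s : ℂ) : ℂ := NZ s ^ 2 / riemannZeta₁ s * PK x s

lemma hasDerivAt_zeta1 (s : ℂ) : HasDerivAt riemannZeta₁ (deriv riemannZeta₁ s) s :=
  (differentiable_riemannZeta₁ s).hasDerivAt

lemma hasDerivAt_dzeta1 (s : ℂ) : HasDerivAt (deriv riemannZeta₁) (deriv (deriv riemannZeta₁) s) s := by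
  have : Differentiable ℂ (deriv riemannZeta₁) := by
    have h := (differentiable_riemannZeta₁.differentiableOn (s := Set.univ)).deriv isOpen_univ
    exact differentiableOn_univ.mp h
  exact (this s).hasDerivAt

lemma differentiable_ddzeta1 : Differentiable ℂ (deriv (deriv riemannZeta₁)) := by
  have : Differentiable ℂ (deriv riemannZeta₁) := fun s => (hasDerivAt_dzeta1 s).differentiableAt
  exact differentiableOn_univ.mp ((this.differentiableOn (s := Set.univ)).deriv isOpen_univ)

lemma hasDerivAt_NZ (s : ℂ) : HasDerivAt NZ (deriv (deriv riemannZeta₁) s * (s - 1)) s := by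
  have h := ((hasDerivAt_dzeta1 s).mul ((hasDerivAt_id s).sub_const 1)).sub (hasDerivAt_zeta1 s)
  have h2 := h.congr_deriv (show _ = deriv (deriv riemannZeta₁) s * (s - 1) by simp)
  exact h2

lemma hasDerivAt_PK {y : ℝ} (hy : 0 < y) {s : ℂ} (hs : s ≠ 0) :
    HasDerivAt (PK y) (PK y s * ((Real.log y : ℂ) - 1 / s)) s := by
  have hy0 : (y : ℂ) ≠ 0 := by exact_mod_cast hy.ne'
  have h1 : HasDerivAt (fun s : ℂ => (y : ℂ) ^ s) ((y : ℂ) ^ s * Complex.log y * 1) s :=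
    (hasDerivAt_id s).const_cpow (Or.inl hy0)
  have h2 := h1.div (hasDerivAt_id s) hs
  have h3 := h2.congr_deriv (show _ = PK y s * ((Real.log y : ℂ) - 1 / s) by
    rw [PK, Complex.ofReal_log hy.le]; simp only [id]; field_simp)
  exact h3

noncomputable def LZ (x : ℝ) (s : ℂ) : ℂ := (Real.log x : ℂ) - 1 / s - deriv riemannZeta₁ s / riemannZeta₁ s

lemma hasDerivAt_WZ {x : ℝ} (hx : 0 < x) {s : ℂ} (hs : s ≠ 0) (hz : riemannZeta₁ s ≠ 0) :
    HasDerivAt (fun s => PK x s / riemannZeta₁ s) (PK x s / riemannZeta₁ s * LZ x s) s := by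
  have h := (hasDerivAt_PK hx hs).div (hasDerivAt_zeta1 s) hz
  exact h.congr_deriv (by rw [LZ]; field_simp)

lemma hasDerivAt_UZ {x : ℝ} (hx : 0 < x) {s : ℂ} (hs : s ≠ 0) (hz : riemannZeta₁ s ≠ 0) :
    HasDerivAt (UZ x) (PK x s / riemannZeta₁ s * (2 * NZ s * (deriv (deriv riemannZeta₁) s * (s - 1)) + NZ s ^ 2 * LZ x s)) s := by
  have h := ((hasDerivAt_NZ s).pow 2).mul (hasDerivAt_WZ hx hs hz)
  have e : UZ x = fun s => NZ s ^ 2 * (PK x s / riemannZeta₁ s) := by funext s; rw [UZ]; ring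
  rw [e]
  refine HasDerivAt.congr_deriv h ?_
  simp; ring

lemma UZ_second {x : ℝ} (hx : 0 < x) (C : ℕ → ℂ) (hC : ∀ᶠ s in nhdsWithin (1 : ℂ) {1}ᶜ,
      HasSum (fun j : ℕ => C j * (s - 1) ^ j) (riemannZeta s - 1 / (s - 1))) :
    deriv (deriv (UZ x)) 1 = x * ((Real.log x : ℂ) ^ 2 - 2 * Real.log x + 2 - 2 * C 0 * (Real.log x - 1) + 2 * C 0 ^ 2 - 6 * C 1) := by
  obtain ⟨hC0, hC1⟩ := zeta1_jet C hC
  have hz1 : riemannZeta₁ 1 = 1 := riemannZeta₁_one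
  have hev : deriv (UZ x) =ᶠ[nhds 1] fun s => PK x s / riemannZeta₁ s *
      (2 * NZ s * (deriv (deriv riemannZeta₁) s * (s - 1)) + NZ s ^ 2 * LZ x s) := by
    have h1 : ∀ᶠ s in nhds (1 : ℂ), s ≠ 0 := isOpen_ne.mem_nhds one_ne_zero
    have h2 : ∀ᶠ s in nhds (1 : ℂ), riemannZeta₁ s ≠ 0 :=
      differentiable_riemannZeta₁.continuous.continuousAt.eventually_ne (by rw [hz1]; exact one_ne_zero)
    filter_upwards [h1, h2] with s h1 h2
    exact (hasDerivAt_UZ hx h1 h2).deriv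
  rw [hev.deriv_eq]
  have hz : riemannZeta₁ 1 ≠ 0 := by rw [hz1]; exact one_ne_zero
  have hW := hasDerivAt_WZ hx one_ne_zero hz
  have hN := hasDerivAt_NZ 1
  have hL : HasDerivAt (LZ x) (1 - 2 * C 1 + C 0 ^ 2) 1 := by
    have ha : HasDerivAt (fun s : ℂ => 1 / s) (-1) 1 := by
      have := hasDerivAt_inv (one_ne_zero (α := ℂ))
      simpa using this
    have h := (ha.const_sub (Real.log x : ℂ)).sub ((hasDerivAt_dzeta1 1).div (hasDerivAt_zeta1 1) hz)
    have h' := h.congr_deriv (show _ = 1 - 2 * C 1 + C 0 ^ 2 by rw [hz1, hC0, hC1]; ring)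
    exact h'
  have hd2 : HasDerivAt (fun s => deriv (deriv riemannZeta₁) s * (s - 1)) (2 * C 1) 1 := by
    have h := (differentiable_ddzeta1 1).hasDerivAt.mul ((hasDerivAt_id (1 : ℂ)).sub_const 1)
    have h' := h.congr_deriv (show _ = 2 * C 1 by simp [hC1])
    exact h'
  have hN1 : NZ 1 = -1 := by simp [NZ]
  have hL1 : LZ x 1 = Real.log x - 1 - C 0 := by rw [LZ, hz1, hC0]; ring
  have hP1 : PK x 1 = x := by simp [PK]
  have hall := hW.mul (((hN.const_mul 2).mul hd2).add ((hN.pow 2).mul hL))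
  have h3 := hall.deriv
  have e : (deriv fun s => PK x s / riemannZeta₁ s * (2 * NZ s * (deriv (deriv riemannZeta₁) s * (s - 1)) + NZ s ^ 2 * LZ x s)) 1 =
    _ := h3
  rw [e]
  simp only [Pi.add_apply, Pi.mul_apply, Pi.pow_apply, hN1, hL1, hP1, hz1, sub_self, mul_zero]
  ring

lemma perron_residue (hRH : RiemannHypothesis) (C : ℕ → ℂ) (hC : ∀ᶠ s in nhdsWithin (1 : ℂ) {1}ᶜ,
      HasSum (fun j : ℕ => C j * (s - 1) ^ j) (riemannZeta s - 1 / (s - 1))) {x σ a : ℝ} (hx : 0 < x) (hσ : 1 / 2 < σ) (hσ1 : σ < 1)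
      (ha : 1 < a) :
    RI (fun s => fZ s * PK x s) σ a (-x) x = Real.pi * I * (x * ((Real.log x : ℂ) ^ 2 - 2 * Real.log x + 2 -
      2 * C 0 * (Real.log x - 1) + 2 * C 0 ^ 2 - 6 * C 1)) := by
  rw [← UZ_second hx C hC]
  have h := RI_triple (p := 1) (a := σ) (b := a) (c := -x) (d := x) (by simpa using hσ1) (by simpa using ha) (by simpa using hx)
    (by simpa using hx) (V := {s : ℂ | 1 / 2 < s.re}) (isOpen_lt continuous_const Complex.continuous_re)
    (fun s hs => lt_of_lt_of_le hσ hs.1.1) (U := UZ x) (fun s hs => by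
      have h0 : s ≠ 0 := fun h => by
        have h2 : 1 / 2 < s.re := hs
        rw [h] at h2; norm_num at h2
      exact (hasDerivAt_UZ hx h0 (zeta1_ne_zero_RH hRH hs)).differentiableAt.differentiableWithinAt)
  rw [← h]
  refine RI_congr (by linarith) (by linarith) fun s hs => ?_
  have hs1 : s ≠ 1 := by
    rintro rfl
    have := hs.2.2
    simp only [one_re, one_im] at this
    rcases this with h | h | h | h <;> linarith
  rw [fZ_near_one hs1, UZ, NZ]; ring

/-! ### Bounds for the shifted integral -/

lemma fZ_right_bound (hRH : RiemannHypothesis) {L B : ℝ} (hL : 0 < L) {s : ℂ} (hre : 1 / 2 + 1 / L ≤ s.re)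
    (h1 : s.re + 1 / L ≤ 1 ∨ 1 / L ≤ |s.im|) (hB : ∀ z ∈ Metric.closedBall s (1 / (2 * L)), ‖riemannZeta z‖ ≤ B) :
    ‖fZ s‖ ≤ 16 * L ^ 2 * B := by
  have hb : ∀ z ∈ Metric.ball s (1 / L), 1 / 2 < z.re ∧ z ≠ 1 := by
    intro z hz
    rw [Metric.mem_ball, dist_eq_norm] at hz
    have h2 := (Complex.abs_re_le_norm (z - s)).trans_lt hz
    have h3 := (Complex.abs_im_le_norm (z - s)).trans_lt hz
    rw [abs_lt, sub_re] at h2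
    refine ⟨by linarith, ?_⟩
    rintro rfl
    rcases h1 with h1 | h1
    · rw [one_re] at h2; linarith
    · rw [sub_im, one_im, zero_sub, abs_neg] at h3; linarith
  have h := local_bound_sup (F := riemannZeta) (s := s) (r := 1 / (2 * L)) (R := 1 / L) (by positivity)
    (by rw [div_lt_div_iff₀ (by positivity) hL]; linarith)
    (fun z hz => (differentiableAt_riemannZeta (hb z hz).2).differentiableWithinAt)
    (fun z hz => zeta_ne_zero_RH hRH (hb z hz).1 (hb z hz).2) hB
  refine h.trans (le_of_eq ?_)
  field_simp; ring

/-! ### The asymptotic formula for the summatory function -/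

lemma log_ge_six {x : ℝ} (hx : 1000 ≤ x) : 6 ≤ Real.log x := by
  rw [Real.le_log_iff_exp_le (by linarith)]
  have h1 : Real.exp 6 = Real.exp 1 ^ 6 := by rw [← Real.exp_nat_mul]; norm_num
  rw [h1]
  calc Real.exp 1 ^ 6 ≤ 3 ^ 6 := by gcongr; exact Real.exp_one_lt_three.le
    _ ≤ x := by norm_num; linarith

lemma log_two_mul_le {x : ℝ} (hx : 3 ≤ x) : Real.log (2 * x) ≤ 2 * Real.log x := by
  rw [Real.log_mul (by norm_num) (by linarith)]
  linarith [Real.log_le_log (by norm_num) (by linarith : (2 : ℝ) ≤ x)]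

lemma horiz_bound (hRH : RiemannHypothesis) : ∃ C > 0, ∀ x σ t : ℝ, 1000 ≤ x → 1 / 2 + 1 / Real.log x ≤ σ → σ ≤ aX x → |t| = x →
    ‖fZ (σ + t * I) * PK x (σ + t * I)‖ ≤ C * Real.log x ^ 3 := by
  obtain ⟨C, hC, hz⟩ := zeta_bound
  refine ⟨16 * C * 2 * 9 * 2, by positivity, fun x σ t hx hσ hσa ht => ?_⟩
  have hL := log_ge_six hx
  have ha2 := aX_le (x := x) (by linarith)
  set L := Real.log x with hLd
  have hL0 : 0 < L := by linarith
  have hre : ((σ : ℂ) + t * I).re = σ := by simp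
  have him : ((σ : ℂ) + t * I).im = t := by simp
  have hr1 : 1 / (2 * L) ≤ 1 := by rw [div_le_one (by positivity)]; linarith
  have hr0 : 0 < 1 / (2 * L) := by positivity
  have hLr : 1 / L = 2 * (1 / (2 * L)) := by field_simp
  set r := 1 / (2 * L) with hr
  set e := max (1 - σ + r) 0 with he
  have hf := fZ_right_bound hRH (L := L) (B := C * (2 * x) ^ e * Real.log (2 * x)) hL0 (s := σ + t * I) (by rw [hre]; exact hσ)
    (Or.inr (by rw [him, ht, hLr]; linarith)) (by
      intro z hz'
      rw [Metric.mem_closedBall, dist_eq_norm] at hz'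
      have h2 := (Complex.abs_re_le_norm (z - (σ + t * I))).trans hz'
      have h3 := (Complex.abs_im_le_norm (z - (σ + t * I))).trans hz'
      rw [abs_le, sub_re, hre] at h2
      rw [sub_im, him] at h3
      have h4 : |t| - |z.im| ≤ r := by
        have := abs_sub_abs_le_abs_sub t z.im
        rw [abs_sub_comm] at this; linarith
      have h5 : |z.im| - |t| ≤ r := by
        have := abs_sub_abs_le_abs_sub z.im t
        linarith
      rw [ht] at h4 h5
      have h6 := hz z (by linarith) (by linarith) (by linarith)
      refine h6.trans ?_
      have h7 : |z.im| ^ max (1 - z.re) 0 ≤ (2 * x) ^ e := by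
        calc _ ≤ (2 * x) ^ max (1 - z.re) 0 := Real.rpow_le_rpow (abs_nonneg _) (by linarith) (le_max_right _ _)
          _ ≤ _ := Real.rpow_le_rpow_of_exponent_le (by linarith) (max_le_max (by linarith) le_rfl)
      have h8 : Real.log |z.im| ≤ Real.log (2 * x) := Real.log_le_log (by linarith) (by linarith)
      have h9 : 0 ≤ Real.log |z.im| := Real.log_nonneg (by linarith)
      gcongr)
  have hP := norm_PK_le (y := x) (by linarith) (s := σ + t * I) (X := x) (by linarith) (by
    have := Complex.abs_im_le_norm ((σ : ℂ) + t * I)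
    rw [him, ht] at this; exact this)
  rw [hre] at hP
  have he1 : e ≤ 1 := max_le (by linarith) zero_le_one
  have h2e : (2 * x) ^ e ≤ 2 * x ^ e := by
    rw [Real.mul_rpow (by norm_num) (by linarith)]
    gcongr
    calc (2 : ℝ) ^ e ≤ 2 ^ (1 : ℝ) := Real.rpow_le_rpow_of_exponent_le (by norm_num) he1
      _ = 2 := Real.rpow_one 2
  have hxx : x ^ e * (x ^ σ / x) ≤ 9 := by
    have h1 : x ^ e * (x ^ σ / x) = x ^ (e + σ - 1) := by
      rw [Real.rpow_sub (by linarith), Real.rpow_add (by linarith), Real.rpow_one]; ring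
    rw [h1]
    have h2 : e + σ - 1 ≤ 2 / L := by
      have h3 : 2 / L = 4 * r := by rw [hr]; field_simp; norm_num
      have h4 : σ ≤ 1 + 2 * r := by rw [aX] at hσa; linarith
      rw [h3]
      rcases le_total (1 - σ + r) 0 with h | h
      · rw [he, max_eq_right h]; linarith
      · rw [he, max_eq_left h]; linarith
    calc x ^ (e + σ - 1) ≤ x ^ (2 / L) := Real.rpow_le_rpow_of_exponent_le (by linarith) h2
      _ = Real.exp 2 := by rw [Real.rpow_def_of_pos (by linarith), ← hLd]; congr 1; field_simp
      _ = Real.exp 1 ^ 2 := by rw [← Real.exp_nat_mul]; norm_num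
      _ ≤ 3 ^ 2 := by gcongr; exact Real.exp_one_lt_three.le
      _ = 9 := by norm_num
  have hl2 := log_two_mul_le (x := x) (by linarith)
  rw [norm_mul]
  have hlog0 : 0 ≤ Real.log (2 * x) := Real.log_nonneg (by linarith)
  have hx0 : 0 < x := by linarith
  calc _ ≤ 16 * L ^ 2 * (C * (2 * x) ^ e * Real.log (2 * x)) * (x ^ σ / x) := by gcongr
    _ ≤ 16 * L ^ 2 * (C * (2 * x ^ e) * (2 * L)) * (x ^ σ / x) := by gcongr
    _ = 16 * L ^ 3 * C * 4 * (x ^ e * (x ^ σ / x)) := by ring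
    _ ≤ 16 * L ^ 3 * C * 4 * 9 := by gcongr
    _ = _ := by ring

lemma zeta_norm_conj (s : ℂ) : ‖fZ ((starRingEnd ℂ) s)‖ = ‖fZ s‖ := by
  have hd : deriv riemannZeta ((starRingEnd ℂ) s) = (starRingEnd ℂ) (deriv riemannZeta s) := by
    have h := congrFun (deriv_conj_conj (f := riemannZeta)) s
    have e : (starRingEnd ℂ) ∘ riemannZeta ∘ (starRingEnd ℂ) = riemannZeta := by
      funext z; simp [riemannZeta_conj]
    rw [e] at h
    rw [h]; simp
  rw [fZ, fZ, hd, riemannZeta_conj, ← map_pow, ← map_div₀, RCLike.norm_conj]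

lemma swap_cont {a b c d : ℝ} (hab : a ≤ b) (hcd : c ≤ d) {h : ℝ → ℝ → ℝ}
    (hc : ContinuousOn (fun p : ℝ × ℝ => h p.1 p.2) (Set.Icc a b ×ˢ Set.Icc c d)) :
    ∫ x in a..b, ∫ y in c..d, h x y = ∫ y in c..d, ∫ x in a..b, h x y := by
  simp only [intervalIntegral.integral_of_le hab, intervalIntegral.integral_of_le hcd]
  refine MeasureTheory.integral_integral_swap ?_
  have h1 : MeasureTheory.IntegrableOn (fun p : ℝ × ℝ => h p.1 p.2) (Set.Icc a b ×ˢ Set.Icc c d) (MeasureTheory.volume.prod MeasureTheory.volume) :=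
    hc.integrableOn_compact (isCompact_Icc.prod isCompact_Icc)
  have h2 := h1.mono_set (Set.prod_mono Set.Ioc_subset_Icc_self Set.Ioc_subset_Icc_self)
  rw [MeasureTheory.IntegrableOn, ← MeasureTheory.Measure.prod_restrict] at h2
  exact h2

lemma zeta_circle_cont {σ r : ℝ} (h : σ + r < 1) (hr : 0 ≤ r) :
    Continuous fun p : ℝ × ℝ => ‖riemannZeta (circleMap (σ + p.1 * I) r p.2)‖ := by
  refine continuous_iff_continuousAt.mpr fun p => ?_
  have hg : Continuous fun p : ℝ × ℝ => circleMap (σ + p.1 * I) r p.2 := by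
    unfold circleMap; fun_prop
  have hne : circleMap (σ + p.1 * I) r p.2 ≠ 1 := by
    intro h1
    have h2 : circleMap (σ + p.1 * I) r p.2 - (σ + p.1 * I) = (1 : ℂ) - (σ + p.1 * I) := by rw [h1]
    have h3 : ‖(1 : ℂ) - (σ + p.1 * I)‖ = r := by
      rw [← h2, circleMap_sub_center, norm_circleMap_zero, abs_of_nonneg hr]
    have h4 := Complex.re_le_norm ((1 : ℂ) - (σ + p.1 * I))
    rw [h3] at h4; simp at h4; linarith
  exact ((differentiableAt_riemannZeta hne).continuousAt.comp (f := fun p : ℝ × ℝ => circleMap (σ + p.1 * I) r p.2) hg.continuousAt).norm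

lemma fZ_line_cont (hRH : RiemannHypothesis) {σ : ℝ} (h : 1 / 2 < σ) (h1 : σ < 1) : Continuous fun t : ℝ => fZ (σ + t * I) := by
  refine continuous_iff_continuousAt.mpr fun t => ?_
  have hre : ((σ : ℂ) + t * I).re = σ := by simp
  have hne : (σ : ℂ) + t * I ≠ 1 := fun h => by rw [h] at hre; simp at hre; linarith
  have hz := zeta_ne_zero_RH hRH (s := σ + t * I) (by rw [hre]; exact h) hne
  have hd : DifferentiableOn ℂ riemannZeta {1}ᶜ := fun s hs => (differentiableAt_riemannZeta hs).differentiableWithinAt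
  have hd' := (hd.deriv isOpen_compl_singleton).differentiableAt (isOpen_compl_singleton.mem_nhds hne)
  have hf : ContinuousAt fZ (σ + t * I) := by
    unfold fZ
    exact (hd'.continuousAt.pow 2).div (differentiableAt_riemannZeta hne).continuousAt hz
  exact hf.comp (f := fun t : ℝ => (σ : ℂ) + t * I) (by fun_prop)

lemma left_high (hRH : RiemannHypothesis) : ∃ C > 0, ∀ x : ℝ, 1000 ≤ x →
    ∫ t in (2 : ℝ)..x, ‖fZ (((1 / 2 + 1 / Real.log x : ℝ) : ℂ) + t * I)‖ / t ≤ C * Real.log x ^ (13 / 4 : ℝ) := by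
  obtain ⟨C, hC, hFM⟩ := FM
  refine ⟨128 * C, by positivity, fun x hx => ?_⟩
  have hL := log_ge_six hx
  set L := Real.log x with hLd
  have hL0 : 0 < L := by linarith
  have hLr : 1 / L = 2 * (1 / (2 * L)) := by field_simp
  have hr0 : 0 < 1 / (2 * L) := by positivity
  have hr1 : 1 / (2 * L) ≤ 1 / 12 := by
    rw [div_le_div_iff₀ (by positivity) (by norm_num)]; linarith
  have hr4 : 4 / (1 / (2 * L)) ^ 2 = 16 * L ^ 2 := by field_simp; norm_num
  set r := 1 / (2 * L) with hr
  set σ := 1 / 2 + 1 / L with hσ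
  have hpt : ∀ t : ℝ, ‖fZ (σ + t * I)‖ ≤ 16 * L ^ 2 * ((2 * Real.pi)⁻¹ * ∫ θ in (0:ℝ)..2 * Real.pi, ‖riemannZeta (circleMap (σ + t * I) r θ)‖) := by
    intro t
    have hre : ((σ : ℂ) + t * I).re = σ := by simp
    have hb : ∀ z ∈ Metric.ball ((σ : ℂ) + t * I) (1 / L), 1 / 2 < z.re ∧ z ≠ 1 := by
      intro z hz
      rw [Metric.mem_ball, dist_eq_norm] at hz
      have h2 := (Complex.abs_re_le_norm (z - (σ + t * I))).trans_lt hz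
      rw [abs_lt, sub_re, hre] at h2
      refine ⟨by linarith, ?_⟩
      rintro rfl
      rw [one_re] at h2; linarith
    have h := local_bound (F := riemannZeta) (s := σ + t * I) (r := r) (R := 1 / L) hr0 (by linarith)
      (fun z hz => (differentiableAt_riemannZeta (hb z hz).2).differentiableWithinAt)
      (fun z hz => zeta_ne_zero_RH hRH (hb z hz).1 (hb z hz).2)
    rw [hr4] at h
    exact h
  have hcc := zeta_circle_cont (σ := σ) (r := r) (by linarith) hr0.le
  have hcon : ContinuousOn (fun p : ℝ × ℝ => ‖riemannZeta (circleMap (σ + p.1 * I) r p.2)‖ / p.1) (Set.Icc 2 x ×ˢ Set.Icc 0 (2 * Real.pi)) :=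
    hcc.continuousOn.div continuous_fst.continuousOn fun p hp => by have := hp.1.1; linarith
  have hpi := Real.pi_pos
  have hinner : ∀ θ : ℝ, ∫ t in (2 : ℝ)..x, ‖riemannZeta (circleMap (σ + t * I) r θ)‖ / t ≤ 2 * (C * Real.log (2 * x) ^ (5 / 4 : ℝ)) := by
    intro θ
    set σ' := σ + r * Real.cos θ with hσ'
    set η := r * Real.sin θ with hη
    have hcos := Real.abs_cos_le_one θ
    have hsin := Real.abs_sin_le_one θ
    rw [abs_le] at hcos hsin
    have hσ'1 : 1 / 2 ≤ σ' := by rw [hσ', hσ, hLr]; nlinarith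
    have hσ'2 : σ' ≤ 3 / 4 := by rw [hσ', hσ, hLr]; nlinarith
    have hη1 : -1 ≤ η := by rw [hη]; nlinarith
    have hη2 : η ≤ 1 := by rw [hη]; nlinarith
    have ecirc : ∀ t : ℝ, circleMap (σ + t * I) r θ = σ' + ((t + η : ℝ) : ℂ) * I := by
      intro t
      rw [circleMap, Complex.exp_mul_I, hσ', hη]; push_cast; ring
    have hzc := zeta_line_cont (σ := σ') (by linarith)
    have hzi : ∀ a b : ℝ, 0 < a → a ≤ b → IntervalIntegrable (fun u : ℝ => ‖riemannZeta (σ' + u * I)‖ / u) MeasureTheory.volume a b := by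
      intro a b ha hab
      refine ContinuousOn.intervalIntegrable ?_
      rw [Set.uIcc_of_le hab]
      exact hzc.continuousOn.div continuousOn_id fun u hu => by have := hu.1; simp; linarith
    calc ∫ t in (2 : ℝ)..x, ‖riemannZeta (circleMap (σ + t * I) r θ)‖ / t
        ≤ ∫ t in (2 : ℝ)..x, 2 * (‖riemannZeta (σ' + ((t + η : ℝ) : ℂ) * I)‖ / (t + η)) := by
          refine intervalIntegral.integral_mono_on (by linarith) ?_ ?_ fun t ht => ?_
          · refine ContinuousOn.intervalIntegrable ?_
            rw [Set.uIcc_of_le (by linarith)]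
            have : Continuous fun t : ℝ => ‖riemannZeta (circleMap (σ + t * I) r θ)‖ :=
              hcc.comp (f := fun t : ℝ => (t, θ)) (by fun_prop)
            exact this.continuousOn.div continuousOn_id fun u hu => by have := hu.1; simp; linarith
          · refine ContinuousOn.intervalIntegrable ?_
            rw [Set.uIcc_of_le (by linarith)]
            have : Continuous fun t : ℝ => ‖riemannZeta (σ' + ((t + η : ℝ) : ℂ) * I)‖ :=
              hzc.comp (f := fun t : ℝ => t + η) (by fun_prop)
            exact (this.continuousOn.div (by fun_prop) fun u hu => by have := hu.1; linarith).const_smul (2 : ℝ)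
          · rw [ecirc t, ← mul_div_assoc, div_le_div_iff₀ (by linarith [ht.1]) (by linarith [ht.1])]
            have h0 := norm_nonneg (riemannZeta (σ' + ((t + η : ℝ) : ℂ) * I))
            nlinarith [ht.1]
      _ = 2 * ∫ u in (2 + η)..(x + η), ‖riemannZeta (σ' + u * I)‖ / u := by
          rw [intervalIntegral.integral_const_mul]
          congr 1
          exact intervalIntegral.integral_comp_add_right (fun u : ℝ => ‖riemannZeta (σ' + (u : ℂ) * I)‖ / u) η
      _ ≤ 2 * ∫ u in (1 : ℝ)..(2 * x), ‖riemannZeta (σ' + u * I)‖ / u := by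
          refine mul_le_mul_of_nonneg_left ?_ (by norm_num)
          refine intervalIntegral.integral_mono_interval (by linarith) (by linarith) (by linarith) ?_ (hzi _ _ (by norm_num) (by linarith))
          filter_upwards [MeasureTheory.self_mem_ae_restrict measurableSet_Ioc] with u hu
          exact div_nonneg (norm_nonneg _) (by linarith [hu.1])
      _ ≤ _ := mul_le_mul_of_nonneg_left (hFM σ' (2 * x) hσ'1 hσ'2 (by linarith)) (by norm_num)
  have hfc := fZ_line_cont hRH (σ := σ) (by rw [hσ]; linarith) (by rw [hσ]; linarith)
  have hJc : Continuous fun t : ℝ => ∫ θ in (0:ℝ)..2 * Real.pi, ‖riemannZeta (circleMap (σ + t * I) r θ)‖ :=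
    intervalIntegral.continuous_parametric_intervalIntegral_of_continuous' hcc _ _
  have hlog := log_two_mul_le (x := x) (by linarith)
  have hlog0 : 0 ≤ Real.log (2 * x) := Real.log_nonneg (by linarith)
  have h54 : Real.log (2 * x) ^ (5 / 4 : ℝ) ≤ 4 * L ^ (5 / 4 : ℝ) := by
    calc _ ≤ (2 * L) ^ (5 / 4 : ℝ) := Real.rpow_le_rpow hlog0 hlog (by norm_num)
      _ = 2 ^ (5 / 4 : ℝ) * L ^ (5 / 4 : ℝ) := Real.mul_rpow (by norm_num) hL0.le
      _ ≤ _ := by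
        gcongr
        calc (2 : ℝ) ^ (5 / 4 : ℝ) ≤ 2 ^ (2 : ℝ) := Real.rpow_le_rpow_of_exponent_le (by norm_num) (by norm_num)
          _ = 4 := by norm_num
  calc ∫ t in (2 : ℝ)..x, ‖fZ (σ + t * I)‖ / t
      ≤ ∫ t in (2 : ℝ)..x, (16 * L ^ 2 * (2 * Real.pi)⁻¹) * ∫ θ in (0:ℝ)..2 * Real.pi, ‖riemannZeta (circleMap (σ + t * I) r θ)‖ / t := by
        refine intervalIntegral.integral_mono_on (by linarith) ?_ ?_ fun t ht => ?_
        · refine ContinuousOn.intervalIntegrable ?_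
          rw [Set.uIcc_of_le (by linarith)]
          exact hfc.norm.continuousOn.div continuousOn_id fun u hu => by have := hu.1; simp; linarith
        · simp only [intervalIntegral.integral_div]
          refine ContinuousOn.intervalIntegrable ?_
          rw [Set.uIcc_of_le (by linarith)]
          exact continuousOn_const.mul (hJc.continuousOn.div continuousOn_id fun u hu => by have := hu.1; simp; linarith)
        · rw [intervalIntegral.integral_div, ← mul_div_assoc]
          refine div_le_div_of_nonneg_right ?_ (by linarith [ht.1])
          rw [mul_assoc]
          exact hpt t
    _ = (16 * L ^ 2 * (2 * Real.pi)⁻¹) * ∫ θ in (0:ℝ)..2 * Real.pi, ∫ t in (2 : ℝ)..x, ‖riemannZeta (circleMap (σ + t * I) r θ)‖ / t := by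
        rw [intervalIntegral.integral_const_mul, swap_cont (by linarith) (by positivity) hcon]
    _ ≤ (16 * L ^ 2 * (2 * Real.pi)⁻¹) * ∫ θ in (0:ℝ)..2 * Real.pi, 2 * (C * Real.log (2 * x) ^ (5 / 4 : ℝ)) := by
        refine mul_le_mul_of_nonneg_left ?_ (by positivity)
        by_cases hii : IntervalIntegrable (fun θ => ∫ t in (2 : ℝ)..x, ‖riemannZeta (circleMap (σ + t * I) r θ)‖ / t) MeasureTheory.volume 0 (2 * Real.pi)
        · exact intervalIntegral.integral_mono_on (by positivity) hii (by simp) fun θ _ => hinner θ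
        · rw [intervalIntegral.integral_undef hii, intervalIntegral.integral_const, smul_eq_mul]
          have : 0 ≤ Real.log (2 * x) ^ (5 / 4 : ℝ) := Real.rpow_nonneg hlog0 _
          simp only [sub_zero]; positivity
    _ = 32 * L ^ 2 * C * Real.log (2 * x) ^ (5 / 4 : ℝ) := by
        rw [intervalIntegral.integral_const, smul_eq_mul]; field_simp; ring
    _ ≤ 32 * L ^ 2 * C * (4 * L ^ (5 / 4 : ℝ)) := by gcongr
    _ = _ := by
        rw [show (13 / 4 : ℝ) = (2 : ℕ) + 5 / 4 by norm_num, Real.rpow_add hL0, Real.rpow_natCast]; ring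

lemma left_low (hRH : RiemannHypothesis) : ∃ C > 0, ∀ x t : ℝ, 1000 ≤ x → |t| ≤ 2 →
    ‖fZ (((1 / 2 + 1 / Real.log x : ℝ) : ℂ) + t * I)‖ ≤ C * Real.log x ^ 2 := by
  have hK : IsCompact {s : ℂ | s.re ∈ Set.Icc (1 / 4 : ℝ) (3 / 4) ∧ s.im ∈ Set.Icc (-3 : ℝ) 3} :=
    (isCompact_Icc (a := (1 / 4 : ℝ)) (b := 3 / 4)).reProdIm (isCompact_Icc (a := (-3 : ℝ)) (b := 3))
  obtain ⟨M, hM⟩ := hK.exists_bound_of_continuousOn (f := riemannZeta) fun s hs => by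
    refine (differentiableAt_riemannZeta fun h1 => ?_).continuousAt.continuousWithinAt
    have := hs.1.2
    rw [h1] at this; norm_num at this
  refine ⟨16 * (|M| + 1), by positivity, fun x t hx ht => ?_⟩
  have hL := log_ge_six hx
  set L := Real.log x with hLd
  have hL0 : 0 < L := by linarith
  have hLr : 1 / L = 2 * (1 / (2 * L)) := by field_simp
  have hr0 : 0 < 1 / (2 * L) := by positivity
  have hr1 : 1 / (2 * L) ≤ 1 / 12 := by
    rw [div_le_div_iff₀ (by positivity) (by norm_num)]; linarith
  have hre : (((1 / 2 + 1 / L : ℝ) : ℂ) + t * I).re = 1 / 2 + 1 / L := by simp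
  have him : (((1 / 2 + 1 / L : ℝ) : ℂ) + t * I).im = t := by simp
  rw [abs_le] at ht
  have h := fZ_right_bound hRH hL0 (s := ((1 / 2 + 1 / L : ℝ) : ℂ) + t * I) (B := |M| + 1) (by rw [hre])
    (Or.inl (by rw [hre]; linarith)) (fun z hz => by
      rw [Metric.mem_closedBall, dist_eq_norm] at hz
      have h2 := (Complex.abs_re_le_norm _).trans hz
      have h3 := (Complex.abs_im_le_norm _).trans hz
      rw [abs_le, sub_re, hre] at h2
      rw [abs_le, sub_im, him] at h3
      refine (hM z ⟨⟨by linarith, by linarith⟩, ⟨by linarith, by linarith⟩⟩).trans ?_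
      linarith [le_abs_self M])
  linarith

lemma left_line (hRH : RiemannHypothesis) : ∃ C > 0, ∀ x : ℝ, 1000 ≤ x →
    ‖∫ t in (-x)..x, fZ (((1 / 2 + 1 / Real.log x : ℝ) : ℂ) + t * I) * PK x (((1 / 2 + 1 / Real.log x : ℝ) : ℂ) + t * I)‖ ≤
      C * (√x * Real.log x ^ (13 / 4 : ℝ)) := by
  obtain ⟨C1, hC1, hlow⟩ := left_low hRH
  obtain ⟨C2, hC2, hhigh⟩ := left_high hRH
  refine ⟨24 * C1 + 6 * C2, by positivity, fun x hx => ?_⟩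
  have hL := log_ge_six hx
  have hh := hhigh x hx
  have hl := hlow x
  have hx0 : 0 < x := by linarith
  set L := Real.log x with hLd
  have hL0 : 0 < L := by linarith
  have h1L : 1 / L ≤ 1 / 6 := div_le_div_of_nonneg_left (by norm_num) (by norm_num) hL
  have h1L0 : 0 < 1 / L := by positivity
  have hxs : x ^ (1 / 2 + 1 / L) ≤ 3 * √x := by
    rw [Real.rpow_add hx0, ← Real.sqrt_eq_rpow]
    have : x ^ (1 / L) = Real.exp 1 := by
      rw [Real.rpow_def_of_pos hx0, ← hLd]; congr 1; field_simp
    rw [this, mul_comm]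
    exact mul_le_mul_of_nonneg_right Real.exp_one_lt_three.le (Real.sqrt_nonneg _)
  set σ := 1 / 2 + 1 / L with hσ
  have hre : ∀ t : ℝ, ((σ : ℂ) + t * I).re = σ := fun t => by simp
  have him : ∀ t : ℝ, ((σ : ℂ) + t * I).im = t := fun t => by simp
  have hfc := fZ_line_cont hRH (σ := σ) (by linarith) (by linarith)
  have hc : Continuous fun t : ℝ => fZ (σ + t * I) * PK x (σ + t * I) := hfc.mul (PK_cont hx0 (by linarith))
  have hi : ∀ a b : ℝ, IntervalIntegrable (fun t : ℝ => fZ (σ + t * I) * PK x (σ + t * I)) MeasureTheory.volume a b := fun a b => hc.intervalIntegrable a b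
  have hP : ∀ t : ℝ, ∀ X : ℝ, 0 < X → X ≤ ‖(σ : ℂ) + t * I‖ → ‖PK x (σ + t * I)‖ ≤ 3 * √x / X := by
    intro t X hX h
    refine (norm_PK_le hx0 hX h).trans ?_
    rw [hre]; exact div_le_div_of_nonneg_right hxs hX.le
  have hmid : ‖∫ t in (-2 : ℝ)..2, fZ (σ + t * I) * PK x (σ + t * I)‖ ≤ C1 * L ^ 2 * (6 * √x) * 4 := by
    have h := intervalIntegral.norm_integral_le_of_norm_le_const (a := (-2 : ℝ)) (b := 2) (C := C1 * L ^ 2 * (6 * √x))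
      (f := fun t : ℝ => fZ (σ + t * I) * PK x (σ + t * I)) (fun t ht => by
        rw [Set.uIoc_of_le (by norm_num)] at ht
        rw [norm_mul]
        have h1 := hl t hx (abs_le.mpr ⟨ht.1.le, ht.2⟩)
        have h2 := hP t (1 / 2) (by norm_num) (by
          have := Complex.re_le_norm ((σ : ℂ) + t * I)
          rw [hre] at this; linarith)
        have h3 : 3 * √x / (1 / 2) = 6 * √x := by ring
        rw [h3] at h2
        exact mul_le_mul h1 h2 (norm_nonneg _) (by positivity))
    rw [show |(2 : ℝ) - -2| = 4 by norm_num] at h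
    exact h
  have hbase : ∀ g : ℝ → ℂ, Continuous g → (∀ t : ℝ, 2 ≤ t → ‖g t‖ ≤ ‖fZ (σ + t * I)‖ * (3 * √x / t)) →
      ‖∫ t in (2 : ℝ)..x, g t‖ ≤ 3 * √x * (C2 * L ^ (13 / 4 : ℝ)) := by
    intro g hg hgb
    have hdiv : IntervalIntegrable (fun t : ℝ => ‖fZ (σ + t * I)‖ / t) MeasureTheory.volume 2 x := by
      refine ContinuousOn.intervalIntegrable ?_
      rw [Set.uIcc_of_le (by linarith)]
      exact hfc.norm.continuousOn.div continuousOn_id fun u hu => by have := hu.1; simp; linarith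
    calc _ ≤ ∫ t in (2 : ℝ)..x, 3 * √x * (‖fZ (σ + t * I)‖ / t) := by
          refine intervalIntegral.norm_integral_le_of_norm_le (by linarith) ?_ (hdiv.const_mul _)
          filter_upwards with t ht
          refine (hgb t ht.1.le).trans (le_of_eq ?_)
          ring
      _ = 3 * √x * ∫ t in (2 : ℝ)..x, ‖fZ (σ + t * I)‖ / t := intervalIntegral.integral_const_mul _ _
      _ ≤ _ := mul_le_mul_of_nonneg_left hh (by positivity)
  have hright := hbase (fun t : ℝ => fZ (σ + t * I) * PK x (σ + t * I)) hc (fun t ht => by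
    rw [norm_mul]
    refine mul_le_mul_of_nonneg_left (hP t t (by linarith) ?_) (norm_nonneg _)
    have := Complex.abs_im_le_norm ((σ : ℂ) + t * I)
    rw [him, abs_of_nonneg (by linarith)] at this; exact this)
  have hleft := hbase (fun t : ℝ => fZ (σ + ((-t : ℝ) : ℂ) * I) * PK x (σ + ((-t : ℝ) : ℂ) * I)) (hc.comp (f := fun t : ℝ => -t) (by fun_prop)) (fun t ht => by
    rw [norm_mul]
    have e : (σ : ℂ) + ((-t : ℝ) : ℂ) * I = (starRingEnd ℂ) (σ + t * I) := by
      apply Complex.ext <;> simp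
    have e2 : ‖fZ (σ + ((-t : ℝ) : ℂ) * I)‖ = ‖fZ (σ + t * I)‖ := by rw [e, zeta_norm_conj]
    rw [e2]
    refine mul_le_mul_of_nonneg_left (hP (-t) t (by linarith) ?_) (norm_nonneg _)
    have := Complex.abs_im_le_norm ((σ : ℂ) + ((-t : ℝ) : ℂ) * I)
    rw [him, abs_neg, abs_of_nonneg (by linarith)] at this; exact this)
  have hneg : ∫ t in (2 : ℝ)..x, fZ (σ + ((-t : ℝ) : ℂ) * I) * PK x (σ + ((-t : ℝ) : ℂ) * I) =
      ∫ t in (-x)..(-2), fZ (σ + t * I) * PK x (σ + t * I) :=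
    intervalIntegral.integral_comp_neg (fun t : ℝ => fZ (σ + t * I) * PK x (σ + t * I))
  rw [hneg] at hleft
  rw [← intervalIntegral.integral_add_adjacent_intervals (hi (-x) (-2)) (hi (-2) x),
    ← intervalIntegral.integral_add_adjacent_intervals (hi (-2) 2) (hi 2 x)]
  have hpow : L ^ 2 ≤ L ^ (13 / 4 : ℝ) := by
    rw [← Real.rpow_natCast]
    exact Real.rpow_le_rpow_of_exponent_le (by linarith) (by norm_num)
  have h5 : C1 * L ^ 2 * (6 * √x) * 4 ≤ C1 * L ^ (13 / 4 : ℝ) * (6 * √x) * 4 := by gcongr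
  refine (norm_add_le _ _).trans ?_
  have h6 := norm_add_le (∫ t in (-2 : ℝ)..2, fZ (σ + t * I) * PK x (σ + t * I)) (∫ t in (2 : ℝ)..x, fZ (σ + t * I) * PK x (σ + t * I))
  linarith

lemma DX_asymp (hRH : RiemannHypothesis) (C : ℕ → ℂ) (hC : ∀ᶠ s in nhdsWithin (1 : ℂ) {1}ᶜ,
      HasSum (fun j : ℕ => C j * (s - 1) ^ j) (riemannZeta s - 1 / (s - 1))) :
    ∃ K > 0, ∀ x : ℝ, 1000 ≤ x → ‖2 * (DX x : ℂ) - x * ((Real.log x : ℂ) ^ 2 - 2 * Real.log x + 2 -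
      2 * C 0 * (Real.log x - 1) + 2 * C 0 ^ 2 - 6 * C 1)‖ ≤ K * (√x * Real.log x ^ (13 / 4 : ℝ)) := by
  obtain ⟨C1, hC1, hper⟩ := perron
  obtain ⟨C2, hC2, hh⟩ := horiz_bound hRH
  obtain ⟨C3, hC3, hl⟩ := left_line hRH
  refine ⟨C1 + 2 * C2 + C3, by positivity, fun x hx => ?_⟩
  have hL := log_ge_six hx
  have hper := hper x (by linarith)
  have hl := hl x hx
  have ha1 := aX_gt (x := x) (by linarith)
  have hx0 : 0 < x := by linarith
  have hres := perron_residue hRH C hC (x := x) (σ := 1 / 2 + 1 / Real.log x) (a := aX x) hx0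
    (by have : 0 < 1 / Real.log x := by positivity
        linarith)
    (by have : 1 / Real.log x ≤ 1 / 6 := div_le_div_of_nonneg_left (by norm_num) (by norm_num) hL
        linarith) ha1
  have hh := hh x
  set Q : ℂ := x * ((Real.log x : ℂ) ^ 2 - 2 * Real.log x + 2 -
      2 * C 0 * (Real.log x - 1) + 2 * C 0 ^ 2 - 6 * C 1) with hQ
  have haX : aX x - (1 / 2 + 1 / Real.log x) = 1 / 2 := by rw [aX]; ring
  have hhor : ∀ t : ℝ, |t| = x → ‖∫ y in (1 / 2 + 1 / Real.log x)..(aX x), (fun s => fZ s * PK x s) (y + t * I)‖ ≤ C2 * Real.log x ^ 3 := by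
    intro t ht
    have h := intervalIntegral.norm_integral_le_of_norm_le_const (a := 1 / 2 + 1 / Real.log x) (b := aX x) (C := C2 * Real.log x ^ 3)
      (f := fun y : ℝ => fZ (y + t * I) * PK x (y + t * I)) (fun y hy => by
        rw [Set.uIoc_of_le (by linarith)] at hy
        exact hh y t hx hy.1.le hy.2 ht)
    rw [haX] at h
    refine h.trans ?_
    rw [abs_of_nonneg (by norm_num)]
    have : 0 ≤ C2 * Real.log x ^ 3 := by positivity
    linarith
  rw [RI] at hres
  have hb := hhor (-x) (by rw [abs_neg, abs_of_pos hx0])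
  have ht := hhor x (abs_of_pos hx0)
  set bot := ∫ y in (1 / 2 + 1 / Real.log x)..(aX x), (fun s => fZ s * PK x s) (y + ((-x : ℝ) : ℂ) * I) with hbot
  set top := ∫ y in (1 / 2 + 1 / Real.log x)..(aX x), (fun s => fZ s * PK x s) (y + (x : ℂ) * I) with htop
  set lef := ∫ t in (-x)..x, fZ (((1 / 2 + 1 / Real.log x : ℝ) : ℂ) + t * I) * PK x (((1 / 2 + 1 / Real.log x : ℝ) : ℂ) + t * I) with hlef
  set rig := ∫ t in (-x)..x, fZ (aX x + t * I) * PK x (aX x + t * I) with hrig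
  have hres' : bot - top + I * rig - I * lef = Real.pi * I * Q := hres
  have key : (Real.pi : ℂ) * (2 * (DX x : ℂ) - Q) = -(rig - 2 * Real.pi * DX x) + lef + I * bot - I * top := by
    have : I * (bot - top + I * rig - I * lef) = I * (Real.pi * I * Q) := by rw [hres']
    have hI := Complex.I_mul_I
    linear_combination (-1 : ℂ) * this + (rig - lef - Real.pi * Q) * hI
  have hpow : Real.log x ^ 3 ≤ √x * Real.log x ^ (13 / 4 : ℝ) := by
    have h1 : Real.log x ^ 3 ≤ Real.log x ^ (13 / 4 : ℝ) := by
      rw [← Real.rpow_natCast]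
      exact Real.rpow_le_rpow_of_exponent_le (by linarith) (by norm_num)
    have h2 : 1 ≤ √x := by rw [Real.one_le_sqrt]; linarith
    nlinarith [Real.rpow_nonneg (by linarith : 0 ≤ Real.log x) (13 / 4 : ℝ)]
  have hn : Real.pi * ‖2 * (DX x : ℂ) - Q‖ ≤ C1 * Real.log x ^ 3 + C3 * (√x * Real.log x ^ (13 / 4 : ℝ)) + 2 * (C2 * Real.log x ^ 3) := by
    have e : Real.pi * ‖2 * (DX x : ℂ) - Q‖ = ‖(Real.pi : ℂ) * (2 * (DX x : ℂ) - Q)‖ := by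
      rw [norm_mul, Complex.norm_real, Real.norm_of_nonneg Real.pi_pos.le]
    rw [e, key]
    have h1 := norm_sub_le (-(rig - 2 * Real.pi * DX x) + lef + I * bot) (I * top)
    have h2 := norm_add_le (-(rig - 2 * Real.pi * DX x) + lef) (I * bot)
    have h3 := norm_add_le (-(rig - 2 * Real.pi * DX x)) lef
    rw [norm_neg] at h3
    rw [norm_mul, norm_I, one_mul] at h1 h2
    linarith
  have h0 := norm_nonneg (2 * (DX x : ℂ) - Q)
  have hpi := Real.pi_gt_three
  have h7 : ‖2 * (DX x : ℂ) - Q‖ ≤ Real.pi * ‖2 * (DX x : ℂ) - Q‖ := by nlinarith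
  have h8 := mul_le_mul_of_nonneg_left hpow hC1.le
  have h9 := mul_le_mul_of_nonneg_left hpow hC2.le
  linarith

/-! ### Residues at the zeros and the argument principle -/

lemma zeta_analyticAt {p : ℂ} (hp : p ≠ 1) : AnalyticAt ℂ riemannZeta p := by
  have : DifferentiableOn ℂ riemannZeta {(1 : ℂ)}ᶜ := fun s hs =>
    (differentiableAt_riemannZeta hs).differentiableWithinAt
  exact this.analyticAt (isOpen_compl_singleton.mem_nhds hp)

lemma zeta_im_ne_zero (hRH : RiemannHypothesis) {s : ℂ} (him : s.im ≠ 0) (hre : s.re ≠ 1 / 2) :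
    riemannZeta s ≠ 0 := by
  intro h
  refine hre (hRH s h ?_ (ne_one_of_im him))
  rintro ⟨n, rfl⟩
  apply him
  simp

lemma res_tendsto (hRH : RiemannHypothesis) {p : ℂ} (him : p.im ≠ 0) (hp : riemannZeta p = 0) :
    Tendsto (fun s => (s - p) * fZ s) (nhdsWithin p {p}ᶜ)
      (nhds ((zetaZeroOrder p : ℂ) * iteratedDeriv 1 riemannZeta p)) := by
  have hp1 := ne_one_of_im him
  have hA := zeta_analyticAt hp1
  have hd := hA.deriv
  have hdc : Tendsto (deriv riemannZeta) (nhdsWithin p {p}ᶜ) (nhds (deriv riemannZeta p)) :=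
    hd.continuousAt.tendsto.mono_left nhdsWithin_le_nhds
  rw [iteratedDeriv_one]
  by_cases hz : deriv riemannZeta p = 0
  · -- multiple zero
    have hne : ¬ ∀ᶠ z in nhds p, riemannZeta z = 0 := by
      intro hall
      have h2 : ∀ᶠ z in nhdsWithin p {p}ᶜ, riemannZeta z = 0 := hall.filter_mono nhdsWithin_le_nhds
      have h3 : ∀ᶠ z : ℂ in nhds p, z.im ≠ 0 :=
        (isOpen_ne_fun Complex.continuous_im continuous_const).mem_nhds him
      have h4 : ∀ᶠ z : ℂ in nhds p, z.re = 1 / 2 := by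
        filter_upwards [hall, h3] with z hz1 hz2
        by_contra h
        exact zeta_im_ne_zero hRH hz2 h hz1
      obtain ⟨ε, hε, hb⟩ := Metric.eventually_nhds_iff.mp h4
      have h5 := hb (y := p + (ε / 2 : ℝ)) (by
        rw [dist_eq_norm, add_sub_cancel_left, Complex.norm_real, Real.norm_of_nonneg (by linarith)]
        linarith)
      have h6 := hb (y := p) (by simpa using hε)
      simp at h5 h6
      linarith
    obtain ⟨n, h, hh, hh0, heq⟩ := (hA.exists_eventuallyEq_pow_smul_nonzero_iff).mpr hne
    have hdh := hh.deriv
    have hev : ∀ᶠ z in nhds p, fZ z * (z - p) = (n + (z - p) * deriv h z / h z) * deriv riemannZeta z ∨ z = p := by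
      have e1 : ∀ᶠ z in nhds p, riemannZeta =ᶠ[nhds z] (fun z => (z - p) ^ n • h z) := heq.eventually_nhds
      filter_upwards [e1, hh.eventually_analyticAt, hh.continuousAt.eventually_ne hh0] with z hz1 hz2 hz3
      by_cases hzp : z = p
      · exact Or.inr hzp
      left
      have hzp' : z - p ≠ 0 := sub_ne_zero.mpr hzp
      have v := hz1.eq_of_nhds
      have d := hz1.deriv_eq
      have d2 : HasDerivAt (fun z => (z - p) ^ n • h z)
          ((n : ℂ) * (z - p) ^ (n - 1) * 1 * h z + (z - p) ^ n * deriv h z) z := by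
        exact (((hasDerivAt_id' z).sub_const p).pow n).mul hz2.differentiableAt.hasDerivAt
      rw [d2.deriv] at d
      have hζ : riemannZeta z ≠ 0 := by
        rw [v]; exact mul_ne_zero (pow_ne_zero _ hzp') hz3
      have key : deriv riemannZeta z * (z - p) = (n + (z - p) * deriv h z / h z) * riemannZeta z := by
        rw [d, v, smul_eq_mul]
        rcases n with _ | k
        · field_simp; push_cast; ring
        · simp only [Nat.add_sub_cancel]; field_simp; ring
      rw [fZ]
      rw [div_mul_eq_mul_div, div_eq_iff hζ]
      linear_combination deriv riemannZeta z * key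
    rw [hz, mul_zero]
    have hlim : Tendsto (fun z => ((n : ℂ) + (z - p) * deriv h z / h z) * deriv riemannZeta z) (nhdsWithin p {p}ᶜ) (nhds 0) := by
      have c : ContinuousAt (fun z => ((n : ℂ) + (z - p) * deriv h z / h z) * deriv riemannZeta z) p := by
        refine ContinuousAt.mul (continuousAt_const.add ?_) hd.continuousAt
        exact ((continuousAt_id.sub continuousAt_const).mul hdh.continuousAt).div hh.continuousAt hh0
      have := c.tendsto.mono_left (nhdsWithin_le_nhds (s := {p}ᶜ))
      rwa [hz, mul_zero] at this
    refine hlim.congr' ?_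
    filter_upwards [hev.filter_mono nhdsWithin_le_nhds, self_mem_nhdsWithin] with z h1 h2
    rcases h1 with h1 | h1
    · rw [← h1]; ring
    · exact absurd h1 h2
  · have ho : zetaZeroOrder p = 1 := by
      unfold zetaZeroOrder
      apply le_antisymm
      · apply Nat.sInf_le
        simpa [iteratedDeriv_one] using hz
      · apply le_csInf
        · exact ⟨1, by simpa [iteratedDeriv_one] using hz⟩
        · intro k hk
          rcases Nat.eq_zero_or_pos k with h0 | h0
          · subst h0; simp [iteratedDeriv_zero, hp] at hk
          · exact h0
    rw [ho, Nat.cast_one, one_mul]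
    have hs := (hasDerivAt_iff_tendsto_slope.mp hA.differentiableAt.hasDerivAt)
    have h2 := (hdc.pow 2).mul (hs.inv₀ hz)
    have e : deriv riemannZeta p ^ 2 * (deriv riemannZeta p)⁻¹ = deriv riemannZeta p := by
      field_simp
    rw [e] at h2
    refine h2.congr' ?_
    filter_upwards [] with z
    rw [slope_def_field, hp, sub_zero, fZ, inv_div]; ring

lemma RC_compact (a b c d : ℝ) : IsCompact (RC a b c d) := by
  have h := (isCompact_Icc (a := a) (b := b)).reProdIm (isCompact_Icc (a := c) (b := d))
  have e : RC a b c d = Set.Icc a b ×ℂ Set.Icc c d := by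
    ext s; rw [Complex.mem_reProdIm]; rfl
  rw [e]; exact h

lemma zeros_finite (a b c d : ℝ) : {s | s ∈ RC a b c d ∧ riemannZeta s = 0}.Finite := by
  have := (RC_compact a b c d).inter_riemannZetaZeros_finite
  refine this.subset ?_
  intro s hs
  refine ⟨hs.1, ?_⟩
  first | exact hs.2 | exact mem_riemannZetaZeros.mpr hs.2

lemma arg_principle (hRH : RiemannHypothesis) {t0 T α : ℝ} (h0 : 0 < t0) (hT : t0 < T) (hα : -1 ≤ α) (hα2 : α < 1 / 2)
    (n0 : ∀ s : ℂ, s.im = t0 → riemannZeta s ≠ 0) (nT : ∀ s : ℂ, s.im = T → riemannZeta s ≠ 0) :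
    RI fZ α 2 t0 T = 2 * Real.pi * I * (zetaZeroSum 1 T - zetaZeroSum 1 t0) := by
  have hQ := zeros_finite (-2) 3 (t0 / 2) (T + 1)
  set Q := hQ.toFinset with hQd
  set P := Q.filter (fun s => t0 < s.im ∧ s.im < T) with hPd
  have memQ : ∀ s, s ∈ Q ↔ s ∈ RC (-2) 3 (t0 / 2) (T + 1) ∧ riemannZeta s = 0 := by
    intro s; rw [hQd, Set.Finite.mem_toFinset]; rfl
  have reQ : ∀ s, riemannZeta s = 0 → 0 < s.im → s.re = 1 / 2 := by
    intro s h1 h2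
    by_contra h
    exact zeta_im_ne_zero hRH h2.ne' h h1
  have memP : ∀ s, s ∈ P ↔ riemannZeta s = 0 ∧ t0 < s.im ∧ s.im < T := by
    intro s
    rw [hPd, Finset.mem_filter, memQ]
    constructor
    · rintro ⟨⟨_, h1⟩, h2⟩; exact ⟨h1, h2⟩
    · rintro ⟨h1, h2, h3⟩
      have := reQ s h1 (by linarith)
      refine ⟨⟨⟨⟨?_, ?_⟩, ⟨?_, ?_⟩⟩, h1⟩, h2, h3⟩ <;> linarith
  set U : Set ℂ := {s : ℂ | -2 < s.re ∧ s.re < 3 ∧ t0 / 2 < s.im ∧ s.im < T + 1} \ ((Q \ P : Finset ℂ) : Set ℂ) with hUd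
  have hU : IsOpen U := by
    refine IsOpen.sdiff ?_ (Finset.finite_toSet _).isClosed
    refine (isOpen_lt continuous_const Complex.continuous_re).inter ?_
    refine (isOpen_lt Complex.continuous_re continuous_const).inter ?_
    exact (isOpen_lt continuous_const Complex.continuous_im).inter
      (isOpen_lt Complex.continuous_im continuous_const)
  have hRU : RC α 2 t0 T ⊆ U := by
    rintro s ⟨⟨h1, h2⟩, ⟨h3, h4⟩⟩
    refine ⟨⟨by linarith, by linarith, by linarith, by linarith⟩, ?_⟩
    intro hs
    rw [Finset.mem_coe, Finset.mem_sdiff, memQ, memP] at hs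
    obtain ⟨⟨_, hz⟩, h5⟩ := hs
    apply h5
    refine ⟨hz, lt_of_le_of_ne h3 ?_, lt_of_le_of_ne h4 ?_⟩
    · intro h; exact n0 s h.symm hz
    · intro h; exact nT s h hz
  have hdiff : DifferentiableOn ℂ fZ (U \ P) := by
    rintro s ⟨⟨⟨h1, h2, h3, h4⟩, h5⟩, h6⟩
    have him : s.im ≠ 0 := by linarith
    have hz : riemannZeta s ≠ 0 := by
      intro hz
      apply h5
      rw [Finset.mem_coe, Finset.mem_sdiff]
      refine ⟨(memQ s).mpr ⟨⟨⟨h1.le, h2.le⟩, ⟨h3.le, h4.le⟩⟩, hz⟩, h6⟩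
    have hA := zeta_analyticAt (ne_one_of_im him)
    exact ((hA.deriv.pow 2).div hA hz).differentiableAt.differentiableWithinAt
  have main := RI_residues (by linarith : α ≤ 2) hT.le U hU hRU P
    (fun p => (zetaZeroOrder p : ℂ) * iteratedDeriv 1 riemannZeta p) fZ (by
      intro p hp
      rw [memP] at hp
      have := reQ p hp.1 (by linarith [hp.2.1])
      exact ⟨by linarith, by linarith, hp.2⟩) hdiff (by
      intro p hp
      rw [memP] at hp
      exact res_tendsto hRH (by linarith [hp.2.1] : 0 < p.im).ne' hp.1)
  rw [main]
  congr 1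
  have hfin : ∀ t : ℝ, {ρ : ℂ | IsNontrivialZero ρ ∧ 0 < ρ.im ∧ ρ.im ≤ t}.Finite := by
    intro t
    refine (zeros_finite 0 1 0 t).subset ?_
    rintro s ⟨⟨h1, h2, h3⟩, h4, h5⟩
    exact ⟨⟨⟨h2.le, h3.le⟩, ⟨h4.le, h5⟩⟩, h1⟩
  have hun : {ρ : ℂ | IsNontrivialZero ρ ∧ 0 < ρ.im ∧ ρ.im ≤ T} =
      {ρ : ℂ | IsNontrivialZero ρ ∧ 0 < ρ.im ∧ ρ.im ≤ t0} ∪ (P : Set ℂ) := by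
    ext s
    simp only [Set.mem_union, Set.mem_setOf_eq, Finset.mem_coe, memP]
    constructor
    · rintro ⟨h1, h2, h3⟩
      rcases le_or_gt s.im t0 with h | h
      · exact Or.inl ⟨h1, h2, h⟩
      · exact Or.inr ⟨h1.1, h, lt_of_le_of_ne h3 (fun h => nT s h h1.1)⟩
    · rintro (⟨h1, h2, h3⟩ | ⟨h1, h2, h3⟩)
      · exact ⟨h1, h2, by linarith⟩
      · have := reQ s h1 (by linarith)
        exact ⟨⟨h1, by linarith, by linarith⟩, by linarith, h3.le⟩
  have hdis : Disjoint {ρ : ℂ | IsNontrivialZero ρ ∧ 0 < ρ.im ∧ ρ.im ≤ t0} (P : Set ℂ) := by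
    rw [Set.disjoint_left]
    rintro s ⟨_, _, h3⟩ h4
    rw [Finset.mem_coe, memP] at h4
    linarith [h4.2.1]
  unfold zetaZeroSum
  rw [hun, finsum_mem_union hdis (hfin t0) P.finite_toSet, finsum_mem_coe_finset]
  ring

lemma exists_t0 : ∃ t0 : ℝ, 16 ≤ t0 ∧ t0 ≤ 17 ∧ ∀ s : ℂ, 0 ≤ s.re → s.re ≤ 1 → s.im = t0 → riemannZeta s ≠ 0 := by
  have hf := (zeros_finite 0 1 16 17).image Complex.im
  obtain ⟨t, ht, hn⟩ := (Set.Icc_infinite (show (16 : ℝ) < 17 by norm_num)).exists_notMem_finite hf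
  refine ⟨t, ht.1, ht.2, ?_⟩
  intro s h1 h2 h3 hz
  apply hn
  refine ⟨s, ⟨⟨⟨h1, h2⟩, ?_⟩, hz⟩, h3⟩
  rw [h3]; exact ht

/-! ### Bounds on the horizontal edges -/

lemma zeta_top : ∃ C > (0 : ℝ), ∀ (T : ℝ) (z : ℂ), 1000 ≤ T → -(4 / Real.log T) ≤ z.re → z.re ≤ 4 → |z.im - T| ≤ 1 →
    ‖riemannZeta z‖ ≤ C * (√T * Real.log T) := by
  obtain ⟨C1, hC1, H1⟩ := zeta_bound
  obtain ⟨C2, hC2, H2⟩ := zeta_bound_left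
  refine ⟨(C1 + C2) * (2 * Real.exp 8 * 2), by positivity, fun T z hT h1 h2 h3 => ?_⟩
  have hL := log_ge_six hT
  have hL0 : 0 < Real.log T := by linarith
  have h4 : 4 / Real.log T ≤ 1 := by rw [div_le_one hL0]; linarith
  have h40 : 0 < 4 / Real.log T := by positivity
  rw [abs_le] at h3
  have hT0 : 0 < T := by linarith
  have him : |z.im| = z.im := abs_of_pos (by linarith)
  have him2 : z.im ≤ 2 * T := by linarith
  have him1 : 2 ≤ z.im := by linarith
  have hlog : Real.log z.im ≤ 2 * Real.log T :=
    (Real.log_le_log (by linarith) him2).trans (log_two_mul_le (by linarith))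
  have hlog0 : 0 ≤ Real.log z.im := Real.log_nonneg (by linarith)
  have key : ‖riemannZeta z‖ ≤ (C1 + C2) * z.im ^ (1 / 2 + 4 / Real.log T) * Real.log z.im := by
    rcases le_or_gt z.re (1 / 2) with h | h
    · have := H2 z (by linarith) h (by rw [him]; linarith)
      rw [him] at this
      refine this.trans ?_
      refine mul_le_mul_of_nonneg_right ?_ hlog0
      refine mul_le_mul (by linarith) ?_ (by positivity) (by positivity)
      refine Real.rpow_le_rpow_of_exponent_le (by linarith) ?_
      have : max (-z.re) 0 ≤ 4 / Real.log T := max_le (by linarith) h40.le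
      linarith
    · have := H1 z (by linarith) (by linarith) (by rw [him]; linarith)
      rw [him] at this
      refine this.trans ?_
      refine mul_le_mul_of_nonneg_right ?_ hlog0
      refine mul_le_mul (by linarith) ?_ (by positivity) (by positivity)
      refine Real.rpow_le_rpow_of_exponent_le (by linarith) ?_
      exact max_le (by linarith) (by linarith)
  have hp : z.im ^ (1 / 2 + 4 / Real.log T) ≤ √T * (2 * Real.exp 8) := by
    rw [Real.rpow_add (by linarith)]
    have e1 : z.im ^ (1 / 2 : ℝ) ≤ 2 * √T := by
      rw [← Real.sqrt_eq_rpow]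
      have : 2 * √T = √(4 * T) := by
        rw [Real.sqrt_mul (by norm_num), show (4 : ℝ) = 2 ^ 2 by norm_num, Real.sqrt_sq (by norm_num)]
      rw [this]
      exact Real.sqrt_le_sqrt (by linarith)
    have e2 : z.im ^ (4 / Real.log T) ≤ Real.exp 8 := by
      rw [Real.rpow_def_of_pos (by linarith), Real.exp_le_exp]
      calc Real.log z.im * (4 / Real.log T) ≤ (2 * Real.log T) * (4 / Real.log T) :=
            mul_le_mul_of_nonneg_right hlog h40.le
        _ = 8 := by field_simp; norm_num
    calc z.im ^ (1 / 2 : ℝ) * z.im ^ (4 / Real.log T) ≤ (2 * √T) * Real.exp 8 :=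
          mul_le_mul e1 e2 (by positivity) (by positivity)
      _ = _ := by ring
  refine key.trans ?_
  calc (C1 + C2) * z.im ^ (1 / 2 + 4 / Real.log T) * Real.log z.im
      ≤ (C1 + C2) * (√T * (2 * Real.exp 8)) * (2 * Real.log T) := by
        refine mul_le_mul ?_ hlog hlog0 (by positivity)
        exact mul_le_mul_of_nonneg_left hp (by positivity)
    _ = _ := by ring

lemma fZ_top (hRH : RiemannHypothesis) {δ : ℝ} (hδ : 0 < δ) : ∃ C > (0 : ℝ), ∀ T σ : ℝ, 1000 ≤ T → AdmissibleHeight δ T →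
    -(2 / Real.log T) ≤ σ → σ ≤ 2 → ‖fZ (σ + T * I)‖ ≤ C * (√T * Real.log T ^ 3) := by
  obtain ⟨C, hC, H⟩ := zeta_top
  set η := min δ 1 with hη
  have hη0 : 0 < η := lt_min hδ one_pos
  have hη1 : η ≤ 1 := min_le_right _ _
  have hηδ : η ≤ δ := min_le_left _ _
  refine ⟨16 / η ^ 2 * C, by positivity, fun T σ hT hA h1 h2 => ?_⟩
  have hL := log_ge_six hT
  have hL0 : 0 < Real.log T := by linarith
  have hd1 : 1 / Real.log T ≤ 1 := by rw [div_le_one hL0]; linarith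
  have hR : η / Real.log T ≤ 1 / Real.log T := div_le_div_of_nonneg_right hη1 hL0.le
  have hR0 : 0 < η / Real.log T := by positivity
  have e2 : 2 / Real.log T = 2 * (1 / Real.log T) := by ring
  have e4 : 4 / Real.log T = 4 * (1 / Real.log T) := by ring
  have hd0 : 0 < 1 / Real.log T := by positivity
  have ball : ∀ z : ℂ, ‖z - (σ + T * I)‖ ≤ η / Real.log T → |z.re - σ| ≤ η / Real.log T ∧ |z.im - T| ≤ η / Real.log T := by
    intro z hz
    have a1 := Complex.abs_re_le_norm (z - (σ + T * I))
    have a2 := Complex.abs_im_le_norm (z - (σ + T * I))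
    have b1 : (z - (σ + T * I)).re = z.re - σ := by simp
    have b2 : (z - (σ + T * I)).im = z.im - T := by simp
    rw [b1] at a1
    rw [b2] at a2
    exact ⟨a1.trans hz, a2.trans hz⟩
  have hb := local_bound_sup (F := riemannZeta) (s := σ + T * I) (r := η / Real.log T / 2) (R := η / Real.log T)
    (B := C * (√T * Real.log T)) (by positivity) (by linarith) (by
      intro z hz
      rw [Metric.mem_ball, dist_eq_norm] at hz
      have h := (ball z hz.le).2
      rw [abs_le] at h
      exact (differentiableAt_riemannZeta (ne_one_of_im (by linarith : 0 < z.im).ne')).differentiableWithinAt) (by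
      intro z hz hz0
      rw [Metric.mem_ball, dist_eq_norm] at hz
      have h := (ball z hz.le).2
      have h5 := h
      rw [abs_le] at h
      have him : z.im ≠ 0 := (by linarith : 0 < z.im).ne'
      have hre : z.re = 1 / 2 := by
        by_contra hre
        exact zeta_im_ne_zero hRH him hre hz0
      have h6 := hA z ⟨hz0, by linarith, by linarith⟩
      have h7 := Complex.abs_im_le_norm (z - (σ + T * I))
      have b2 : (z - (σ + T * I)).im = z.im - T := by simp
      rw [b2, abs_sub_comm] at h7
      have h8 : η / Real.log T ≤ δ / Real.log T := div_le_div_of_nonneg_right hηδ hL0.le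
      linarith) (by
      intro z hz
      rw [Metric.mem_closedBall, dist_eq_norm] at hz
      obtain ⟨h5, h6⟩ := ball z (by linarith)
      rw [abs_le] at h5
      exact H T z hT (by linarith) (by linarith) (by linarith))
  rw [fZ]
  refine hb.trans (le_of_eq ?_)
  field_simp
  norm_num

lemma mX_top : ∃ C > (0 : ℝ), ∀ (w : ℂ), -1 ≤ w.re → w.re ≤ 2 → 16 ≤ w.im →
    ‖mX (1 - w) - Real.log (w.im / (2 * Real.pi))‖ ≤ C / w.im := by
  obtain ⟨C, hC, H⟩ := mX_bound
  refine ⟨C, hC, fun w h1 h2 h3 => ?_⟩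
  have h := H (1 - w) (by simp; linarith) (by simp; linarith) (by simp; linarith)
  have e : |(1 - w).im| = w.im := by
    simp; linarith
  rwa [e] at h

lemma gZ_top : ∃ C > (0 : ℝ), ∀ T σ : ℝ, 1000 ≤ T →
    -(2 / Real.log T) ≤ σ → σ ≤ 2 → ‖gZ (σ + T * I)‖ ≤ C * (√T * Real.log T ^ 3) := by
  obtain ⟨C, hC, H⟩ := zeta_top
  obtain ⟨M, hM, HM⟩ := mX_top
  refine ⟨(1 + M) ^ 2 * C + 2 * (1 + M) * C, by positivity, fun T σ hT h1 h2 => ?_⟩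
  have hL := log_ge_six hT
  have hL0 : 0 < Real.log T := by linarith
  have hd1 : 1 / Real.log T ≤ 1 / 6 := div_le_div_of_nonneg_left (by norm_num) (by norm_num) hL
  have e2 : 2 / Real.log T = 2 * (1 / Real.log T) := by ring
  have e4 : 4 / Real.log T = 4 * (1 / Real.log T) := by ring
  have hd0 : 0 < 1 / Real.log T := by positivity
  set w : ℂ := σ + T * I with hw
  have hre : w.re = σ := by simp [hw]
  have him : w.im = T := by simp [hw]
  have hm : ‖mX (1 - w)‖ ≤ (1 + M) * Real.log T := by
    have h := HM w (by rw [hre]; linarith) (by rw [hre]; exact h2) (by rw [him]; linarith)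
    rw [him] at h
    have hpi := Real.pi_gt_three
    have hx : 1 ≤ T / (2 * Real.pi) := by
      rw [le_div_iff₀ (by positivity)]
      have := Real.pi_lt_four
      linarith
    have h5 : Real.log (T / (2 * Real.pi)) ≤ Real.log T := by
      apply Real.log_le_log (by linarith)
      apply div_le_self (by linarith)
      linarith
    have h6 : 0 ≤ Real.log (T / (2 * Real.pi)) := Real.log_nonneg hx
    have h7 : M / T ≤ M * Real.log T := by
      rw [div_le_iff₀ (by linarith)]
      have : 1 ≤ Real.log T * T := by nlinarith
      nlinarith
    have h8 := norm_add_le (mX (1 - w) - Real.log (T / (2 * Real.pi))) (Real.log (T / (2 * Real.pi)) : ℂ)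
    rw [sub_add_cancel, Complex.norm_real, Real.norm_of_nonneg h6] at h8
    linarith
  have hz : ‖riemannZeta w‖ ≤ C * (√T * Real.log T) :=
    H T w hT (by rw [hre]; linarith) (by rw [hre]; linarith) (by rw [him]; simp)
  have hball : ∀ z : ℂ, ‖z - w‖ ≤ 1 / Real.log T → |z.re - σ| ≤ 1 / Real.log T ∧ |z.im - T| ≤ 1 / Real.log T := by
    intro z hz
    have a1 := Complex.abs_re_le_norm (z - w)
    have a2 := Complex.abs_im_le_norm (z - w)
    rw [Complex.sub_re, hre] at a1
    rw [Complex.sub_im, him] at a2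
    exact ⟨a1.trans hz, a2.trans hz⟩
  have hdz : ‖deriv riemannZeta w‖ ≤ C * (√T * Real.log T) / (1 / Real.log T) := by
    apply Complex.norm_deriv_le_of_forall_mem_sphere_norm_le hd0
    · refine DifferentiableOn.diffContOnCl ?_
      rw [closure_ball w hd0.ne']
      intro z hz
      rw [Metric.mem_closedBall, dist_eq_norm] at hz
      have h := (hball z hz).2
      rw [abs_le] at h
      exact (differentiableAt_riemannZeta (ne_one_of_im (by linarith : 0 < z.im).ne')).differentiableWithinAt
    · intro z hz
      rw [mem_sphere_iff_norm] at hz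
      obtain ⟨h5, h6⟩ := hball z hz.le
      rw [abs_le] at h5
      exact H T z hT (by linarith) (by linarith) (by linarith)
  rw [gZ]
  have n1 := norm_sub_le (-(mX (1 - w)) ^ 2 * riemannZeta w) (2 * mX (1 - w) * deriv riemannZeta w)
  have n2 : ‖-(mX (1 - w)) ^ 2 * riemannZeta w‖ ≤ ((1 + M) * Real.log T) ^ 2 * (C * (√T * Real.log T)) := by
    rw [norm_mul, norm_neg, norm_pow]
    gcongr
  have n3 : ‖2 * mX (1 - w) * deriv riemannZeta w‖ ≤ 2 * ((1 + M) * Real.log T) * (C * (√T * Real.log T) / (1 / Real.log T)) := by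
    rw [norm_mul, norm_mul, Complex.norm_ofNat]
    gcongr
  refine (n1.trans (add_le_add n2 n3)).trans (le_of_eq ?_)
  field_simp
  try ring

/-! ### The line `Re = 2` -/

lemma LS_bound {c : ℕ → ℂ} (h : LSeriesSummable c 2) : ∃ B > (0 : ℝ), ∀ t : ℝ, ‖LSeries c (2 + t * I)‖ ≤ B := by
  have hs := h.norm
  refine ⟨(∑' n, ‖LSeries.term c 2 n‖) + 1, ?_, fun t => ?_⟩
  · have : 0 ≤ ∑' n, ‖LSeries.term c 2 n‖ := tsum_nonneg fun n => norm_nonneg _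
    linarith
  · have : ‖LSeries c (2 + t * I)‖ ≤ ∑' n, ‖LSeries.term c 2 n‖ := by
      refine tsum_of_norm_bounded hs.hasSum fun n => ?_
      exact LSeries.norm_term_le_of_re_le_re c (by simp) n
    linarith

lemma line_prim {c : ℕ → ℂ} (h1 : c 1 = 0) (h : LSeriesSummable c ((3 / 2 : ℝ) : ℂ)) :
    ∃ (H : ℝ → ℂ) (B : ℝ), 0 < B ∧ (∀ t, ‖H t‖ ≤ B) ∧ ∀ t : ℝ, HasDerivAt H (LSeries c (2 + t * I)) t := by
  set f : ℕ → ℂ := fun n => c n / Real.log n with hf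
  have hfs : LSeriesSummable f ((3 / 2 : ℝ) : ℂ) := by
    refine Summable.of_norm_bounded (h.norm.mul_left 2) fun n => ?_
    rcases Nat.eq_zero_or_pos n with h0 | h0
    · subst h0; simp
    rw [LSeries.norm_term_eq, LSeries.norm_term_eq, if_neg h0.ne', if_neg h0.ne', ← mul_div_assoc]
    refine div_le_div_of_nonneg_right ?_ (by positivity)
    rcases eq_or_ne n 1 with h2 | h2
    · subst h2; simp [hf]
    have h3 : 2 ≤ n := by omega
    have h4 : Real.log 2 ≤ Real.log n := Real.log_le_log (by norm_num) (by exact_mod_cast h3)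
    have h5 := Real.log_two_gt_d9
    simp only [hf, norm_div, Complex.norm_real]
    rw [Real.norm_of_nonneg (by linarith), div_le_iff₀ (by linarith)]
    nlinarith [norm_nonneg (c n)]
  have hab : LSeries.abscissaOfAbsConv f < ((2 : ℝ) : EReal) :=
    lt_of_le_of_lt hfs.abscissaOfAbsConv_le (by
      rw [Complex.ofReal_re]; exact_mod_cast (by norm_num : (3 / 2 : ℝ) < 2))
  obtain ⟨B, hB, HB⟩ := LS_bound (hfs.of_re_le_re (s' := 2) (by simp; norm_num))
  refine ⟨fun t => I * LSeries f (2 + t * I), B, hB, fun t => ?_, fun t => ?_⟩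
  · rw [norm_mul, norm_I, one_mul]; exact HB t
  · have d := LSeries_hasDerivAt (f := f) (s := 2 + t * I) (by simpa using hab)
    have e : LSeries (LSeries.logMul f) (2 + t * I) = LSeries c (2 + t * I) := by
      refine LSeries_congr (fun {n} hn => ?_) _
      simp only [LSeries.logMul, hf, ← Complex.natCast_log]
      rcases eq_or_ne n 1 with h2 | h2
      · subst h2; simp [h1]
      have h3 : (2 : ℝ) ≤ n := by exact_mod_cast (by omega : 2 ≤ n)
      have h4 : Real.log n ≠ 0 := (Real.log_pos (by linarith)).ne'
      have h5 : (Real.log n : ℂ) ≠ 0 := by exact_mod_cast h4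
      field_simp
    rw [e] at d
    have d1 : HasDerivAt (fun t : ℝ => (2 : ℂ) + t * I) I t := by
      have := ((Complex.ofRealCLM.hasDerivAt (x := t)).mul_const I).const_add (2 : ℂ)
      simpa using this
    have d2 := (d.comp t d1).const_mul I
    refine d2.congr_deriv ?_
    linear_combination (-LSeries c (2 + t * I)) * Complex.I_mul_I

lemma upper_line_cont {F : ℂ → ℂ} (h : ∀ s : ℂ, 0 < s.im → DifferentiableAt ℂ F s) {σ a b : ℝ} (ha : 0 < a) :
    ContinuousOn (fun t : ℝ => F (σ + t * I)) (Set.Icc a b) := by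
  intro t ht
  have h1 := (h (σ + t * I) (by simp; linarith [ht.1])).continuousAt
  have h2 : ContinuousAt (fun t : ℝ => (σ : ℂ) + t * I) t := by fun_prop
  exact (ContinuousAt.comp (f := fun t : ℝ => (σ : ℂ) + t * I) (x := t) h1 h2).continuousWithinAt

lemma parts_bound {H h : ℝ → ℂ} {B : ℝ} {u u' : ℝ → ℝ} {a b : ℝ} (hab : a ≤ b)
    (hH : ∀ t ∈ Set.Icc a b, ‖H t‖ ≤ B) (dH : ∀ t ∈ Set.Icc a b, HasDerivAt H (h t) t)
    (ch : ContinuousOn h (Set.Icc a b)) (du : ∀ t ∈ Set.Icc a b, HasDerivAt u (u' t) t)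
    (cu : ContinuousOn u' (Set.Icc a b)) (u0 : 0 ≤ u a) (u1 : ∀ t ∈ Set.Icc a b, 0 ≤ u' t) :
    ‖∫ t in a..b, (u t : ℂ) * h t‖ ≤ 2 * B * u b := by
  have huI : Set.uIcc a b = Set.Icc a b := Set.uIcc_of_le hab
  have iu : IntervalIntegrable u' MeasureTheory.volume a b :=
    ContinuousOn.intervalIntegrable (by rw [huI]; exact cu)
  have ih : IntervalIntegrable h MeasureTheory.volume a b :=
    ContinuousOn.intervalIntegrable (by rw [huI]; exact ch)
  have main := intervalIntegral.integral_mul_deriv_eq_deriv_mul (a := a) (b := b)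
    (u := fun t => (u t : ℂ)) (v := H) (u' := fun t => (u' t : ℂ)) (v' := h)
    (by rw [huI]; exact fun t ht => (du t ht).ofReal_comp)
    (by rw [huI]; exact dH) (ContinuousOn.intervalIntegrable (by rw [huI]; exact Complex.continuous_ofReal.comp_continuousOn cu)) ih
  rw [main]
  have ftc : ∫ t in a..b, u' t = u b - u a :=
    intervalIntegral.integral_eq_sub_of_hasDerivAt (by rw [huI]; exact du) iu
  have hint : 0 ≤ ∫ t in a..b, u' t := intervalIntegral.integral_nonneg hab u1
  have ub : 0 ≤ u b := by linarith
  have hB := hH a ⟨le_rfl, hab⟩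
  have hB2 := hH b ⟨hab, le_rfl⟩
  have hI : ‖∫ t in a..b, (u' t : ℂ) * H t‖ ≤ B * (u b - u a) := by
    rw [← ftc, ← intervalIntegral.integral_const_mul]
    refine intervalIntegral.norm_integral_le_of_norm_le hab ?_ (iu.const_mul B)
    refine MeasureTheory.ae_of_all _ fun t ht => ?_
    have ht' : t ∈ Set.Icc a b := Set.Ioc_subset_Icc_self ht
    rw [norm_mul, Complex.norm_real, Real.norm_of_nonneg (u1 t ht'), mul_comm]
    exact mul_le_mul_of_nonneg_right (hH t ht') (u1 t ht')
  have n1 := norm_sub_le ((u b : ℂ) * H b - (u a : ℂ) * H a) (∫ t in a..b, (u' t : ℂ) * H t)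
  have n2 := norm_sub_le ((u b : ℂ) * H b) ((u a : ℂ) * H a)
  rw [norm_mul, norm_mul, Complex.norm_real, Complex.norm_real, Real.norm_of_nonneg u0, Real.norm_of_nonneg ub] at n2
  have n3 := mul_le_mul_of_nonneg_left hB u0
  have n4 := mul_le_mul_of_nonneg_left hB2 ub
  nlinarith

lemma zeta_LS {s : ℂ} (hs : 1 < s.re) : riemannZeta s = LSeries 1 s := (LSeries_one_eq_riemannZeta hs).symm

lemma deriv_zeta_LS {s : ℂ} (hs : 1 < s.re) : deriv riemannZeta s = -LSeries (LSeries.logMul 1) s := by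
  have : LSeries.abscissaOfAbsConv 1 < s.re := by
    rw [LSeries.abscissaOfAbsConv_one]; exact_mod_cast hs
  rw [← (LSeries_hasDerivAt this).deriv]
  apply Filter.EventuallyEq.deriv_eq
  have : {z : ℂ | 1 < z.re} ∈ nhds s := (isOpen_lt continuous_const Complex.continuous_re).mem_nhds hs
  filter_upwards [this] with z hz
  exact zeta_LS hz

lemma delta_summable (s : ℂ) : LSeriesSummable LSeries.delta s := by
  refine summable_of_ne_finset_zero (s := {1}) fun n hn => ?_
  have : n ≠ 1 := by simpa using hn
  simp [LSeries.term_def, LSeries.delta, this]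

lemma fZ_right : ∃ C > (0 : ℝ), ∀ a b : ℝ, 0 < a → a ≤ b → ‖∫ t in a..b, fZ (2 + t * I)‖ ≤ C := by
  obtain ⟨hs, _⟩ := bZ_LS (s := ((3 / 2 : ℝ) : ℂ)) (by simp; norm_num)
  obtain ⟨H, B, hB, HB, dH⟩ := line_prim (by simp [bZ_one]) hs
  refine ⟨2 * B, by positivity, fun a b ha hab => ?_⟩
  have e : ∀ t : ℝ, LSeries (fun n => (bZ n : ℂ)) (2 + t * I) = fZ (2 + t * I) := fun t =>
    (bZ_LS (s := 2 + t * I) (by simp)).2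
  have hd : ∀ t ∈ Set.uIcc a b, HasDerivAt H (fZ (2 + t * I)) t := fun t _ => by rw [← e]; exact dH t
  have hc : IntervalIntegrable (fun t : ℝ => fZ (2 + t * I)) MeasureTheory.volume a b := by
    apply ContinuousOn.intervalIntegrable
    rw [Set.uIcc_of_le hab]
    intro t ht
    have him : ((2 : ℂ) + t * I).im ≠ 0 := by simp; linarith [ht.1]
    have hz : riemannZeta (2 + t * I) ≠ 0 := riemannZeta_ne_zero_of_one_le_re (by simp)
    have hA := zeta_analyticAt (ne_one_of_im him)
    have h1 : ContinuousAt fZ (2 + t * I) := ((hA.deriv.pow 2).div hA hz).continuousAt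
    have h2 : ContinuousAt (fun t : ℝ => (2 : ℂ) + t * I) t := by fun_prop
    exact (ContinuousAt.comp (f := fun t : ℝ => (2 : ℂ) + t * I) (x := t) h1 h2).continuousWithinAt
  rw [intervalIntegral.integral_eq_sub_of_hasDerivAt hd hc]
  have := norm_sub_le (H b) (H a)
  linarith [HB a, HB b]

/-! ### The integral of `gZ` -/

lemma mX_diff {s : ℂ} (h : s.im ≠ 0) : DifferentiableAt ℂ mX s := by
  have hO : IsOpen {z : ℂ | z.im ≠ 0} := isOpen_ne_fun Complex.continuous_im continuous_const
  have h1 : DifferentiableOn ℂ chiX {z : ℂ | z.im ≠ 0} := fun z hz =>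
    (hasDerivAt_chiX hz).differentiableAt.differentiableWithinAt
  have h2 := (h1.deriv hO).differentiableAt (hO.mem_nhds h)
  have h3 := h1.differentiableAt (hO.mem_nhds h)
  refine (h2.div h3 (chiX_ne_zero h)).congr_of_eventuallyEq ?_
  filter_upwards [hO.mem_nhds h] with z hz
  simp only [Pi.div_apply]
  rw [(hasDerivAt_chiX hz).deriv, mul_div_assoc, div_self (chiX_ne_zero hz), mul_one]

lemma gZ_diff {w : ℂ} (h : 0 < w.im) : DifferentiableAt ℂ gZ w := by
  have hA := zeta_analyticAt (ne_one_of_im h.ne')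
  have h1 : DifferentiableAt ℂ (fun w : ℂ => mX (1 - w)) w := by
    have : DifferentiableAt ℂ mX (1 - w) := mX_diff (by simp; exact h.ne')
    exact DifferentiableAt.comp w this (by fun_prop)
  exact ((h1.pow 2).neg.mul hA.differentiableAt).sub ((h1.const_mul 2).mul hA.deriv.differentiableAt)

lemma hasDerivAt_log2pi {t : ℝ} (ht : 0 < t) : HasDerivAt (fun t : ℝ => Real.log (t / (2 * Real.pi))) (1 / t) t := by
  have hpi := Real.pi_pos
  have h := ((hasDerivAt_id' t).div_const (2 * Real.pi)).log (by positivity)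
  refine h.congr_deriv ?_
  field_simp

lemma integral_logsq {a b : ℝ} (ha : 0 < a) (hab : a ≤ b) :
    ∫ t in a..b, Real.log (t / (2 * Real.pi)) ^ 2 =
      b * (Real.log (b / (2 * Real.pi)) ^ 2 - 2 * Real.log (b / (2 * Real.pi)) + 2) -
      a * (Real.log (a / (2 * Real.pi)) ^ 2 - 2 * Real.log (a / (2 * Real.pi)) + 2) := by
  have huI : Set.uIcc a b = Set.Icc a b := Set.uIcc_of_le hab
  apply intervalIntegral.integral_eq_sub_of_hasDerivAt
    (f := fun t => t * (Real.log (t / (2 * Real.pi)) ^ 2 - 2 * Real.log (t / (2 * Real.pi)) + 2))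
  · rw [huI]
    intro t ht
    have ht0 : 0 < t := by linarith [ht.1]
    have d := hasDerivAt_log2pi ht0
    have d2 := (hasDerivAt_id' t).mul (((d.pow 2).sub (d.const_mul 2)).add_const 2)
    refine d2.congr_deriv ?_
    simp only [Pi.sub_apply, Pi.pow_apply]
    field_simp
    push_cast
    ring
  · apply ContinuousOn.intervalIntegrable
    rw [huI]
    intro t ht
    exact ((hasDerivAt_log2pi (by linarith [ht.1])).continuousAt.pow 2).continuousWithinAt

lemma gZ_right : ∃ C > (0 : ℝ), ∀ a T : ℝ, 16 ≤ a → a ≤ 17 → 1000 ≤ T →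
    ‖(∫ t in a..T, gZ ((2 : ℝ) + t * I)) + (T * (Real.log (T / (2 * Real.pi)) ^ 2 -
      2 * Real.log (T / (2 * Real.pi)) + 2) : ℝ)‖ ≤ C * Real.log T ^ 2 := by
  obtain ⟨M, hM, HM⟩ := mX_top
  have s1 : ∀ s : ℂ, 1 < s.re → LSeriesSummable 1 s := fun s hs => LSeriesSummable_one_iff.mpr hs
  obtain ⟨B1, hB1, HB1⟩ := LS_bound (s1 2 (by simp))
  obtain ⟨B2, hB2, HB2⟩ := LS_bound (c := LSeries.logMul 1) (LSeriesSummable_logMul_of_lt_re (by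
    rw [LSeries.abscissaOfAbsConv_one]; norm_num; exact_mod_cast (by norm_num : (1 : ℝ) < 2)))
  obtain ⟨H, B, hB, HB, dH⟩ := line_prim (c := 1 - LSeries.delta) (by simp [LSeries.delta])
    ((s1 _ (by simp; norm_num)).sub (delta_summable _))
  have eH : ∀ t : ℝ, LSeries (1 - LSeries.delta) (2 + t * I) = riemannZeta (2 + t * I) - 1 := by
    intro t
    rw [LSeries_sub (s1 _ (by simp)) (delta_summable _), LSeries_delta, ← zeta_LS (by simp)]
    simp
  have bz : ∀ t : ℝ, ‖riemannZeta (2 + t * I)‖ ≤ B1 := fun t => by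
    rw [zeta_LS (by simp)]; exact HB1 t
  have bdz : ∀ t : ℝ, ‖deriv riemannZeta (2 + t * I)‖ ≤ B2 := fun t => by
    rw [deriv_zeta_LS (by simp), norm_neg]; exact HB2 t
  refine ⟨17 * 10 + 2 * B + 4 * B1 + (M * (2 + M) * B1 + 2 * M * B2), by positivity, fun a T ha ha2 hT => ?_⟩
  have hL := log_ge_six hT
  have haT : a ≤ T := by linarith
  have huI : Set.uIcc a T = Set.Icc a T := Set.uIcc_of_le haT
  have hpi := Real.pi_gt_three
  have hpi4 := Real.pi_lt_four
  set ℓ : ℝ → ℝ := fun t => Real.log (t / (2 * Real.pi)) with hℓ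
  have hx : ∀ t, 16 ≤ t → 1 ≤ t / (2 * Real.pi) := fun t ht => by
    rw [le_div_iff₀ (by positivity)]; linarith
  have ℓ0 : ∀ t, 16 ≤ t → 0 ≤ ℓ t := fun t ht => Real.log_nonneg (hx t ht)
  have ℓmono : ∀ t, 16 ≤ t → t ≤ T → ℓ t ≤ Real.log T := fun t ht htT => by
    have h1 : t / (2 * Real.pi) ≤ T := (div_le_self (by linarith) (by linarith)).trans htT
    exact Real.log_le_log (by linarith [hx t ht]) h1
  have dℓ : ∀ t ∈ Set.Icc a T, HasDerivAt ℓ (1 / t) t := fun t ht => hasDerivAt_log2pi (by linarith [ht.1])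
  have cinv : ContinuousOn (fun t : ℝ => 1 / t) (Set.Icc a T) := by
    intro t ht
    have : t ≠ 0 := by linarith [ht.1]
    exact (continuousAt_const.div continuousAt_id this).continuousWithinAt
  have cℓ : ContinuousOn ℓ (Set.Icc a T) := fun t ht => (dℓ t ht).continuousAt.continuousWithinAt
  have cℓC : ContinuousOn (fun t => (ℓ t : ℂ)) (Set.Icc a T) := Complex.continuous_ofReal.comp_continuousOn cℓ
  have a0 : 0 < a := by linarith
  have cz : ContinuousOn (fun t : ℝ => riemannZeta (2 + t * I)) (Set.Icc a T) :=
    upper_line_cont (σ := 2) (fun s hs => (zeta_analyticAt (ne_one_of_im hs.ne')).differentiableAt) a0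
  have cdz : ContinuousOn (fun t : ℝ => deriv riemannZeta (2 + t * I)) (Set.Icc a T) :=
    upper_line_cont (σ := 2) (fun s hs => (zeta_analyticAt (ne_one_of_im hs.ne')).deriv.differentiableAt) a0
  have cg : ContinuousOn (fun t : ℝ => gZ (2 + t * I)) (Set.Icc a T) :=
    upper_line_cont (σ := 2) (fun s hs => gZ_diff hs) a0
  -- the three pieces
  have p1 : ‖∫ t in a..T, ((ℓ t ^ 2 : ℝ) : ℂ) * (riemannZeta (2 + t * I) - 1)‖ ≤ 2 * B * ℓ T ^ 2 := by
    refine parts_bound (H := H) (u := fun t => ℓ t ^ 2) (u' := fun t => 2 * ℓ t * (1 / t)) haT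
      (fun t _ => HB t) (fun t _ => by rw [← eH]; exact dH t) (cz.sub continuousOn_const) ?_
      ((continuousOn_const.mul cℓ).mul cinv) (by positivity) ?_
    · intro t ht
      refine ((dℓ t ht).pow 2).congr_deriv ?_
      push_cast; ring
    · intro t ht
      have := ℓ0 t (by linarith [ht.1])
      have ht0 : 0 < t := by linarith [ht.1]
      positivity
  have p2 : ‖∫ t in a..T, (ℓ t : ℂ) * deriv riemannZeta (2 + t * I)‖ ≤ 2 * B1 * ℓ T := by
    refine parts_bound (H := fun t => -I * riemannZeta (2 + t * I)) (u := ℓ) (u' := fun t => 1 / t) haT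
      (fun t _ => by rw [norm_mul, norm_neg, norm_I, one_mul]; exact bz t) ?_ cdz dℓ cinv (ℓ0 a ha) ?_
    · intro t ht
      have him : ((2 : ℂ) + t * I).im ≠ 0 := by simp; linarith [ht.1]
      have d := (differentiableAt_riemannZeta (ne_one_of_im him)).hasDerivAt
      have d1 : HasDerivAt (fun t : ℝ => (2 : ℂ) + t * I) I t := by
        have := ((Complex.ofRealCLM.hasDerivAt (x := t)).mul_const I).const_add (2 : ℂ)
        simpa using this
      refine ((d.comp t d1).const_mul (-I)).congr_deriv ?_
      linear_combination (-deriv riemannZeta (2 + t * I)) * Complex.I_mul_I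
    · intro t ht
      have ht0 : 0 < t := by linarith [ht.1]
      positivity
  set E : ℝ → ℂ := fun t => gZ (2 + t * I) + (ℓ t : ℂ) ^ 2 * riemannZeta (2 + t * I) + 2 * ℓ t * deriv riemannZeta (2 + t * I) with hE
  set K := M * (2 + M) * B1 + 2 * M * B2 with hK
  have hK0 : 0 ≤ K := by positivity
  have bE : ∀ t ∈ Set.Icc a T, ‖E t‖ ≤ K * Real.log T * (1 / t) := by
    intro t ht
    have ht0 : 16 ≤ t := by linarith [ht.1]
    have hm := HM (2 + t * I) (by simp; norm_num) (by simp) (by simpa using ht0)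
    have e : ((2 : ℂ) + t * I).im = t := by simp
    rw [e] at hm
    set m := mX (1 - (2 + t * I)) with hmd
    have h0 := ℓ0 t ht0
    have h1 := ℓmono t ht0 ht.2
    have hEe : E t = -((m - ℓ t) * ((m - ℓ t) + 2 * ℓ t) * riemannZeta (2 + t * I)) - 2 * (m - ℓ t) * deriv riemannZeta (2 + t * I) := by
      simp only [hE, gZ, ← hmd]; ring
    have hMt : M / t ≤ M := div_le_self hM.le (by linarith)
    have q1 : ‖(m - ℓ t) + 2 * ℓ t‖ ≤ (2 + M) * Real.log T := by
      have := norm_add_le (m - ℓ t) (2 * (ℓ t : ℂ))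
      rw [norm_mul, Complex.norm_ofNat, Complex.norm_real, Real.norm_of_nonneg h0] at this
      have hm' : ‖m - ℓ t‖ ≤ M / t := hm
      nlinarith
    rw [hEe]
    have n1 := norm_sub_le (-((m - ℓ t) * ((m - ℓ t) + 2 * ℓ t) * riemannZeta (2 + t * I))) (2 * (m - ℓ t) * deriv riemannZeta (2 + t * I))
    have n2 : ‖-((m - ℓ t) * ((m - ℓ t) + 2 * ℓ t) * riemannZeta (2 + t * I))‖ ≤ M / t * ((2 + M) * Real.log T) * B1 := by
      rw [norm_neg, norm_mul, norm_mul]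
      have := bz t
      have hm' : ‖m - ℓ t‖ ≤ M / t := hm
      gcongr
    have n3 : ‖2 * (m - ℓ t) * deriv riemannZeta (2 + t * I)‖ ≤ 2 * (M / t) * B2 := by
      rw [norm_mul, norm_mul, Complex.norm_ofNat]
      have := bdz t
      have hm' : ‖m - ℓ t‖ ≤ M / t := hm
      gcongr
    have n4 : 2 * (M / t) * B2 ≤ 2 * (M / t) * B2 * Real.log T := by
      apply le_mul_of_one_le_right (by positivity) (by linarith)
    refine (n1.trans (add_le_add n2 (n3.trans n4))).trans (le_of_eq ?_)
    rw [hK]; ring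
  have cE : ContinuousOn E (Set.Icc a T) :=
    (cg.add ((cℓC.pow 2).mul cz)).add ((continuousOn_const.mul cℓC).mul cdz)
  have ii : ∀ {F : ℝ → ℂ}, ContinuousOn F (Set.Icc a T) → IntervalIntegrable F MeasureTheory.volume a T := by
    intro F hF
    exact ContinuousOn.intervalIntegrable (by rw [huI]; exact hF)
  have p3 : ‖∫ t in a..T, E t‖ ≤ K * Real.log T * Real.log T := by
    have i1 : IntervalIntegrable (fun t : ℝ => K * Real.log T * (1 / t)) MeasureTheory.volume a T :=
      ContinuousOn.intervalIntegrable (by rw [huI]; exact continuousOn_const.mul cinv)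
    have := intervalIntegral.norm_integral_le_of_norm_le haT
      (MeasureTheory.ae_of_all _ fun t ht => bE t (Set.Ioc_subset_Icc_self ht)) i1
    refine this.trans ?_
    rw [intervalIntegral.integral_const_mul, integral_one_div_of_pos a0 (by linarith)]
    refine mul_le_mul_of_nonneg_left ?_ (by positivity)
    apply Real.log_le_log (by positivity)
    exact div_le_self (by linarith) (by linarith)
  have p4 := integral_logsq a0 haT
  have c1 : ContinuousOn (fun t => ((ℓ t ^ 2 : ℝ) : ℂ)) (Set.Icc a T) :=
    Complex.continuous_ofReal.comp_continuousOn (cℓ.pow 2)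
  have c2 : ContinuousOn (fun t : ℝ => ((ℓ t ^ 2 : ℝ) : ℂ) * (riemannZeta (2 + t * I) - 1)) (Set.Icc a T) :=
    c1.mul (cz.sub continuousOn_const)
  have c3 : ContinuousOn (fun t : ℝ => (ℓ t : ℂ) * deriv riemannZeta (2 + t * I)) (Set.Icc a T) := cℓC.mul cdz
  have split : ∫ t in a..T, gZ ((2 : ℝ) + t * I) = (∫ t in a..T, E t) - (∫ t in a..T, ((ℓ t ^ 2 : ℝ) : ℂ) * (riemannZeta (2 + t * I) - 1))
      - 2 * (∫ t in a..T, (ℓ t : ℂ) * deriv riemannZeta (2 + t * I)) - ∫ t in a..T, ((ℓ t ^ 2 : ℝ) : ℂ) := by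
    rw [← intervalIntegral.integral_const_mul, ← intervalIntegral.integral_sub (ii cE) (ii c2),
      ← intervalIntegral.integral_sub ((ii cE).sub (ii c2)) ((ii c3).const_mul 2),
      ← intervalIntegral.integral_sub (((ii cE).sub (ii c2)).sub ((ii c3).const_mul 2)) (ii c1)]
    apply intervalIntegral.integral_congr
    intro t _
    simp only [hE]
    push_cast
    ring
  have p4c : ∫ t in a..T, ((ℓ t ^ 2 : ℝ) : ℂ) = ((T * (ℓ T ^ 2 - 2 * ℓ T + 2) - a * (ℓ a ^ 2 - 2 * ℓ a + 2) : ℝ) : ℂ) := by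
    rw [intervalIntegral.integral_ofReal, p4]
  rw [split, p4c]
  have hla0 := ℓ0 a ha
  have hla : ℓ a ≤ 2 := by
    have : a / (2 * Real.pi) ≤ Real.exp 2 := by
      have h1 : a / (2 * Real.pi) ≤ 3 := by rw [div_le_iff₀ (by positivity)]; linarith
      have h2 := Real.add_one_le_exp 2
      linarith
    have h3 := Real.log_le_log (by linarith [hx a ha]) this
    rwa [Real.log_exp] at h3
  have hla2 : |a * (ℓ a ^ 2 - 2 * ℓ a + 2)| ≤ 17 * 10 := by
    rw [abs_mul]
    refine mul_le_mul (by rw [abs_of_pos a0]; exact ha2) ?_ (abs_nonneg _) (by norm_num)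
    rw [abs_le]; constructor <;> nlinarith
  have hlT0 := ℓ0 T (by linarith)
  have hlT := ℓmono T (by linarith) le_rfl
  set G1 := ∫ t in a..T, E t
  set G2 := ∫ t in a..T, ((ℓ t ^ 2 : ℝ) : ℂ) * (riemannZeta (2 + t * I) - 1)
  set G3 := ∫ t in a..T, (ℓ t : ℂ) * deriv riemannZeta (2 + t * I)
  have fin : G1 - G2 - 2 * G3 - ((T * (ℓ T ^ 2 - 2 * ℓ T + 2) - a * (ℓ a ^ 2 - 2 * ℓ a + 2) : ℝ) : ℂ) +
      ((T * (ℓ T ^ 2 - 2 * ℓ T + 2) : ℝ) : ℂ) = G1 - G2 - 2 * G3 + ((a * (ℓ a ^ 2 - 2 * ℓ a + 2) : ℝ) : ℂ) := by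
    push_cast; ring
  rw [fin]
  have m1 := norm_add_le (G1 - G2 - 2 * G3) ((a * (ℓ a ^ 2 - 2 * ℓ a + 2) : ℝ) : ℂ)
  have m2 := norm_sub_le (G1 - G2) (2 * G3)
  have m3 := norm_sub_le G1 G2
  rw [norm_mul, Complex.norm_ofNat] at m2
  rw [Complex.norm_real, Real.norm_eq_abs] at m1
  have w1 : ℓ T ^ 2 ≤ Real.log T ^ 2 := by gcongr
  have w2 : ℓ T ≤ Real.log T ^ 2 := by nlinarith
  have w3 : 2 * B * ℓ T ^ 2 ≤ 2 * B * Real.log T ^ 2 := by gcongr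
  have w4 : 2 * B1 * ℓ T ≤ 2 * B1 * Real.log T ^ 2 := by gcongr
  have w5 : 1 ≤ Real.log T ^ 2 := by nlinarith
  have w6 : K * Real.log T * Real.log T = K * Real.log T ^ 2 := by ring
  nlinarith

/-! ### Assembly -/

lemma bottom_bound {F : ℂ → ℂ} {t0 : ℝ} (hF : ∀ σ : ℝ, ContinuousAt F (σ + t0 * I)) :
    ∃ B > (0 : ℝ), ∀ α : ℝ, -1 ≤ α → α ≤ 2 → ‖∫ y in α..2, F (y + t0 * I)‖ ≤ B := by
  have hc : Continuous (fun y : ℝ => F (y + t0 * I)) := by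
    rw [continuous_iff_continuousAt]
    intro y
    have h2 : ContinuousAt (fun y : ℝ => (y : ℂ) + t0 * I) y := by fun_prop
    exact ContinuousAt.comp (f := fun y : ℝ => (y : ℂ) + t0 * I) (x := y) (hF y) h2
  obtain ⟨B, hB⟩ := (isCompact_Icc (a := (-1 : ℝ)) (b := 2)).exists_bound_of_continuousOn hc.continuousOn
  refine ⟨3 * (|B| + 1), by positivity, fun α h1 h2 => ?_⟩
  have := intervalIntegral.norm_integral_le_of_norm_le_const (a := α) (b := 2) (C := |B| + 1)
    (f := fun y : ℝ => F (y + t0 * I)) (fun y hy => by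
      rw [Set.uIoc_of_le h2] at hy
      have := hB y ⟨by linarith [hy.1], hy.2⟩
      linarith [le_abs_self B])
  refine this.trans ?_
  rw [abs_of_nonneg (show (0 : ℝ) ≤ 2 - α by linarith), mul_comm]
  exact mul_le_mul_of_nonneg_right (by linarith) (by positivity)

lemma top_integral {F : ℂ → ℂ} {α T B : ℝ} (h1 : -1 ≤ α) (h2 : α ≤ 2) (hB : 0 ≤ B)
    (h : ∀ σ : ℝ, α ≤ σ → σ ≤ 2 → ‖F (σ + T * I)‖ ≤ B) : ‖∫ y in α..2, F (y + T * I)‖ ≤ 3 * B := by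
  have := intervalIntegral.norm_integral_le_of_norm_le_const (a := α) (b := 2) (C := B)
    (f := fun y : ℝ => F (y + T * I)) (fun y hy => by
      rw [Set.uIoc_of_le h2] at hy
      exact h y hy.1.le hy.2)
  refine this.trans ?_
  rw [abs_of_nonneg (show (0 : ℝ) ≤ 2 - α by linarith), mul_comm]
  exact mul_le_mul_of_nonneg_right (by linarith) hB

lemma fZ_conj (s : ℂ) : fZ (starRingEnd ℂ s) = starRingEnd ℂ (fZ s) := by
  have hz : (fun z => starRingEnd ℂ (riemannZeta (starRingEnd ℂ z))) = riemannZeta := by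
    funext z; rw [riemannZeta_conj, Complex.conj_conj]
  have hd : deriv riemannZeta (starRingEnd ℂ s) = starRingEnd ℂ (deriv riemannZeta s) := by
    have := congrFun (deriv_conj_conj (f := riemannZeta)) s
    have e : (⇑(starRingEnd ℂ) ∘ riemannZeta ∘ ⇑(starRingEnd ℂ)) = riemannZeta := hz
    rw [e] at this
    simp only [Function.comp_apply] at this
    rw [this, Complex.conj_conj]
  rw [fZ, fZ, hd, riemannZeta_conj, map_div₀, map_pow]

lemma left_edge (hRH : RiemannHypothesis) {a t0 T : ℝ} (ha : 1 < a) (h0 : 0 < t0) (hT : t0 ≤ T) :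
    ∫ t in t0..T, fZ (((1 - a : ℝ) : ℂ) + t * I) =
      starRingEnd ℂ (∫ t in t0..T, chiX (a + t * I) * fZ (a + t * I)) + ∫ t in t0..T, gZ (((1 - a : ℝ) : ℂ) + t * I) := by
  have huI : Set.uIcc t0 T = Set.Icc t0 T := Set.uIcc_of_le hT
  have hfe : ∀ t ∈ Set.Icc t0 T, fZ (((1 - a : ℝ) : ℂ) + t * I) =
      starRingEnd ℂ (chiX (a + t * I) * fZ (a + t * I)) + gZ (((1 - a : ℝ) : ℂ) + t * I) := by
    intro t ht
    have ht0 : 0 < t := by linarith [ht.1]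
    have him : (((1 - a : ℝ) : ℂ) + t * I).im ≠ 0 := by simp; exact ht0.ne'
    have hz : riemannZeta (((1 - a : ℝ) : ℂ) + t * I) ≠ 0 := by
      refine zeta_im_ne_zero hRH him ?_
      simp only [add_re, ofReal_re, mul_re, ofReal_im, I_re, I_im]
      intro h
      linarith
    rw [fZ_fe him hz, map_mul, ← fZ_conj, ← chiX_conj]
    have e : 1 - (((1 - a : ℝ) : ℂ) + t * I) = starRingEnd ℂ (a + t * I) := by
      simp only [map_add, map_mul, conj_ofReal, conj_I]; push_cast; ring
    rw [e]
  have c1 : ContinuousOn (fun t : ℝ => starRingEnd ℂ (chiX (a + t * I) * fZ (a + t * I))) (Set.Icc t0 T) := by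
    apply Complex.continuous_conj.comp_continuousOn
    intro t ht
    have ht0 : 0 < t := by linarith [ht.1]
    have him : ((a : ℂ) + t * I).im ≠ 0 := by simp; exact ht0.ne'
    have hz : riemannZeta (a + t * I) ≠ 0 := riemannZeta_ne_zero_of_one_le_re (by simp; exact ha.le)
    have hA := zeta_analyticAt (ne_one_of_im him)
    have h1 : ContinuousAt (fun s => chiX s * fZ s) (a + t * I) :=
      (hasDerivAt_chiX him).continuousAt.mul ((hA.deriv.pow 2).div hA hz).continuousAt
    have h2 : ContinuousAt (fun t : ℝ => (a : ℂ) + t * I) t := by fun_prop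
    exact (ContinuousAt.comp (f := fun t : ℝ => (a : ℂ) + t * I) (x := t) h1 h2).continuousWithinAt
  have c2 : ContinuousOn (fun t : ℝ => gZ (((1 - a : ℝ) : ℂ) + t * I)) (Set.Icc t0 T) :=
    upper_line_cont (fun s hs => gZ_diff hs) h0
  rw [← intervalIntegral.intervalIntegral_conj, ← intervalIntegral.integral_add
    (ContinuousOn.intervalIntegrable (by rw [huI]; exact c1)) (ContinuousOn.intervalIntegrable (by rw [huI]; exact c2))]
  apply intervalIntegral.integral_congr
  intro t ht
  rw [huI] at ht
  exact hfe t ht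

/-- assuming the Riemann Hypothesis,
`∑_{0<γ≤T} ζ'(ρ)` equals Fujii's main term with the improved error
`O(T^{1/2} log^{13/4} T)`. -/
theorem shanks_improved_error (hRH : RiemannHypothesis) (C : ℕ → ℂ)
    (hC : ∀ᶠ s in nhdsWithin (1 : ℂ) {(1 : ℂ)}ᶜ,
      HasSum (fun j : ℕ => C j * (s - 1) ^ j) (riemannZeta s - 1 / (s - 1)))
    (δ : ℝ) (hδ : 0 < δ) :
    ∃ K > (0 : ℝ), ∃ T₀ : ℝ, ∀ T ≥ T₀, AdmissibleHeight δ T →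
      ‖zetaZeroSum 1 T -
          ((((T / (4 * Real.pi)) * Real.log (T / (2 * Real.pi)) ^ 2 : ℝ) : ℂ)
            + (-1 + C 0) * (((T / (2 * Real.pi)) * Real.log (T / (2 * Real.pi)) : ℝ) : ℂ)
            + (1 - C 0 - (C 0) ^ 2 + 3 * C 1) * ((T / (2 * Real.pi) : ℝ) : ℂ))‖ ≤
        K * T ^ ((1 : ℝ) / 2) * Real.log T ^ ((13 : ℝ) / 4) := by
  obtain ⟨t0, ht16, ht17, hn0⟩ := exists_t0
  have n0 : ∀ s : ℂ, s.im = t0 → riemannZeta s ≠ 0 := by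
    intro s hs hz
    have hre : s.re = 1 / 2 := by
      by_contra hre
      exact zeta_im_ne_zero hRH (by rw [hs]; linarith) hre hz
    exact hn0 s (by rw [hre]; norm_num) (by rw [hre]; norm_num) hs hz
  have him0 : ∀ σ : ℝ, ((σ : ℂ) + t0 * I).im = t0 := fun σ => by simp
  obtain ⟨Bb, hBb, HBb⟩ := bottom_bound (F := fZ) (t0 := t0) (by
    intro σ
    have hz := n0 (σ + t0 * I) (him0 σ)
    have hA := zeta_analyticAt (ne_one_of_im (s := σ + t0 * I) (by rw [him0]; linarith))
    exact ((hA.deriv.pow 2).div hA hz).continuousAt)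
  obtain ⟨Bg, hBg, HBg⟩ := bottom_bound (F := gZ) (t0 := t0) (by
    intro σ
    exact (gZ_diff (by rw [him0]; linarith)).continuousAt)
  obtain ⟨Ct, hCt, HCt⟩ := fZ_top hRH hδ
  obtain ⟨Cg, hCg, HCg⟩ := gZ_top
  obtain ⟨Cr, hCr, HCr⟩ := fZ_right
  obtain ⟨C1, hC1, HC1⟩ := J_sum
  obtain ⟨C2, hC2, HC2⟩ := gZ_right
  obtain ⟨C3, hC3, HC3⟩ := DX_asymp hRH C hC
  set S0 := zetaZeroSum 1 t0 with hS0
  refine ⟨2 * Real.pi * ‖S0‖ + Bb + 3 * Ct + Cr + C1 + C2 + Bg + 3 * Cg + Real.pi * C3, by positivity, 10000,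
    fun T hT hA => ?_⟩
  have hpi := Real.pi_gt_three
  have hpi4 := Real.pi_lt_four
  have hT0 : 0 < T := by linarith
  have hL := log_ge_six (x := T) (by linarith)
  set x := T / (2 * Real.pi) with hxd
  have hTx : T = 2 * Real.pi * x := by rw [hxd]; field_simp
  have hx1000 : 1000 ≤ x := by
    rw [hxd, le_div_iff₀ (by positivity)]; linarith
  have hxT : x ≤ T := div_le_self hT0.le (by linarith)
  have hl := log_ge_six hx1000
  have hlL : Real.log x ≤ Real.log T := Real.log_le_log (by linarith) hxT
  have hl2 : Real.log T ≤ 2 * Real.log x := by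
    have h : T ≤ x ^ 2 := by rw [hTx]; nlinarith
    have := Real.log_le_log hT0 h
    rwa [Real.log_pow] at this
  have hα : -(2 / Real.log T) ≤ 1 - aX x := by
    rw [aX]
    have : 1 / Real.log x ≤ 2 / Real.log T := by
      rw [div_le_div_iff₀ (by linarith) (by linarith)]; linarith
    linarith
  have ha1 := aX_gt (x := x) (by linarith)
  have ha2 := aX_le (x := x) (by linarith)
  have nT : ∀ s : ℂ, s.im = T → riemannZeta s ≠ 0 := by
    intro s hs hz
    have hre : s.re = 1 / 2 := by
      by_contra hre
      exact zeta_im_ne_zero hRH (by rw [hs]; linarith) hre hz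
    have h := hA s ⟨hz, by linarith, by linarith⟩
    rw [hs, sub_self, abs_zero] at h
    have : 0 < δ / Real.log T := div_pos hδ (by linarith)
    linarith
  have arg := arg_principle hRH (t0 := t0) (T := T) (α := 1 - aX x) (by linarith) (by linarith) (by linarith) (by linarith) n0 nT
  have hol : RI gZ (1 - aX x) 2 t0 T = 0 := by
    refine RI_holo (by linarith) (by linarith) ?_
    rintro s ⟨_, h3, _⟩
    exact (gZ_diff (by linarith)).differentiableWithinAt
  have lef := left_edge hRH (a := aX x) (t0 := t0) (T := T) ha1 (by linarith) (by linarith)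
  rw [RI] at arg hol
  have b1 := HBb (1 - aX x) (by linarith) (by linarith)
  have b2 := HBg (1 - aX x) (by linarith) (by linarith)
  have b3 := top_integral (F := fZ) (α := 1 - aX x) (T := T) (B := Ct * (√T * Real.log T ^ 3)) (by linarith) (by linarith) (by positivity)
    (fun σ h1 h2 => HCt T σ (by linarith) hA (by linarith) h2)
  have b4 := top_integral (F := gZ) (α := 1 - aX x) (T := T) (B := Cg * (√T * Real.log T ^ 3)) (by linarith) (by linarith) (by positivity)
    (fun σ h1 h2 => HCg T σ (by linarith) (by linarith) h2)
  have b5 : ‖∫ t in t0..T, fZ ((2 : ℝ) + t * I)‖ ≤ Cr := HCr t0 T (by linarith) (by linarith)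
  have b6 := HC1 t0 x (by linarith) ht17 (by linarith)
  have b7 := HC2 t0 T ht16 ht17 (by linarith)
  have b8 := HC3 x hx1000
  rw [← hTx] at b6
  rw [← hxd] at b7
  rw [lef, ← hS0] at arg
  set J := ∫ t in t0..T, chiX (aX x + t * I) * fZ (aX x + t * I) with hJ
  set fb := ∫ y in (1 - aX x)..2, fZ (y + t0 * I) with hfb
  set ft := ∫ y in (1 - aX x)..2, fZ (y + T * I) with hft
  set fr := ∫ t in t0..T, fZ ((2 : ℝ) + t * I) with hfr
  set gb := ∫ y in (1 - aX x)..2, gZ (y + t0 * I) with hgb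
  set gt := ∫ y in (1 - aX x)..2, gZ (y + T * I) with hgt
  set gr := ∫ t in t0..T, gZ ((2 : ℝ) + t * I) with hgr
  set gl := ∫ t in t0..T, gZ (((1 - aX x : ℝ) : ℂ) + t * I) with hgl
  set S := zetaZeroSum 1 T with hS
  set Q : ℂ := x * ((Real.log x : ℂ) ^ 2 - 2 * Real.log x + 2 -
      2 * C 0 * (Real.log x - 1) + 2 * C 0 ^ 2 - 6 * C 1) with hQ
  have b6' : ‖starRingEnd ℂ J - 2 * Real.pi * DX x‖ ≤ C1 * √x * Real.log x ^ 3 := by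
    have e : starRingEnd ℂ J - 2 * Real.pi * DX x = starRingEnd ℂ (J - 2 * Real.pi * DX x) := by
      rw [map_sub, map_mul, map_mul, conj_ofReal, conj_ofReal, map_ofNat]
    rw [e, Complex.norm_conj]; exact b6
  set q : ℝ := Real.log x ^ 2 - 2 * Real.log x + 2 with hq
  have e4 : T / (4 * Real.pi) = x / 2 := by rw [hxd]; field_simp; norm_num
  have hmain : ((((T / (4 * Real.pi)) * Real.log x ^ 2 : ℝ) : ℂ)
            + (-1 + C 0) * ((x * Real.log x : ℝ) : ℂ)
            + (1 - C 0 - (C 0) ^ 2 + 3 * C 1) * ((x : ℝ) : ℂ)) = x * (q : ℂ) - Q / 2 := by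
    rw [e4, hQ, hq]; push_cast; ring
  rw [hmain]
  have key : 2 * Real.pi * (S - (x * (q : ℂ) - Q / 2)) = 2 * Real.pi * S0 - I * fb + I * ft + fr -
      (starRingEnd ℂ J - 2 * Real.pi * DX x) - (gr + ((T * q : ℝ) : ℂ)) + I * gb - I * gt - Real.pi * (2 * (DX x : ℂ) - Q) := by
    have hI := Complex.I_mul_I
    have hTc : (T : ℂ) = 2 * Real.pi * x := by rw [hTx]; push_cast; rfl
    push_cast
    rw [hTc]
    clear_value J fb ft fr gb gt gr gl S Q q S0
    linear_combination I * arg - I * hol + (2 * Real.pi * (S - S0) - fr + starRingEnd ℂ J + gr) * hI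
  have hP3 : Real.log T ^ 3 ≤ Real.log T ^ (13 / 4 : ℝ) := by
    rw [← Real.rpow_natCast]
    exact Real.rpow_le_rpow_of_exponent_le (by linarith) (by norm_num)
  have hsT : 1 ≤ √T := by rw [Real.one_le_sqrt]; linarith
  have hsx : √x ≤ √T := Real.sqrt_le_sqrt hxT
  set W := √T * Real.log T ^ (13 / 4 : ℝ) with hW
  have w3 : √T * Real.log T ^ 3 ≤ W := mul_le_mul_of_nonneg_left hP3 (by positivity)
  have w0 : Real.log T ^ 3 ≤ √T * Real.log T ^ 3 := le_mul_of_one_le_left (by positivity) hsT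
  have w2 : Real.log T ^ 2 ≤ Real.log T ^ 3 := pow_le_pow_right₀ (by linarith) (by norm_num)
  have w1 : 1 ≤ Real.log T ^ 2 := one_le_pow₀ (by linarith)
  have wx3 : √x * Real.log x ^ 3 ≤ √T * Real.log T ^ 3 := by
    have : Real.log x ^ 3 ≤ Real.log T ^ 3 := by gcongr
    exact mul_le_mul hsx this (by positivity) (by positivity)
  have wx4 : √x * Real.log x ^ (13 / 4 : ℝ) ≤ W := by
    have : Real.log x ^ (13 / 4 : ℝ) ≤ Real.log T ^ (13 / 4 : ℝ) :=
      Real.rpow_le_rpow (by linarith) hlL (by norm_num)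
    exact mul_le_mul hsx this (by positivity) (by positivity)
  have hWe : ∀ k : ℝ, k * T ^ ((1 : ℝ) / 2) * Real.log T ^ ((13 : ℝ) / 4) = k * W := by
    intro k; rw [hW, Real.sqrt_eq_rpow]; ring
  rw [hWe]
  have hn : 2 * Real.pi * ‖S - (x * (q : ℂ) - Q / 2)‖ ≤ 2 * Real.pi * ‖S0‖ + Bb + 3 * (Ct * (√T * Real.log T ^ 3)) + Cr +
      C1 * √x * Real.log x ^ 3 + C2 * Real.log T ^ 2 + Bg + 3 * (Cg * (√T * Real.log T ^ 3)) +
      Real.pi * (C3 * (√x * Real.log x ^ (13 / 4 : ℝ))) := by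
    have e2 : ‖(2 * Real.pi : ℂ)‖ = 2 * Real.pi := by
      rw [norm_mul, Complex.norm_ofNat, Complex.norm_real, Real.norm_of_nonneg Real.pi_pos.le]
    have e : 2 * Real.pi * ‖S - (x * (q : ℂ) - Q / 2)‖ = ‖2 * Real.pi * (S - (x * (q : ℂ) - Q / 2))‖ := by
      rw [norm_mul, e2]
    rw [e, key]
    have m1 := norm_sub_le (2 * Real.pi * S0 - I * fb + I * ft + fr -
      (starRingEnd ℂ J - 2 * Real.pi * DX x) - (gr + ((T * q : ℝ) : ℂ)) + I * gb - I * gt) (Real.pi * (2 * (DX x : ℂ) - Q))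
    have m2 := norm_sub_le (2 * Real.pi * S0 - I * fb + I * ft + fr -
      (starRingEnd ℂ J - 2 * Real.pi * DX x) - (gr + ((T * q : ℝ) : ℂ)) + I * gb) (I * gt)
    have m3 := norm_add_le (2 * Real.pi * S0 - I * fb + I * ft + fr -
      (starRingEnd ℂ J - 2 * Real.pi * DX x) - (gr + ((T * q : ℝ) : ℂ))) (I * gb)
    have m4 := norm_sub_le (2 * Real.pi * S0 - I * fb + I * ft + fr -
      (starRingEnd ℂ J - 2 * Real.pi * DX x)) (gr + ((T * q : ℝ) : ℂ))
    have m5 := norm_sub_le (2 * Real.pi * S0 - I * fb + I * ft + fr) (starRingEnd ℂ J - 2 * Real.pi * DX x)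
    have m6 := norm_add_le (2 * Real.pi * S0 - I * fb + I * ft) fr
    have m7 := norm_add_le (2 * Real.pi * S0 - I * fb) (I * ft)
    have m8 := norm_sub_le (2 * Real.pi * S0) (I * fb)
    have nI : ∀ z : ℂ, ‖I * z‖ = ‖z‖ := fun z => by rw [norm_mul, norm_I, one_mul]
    rw [nI] at m2 m3 m7 m8
    rw [norm_mul _ S0, e2] at m8
    have m9 : ‖(Real.pi : ℂ) * (2 * (DX x : ℂ) - Q)‖ ≤ Real.pi * (C3 * (√x * Real.log x ^ (13 / 4 : ℝ))) := by
      rw [norm_mul, Complex.norm_real, Real.norm_of_nonneg Real.pi_pos.le]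
      exact mul_le_mul_of_nonneg_left b8 Real.pi_pos.le
    linarith
  have v0 : 1 ≤ W := by linarith
  have z1 : 2 * Real.pi * ‖S0‖ ≤ 2 * Real.pi * ‖S0‖ * W := le_mul_of_one_le_right (by positivity) v0
  have z2 : Bb ≤ Bb * W := le_mul_of_one_le_right hBb.le v0
  have z3 : Bg ≤ Bg * W := le_mul_of_one_le_right hBg.le v0
  have z4 : Cr ≤ Cr * W := le_mul_of_one_le_right hCr.le v0
  have z5 : Ct * (√T * Real.log T ^ 3) ≤ Ct * W := mul_le_mul_of_nonneg_left w3 hCt.le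
  have z6 : Cg * (√T * Real.log T ^ 3) ≤ Cg * W := mul_le_mul_of_nonneg_left w3 hCg.le
  have z7 : C1 * √x * Real.log x ^ 3 ≤ C1 * W := by
    rw [mul_assoc]; exact mul_le_mul_of_nonneg_left (wx3.trans w3) hC1.le
  have z8 : C2 * Real.log T ^ 2 ≤ C2 * W := mul_le_mul_of_nonneg_left (by linarith) hC2.le
  have z9 : Real.pi * (C3 * (√x * Real.log x ^ (13 / 4 : ℝ))) ≤ Real.pi * (C3 * W) :=
    mul_le_mul_of_nonneg_left (mul_le_mul_of_nonneg_left wx4 hC3.le) Real.pi_pos.le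
  have hnn := norm_nonneg (S - (x * (q : ℂ) - Q / 2))
  have z10 : ‖S - (x * (q : ℂ) - Q / 2)‖ ≤ 2 * Real.pi * ‖S - (x * (q : ℂ) - Q / 2)‖ :=
    le_mul_of_one_le_left hnn (by linarith)
  have z11 : (2 * Real.pi * ‖S0‖ + Bb + 3 * Ct + Cr + C1 + C2 + Bg + 3 * Cg + Real.pi * C3) * W =
      2 * Real.pi * ‖S0‖ * W + Bb * W + 3 * (Ct * W) + Cr * W + C1 * W + C2 * W + Bg * W + 3 * (Cg * W) + Real.pi * (C3 * W) := by
    ring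
  rw [z11]
  linarith
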